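/- Let n > 35 be an integer and let F(x;y) ∈ ℤ[x₁,…,xₙ,y₁,…,yₙ] be a bihomogeneous form of bidegree (2,2) such that the hypersurface X = {F = 0} ⊂ ℙ^{n−1} × ℙ^{n−1} is smooth. For B ≥ 1 let N_U(B) = (1/4)·#{(x,y) ∈ ℤⁿ × ℤⁿ : gcd(x₁,…,xₙ) = gcd(y₁,…,yₙ) = 1, det(F_x) ≠ 0, det(F_y) ≠ 0, F(x;y) = 0, and |x|^{n−2}|y|^{n−2} ≤ B}. Then N_U(B)/(B·log B) tends to 𝔖·ℑ/(4·ζ(n−2)²) as B → ∞, where ζ is the Riemann zeta function. -/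

import Mathlib

open scoped BigOperators
open MeasureTheory Filter

noncomputable section

def ee (t : ℝ) : ℂ := Complex.exp (2 * Real.pi * Complex.I * t)

def supNorm {n : ℕ} (x : Fin n → ℤ) : ℕ := Finset.univ.sup fun i => (x i).natAbs

def box (n : ℕ) (κ : ℝ) : Set (Fin n → ℝ) := Set.univ.pi fun _ => Set.Icc (-κ) κ

/-- the bihomogeneous form `F(x;y) = ∑ A_{ijkl} x_i x_j y_k y_l` over `ℤ` -/
def biForm {n : ℕ} (A : Fin n → Fin n → Fin n → Fin n → ℤ) (x y : Fin n → ℤ) : ℤ :=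
  ∑ i, ∑ j, ∑ k, ∑ l, A i j k l * x i * x j * y k * y l

/-- the bihomogeneous form over `ℝ` -/
def biFormR {n : ℕ} (A : Fin n → Fin n → Fin n → Fin n → ℤ) (x y : Fin n → ℝ) : ℝ :=
  ∑ i, ∑ j, ∑ k, ∑ l, (A i j k l : ℝ) * x i * x j * y k * y l

/-- the symmetric matrix `M(x)` of the quadratic form `F_x`, over `ℚ` -/
def matFx {n : ℕ} (A : Fin n → Fin n → Fin n → Fin n → ℤ) (x : Fin n → ℚ) :
    Matrix (Fin n) (Fin n) ℚ :=
  Matrix.of fun k l => (∑ i, ∑ j, ((A i j k l + A i j l k : ℤ) : ℚ) * x i * x j) / 2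

/-- the symmetric matrix of the quadratic form `F_y`, over `ℚ` -/
def matFy {n : ℕ} (A : Fin n → Fin n → Fin n → Fin n → ℤ) (y : Fin n → ℚ) :
    Matrix (Fin n) (Fin n) ℚ :=
  Matrix.of fun i j => (∑ k, ∑ l, ((A i j k l + A j i k l : ℤ) : ℚ) * y k * y l) / 2

/-- `det(F_x)` for an integer vector `x` -/
def detFx {n : ℕ} (A : Fin n → Fin n → Fin n → Fin n → ℤ) (x : Fin n → ℤ) : ℚ :=
  (matFx A fun i => (x i : ℚ)).det

/-- `det(F_y)` for an integer vector `y` -/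
def detFy {n : ℕ} (A : Fin n → Fin n → Fin n → Fin n → ℤ) (y : Fin n → ℤ) : ℚ :=
  (matFy A fun i => (y i : ℚ)).det

/-- smoothness of the biprojective hypersurface `{F = 0}`: no point with `x ≠ 0`, `y ≠ 0`
where all `2n` partial derivatives of `F` vanish. -/
def SmoothBiquad {n : ℕ} (A : Fin n → Fin n → Fin n → Fin n → ℤ) : Prop :=
  ∀ x y : Fin n → ℂ, x ≠ 0 → y ≠ 0 →
    ¬ ((∀ m, ∑ j, ∑ k, ∑ l, ((A m j k l + A j m k l : ℤ) : ℂ) * x j * y k * y l = 0) ∧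
       (∀ m, ∑ i, ∑ j, ∑ l, ((A i j m l + A i j l m : ℤ) : ℂ) * x i * x j * y l = 0))

/-- the complete exponential sum attached to `F(x;y)` -/
def biExpSum {n : ℕ} (A : Fin n → Fin n → Fin n → Fin n → ℤ) (q : ℕ) : ℂ :=
  ∑ a ∈ (Finset.range q).filter fun a => Nat.Coprime a q,
    ∑ x : Fin n → Fin q, ∑ y : Fin n → Fin q,
      ee ((((a : ℤ) * biForm A (fun i => ((x i : ℕ) : ℤ)) (fun i => ((y i : ℕ) : ℤ)) : ℤ) : ℝ) / q)

/-- the singular series `𝔖` of `F(x;y)` -/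
def biSingSeries {n : ℕ} (A : Fin n → Fin n → Fin n → Fin n → ℤ) : ℂ :=
  ∑' q : ℕ+, ((q : ℕ) : ℂ) ^ (-(2 * (n : ℤ))) * biExpSum A q

/-- the singular integral `ℑ` of `F(x;y)` -/
def biSingInt {n : ℕ} (A : Fin n → Fin n → Fin n → Fin n → ℤ) : ℂ :=
  ∫ θ : ℝ, ∫ p in (box n 1) ×ˢ (box n 1), ee (-(θ * biFormR A p.1 p.2))

def expSumGen {n : ℕ} (G : (Fin n → ℤ) → ℤ) (c : Fin n → ℤ) (q : ℕ) : ℂ :=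
  ∑ a ∈ (Finset.range q).filter fun a => Nat.Coprime a q,
    ∑ b : Fin n → Fin q,
      ee ((((a : ℤ) * G (fun i => ((b i : ℕ) : ℤ)) + ∑ i, ((b i : ℕ) : ℤ) * c i : ℤ) : ℝ) / q)

def singSeriesGen {n : ℕ} (G : (Fin n → ℤ) → ℤ) : ℂ :=
  ∑' q : ℕ+, ((q : ℕ) : ℂ) ^ (-(n : ℤ)) * expSumGen G 0 q

/-- the singular integral `σ_∞(w₀;F_x)` of the quadratic form `F_x` -/
def sigFx {n : ℕ} (A : Fin n → Fin n → Fin n → Fin n → ℤ) (x : Fin n → ℤ) : ℂ :=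
  ∫ θ : ℝ, ∫ y in box n 1, ee (-(θ * biFormR A (fun i => (x i : ℝ)) y))

/-- the singular series `𝔖(F_x)` of the quadratic form `F_x` -/
def serFx {n : ℕ} (A : Fin n → Fin n → Fin n → Fin n → ℤ) (x : Fin n → ℤ) : ℂ :=
  singSeriesGen (fun y => biForm A x y)

/-- `S(X) = ∑_{x ∈ 𝒜₁, |x| ≤ X} σ_∞(w₀;F_x)𝔖(F_x)` -/
def SFx {n : ℕ} (A : Fin n → Fin n → Fin n → Fin n → ℤ) (X : ℝ) : ℂ :=
  ∑' x : Fin n → ℤ,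
    if detFx A x ≠ 0 ∧ (supNorm x : ℝ) ≤ X then sigFx A x * serFx A x else 0

/-- `N(𝒜;X,Y)` -/
def NcalA {n : ℕ} (A : Fin n → Fin n → Fin n → Fin n → ℤ) (X Y : ℝ) : ℕ :=
  Nat.card {p : (Fin n → ℤ) × (Fin n → ℤ) //
    detFx A p.1 ≠ 0 ∧ detFy A p.2 ≠ 0 ∧ (supNorm p.1 : ℝ) ≤ X ∧ (supNorm p.2 : ℝ) ≤ Y ∧
    biForm A p.1 p.2 = 0}

/-- `Ñ(X,Y)` -/
def Ntilde {n : ℕ} (A : Fin n → Fin n → Fin n → Fin n → ℤ) (X Y : ℝ) : ℕ :=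
  Nat.card {p : (Fin n → ℤ) × (Fin n → ℤ) //
    detFx A p.1 ≠ 0 ∧ (supNorm p.1 : ℝ) ≤ X ∧ (supNorm p.2 : ℝ) ≤ Y ∧ biForm A p.1 p.2 = 0}

/-- `N_U(B)`, counting rational points of height at most `B` on the open subset `U` -/
def NU {n : ℕ} (A : Fin n → Fin n → Fin n → Fin n → ℤ) (B : ℝ) : ℝ :=
  (Nat.card {p : (Fin n → ℤ) × (Fin n → ℤ) //
    Finset.univ.gcd p.1 = 1 ∧ Finset.univ.gcd p.2 = 1 ∧
    detFx A p.1 ≠ 0 ∧ detFy A p.2 ≠ 0 ∧ biForm A p.1 p.2 = 0 ∧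
    (supNorm p.1 : ℝ) ^ (n - 2) * (supNorm p.2 : ℝ) ^ (n - 2) ≤ B} : ℝ) / 4

def kap (n : ℕ) : ℝ := if Even n then 0 else 1

section

/-! ### Lattice points in symmetric domains and exponential sums -/

variable {n : ℕ}

/-- A `δ`-separated finite subset of the unit ball of a normed space of finite dimension `d`
has at most `(1 + 2 / δ) ^ d` elements. -/
theorem card_le_of_separated_unitBall {E : Type*} [NormedAddCommGroup E] [NormedSpace ℝ E]
    [FiniteDimensional ℝ E] (s : Finset E) {δ : ℝ} (hδ : 0 < δ) (hs : ∀ c ∈ s, ‖c‖ ≤ 1)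
    (h : ∀ c ∈ s, ∀ d ∈ s, c ≠ d → δ ≤ ‖c - d‖) :
    (s.card : ℝ) ≤ (1 + 2 / δ) ^ Module.finrank ℝ E := by
  borelize E
  let μ : Measure E := Measure.addHaar
  have hρ : 0 < 1 + δ / 2 := by positivity
  have hδ2 : 0 < δ / 2 := by positivity
  set A := ⋃ c ∈ s, Metric.ball (c : E) (δ / 2) with hA
  have D : Set.Pairwise (s : Set E) (Function.onFun Disjoint fun c => Metric.ball (c : E) (δ / 2)) := by
    rintro c hc d hd hcd
    apply Metric.ball_disjoint_ball
    rw [dist_eq_norm]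
    linarith [h c hc d hd hcd]
  have A_subset : A ⊆ Metric.ball (0 : E) (1 + δ / 2) := by
    refine Set.iUnion₂_subset fun x hx => Metric.ball_subset_ball' ?_
    rw [dist_zero_right]
    linarith [hs x hx]
  have I : (s.card : ENNReal) * ENNReal.ofReal ((δ / 2) ^ Module.finrank ℝ E) * μ (Metric.ball 0 1) ≤
      ENNReal.ofReal ((1 + δ / 2) ^ Module.finrank ℝ E) * μ (Metric.ball 0 1) :=
    calc
      _ = μ A := by
        rw [hA, measure_biUnion_finset D fun c _ => measurableSet_ball]
        simp only [μ.addHaar_ball_of_pos _ hδ2]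
        simp only [Finset.sum_const, nsmul_eq_mul, mul_assoc]
      _ ≤ μ (Metric.ball (0 : E) (1 + δ / 2)) := measure_mono A_subset
      _ = _ := by simp only [μ.addHaar_ball_of_pos _ hρ]
  have J := (ENNReal.mul_le_mul_iff_left (Metric.measure_ball_pos μ _ zero_lt_one).ne'
    measure_ball_lt_top.ne).1 I
  have K := ENNReal.toReal_le_of_le_ofReal (pow_nonneg hρ.le _) J
  rw [ENNReal.toReal_mul, ENNReal.toReal_ofReal (by positivity), ENNReal.toReal_natCast] at K
  rw [← le_div_iff₀ (by positivity), ← div_pow] at K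
  rwa [show 1 + 2 / δ = (1 + δ / 2) / (δ / 2) by field_simp; ring]

/-- Integer pairs `(u, v)` with `u` of size at most `a` and `L u + v` of size at most `e`. -/
def latSet (L : Matrix (Fin n) (Fin n) ℝ) (a e : ℝ) : Set ((Fin n → ℤ) × (Fin n → ℤ)) :=
  {p | (∀ i, |(p.1 i : ℝ)| ≤ a) ∧ ∀ i, |∑ j, L i j * p.1 j + p.2 i| ≤ e}

/-- The number of elements of `latSet`. -/
def latN (L : Matrix (Fin n) (Fin n) ℝ) (a e : ℝ) : ℕ := (latSet L a e).ncard

theorem finite_int_vec (R : ℝ) : {u : Fin n → ℤ | ∀ i, |(u i : ℝ)| ≤ R}.Finite := by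
  refine ((Set.finite_Icc (fun _ : Fin n => ⌊-R⌋) (fun _ => ⌈R⌉))).subset fun u hu => ?_
  constructor <;> intro i
  · have := (abs_le.1 (hu i)).1
    exact_mod_cast (Int.floor_le (-R)).trans this
  · have := (abs_le.1 (hu i)).2
    exact_mod_cast this.trans (Int.le_ceil R)

theorem latSet_finite (L : Matrix (Fin n) (Fin n) ℝ) (a e : ℝ) : (latSet L a e).Finite := by
  set R := ∑ i, ∑ j, |L i j| * |a| + |e| with hR
  refine ((finite_int_vec (n := n) a).prod (finite_int_vec (n := n) R)).subset ?_
  rintro ⟨u, v⟩ ⟨h1, h2⟩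
  refine ⟨h1, fun i => ?_⟩
  have h3 : |(v i : ℝ)| ≤ |∑ j, L i j * u j| + |∑ j, L i j * u j + v i| := by
    have := abs_sub (∑ j, L i j * u j + v i) (∑ j, L i j * u j)
    simp only [add_sub_cancel_left] at this
    linarith
  have h4 : |∑ j, L i j * u j| ≤ ∑ j, |L i j| * |a| := by
    refine (Finset.abs_sum_le_sum_abs _ _).trans (Finset.sum_le_sum fun j _ => ?_)
    rw [abs_mul]
    exact mul_le_mul_of_nonneg_left ((h1 j).trans (le_abs_self a)) (abs_nonneg _)
  have h5 : ∑ j, |L i j| * |a| ≤ ∑ i, ∑ j, |L i j| * |a| :=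
    Finset.single_le_sum (f := fun i => ∑ j, |L i j| * |a|) (fun i _ => by positivity)
      (Finset.mem_univ i)
  have := (h2 i).trans (le_abs_self e)
  simp only at this
  linarith

theorem latN_mono (L : Matrix (Fin n) (Fin n) ℝ) {a e a' e' : ℝ} (ha : a ≤ a') (he : e ≤ e') :
    latN L a e ≤ latN L a' e' :=
  Set.ncard_le_ncard (fun _ hp => ⟨fun i => (hp.1 i).trans ha, fun i => (hp.2 i).trans he⟩)
    (latSet_finite L a' e')

/-- The normalised embedding of a lattice pair into `ℝ^n × ℝ^n`. -/
def latEmb (L : Matrix (Fin n) (Fin n) ℝ) (a e : ℝ) (p : (Fin n → ℤ) × (Fin n → ℤ)) :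
    (Fin n → ℝ) × (Fin n → ℝ) :=
  (fun i => p.1 i / a, fun i => (∑ j, L i j * p.1 j + p.2 i) / e)

theorem latEmb_sub (L : Matrix (Fin n) (Fin n) ℝ) (a e : ℝ) (p q : (Fin n → ℤ) × (Fin n → ℤ)) :
    latEmb L a e (p - q) = latEmb L a e p - latEmb L a e q := by
  ext i
  · simp [latEmb, sub_div]
  · simp only [latEmb, Prod.fst_sub, Prod.snd_sub, Pi.sub_apply, Int.cast_sub, mul_sub,
      Finset.sum_sub_distrib]
    ring

theorem latEmb_norm_le {L : Matrix (Fin n) (Fin n) ℝ} {a e r : ℝ} (ha : 0 < a) (he : 0 < e)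
    (hr : 0 ≤ r) {p : (Fin n → ℤ) × (Fin n → ℤ)} :
    ‖latEmb L a e p‖ ≤ r ↔ p ∈ latSet L (r * a) (r * e) := by
  rw [Prod.norm_def, max_le_iff, pi_norm_le_iff_of_nonneg hr, pi_norm_le_iff_of_nonneg hr]
  simp only [latEmb, Real.norm_eq_abs, abs_div, abs_of_pos ha, abs_of_pos he, div_le_iff₀ ha,
    div_le_iff₀ he]
  rfl

/-- If the normalised lattice pairs lie in a subspace of dimension at most `d`, shrinking the box
by a factor `Z` loses at most a factor `(1 + 2 * Z) ^ d`. -/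
theorem latN_shrink (L : Matrix (Fin n) (Fin n) ℝ) {a e Z : ℝ} (ha : 0 < a) (he : 0 < e)
    (hZ : 0 < Z) (V : Submodule ℝ ((Fin n → ℝ) × (Fin n → ℝ))) {d : ℕ}
    (hd : Module.finrank ℝ V ≤ d) (hV : ∀ p ∈ latSet L a e, latEmb L a e p ∈ V) :
    (latN L a e : ℝ) ≤ (1 + 2 * Z) ^ d * latN L (a / Z) (e / Z) := by
  classical
  set S := (latSet_finite L a e).toFinset with hS
  have hmem : ∀ p, p ∈ S ↔ p ∈ latSet L a e := fun p => by simp [hS]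
  set P : Finset (Finset ((Fin n → ℤ) × (Fin n → ℤ))) := S.powerset.filter fun C =>
    ∀ c ∈ C, ∀ d ∈ C, c ≠ d → 1 / Z ≤ ‖latEmb L a e c - latEmb L a e d‖ with hP
  have hne : P.Nonempty := ⟨∅, by simp [hP]⟩
  obtain ⟨C, hC, hmax⟩ := P.exists_max_image Finset.card hne
  have hCS : C ⊆ S := by simpa using (Finset.mem_filter.1 hC).1
  have hsep := (Finset.mem_filter.1 hC).2
  have hcov : ∀ p ∈ S, ∃ c ∈ C, ‖latEmb L a e p - latEmb L a e c‖ ≤ 1 / Z := by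
    intro p hp
    by_contra! hcon
    have hpC : p ∉ C := fun h => by
      have := hcon p h
      simp only [sub_self, norm_zero] at this
      exact absurd this (not_lt.2 (by positivity))
    have : insert p C ∈ P := by
      refine Finset.mem_filter.2 ⟨Finset.mem_powerset.2 (Finset.insert_subset hp hCS), ?_⟩
      intro c hc d hd hcd
      rcases Finset.mem_insert.1 hc with hc | hc <;> rcases Finset.mem_insert.1 hd with hd | hd
      · exact absurd (hc.trans hd.symm) hcd
      · rw [hc]; exact (hcon d hd).le
      · rw [hd, norm_sub_rev]; exact (hcon c hc).le
      · exact hsep c hc d hd hcd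
    have := hmax _ this
    rw [Finset.card_insert_of_notMem hpC] at this
    omega
  choose! f hf hf2 using hcov
  have h1 : S.card ≤ latN L (a / Z) (e / Z) * C.card := by
    refine Finset.card_le_mul_card_image_of_maps_to hf _ fun c hc => ?_
    rw [← Finset.card_image_of_injective _ (sub_left_injective (b := c)), latN,
      Set.ncard_eq_toFinset_card _ (latSet_finite L (a / Z) (e / Z))]
    refine Finset.card_le_card fun q hq => ?_
    obtain ⟨p, hp, rfl⟩ := Finset.mem_image.1 hq
    obtain ⟨hpS, rfl⟩ := Finset.mem_filter.1 hp
    have := hf2 p hpS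
    rw [← latEmb_sub, latEmb_norm_le ha he (by positivity)] at this
    simpa [div_eq_inv_mul] using this
  have h2 : (C.card : ℝ) ≤ (1 + 2 * Z) ^ d := by
    have hinj : Set.InjOn (latEmb L a e) C := by
      intro c hc d hd hcd
      by_contra hne
      have := hsep c hc d hd hne
      rw [hcd, sub_self, norm_zero] at this
      exact absurd this (not_le.2 (by positivity))
    set g : C → V := fun c => ⟨latEmb L a e c, hV _ ((hmem _).1 (hCS c.2))⟩ with hg
    have hginj : Function.Injective g := fun c d h => by
      have := congrArg Subtype.val h
      exact Subtype.ext (hinj c.2 d.2 this)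
    have h3 := card_le_of_separated_unitBall (Finset.univ.image g) (δ := 1 / Z) (by positivity)
      (by
        intro c hc
        obtain ⟨c, -, rfl⟩ := Finset.mem_image.1 hc
        rw [Submodule.coe_norm, hg]
        rw [latEmb_norm_le ha he zero_le_one, one_mul, one_mul]
        exact (hmem _).1 (hCS c.2))
      (by
        intro c hc d hd hcd
        obtain ⟨c, -, rfl⟩ := Finset.mem_image.1 hc
        obtain ⟨d, -, rfl⟩ := Finset.mem_image.1 hd
        refine hsep c c.2 d d.2 fun h => hcd ?_
        rw [Subtype.ext h])
    rw [Finset.card_image_of_injective _ hginj, Finset.card_univ, Fintype.card_coe] at h3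
    refine h3.trans ?_
    rw [div_div_eq_mul_div, div_one]
    exact pow_le_pow_right₀ (by linarith) hd
  have h0 : latN L a e = S.card := by rw [latN, Set.ncard_eq_toFinset_card _ (latSet_finite L a e)]
  rw [h0]
  calc (S.card : ℝ) ≤ latN L (a / Z) (e / Z) * C.card := by exact_mod_cast h1
    _ ≤ _ := by rw [mul_comm]; gcongr

/-- Covering a dilated box by translates of the box. -/
theorem latN_dilate (L : Matrix (Fin n) (Fin n) ℝ) {a e Z : ℝ} (ha : 0 < a) (he : 0 < e)
    (hZ : 0 < Z) :
    (latN L (Z * a) (Z * e) : ℝ) ≤ (1 + 2 * Z) ^ (2 * n) * latN L a e := by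
  have := latN_shrink L (a := Z * a) (e := Z * e) (by positivity) (by positivity) hZ ⊤ (d := 2 * n)
    (by simp [two_mul]) (fun _ _ => Submodule.mem_top)
  rwa [mul_div_cancel_left₀ _ hZ.ne', mul_div_cancel_left₀ _ hZ.ne'] at this

/-- The normalised lattice spans of dual boxes are orthogonal for the symplectic form, so their
dimensions add up to at most `2n`. -/
theorem finrank_span_latEmb_add_le (L : Matrix (Fin n) (Fin n) ℝ) {a e c : ℝ} (ha : 0 < a)
    (he : 0 < e) (hc : 0 < c) (hcn : 2 * n * c < 1) :
    Module.finrank ℝ (Submodule.span ℝ (latEmb L a e '' latSet L a e)) +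
      Module.finrank ℝ (Submodule.span ℝ
        (latEmb L.transpose (c / e) (c / a) '' latSet L.transpose (c / e) (c / a))) ≤ 2 * n := by
  set V := Submodule.span ℝ (latEmb L a e '' latSet L a e) with hVdef
  set W := Submodule.span ℝ
    (latEmb L.transpose (c / e) (c / a) '' latSet L.transpose (c / e) (c / a)) with hWdef
  let B : LinearMap.BilinForm ℝ ((Fin n → ℝ) × (Fin n → ℝ)) := LinearMap.mk₂ ℝ
    (fun p q => ∑ i, (q.1 i * p.2 i - p.1 i * q.2 i))
    (fun p p' q => by
      rw [← Finset.sum_add_distrib]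
      exact Finset.sum_congr rfl fun i _ => by simp only [Prod.fst_add, Prod.snd_add, Pi.add_apply]; ring)
    (fun r p q => by
      rw [Finset.smul_sum]
      exact Finset.sum_congr rfl fun i _ => by
        simp only [Prod.smul_fst, Prod.smul_snd, Pi.smul_apply, smul_eq_mul]; ring)
    (fun p q q' => by
      rw [← Finset.sum_add_distrib]
      exact Finset.sum_congr rfl fun i _ => by simp only [Prod.fst_add, Prod.snd_add, Pi.add_apply]; ring)
    (fun r p q => by
      rw [Finset.smul_sum]
      exact Finset.sum_congr rfl fun i _ => by
        simp only [Prod.smul_fst, Prod.smul_snd, Pi.smul_apply, smul_eq_mul]; ring)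
  have hB : ∀ p q, B p q = ∑ i, (q.1 i * p.2 i - p.1 i * q.2 i) := fun p q => rfl
  have hker : ∀ p, (∀ q, B p q = 0) → p = 0 := by
    intro p hp
    ext i
    · have := hp (0, Pi.single i 1)
      simp only [hB, Pi.single_apply] at this
      simpa using this
    · have := hp (Pi.single i 1, 0)
      simp only [hB, Pi.single_apply] at this
      simpa using this
  have hanti : ∀ p q, B p q = - B q p := fun p q => by
    rw [hB, hB, ← Finset.sum_neg_distrib]
    exact Finset.sum_congr rfl fun i _ => by ring
  have hBn : B.Nondegenerate := by
    refine ⟨fun p hp => hker p hp, fun p hp => hker p fun q => ?_⟩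
    rw [hanti, hp q, neg_zero]
  have hperp : ∀ p ∈ latSet L a e, ∀ q ∈ latSet L.transpose (c / e) (c / a),
      B (latEmb L a e p) (latEmb L.transpose (c / e) (c / a) q) = 0 := by
    rintro ⟨u, v⟩ ⟨h1, h2⟩ ⟨s, t⟩ ⟨h3, h4⟩
    simp only at h1 h2 h3 h4
    have key : ∑ i, ((s i : ℝ) * (∑ j, L i j * u j + v i) -
        u i * (∑ j, L.transpose i j * s j + t i)) = ((∑ i, (s i * v i - u i * t i) : ℤ) : ℝ) := by
      push_cast
      simp only [mul_add, Finset.sum_sub_distrib, Finset.sum_add_distrib, Finset.mul_sum,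
        Matrix.transpose_apply]
      rw [Finset.sum_comm (f := fun i j => (u i : ℝ) * (L j i * s j))]
      have : ∀ i j, (u j : ℝ) * (L i j * s i) = s i * (L i j * u j) := fun i j => by ring
      simp only [this]
      ring
    have hsmall : |((∑ i, (s i * v i - u i * t i) : ℤ) : ℝ)| < 1 := by
      rw [← key]
      refine (Finset.abs_sum_le_sum_abs _ _).trans_lt ?_
      calc _ ≤ ∑ i : Fin n, (2 * c) := Finset.sum_le_sum fun i _ => by
            refine (abs_sub _ _).trans ?_
            rw [abs_mul, abs_mul]
            have e1 : |(s i : ℝ)| * |∑ j, L i j * u j + v i| ≤ c / e * e :=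
              mul_le_mul (h3 i) (h2 i) (abs_nonneg _) (by positivity)
            have e2 : |(u i : ℝ)| * |∑ j, L.transpose i j * s j + t i| ≤ a * (c / a) :=
              mul_le_mul (h1 i) (h4 i) (abs_nonneg _) (by positivity)
            rw [div_mul_cancel₀ _ he.ne'] at e1
            rw [mul_div_cancel₀ _ ha.ne'] at e2
            linarith
        _ = 2 * n * c := by simp; ring
        _ < 1 := hcn
    have hz : (∑ i, (s i * v i - u i * t i) : ℤ) = 0 := by
      rw [← Int.cast_abs] at hsmall
      exact Int.abs_lt_one_iff.1 (by exact_mod_cast hsmall)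
    rw [hz, Int.cast_zero] at key
    have : B (latEmb L a e (u, v)) (latEmb L.transpose (c / e) (c / a) (s, t)) =
        (∑ i, ((s i : ℝ) * (∑ j, L i j * u j + v i) -
        u i * (∑ j, L.transpose i j * s j + t i))) / c := by
      rw [hB, Finset.sum_div]
      refine Finset.sum_congr rfl fun i _ => ?_
      simp only [latEmb]
      field_simp
    rw [this, key, zero_div]
  have hle : W ≤ B.orthogonal V := by
    rw [hWdef, Submodule.span_le]
    rintro _ ⟨q, hq, rfl⟩
    rw [SetLike.mem_coe, LinearMap.BilinForm.mem_orthogonal_iff]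
    intro x hx
    induction hx using Submodule.span_induction with
    | mem x hx => obtain ⟨p, hp, rfl⟩ := hx; exact hperp p hp q hq
    | zero => exact by change B 0 _ = 0; rw [map_zero, LinearMap.zero_apply]
    | add x y _ _ h1 h2 => change B (x + y) _ = 0; rw [map_add, LinearMap.add_apply]; rw [h1, h2, add_zero]
    | smul r x _ h1 => change B (r • x) _ = 0; rw [map_smul, LinearMap.smul_apply]; rw [h1, smul_zero]
  have h1 := Submodule.finrank_mono hle
  have h2 := LinearMap.BilinForm.finrank_orthogonal hBn V
  have h3 := Submodule.finrank_le V
  have h4 : Module.finrank ℝ ((Fin n → ℝ) × (Fin n → ℝ)) = 2 * n := by simp [two_mul]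
  omega

theorem ee_add (s t : ℝ) : ee (s + t) = ee s * ee t := by
  rw [ee, ee, ee, ← Complex.exp_add]; push_cast; ring_nf

theorem ee_zero : ee 0 = 1 := by simp [ee]

theorem ee_int (m : ℤ) : ee m = 1 := by
  rw [ee, ← Complex.exp_int_mul_two_pi_mul_I m]; congr 1; push_cast; ring

theorem ee_add_int (t : ℝ) (m : ℤ) : ee (t + m) = ee t := by rw [ee_add, ee_int, mul_one]

theorem ee_eq_exp (t : ℝ) : ee t = Complex.exp (Complex.I * ((2 * Real.pi * t : ℝ) : ℂ)) := by
  rw [ee]; congr 1; push_cast; ring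

theorem norm_ee (t : ℝ) : ‖ee t‖ = 1 := by
  rw [ee_eq_exp, mul_comm, Complex.norm_exp_ofReal_mul_I]

theorem ee_neg (t : ℝ) : ee (-t) = (starRingEnd ℂ) (ee t) := by
  rw [ee, ee, ← Complex.exp_conj]; congr 1; simp [Complex.conj_ofNat]

theorem ee_sub (s t : ℝ) : ee (s - t) = ee s * (starRingEnd ℂ) (ee t) := by
  rw [sub_eq_add_neg, ee_add, ee_neg]

theorem ee_nat_mul (t : ℝ) (k : ℕ) : ee (k * t) = ee t ^ k := by
  rw [ee, ee, ← Complex.exp_nat_mul]; congr 1; push_cast; ring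

theorem ee_sum {ι : Type*} (s : Finset ι) (f : ι → ℝ) : ee (∑ i ∈ s, f i) = ∏ i ∈ s, ee (f i) := by
  simp only [ee, ← Complex.exp_sum]; push_cast; rw [Finset.mul_sum]

theorem continuous_ee : Continuous ee := by unfold ee; fun_prop

theorem norm_ee_sub_one_le (t : ℝ) : ‖ee t - 1‖ ≤ 2 * Real.pi * |t| := by
  rw [ee_eq_exp]
  refine (Real.norm_exp_I_mul_ofReal_sub_one_le (x := 2 * Real.pi * t)).trans ?_
  rw [Real.norm_eq_abs, abs_mul, abs_of_pos Real.two_pi_pos]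

theorem le_norm_ee_sub_one (t : ℝ) : 4 * |t - round t| ≤ ‖ee t - 1‖ := by
  have h1 : ee t = ee (t - round t) := by
    rw [← ee_add_int (t - round t) (round t)]; simp
  have h2 := abs_sub_round t
  rw [h1]
  set x := t - round t
  rw [ee_eq_exp, Complex.norm_exp_I_mul_ofReal_sub_one, Real.norm_eq_abs, abs_mul, abs_two,
    show 2 * Real.pi * x / 2 = Real.pi * x by ring]
  have h3 : 2 / Real.pi * |Real.pi * x| ≤ |Real.sin (Real.pi * x)| := by
    apply Real.mul_abs_le_abs_sin
    rw [abs_mul, abs_of_pos Real.pi_pos]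
    nlinarith [Real.pi_pos]
  rw [abs_mul, abs_of_pos Real.pi_pos] at h3
  have h4 : 2 / Real.pi * (Real.pi * |x|) = 2 * |x| := by
    field_simp
  linarith

/-- Geometric sums of additive characters. -/
def geoSum (N : ℕ) (t : ℝ) : ℂ := ∑ k ∈ Finset.range N, ee (k * t)

theorem norm_geoSum_le (N : ℕ) (t : ℝ) : ‖geoSum N t‖ ≤ N := by
  refine (norm_sum_le _ _).trans ?_
  simp [norm_ee]

theorem norm_geoSum_mul_le (N : ℕ) (t : ℝ) : ‖geoSum N t‖ * |t - round t| ≤ 1 / 2 := by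
  have h1 : geoSum N t * (ee t - 1) = ee t ^ N - 1 := by
    simp only [geoSum, ee_nat_mul]; exact geom_sum_mul _ _
  have h2 : ‖geoSum N t‖ * ‖ee t - 1‖ ≤ 2 := by
    rw [← norm_mul, h1]
    refine (norm_sub_le _ _).trans ?_
    rw [norm_pow, norm_ee]; norm_num
  nlinarith [le_norm_ee_sub_one t, norm_nonneg (geoSum N t)]

theorem le_norm_geoSum {N : ℕ} {t : ℝ} {m : ℤ} (h : N * |t + m| ≤ 1 / 16) :
    (N : ℝ) / 2 ≤ ‖geoSum N t‖ := by
  have h0 : ∀ k : ℕ, ee (k * t) = ee (k * (t + m)) := fun k => by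
    rw [mul_add, show (k : ℝ) * (m : ℝ) = ((k * m : ℤ) : ℝ) by push_cast; ring, ee_add_int]
  have h1 : ‖(N : ℂ) - geoSum N t‖ ≤ N / 2 := by
    have : (N : ℂ) - geoSum N t = ∑ k ∈ Finset.range N, (1 - ee (k * (t + m))) := by
      rw [Finset.sum_sub_distrib]; simp [geoSum, h0]
    rw [this]
    refine (norm_sum_le _ _).trans ?_
    calc _ ≤ ∑ k ∈ Finset.range N, (1 / 2 : ℝ) := by
          refine Finset.sum_le_sum fun k hk => ?_
          rw [norm_sub_rev]
          refine (norm_ee_sub_one_le _).trans ?_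
          rw [abs_mul, Nat.abs_cast]
          have hk : (k : ℝ) ≤ N := by exact_mod_cast (Finset.mem_range.1 hk).le
          have : (k : ℝ) * |t + m| ≤ 1 / 16 := (by gcongr : (k : ℝ) * |t + m| ≤ N * |t + m|).trans h
          nlinarith [Real.pi_le_four, Real.pi_pos]
      _ = N / 2 := by simp; ring
  have h2 := norm_sub_norm_le (N : ℂ) (geoSum N t)
  rw [Complex.norm_natCast] at h2
  linarith

/-- A sum of products over integer vectors is controlled by the number of vectors per cell. -/
theorem sum_prod_cell_le {n : ℕ} (L : Matrix (Fin n) (Fin n) ℝ) (S : Finset (Fin n → ℤ)) {R P : ℝ}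
    (hP : 0 < P) (hS : ∀ s ∈ S, ∀ i, |(s i : ℝ)| ≤ R) (f : Fin n → (Fin n → ℤ) → ℝ)
    (w : ℤ → ℝ) (I : Finset ℤ) (hf0 : ∀ s ∈ S, ∀ j, 0 ≤ f j s) (hw : ∀ r ∈ I, 0 ≤ w r)
    (hI : ∀ s ∈ S, ∀ j, ⌊P * (∑ k, L j k * s k - round (∑ k, L j k * s k))⌋ ∈ I)
    (hf : ∀ s ∈ S, ∀ j, f j s ≤ w ⌊P * (∑ k, L j k * s k - round (∑ k, L j k * s k))⌋) :
    ∑ s ∈ S, ∏ j, f j s ≤ (∑ r ∈ I, w r) ^ n * latN L (2 * R) (1 / P) := by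
  classical
  set c : (Fin n → ℤ) → Fin n → ℤ := fun s j =>
    ⌊P * (∑ k, L j k * s k - round (∑ k, L j k * s k))⌋ with hc
  have hfib : ∀ r, ((S.filter fun s => c s = r).card : ℝ) ≤ latN L (2 * R) (1 / P) := by
    intro r
    norm_cast
    rcases (S.filter fun s => c s = r).eq_empty_or_nonempty with h | ⟨s0, h0⟩
    · simp [h]
    have h0' := Finset.mem_filter.1 h0
    rw [latN, Set.ncard_eq_toFinset_card _ (latSet_finite L (2 * R) (1 / P))]
    refine Finset.card_le_card_of_injOn (fun s => (s - s0, fun j =>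
      -round (∑ k, L j k * s k) + round (∑ k, L j k * s0 k))) ?_ ?_
    · intro s hs
      have hs' := Finset.mem_filter.1 (Finset.mem_coe.1 hs)
      simp only [Set.Finite.coe_toFinset]
      refine ⟨fun i => ?_, fun j => ?_⟩
      · have := (abs_sub (s i : ℝ) (s0 i)).trans (add_le_add (hS s hs'.1 i) (hS s0 h0'.1 i))
        simp only [Pi.sub_apply, Int.cast_sub]
        linarith
      · have e1 : c s j = c s0 j := by rw [hs'.2, h0'.2]
        have e2 := Int.abs_sub_lt_one_of_floor_eq_floor e1
        rw [← mul_sub, abs_mul, abs_of_pos hP] at e2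
        rw [le_div_iff₀ hP, mul_comm]
        refine le_of_eq_of_le ?_ e2.le
        congr 2
        simp only [Pi.sub_apply, Int.cast_sub, mul_sub, Finset.sum_sub_distrib]
        push_cast
        ring
    · intro s _ s' _ h
      simpa using congrArg Prod.fst h
  calc ∑ s ∈ S, ∏ j, f j s ≤ ∑ s ∈ S, ∏ j, w (c s j) :=
        Finset.sum_le_sum fun s hs => Finset.prod_le_prod (fun j _ => hf0 s hs j)
          fun j _ => hf s hs j
    _ = ∑ r ∈ Fintype.piFinset fun _ => I, ∑ s ∈ S.filter fun s => c s = r, ∏ j, w (c s j) :=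
        (Finset.sum_fiberwise_of_maps_to (fun s hs => Fintype.mem_piFinset.2 fun j => hI s hs j) _).symm
    _ ≤ ∑ r ∈ Fintype.piFinset fun _ => I, latN L (2 * R) (1 / P) * ∏ j, w (r j) := by
        refine Finset.sum_le_sum fun r hr => ?_
        rw [Finset.sum_congr rfl (g := fun _ => ∏ j, w (r j)) fun s hs => by
          rw [(Finset.mem_filter.1 hs).2], Finset.sum_const, nsmul_eq_mul]
        exact mul_le_mul_of_nonneg_right (hfib r)
          (Finset.prod_nonneg fun j _ => hw _ (Fintype.mem_piFinset.1 hr j))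
    _ = _ := by
        rw [← Finset.mul_sum, ← Finset.prod_univ_sum, Finset.prod_const, Finset.card_univ,
          Fintype.card_fin, mul_comm]

theorem exists_sum_cell_weight_le : ∃ C : ℝ, 1 ≤ C ∧ ∀ I : Finset ℤ,
    ∑ r ∈ I, 5 / (1 + (r : ℝ) ^ 2) ≤ C := by
  have hs : Summable fun r : ℤ => 5 / (1 + (r : ℝ) ^ 2) := by
    refine Summable.of_norm_bounded_eventually (g := fun r : ℤ => 5 * (1 / (r : ℝ) ^ 2))
      ((Real.summable_one_div_int_pow.2 one_lt_two).mul_left 5) ?_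
    filter_upwards [(Set.finite_singleton (0 : ℤ)).compl_mem_cofinite] with r hr
    have hr' : (r : ℝ) ≠ 0 := by exact_mod_cast hr
    rw [Real.norm_of_nonneg (by positivity), mul_one_div]
    gcongr
    linarith
  refine ⟨max 1 (∑' r : ℤ, 5 / (1 + (r : ℝ) ^ 2)), le_max_left _ _, fun I =>
    (hs.sum_le_tsum I fun _ _ => by positivity).trans (le_max_right _ _)⟩

/-- Quadratically decaying kernels lose only a constant in the cell decomposition. -/
theorem exists_sum_prod_kernel_le (n : ℕ) : ∃ C : ℝ, 1 ≤ C ∧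
    ∀ (L : Matrix (Fin n) (Fin n) ℝ) (S : Finset (Fin n → ℤ)) (R P B : ℝ), 0 < P → 0 ≤ B →
    (∀ s ∈ S, ∀ i, |(s i : ℝ)| ≤ R) → ∀ f : Fin n → (Fin n → ℤ) → ℝ,
    (∀ s ∈ S, ∀ j, 0 ≤ f j s ∧ f j s ≤ B ∧
      f j s * (P * |∑ k, L j k * s k - round (∑ k, L j k * s k)|) ^ 2 ≤ B) →
    ∑ s ∈ S, ∏ j, f j s ≤ C * B ^ n * latN L (2 * R) (1 / P) := by
  classical
  obtain ⟨C, hC1, hC⟩ := exists_sum_cell_weight_le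
  refine ⟨C ^ n, one_le_pow₀ hC1, fun L S R P B hP hB hS f hf => ?_⟩
  set c : (Fin n → ℤ) → Fin n → ℤ := fun s j =>
    ⌊P * (∑ k, L j k * s k - round (∑ k, L j k * s k))⌋ with hc
  set I : Finset ℤ := S.biUnion fun s => Finset.univ.image (c s) with hI
  refine (sum_prod_cell_le L S hP hS f (fun r => B * (5 / (1 + (r : ℝ) ^ 2))) I
    (fun s hs j => (hf s hs j).1) (fun r _ => by positivity) (fun s hs j => ?_)
    (fun s hs j => ?_)).trans ?_
  · exact Finset.mem_biUnion.2 ⟨s, hs, Finset.mem_image.2 ⟨j, Finset.mem_univ _, rfl⟩⟩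
  · obtain ⟨h0, h1, h2⟩ := hf s hs j
    set x := ∑ k, L j k * s k - round (∑ k, L j k * s k)
    set r := ⌊P * x⌋ with hr
    have hr1 : (r : ℝ) ≤ P * x := Int.floor_le _
    have hr2 : P * x < r + 1 := Int.lt_floor_add_one _
    rw [← abs_of_pos hP, ← abs_mul, sq_abs] at h2
    rw [mul_div_assoc', le_div_iff₀ (by positivity)]
    have key : 1 + (r : ℝ) ^ 2 ≤ 5 ∨ 1 + (r : ℝ) ^ 2 ≤ 5 * (P * x) ^ 2 := by
      rcases lt_trichotomy r 0 with h | h | h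
      · rcases eq_or_ne r (-1) with h' | h'
        · left; rw [h']; norm_num
        · have : r ≤ -2 := by omega
          have : (r : ℝ) ≤ -2 := by exact_mod_cast this
          right; nlinarith
      · left; rw [h]; norm_num
      · have : (1 : ℝ) ≤ r := by exact_mod_cast h
        right; nlinarith
    rcases key with h | h
    · nlinarith
    · nlinarith
  · rw [← Finset.mul_sum, mul_pow, mul_comm (C ^ n)]
    have := pow_le_pow_left₀ (Finset.sum_nonneg fun r _ => by positivity) (hC I) n
    gcongr

theorem sum_norm_sq_ee_duality {n : ℕ} (φ : (Fin n → ℤ) → (Fin n → ℤ) → ℝ)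
    (h1 : ∀ u u' s, φ (u - u') s = φ u s - φ u' s) (h2 : ∀ u s s', φ u (s - s') = φ u s - φ u s')
    (U S : Finset (Fin n → ℤ)) :
    ∑ u ∈ U, ∑ u' ∈ U, ‖∑ s ∈ S, ee (φ (u - u') s)‖ ^ 2 =
      ∑ s ∈ S, ∑ s' ∈ S, ‖∑ u ∈ U, ee (φ u (s - s'))‖ ^ 2 := by
  have key : ∀ (T : Finset (Fin n → ℤ)) (ψ : (Fin n → ℤ) → ℝ),
      ((‖∑ s ∈ T, ee (ψ s)‖ ^ 2 : ℝ) : ℂ) = ∑ s ∈ T, ∑ s' ∈ T, ee (ψ s - ψ s') := by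
    intro T ψ
    push_cast
    rw [← Complex.mul_conj', map_sum, Finset.sum_mul_sum]
    simp only [ee_sub]
  apply Complex.ofReal_injective
  rw [Complex.ofReal_sum, Complex.ofReal_sum]
  simp only [Complex.ofReal_sum, key, h1, h2]
  simp only [← Finset.sum_product']
  refine Finset.sum_nbij' (fun x => (x.2.2.1, x.2.2.2, x.1, x.2.1))
    (fun x => (x.2.2.1, x.2.2.2, x.1, x.2.1)) ?_ ?_ ?_ ?_ ?_
  · simp only [Finset.mem_product]; tauto
  · simp only [Finset.mem_product]; tauto
  · simp
  · simp
  · intro x _; simp only; congr 1; ring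

/-- The box of integer vectors with entries in `[0, N)`. -/
def qbox (n N : ℕ) : Finset (Fin n → ℤ) :=
  Fintype.piFinset fun _ => (Finset.range N).map Nat.castEmbedding

theorem mem_qbox {n N : ℕ} {s : Fin n → ℤ} : s ∈ qbox n N ↔ ∀ i, 0 ≤ s i ∧ s i < N := by
  rw [qbox, Fintype.mem_piFinset]
  refine forall_congr' fun i => ?_
  simp only [Finset.mem_map, Finset.mem_range, Nat.castEmbedding_apply]
  constructor
  · rintro ⟨k, hk, h⟩; omega
  · rintro ⟨h0, h1⟩; exact ⟨(s i).toNat, by omega, by simpa using h0⟩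

theorem card_qbox (n N : ℕ) : (qbox n N).card = N ^ n := by
  simp [qbox, Fintype.card_piFinset]

theorem sum_qbox_ee {n : ℕ} (N : ℕ) (θ : Fin n → ℝ) :
    ∑ s ∈ qbox n N, ee (∑ i, s i * θ i) = ∏ i, geoSum N (θ i) := by
  simp only [ee_sum, qbox, geoSum]
  rw [← Finset.prod_univ_sum (f := fun i (k : ℤ) => ee (k * θ i))]
  simp

/-- Duality for lattice point counts, through Fejér kernels. -/
theorem exists_latN_le_dual (n : ℕ) : ∃ C : ℝ, 1 ≤ C ∧
    ∀ (L : Matrix (Fin n) (Fin n) ℝ) (p M : ℕ) (a e : ℝ), 0 < p → 0 < M → a ≤ p → M * e ≤ 1 / 16 →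
    (latN L a e : ℝ) ≤ C * ((p : ℝ) / M) ^ n * latN L.transpose (2 * M) (1 / (2 * p)) := by
  classical
  obtain ⟨C, hC1, hC⟩ := exists_sum_prod_kernel_le n
  refine ⟨C * 16 ^ n, one_le_mul_of_one_le_of_one_le hC1 (one_le_pow₀ (by norm_num)),
    fun L p M a e hp hM ha he => ?_⟩
  set φ : (Fin n → ℤ) → (Fin n → ℤ) → ℝ := fun u s => ∑ i, s i * ∑ j, L i j * u j with hφ
  have hφt : ∀ u s, φ u s = ∑ j, u j * ∑ i, L.transpose j i * s i := by
    intro u s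
    simp only [hφ, Finset.mul_sum, Matrix.transpose_apply]
    rw [Finset.sum_comm]
    exact Finset.sum_congr rfl fun i _ => Finset.sum_congr rfl fun j _ => by ring
  have hdual := sum_norm_sq_ee_duality φ
    (fun u u' s => by
      simp only [hφ, Pi.sub_apply, Int.cast_sub, mul_sub, Finset.sum_sub_distrib])
    (fun u s s' => by
      simp only [hφ, Pi.sub_apply, Int.cast_sub, sub_mul, Finset.sum_sub_distrib])
    (qbox n (2 * p)) (qbox n M)
  have hpR : (0 : ℝ) < p := by exact_mod_cast hp
  have hMR : (0 : ℝ) < M := by exact_mod_cast hM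
  -- the upper bound
  have hup : ∑ s ∈ qbox n M, ∑ s' ∈ qbox n M, ‖∑ u ∈ qbox n (2 * p), ee (φ u (s - s'))‖ ^ 2 ≤
      (M : ℝ) ^ n * (C * ((2 * p : ℝ) ^ 2) ^ n * latN L.transpose (2 * M) (1 / (2 * p))) := by
    rw [Finset.sum_comm]
    refine (Finset.sum_le_card_nsmul _ _ _ fun s' hs' => ?_).trans_eq
      (by rw [card_qbox, nsmul_eq_mul]; push_cast; rfl)
    have e1 : ∑ s ∈ qbox n M, ‖∑ u ∈ qbox n (2 * p), ee (φ u (s - s'))‖ ^ 2 =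
        ∑ t ∈ (qbox n M).image (· - s'), ∏ j, ‖geoSum (2 * p) (∑ i, L.transpose j i * t i)‖ ^ 2 := by
      rw [Finset.sum_image fun _ _ _ _ h => sub_left_injective h]
      refine Finset.sum_congr rfl fun s _ => ?_
      simp only [hφt, sum_qbox_ee, norm_prod, Finset.prod_pow]
    rw [e1]
    refine hC L.transpose _ M (2 * p) ((2 * p) ^ 2) (by positivity) (by positivity) ?_ 
      (fun j t => ‖geoSum (2 * p) (∑ i, L.transpose j i * t i)‖ ^ 2) ?_
    · intro t ht i
      obtain ⟨s, hs, rfl⟩ := Finset.mem_image.1 ht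
      have h1 := mem_qbox.1 hs i
      have h2 := mem_qbox.1 hs' i
      have : |s i - s' i| ≤ M := by rw [abs_le]; omega
      exact_mod_cast this
    · intro t _ j
      set x := ∑ i, L.transpose j i * (t i : ℝ)
      have h1 := norm_geoSum_le (2 * p) x
      have h2 := norm_geoSum_mul_le (2 * p) x
      push_cast at h1
      refine ⟨by positivity, by gcongr, ?_⟩
      have h3 : (‖geoSum (2 * p) x‖ * |x - round x|) ^ 2 ≤ (1 / 2) ^ 2 := by gcongr
      rw [mul_pow, ← mul_assoc, mul_comm _ ((2 * p : ℝ) ^ 2), mul_assoc, ← mul_pow]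
      nlinarith [sq_nonneg (2 * p : ℝ)]
  -- the lower bound
  have hlow : (latN L a e : ℝ) * (p : ℝ) ^ n * (((M : ℝ) / 2) ^ 2) ^ n ≤
      ∑ u ∈ qbox n (2 * p), ∑ u' ∈ qbox n (2 * p), ‖∑ s ∈ qbox n M, ee (φ (u - u') s)‖ ^ 2 := by
    set Λ := (latSet_finite L a e).toFinset with hΛ
    have hmem : ∀ x, x ∈ Λ ↔ x ∈ latSet L a e := fun x => by simp [hΛ]
    set g : ((Fin n → ℤ) × (Fin n → ℤ)) × (Fin n → ℤ) → (Fin n → ℤ) × (Fin n → ℤ) := fun x =>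
      (fun i => x.2 i + max (x.1.1 i) 0, fun i => x.2 i + max (-x.1.1 i) 0) with hg
    have hgsub : ∀ x, (g x).1 - (g x).2 = x.1.1 := by
      intro x; funext i; simp only [hg, Pi.sub_apply]; omega
    have hge : ∀ x ∈ Λ, (M : ℝ) * e ≤ 1 / 16 := fun _ _ => he
    have hinj : Set.InjOn g (Λ ×ˢ qbox n p : Finset _) := by
      rintro ⟨⟨u, v⟩, z⟩ h1 ⟨⟨u', v'⟩, z'⟩ h2 h
      have hu : u = u' := by
        have := hgsub ((u, v), z)
        rw [h, hgsub] at this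
        exact this.symm
      subst hu
      have hz : z = z' := by
        funext i
        have := congrFun (congrArg Prod.fst h) i
        simpa [hg] using this
      subst hz
      have hv : v = v' := by
        funext i
        have h1' := ((hmem _).1 (Finset.mem_product.1 (Finset.mem_coe.1 h1)).1).2 i
        have h2' := ((hmem _).1 (Finset.mem_product.1 (Finset.mem_coe.1 h2)).1).2 i
        have hM1 : (1 : ℝ) ≤ M := by exact_mod_cast hM
        have he2 : 0 ≤ e := (abs_nonneg _).trans h1'
        have he3 : e ≤ 1 / 16 := by nlinarith
        have h3 : |((v i - v' i : ℤ) : ℝ)| < 1 := by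
          have := abs_sub (∑ j, L i j * u j + v i) (∑ j, L i j * u j + v' i)
          simp only [add_sub_add_left_eq_sub] at this
          push_cast
          simp only at h1' h2'
          linarith
        rw [← Int.cast_abs] at h3
        have := Int.abs_lt_one_iff.1 (by exact_mod_cast h3 : |v i - v' i| < 1)
        omega
      rw [hv]
    have hmaps : (Λ ×ˢ qbox n p).image g ⊆ qbox n (2 * p) ×ˢ qbox n (2 * p) := by
      intro y hy
      obtain ⟨⟨⟨u, v⟩, z⟩, hx, rfl⟩ := Finset.mem_image.1 hy
      obtain ⟨h1, h2⟩ := Finset.mem_product.1 hx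
      have h3 := ((hmem _).1 h1).1
      rw [mem_qbox] at h2
      have h4 : ∀ i, |u i| ≤ p := fun i => by
        have := (h3 i).trans ha
        exact_mod_cast this
      simp only [hg, Finset.mem_product, mem_qbox]
      refine ⟨fun i => ?_, fun i => ?_⟩
      · have h5 := h2 i; have h6 := abs_le.1 (h4 i); simp only at h5; push_cast; omega
      · have h5 := h2 i; have h6 := abs_le.1 (h4 i); simp only at h5; push_cast; omega
    rw [← Finset.sum_product' (f := fun u u' => ‖∑ s ∈ qbox n M, ee (φ (u - u') s)‖ ^ 2)]
    refine le_trans ?_ (Finset.sum_le_sum_of_subset_of_nonneg hmaps fun _ _ _ => by positivity)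
    rw [Finset.sum_image hinj]
    have hcard : (latN L a e : ℝ) * (p : ℝ) ^ n = ((Λ ×ˢ qbox n p).card : ℝ) := by
      rw [Finset.card_product, card_qbox, latN, Set.ncard_eq_toFinset_card _ (latSet_finite L a e)]
      push_cast; rfl
    rw [hcard, ← nsmul_eq_mul]
    refine Finset.card_nsmul_le_sum _ _ _ fun x hx => ?_
    simp only [hgsub, hφ, sum_qbox_ee, norm_prod]
    rw [← Finset.prod_pow]
    have : (((M : ℝ) / 2) ^ 2) ^ n = ∏ _i : Fin n, ((M : ℝ) / 2) ^ 2 := by simp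
    rw [this]
    refine Finset.prod_le_prod (fun _ _ => by positivity) fun i _ => ?_
    have h1 := ((hmem _).1 (Finset.mem_product.1 hx).1).2 i
    have := le_norm_geoSum (N := M) (t := ∑ j, L i j * x.1.1 j) (m := x.1.2 i)
      ((mul_le_mul_of_nonneg_left h1 hMR.le).trans he)
    gcongr
  rw [← hdual] at hup
  have h := hlow.trans hup
  have e1 : (latN L a e : ℝ) * ((p : ℝ) ^ n * (((M : ℝ) / 2) ^ 2) ^ n) ≤
    (C * 16 ^ n * ((p : ℝ) / M) ^ n * latN L.transpose (2 * M) (1 / (2 * p))) *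
      ((p : ℝ) ^ n * (((M : ℝ) / 2) ^ 2) ^ n) := by
    refine le_of_eq_of_le (by ring) (h.trans_eq ?_)
    have e2 : (M : ℝ) ^ n * ((2 * p : ℝ) ^ 2) ^ n =
        16 ^ n * ((p : ℝ) / M) ^ n * ((p : ℝ) ^ n * (((M : ℝ) / 2) ^ 2) ^ n) := by
      rw [← mul_pow, ← mul_pow, ← mul_pow, ← mul_pow]
      congr 1
      field_simp
      ring
    linear_combination (C * latN L.transpose (2 * M) (1 / (2 * p))) * e2
  exact le_of_mul_le_mul_right e1 (by positivity)

/-- The shrinking lemma: the variables can be reduced from size `a` to size `K`, possibly passing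
to the transposed matrix. -/
theorem exists_latN_le_shrink (n : ℕ) : ∃ C : ℝ, 1 ≤ C ∧
    ∀ (L : Matrix (Fin n) (Fin n) ℝ) (a e K : ℝ), 1 ≤ K → K ≤ a → 0 < e → K * e ≤ 1 →
    (latN L a e : ℝ) ≤ C * (a / K) ^ n *
      (latN L K (K * e / a) + latN L.transpose K (K * e / a)) := by
  obtain ⟨C, hC1, hC⟩ := exists_latN_le_dual n
  set c : ℝ := 1 / (4 * (n + 1)) with hc
  have hc0 : 0 < c := by positivity
  have hc1 : c ≤ 1 := by rw [hc, div_le_one (by positivity)]; linarith [(Nat.cast_nonneg n : (0:ℝ) ≤ n)]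
  have hcn : 2 * n * c < 1 := by
    rw [hc, mul_one_div, div_lt_one (by positivity)]; linarith [(Nat.cast_nonneg n : (0:ℝ) ≤ n)]
  set C1 : ℝ := (1 + 2 * 64) ^ (2 * n) with hC1'
  set C2 : ℝ := (1 + 2 * (4 / c)) ^ (2 * n) with hC2'
  have hC11 : 1 ≤ C1 := one_le_pow₀ (by norm_num)
  have hC21 : 1 ≤ C2 := one_le_pow₀ (by linarith [show 0 < 4 / c by positivity])
  have hCC : 1 ≤ C1 * (C * 2 ^ n) * C2 := one_le_mul_of_one_le_of_one_le
    (one_le_mul_of_one_le_of_one_le hC11 (one_le_mul_of_one_le_of_one_le hC1 (one_le_pow₀ (by norm_num)))) hC21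
  refine ⟨C1 * (C * 2 ^ n) * C2 * 3 ^ n,
    one_le_mul_of_one_le_of_one_le hCC (one_le_pow₀ (by norm_num)), fun L a e K hK hKa he hKe => ?_⟩
  have ha : 0 < a := by linarith
  have hK0 : 0 < K := by linarith
  have hdim := finrank_span_latEmb_add_le L ha he hc0 hcn
  by_cases hV : Module.finrank ℝ (Submodule.span ℝ (latEmb L a e '' latSet L a e)) ≤ n
  · have h1 := latN_shrink L ha he (Z := a / K) (by positivity) _ hV
      fun p hp => Submodule.subset_span ⟨p, hp, rfl⟩
    rw [div_div_cancel₀ ha.ne', show e / (a / K) = K * e / a by field_simp] at h1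
    have hZ : 1 ≤ a / K := by rwa [one_le_div hK0]
    calc (latN L a e : ℝ) ≤ (1 + 2 * (a / K)) ^ n * latN L K (K * e / a) := h1
      _ ≤ (3 * (a / K)) ^ n * latN L K (K * e / a) := by gcongr; linarith
      _ = 1 * 3 ^ n * (a / K) ^ n * (latN L K (K * e / a) + 0) := by rw [mul_pow]; ring
      _ ≤ _ := by gcongr; positivity
  · have hW : Module.finrank ℝ (Submodule.span ℝ
        (latEmb L.transpose (c / e) (c / a) '' latSet L.transpose (c / e) (c / a))) ≤ n := by omega
    have he1 : e ≤ 1 := by nlinarith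
    have h1e : 1 ≤ 1 / e := by rwa [one_le_div he]
    have h1 := latN_dilate L (a := a / 64) (e := e / 64) (by positivity) (by positivity)
      (Z := 64) (by norm_num)
    rw [mul_div_cancel₀ _ (by norm_num), mul_div_cancel₀ _ (by norm_num)] at h1
    set p := ⌈a⌉₊ with hp
    set M := ⌈1 / e⌉₊ with hM
    have hpa : a ≤ p := Nat.le_ceil a
    have hp2 : (p : ℝ) ≤ 2 * a := by linarith [Nat.ceil_lt_add_one ha.le]
    have hMe : 1 / e ≤ M := Nat.le_ceil _
    have hM2 : (M : ℝ) ≤ 2 / e := by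
      have := Nat.ceil_lt_add_one (a := 1 / e) (by positivity)
      rw [show 2 / e = 1 / e + 1 / e by ring]; linarith
    have hp0 : (0 : ℝ) < p := by linarith
    have hM0 : (0 : ℝ) < M := by linarith
    have h2 := hC L p M (a / 64) (e / 64) (by exact_mod_cast hp0) (by exact_mod_cast hM0)
      (by linarith) (by
        calc (M : ℝ) * (e / 64) ≤ 2 / e * (e / 64) := by gcongr
          _ = 1 / 32 := by field_simp; norm_num
          _ ≤ 1 / 16 := by norm_num)
    have h3 : (latN L.transpose (2 * M) (1 / (2 * p)) : ℝ) ≤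
        latN L.transpose (4 / c * (c / e)) (4 / c * (c / a)) := by
      refine Nat.cast_le.2 (latN_mono _ ?_ ?_)
      · rw [show 4 / c * (c / e) = 2 * (2 / e) by field_simp; norm_num]; linarith
      · rw [show 4 / c * (c / a) = 4 / a by field_simp]
        rw [div_le_div_iff₀ (by positivity) ha]; linarith
    have h4 := latN_dilate L.transpose (a := c / e) (e := c / a) (by positivity) (by positivity)
      (Z := 4 / c) (by positivity)
    have h5 := latN_shrink L.transpose (a := c / e) (e := c / a) (by positivity) (by positivity)
      (Z := 1 / (K * e)) (by positivity) _ hW fun p hp => Submodule.subset_span ⟨p, hp, rfl⟩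
    have h6 : (latN L.transpose (c / e / (1 / (K * e))) (c / a / (1 / (K * e))) : ℝ) ≤
        latN L.transpose K (K * e / a) := by
      refine Nat.cast_le.2 (latN_mono _ ?_ ?_)
      · rw [show c / e / (1 / (K * e)) = c * K by field_simp]; nlinarith
      · rw [show c / a / (1 / (K * e)) = c * (K * e / a) by field_simp]
        have : 0 < K * e / a := by positivity
        nlinarith
    have hZ : 1 ≤ 1 / (K * e) := by rwa [one_le_div (by positivity)]
    have hpM : (p : ℝ) / M ≤ 2 * (a * e) := by
      rw [div_le_iff₀ hM0]
      calc (p : ℝ) ≤ 2 * (a * e) * (1 / e) := by rw [mul_one_div, ← mul_assoc, mul_div_assoc, div_self he.ne', mul_one]; exact hp2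
        _ ≤ _ := by gcongr
    calc (latN L a e : ℝ) ≤ C1 * latN L (a / 64) (e / 64) := h1
      _ ≤ C1 * (C * ((p : ℝ) / M) ^ n * latN L.transpose (2 * M) (1 / (2 * p))) := by gcongr
      _ ≤ C1 * (C * (2 * (a * e)) ^ n * (C2 * latN L.transpose (c / e) (c / a))) := by
          gcongr; exact h3.trans h4
      _ ≤ C1 * (C * (2 * (a * e)) ^ n * (C2 * ((3 * (1 / (K * e))) ^ n *
            latN L.transpose K (K * e / a)))) := by
          gcongr
          refine h5.trans ?_
          gcongr
          linarith
      _ = C1 * (C * 2 ^ n) * C2 * 3 ^ n * (a / K) ^ n * (0 + latN L.transpose K (K * e / a)) := by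
          have : (2 * (a * e)) ^ n * (3 * (1 / (K * e))) ^ n = 2 ^ n * 3 ^ n * (a / K) ^ n := by
            rw [← mul_pow, ← mul_pow, ← mul_pow]; congr 1; field_simp
          linear_combination (C1 * C * C2 * latN L.transpose K (K * e / a)) * this
      _ ≤ _ := by gcongr; positivity

end

section

/-! ### Weyl differencing for a biquadratic form -/

variable {n : ℕ}

/-- The box of integer vectors with entries in `[-R, R]`. -/
def ibox (n : ℕ) (R : ℤ) : Finset (Fin n → ℤ) := Fintype.piFinset fun _ => Finset.Icc (-R) R

theorem mem_ibox {R : ℤ} {y : Fin n → ℤ} : y ∈ ibox n R ↔ ∀ i, |y i| ≤ R := by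
  simp [ibox, Fintype.mem_piFinset, abs_le]

/-- Twice the symmetric matrix of the quadratic form `y ↦ F(x; y)`. -/
def matQ (A : Fin n → Fin n → Fin n → Fin n → ℤ) (x : Fin n → ℤ) : Matrix (Fin n) (Fin n) ℤ :=
  Matrix.of fun l k => ∑ i, ∑ j, (A i j k l + A i j l k) * x i * x j

theorem matQ_transpose (A : Fin n → Fin n → Fin n → Fin n → ℤ) (x : Fin n → ℤ) :
    (matQ A x).transpose = matQ A x := by
  ext l k
  simp only [matQ, Matrix.transpose_apply, Matrix.of_apply]
  exact Finset.sum_congr rfl fun i _ => Finset.sum_congr rfl fun j _ => by ring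

/-- The real matrix `α · matQ`. -/
def matQR (A : Fin n → Fin n → Fin n → Fin n → ℤ) (α : ℝ) (x : Fin n → ℤ) :
    Matrix (Fin n) (Fin n) ℝ := Matrix.of fun l k => α * (matQ A x l k : ℝ)

theorem matQR_transpose (A : Fin n → Fin n → Fin n → Fin n → ℤ) (α : ℝ) (x : Fin n → ℤ) :
    (matQR A α x).transpose = matQR A α x := by
  ext l k
  have := congrFun (congrFun (matQ_transpose A x) l) k
  simp only [Matrix.transpose_apply] at this
  simp [matQR, this]

theorem biForm_add_right (A : Fin n → Fin n → Fin n → Fin n → ℤ) (x y h : Fin n → ℤ) :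
    biForm A x (y + h) = biForm A x y + biForm A x h + ∑ l, y l * ∑ k, matQ A x l k * h k := by
  have e1 : ∑ l, y l * ∑ k, matQ A x l k * h k =
      ∑ i, ∑ j, ∑ k, ∑ l, (A i j k l + A i j l k) * x i * x j * h k * y l := by
    simp only [matQ, Matrix.of_apply, Finset.mul_sum, Finset.sum_mul]
    simp only [← Finset.sum_product']
    refine Finset.sum_nbij' (fun p => (p.2.2.1, p.2.2.2, p.2.1, p.1))
      (fun p => (p.2.2.2, p.2.2.1, p.1, p.2.1)) ?_ ?_ ?_ ?_ ?_ <;> simp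
    intros; ring
  have e2 : ∑ i, ∑ j, ∑ k, ∑ l, (A i j k l + A i j l k) * x i * x j * h k * y l =
      ∑ i, ∑ j, ∑ k, ∑ l, A i j k l * x i * x j * (h k * y l + y k * h l) := by
    refine Finset.sum_congr rfl fun i _ => Finset.sum_congr rfl fun j _ => ?_
    have : ∑ k, ∑ l, A i j k l * x i * x j * (y k * h l) =
        ∑ k, ∑ l, A i j l k * x i * x j * (h k * y l) := by
      rw [Finset.sum_comm]
      exact Finset.sum_congr rfl fun k _ => Finset.sum_congr rfl fun l _ => by ring
    simp only [mul_add, Finset.sum_add_distrib, this]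
    simp only [← Finset.sum_add_distrib]
    exact Finset.sum_congr rfl fun k _ => Finset.sum_congr rfl fun l _ => by ring
  rw [e1, e2]
  simp only [biForm, Pi.add_apply, ← Finset.sum_add_distrib]
  refine Finset.sum_congr rfl fun i _ => Finset.sum_congr rfl fun j _ =>
    Finset.sum_congr rfl fun k _ => Finset.sum_congr rfl fun l _ => by ring

/-- The weighted exponential sum over `y` for fixed `x`. -/
def expY (A : Fin n → Fin n → Fin n → Fin n → ℤ) (v : Fin n → ℤ → ℝ) (R : ℤ) (α : ℝ)
    (x : Fin n → ℤ) : ℂ :=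
  ∑ y ∈ ibox n R, ((∏ i, v i (y i) : ℝ) : ℂ) * ee (α * biForm A x y)

/-- Weyl differencing for weighted exponential sums. -/
theorem norm_expY_sq_le (A : Fin n → Fin n → Fin n → Fin n → ℤ) (v : Fin n → ℤ → ℝ) (R : ℤ)
    (hv : ∀ i m, R < |m| → v i m = 0) (α : ℝ) (x : Fin n → ℤ) :
    ‖expY A v R α x‖ ^ 2 ≤ ∑ h ∈ ibox n (2 * R), ∏ j,
      ‖∑ m ∈ Finset.Icc (-R) R, ((v j m * v j (m + h j) : ℝ) : ℂ) *
        ee (m * ∑ k, matQR A α x j k * h k)‖ := by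
  set V : (Fin n → ℤ) → ℝ := fun y => ∏ i, v i (y i) with hV
  have hV0 : ∀ y, y ∉ ibox n R → V y = 0 := by
    intro y hy
    rw [mem_ibox] at hy
    push Not at hy
    obtain ⟨i, hi⟩ := hy
    exact Finset.prod_eq_zero (Finset.mem_univ i) (hv i _ hi)
  have h1 : ((‖expY A v R α x‖ ^ 2 : ℝ) : ℂ) = ∑ y ∈ ibox n R, ∑ z ∈ ibox n R,
      ((V y * V z : ℝ) : ℂ) * ee (α * biForm A x z - α * biForm A x y) := by
    push_cast
    rw [← Complex.mul_conj', expY, map_sum, Finset.sum_mul_sum, Finset.sum_comm]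
    refine Finset.sum_congr rfl fun y _ => Finset.sum_congr rfl fun z _ => ?_
    rw [map_mul, Complex.conj_ofReal, ee_sub]
    simp only [hV]
    push_cast
    ring
  have h2 : ∀ y ∈ ibox n R, ∑ z ∈ ibox n R,
      ((V y * V z : ℝ) : ℂ) * ee (α * biForm A x z - α * biForm A x y) =
      ∑ h ∈ ibox n (2 * R),
      ((V y * V (y + h) : ℝ) : ℂ) * ee (α * biForm A x (y + h) - α * biForm A x y) := by
    intro y hy
    rw [← Finset.sum_image (s := ibox n (2 * R)) (g := fun h => y + h)
      (f := fun z => ((V y * V z : ℝ) : ℂ) * ee (α * biForm A x z - α * biForm A x y))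
      fun _ _ _ _ h => add_left_cancel h]
    refine Finset.sum_subset (fun z hz => ?_) fun z _ hz => by rw [hV0 z hz]; simp
    refine Finset.mem_image.2 ⟨z - y, ?_, by abel⟩
    rw [mem_ibox] at *
    intro i
    have := abs_sub (z i) (y i)
    have := hz i; have := hy i
    simp only [Pi.sub_apply]
    omega
  rw [Finset.sum_congr rfl h2, Finset.sum_comm] at h1
  have h3 : ‖expY A v R α x‖ ^ 2 = ‖((‖expY A v R α x‖ ^ 2 : ℝ) : ℂ)‖ := by
    rw [Complex.norm_real, Real.norm_of_nonneg (by positivity)]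
  rw [h3, h1]
  refine (norm_sum_le _ _).trans (Finset.sum_le_sum fun h _ => le_of_eq ?_)
  rw [← norm_prod]
  have h4 : ∀ y, ((V y * V (y + h) : ℝ) : ℂ) * ee (α * biForm A x (y + h) - α * biForm A x y) =
      ee (α * biForm A x h) * ∏ j, (((v j (y j) * v j (y j + h j) : ℝ) : ℂ) *
        ee (y j * ∑ k, matQR A α x j k * h k)) := by
    intro y
    rw [biForm_add_right, Finset.prod_mul_distrib, ← ee_sum]
    have : α * ((biForm A x y + biForm A x h + ∑ l, y l * ∑ k, matQ A x l k * h k : ℤ) : ℝ) -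
        α * biForm A x y = α * biForm A x h + ∑ j, y j * ∑ k, matQR A α x j k * h k := by
      push_cast
      simp only [matQR, Matrix.of_apply, mul_assoc, ← Finset.mul_sum]
      have : ∑ j, (y j : ℝ) * (α * ∑ k, (matQ A x j k : ℝ) * h k) =
          α * ∑ j, (y j : ℝ) * ∑ k, (matQ A x j k : ℝ) * h k := by
        rw [Finset.mul_sum]; exact Finset.sum_congr rfl fun j _ => by ring
      rw [this]; ring
    rw [this, ee_add, ← Complex.ofReal_prod, Finset.prod_mul_distrib]
    simp only [hV, Pi.add_apply]
    ring
  rw [Finset.sum_congr rfl fun y _ => h4 y, ← Finset.mul_sum, norm_mul, norm_ee, one_mul, ibox,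
    ← Finset.prod_univ_sum (f := fun j (m : ℤ) => ((v j m * v j (m + h j) : ℝ) : ℂ) *
        ee (m * ∑ k, matQR A α x j k * h k))]

/-! ### Tent weights -/

/-- The tent of width `H` centred at `c`. -/
def tent (H c t : ℝ) : ℝ := max 0 (1 - |t - c| / H)

theorem tent_nonneg (H c t : ℝ) : 0 ≤ tent H c t := le_max_left _ _

theorem tent_le_one {H : ℝ} (hH : 0 < H) (c t : ℝ) : tent H c t ≤ 1 :=
  max_le (zero_le_one (α := ℝ)) (by have : 0 ≤ |t - c| / H := div_nonneg (abs_nonneg _) hH.le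
                                    linarith)

theorem tent_eq_zero {H : ℝ} (hH : 0 < H) {c t : ℝ} (h : H ≤ |t - c|) : tent H c t = 0 :=
  max_eq_left (by have := (one_le_div hH).2 h; linarith)

theorem tent_sub_le {H : ℝ} (hH : 0 < H) (c s t : ℝ) :
    |tent H c s - tent H c t| ≤ |s - t| / H := by
  have h0 := abs_max_sub_max_le_max (0 : ℝ) (1 - |s - c| / H) 0 (1 - |t - c| / H)
  rw [sub_self, abs_zero, max_eq_right (a := 0) (b := |_ - _|) (abs_nonneg _)] at h0
  refine h0.trans ?_
  rw [show 1 - |s - c| / H - (1 - |t - c| / H) = (|t - c| - |s - c|) / H by ring, abs_div,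
    abs_of_pos hH]
  refine div_le_div_of_nonneg_right ?_ hH.le
  have := abs_abs_sub_abs_le_abs_sub (t - c) (s - c)
  rwa [sub_sub_sub_cancel_right, abs_sub_comm t s] at this

theorem tent_second_diff {H : ℝ} (hH : 1 ≤ H) (c t : ℝ) :
    |tent H c (t + 1) - 2 * tent H c t + tent H c (t - 1)| ≤
      if |t - c| < 1 ∨ |t - (c + H)| < 1 ∨ |t - (c - H)| < 1 then 2 / H else 0 := by
  have hH0 : 0 < H := by linarith
  split_ifs with h
  · have h1 := tent_sub_le hH0 c (t + 1) t
    have h2 := tent_sub_le hH0 c (t - 1) t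
    rw [show t + 1 - t = 1 by ring, abs_one] at h1
    rw [show t - 1 - t = -1 by ring, abs_neg, abs_one] at h2
    rw [show tent H c (t + 1) - 2 * tent H c t + tent H c (t - 1) =
      (tent H c (t + 1) - tent H c t) + (tent H c (t - 1) - tent H c t) by ring,
      show 2 / H = 1 / H + 1 / H by ring]
    exact (abs_add_le _ _).trans (add_le_add h1 h2)
  · push Not at h
    obtain ⟨h1, h2, h3⟩ := h
    refine le_of_eq ?_
    rw [abs_eq_zero]
    rcases le_or_gt (c + H) t with ht | ht
    · have : 1 ≤ t - (c + H) := by rwa [abs_of_nonneg (by linarith)] at h2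
      rw [tent_eq_zero hH0 (by rw [abs_of_nonneg] <;> linarith),
        tent_eq_zero hH0 (by rw [abs_of_nonneg] <;> linarith),
        tent_eq_zero hH0 (by rw [abs_of_nonneg] <;> linarith)]
      ring
    rw [abs_of_neg (by linarith)] at h2
    rcases le_or_gt t (c - H) with ht' | ht'
    · have : 1 ≤ (c - H) - t := by rw [abs_of_nonpos (by linarith)] at h3; linarith
      rw [tent_eq_zero hH0 (by rw [abs_of_neg] <;> linarith),
        tent_eq_zero hH0 (by rw [abs_of_neg] <;> linarith),
        tent_eq_zero hH0 (by rw [abs_of_neg] <;> linarith)]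
      ring
    rw [abs_of_pos (by linarith)] at h3
    rcases le_or_gt c t with hc | hc
    · rw [abs_of_nonneg (by linarith)] at h1
      have : ∀ s, c ≤ s → s ≤ c + H → tent H c s = 1 - (s - c) / H := fun s h4 h5 => by
        rw [tent, abs_of_nonneg (by linarith), max_eq_right]
        rw [sub_nonneg, div_le_one hH0]; linarith
      rw [this _ (by linarith) (by linarith), this _ (by linarith) (by linarith),
        this _ (by linarith) (by linarith)]
      ring
    · rw [abs_of_neg (by linarith)] at h1
      have : ∀ s, s ≤ c → c - H ≤ s → tent H c s = 1 + (s - c) / H := fun s h4 h5 => by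
        rw [tent, abs_of_nonpos (by linarith), max_eq_right]
        · ring
        · rw [sub_nonneg, div_le_one hH0]; linarith
      rw [this _ (by linarith) (by linarith), this _ (by linarith) (by linarith),
        this _ (by linarith) (by linarith)]
      ring

theorem card_int_near (a r : ℝ) (hr : 0 ≤ r) :
    (Set.Finite {m : ℤ | |(m : ℝ) - a| < r}) ∧
    (({m : ℤ | |(m : ℝ) - a| < r}.ncard : ℕ) : ℝ) ≤ 2 * r + 1 := by
  have hsub : {m : ℤ | |(m : ℝ) - a| < r} ⊆ (Finset.Icc ⌈a - r⌉ ⌊a + r⌋ : Finset ℤ) := by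
    intro m hm
    have hm' : |(m : ℝ) - a| < r := hm
    have hm := abs_lt.1 hm'
    rw [Finset.mem_coe, Finset.mem_Icc]
    exact ⟨Int.ceil_le.2 (by linarith), Int.le_floor.2 (by linarith)⟩
  refine ⟨(Finset.finite_toSet _).subset hsub, ?_⟩
  have h1 := Set.ncard_le_ncard hsub (Finset.finite_toSet _)
  rw [Set.ncard_coe_finset, Int.card_Icc] at h1
  have h2 : ((⌊a + r⌋ + 1 - ⌈a - r⌉).toNat : ℝ) ≤ 2 * r + 1 := by
    rcases le_total 0 (⌊a + r⌋ + 1 - ⌈a - r⌉) with h | h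
    · have : ((⌊a + r⌋ + 1 - ⌈a - r⌉).toNat : ℤ) = ⌊a + r⌋ + 1 - ⌈a - r⌉ := Int.toNat_of_nonneg h
      have h3 : ((⌊a + r⌋ + 1 - ⌈a - r⌉).toNat : ℝ) = ⌊a + r⌋ + 1 - ⌈a - r⌉ := by exact_mod_cast this
      rw [h3]
      linarith [Int.floor_le (a + r), Int.le_ceil (a - r)]
    · rw [Int.toNat_of_nonpos h]; push_cast; linarith
  exact (Nat.cast_le.2 h1).trans h2

theorem sum_second_diff_kernel (w : ℤ → ℝ) (R : ℤ) (hw : ∀ m, R < |m| → w m = 0) (b : ℝ) :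
    ‖∑ m ∈ Finset.Icc (-R) R, (w m : ℂ) * ee (m * b)‖ * (16 * |b - round b| ^ 2) ≤
      ∑ m ∈ Finset.Icc (-(R + 1)) (R + 1), |w (m + 1) - 2 * w m + w (m - 1)| := by
  set T : Finset ℤ := Finset.Icc (-(R + 1)) (R + 1) with hT
  have hw' : ∀ m, m ∉ Finset.Icc (-R) R → w m = 0 := fun m hm => hw m (by
    rw [Finset.mem_Icc, ← abs_le] at hm; omega)
  have hfs : ∀ g : ℤ → ℂ, Summable fun m => (w m : ℂ) * g m := fun g =>
    summable_of_ne_finset_zero (s := Finset.Icc (-R) R) fun m hm => by rw [hw' m hm]; simp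
  have hS : ∑ m ∈ Finset.Icc (-R) R, (w m : ℂ) * ee (m * b) = ∑' m : ℤ, (w m : ℂ) * ee (m * b) :=
    (tsum_eq_sum fun m hm => by rw [hw' m hm]; simp).symm
  have s1 : ∑' m : ℤ, (w (m + 1) : ℂ) * ee (m * b) = ∑' m : ℤ, (w m : ℂ) * ee ((m - 1) * b) := by
    rw [← (Equiv.addRight (1 : ℤ)).tsum_eq fun m : ℤ => (w m : ℂ) * ee ((m - 1) * b)]
    refine tsum_congr fun m => ?_
    simp
  have s2 : ∑' m : ℤ, (w (m - 1) : ℂ) * ee (m * b) = ∑' m : ℤ, (w m : ℂ) * ee ((m + 1) * b) := by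
    rw [← (Equiv.subRight (1 : ℤ)).tsum_eq fun m : ℤ => (w m : ℂ) * ee ((m + 1) * b)]
    refine tsum_congr fun m => ?_
    simp
  have sm1 : Summable fun m : ℤ => (w (m + 1) : ℂ) * ee (m * b) := by
    have := (Equiv.addRight (1 : ℤ)).summable_iff.2 (hfs fun m => ee ((m - 1) * b))
    refine this.congr fun m => ?_
    simp
  have sm2 : Summable fun m : ℤ => (w (m - 1) : ℂ) * ee (m * b) := by
    have := (Equiv.subRight (1 : ℤ)).summable_iff.2 (hfs fun m => ee ((m + 1) * b))
    refine this.congr fun m => ?_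
    simp
  have sm0 := hfs fun m => ee (m * b)
  have key : ∑' m : ℤ, (((w (m + 1) - 2 * w m + w (m - 1) : ℝ)) : ℂ) * ee (m * b) =
      (ee b - 2 + ee (-b)) * ∑' m : ℤ, (w m : ℂ) * ee (m * b) := by
    have e1 : ∑' m : ℤ, (((w (m + 1) - 2 * w m + w (m - 1) : ℝ)) : ℂ) * ee (m * b) =
        ∑' m : ℤ, (w (m + 1) : ℂ) * ee (m * b) - 2 * ∑' m : ℤ, (w m : ℂ) * ee (m * b) +
        ∑' m : ℤ, (w (m - 1) : ℂ) * ee (m * b) := by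
      rw [← tsum_mul_left, ← sm1.tsum_sub (sm0.mul_left 2), ← (sm1.sub (sm0.mul_left 2)).tsum_add sm2]
      refine tsum_congr fun m => ?_
      push_cast; ring
    rw [e1, s1, s2, ← tsum_mul_left, ← tsum_mul_left, ← (hfs _).tsum_sub (sm0.mul_left 2),
      ← ((hfs _).sub (sm0.mul_left 2)).tsum_add (hfs _)]
    refine tsum_congr fun m => ?_
    rw [show ((m : ℝ) - 1) * b = m * b + -b by ring, show ((m : ℝ) + 1) * b = m * b + b by ring,
      ee_add, ee_add]
    ring
  have hT0 : ∀ m ∉ T, (((w (m + 1) - 2 * w m + w (m - 1) : ℝ)) : ℂ) * ee (m * b) = 0 := by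
    intro m hm
    rw [hT, Finset.mem_Icc, ← abs_le] at hm
    rw [hw (m + 1), hw m, hw (m - 1)]
    · simp
    · have := abs_sub_abs_le_abs_sub m 1; simp only [abs_one] at this; omega
    · omega
    · have := abs_sub_abs_le_abs_sub m (-1); simp only [abs_neg, abs_one, sub_neg_eq_add] at this
      omega
  rw [tsum_eq_sum hT0] at key
  have hn : ‖ee b - 2 + ee (-b)‖ = ‖ee b - 1‖ ^ 2 := by
    have : ee b * ee (-b) = 1 := by rw [← ee_add, add_neg_cancel, ee_zero]
    have h2 : ee b - 2 + ee (-b) = ee (-b) * (ee b - 1) ^ 2 := by linear_combination (2 - ee b) * this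
    rw [h2, norm_mul, norm_ee, one_mul, norm_pow]
  rw [hS]
  calc ‖∑' m : ℤ, (w m : ℂ) * ee (m * b)‖ * (16 * |b - round b| ^ 2)
      ≤ ‖∑' m : ℤ, (w m : ℂ) * ee (m * b)‖ * ‖ee b - 1‖ ^ 2 := by
        gcongr
        have := le_norm_ee_sub_one b
        calc 16 * |b - round b| ^ 2 = (4 * |b - round b|) ^ 2 := by ring
          _ ≤ _ := by gcongr
    _ = ‖∑ m ∈ T, (((w (m + 1) - 2 * w m + w (m - 1) : ℝ)) : ℂ) * ee (m * b)‖ := by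
        rw [key, norm_mul, hn, mul_comm]
    _ ≤ _ := (norm_sum_le _ _).trans (Finset.sum_le_sum fun m _ => by
        rw [norm_mul, norm_ee, mul_one, Complex.norm_real, Real.norm_eq_abs])

theorem sum_ite_near_le (s : Finset ℤ) (p : ℤ → Prop) [DecidablePred p] (a r B : ℝ) (hr : 0 ≤ r)
    (hB : 0 ≤ B) (hp : ∀ m, p m → |(m : ℝ) - a| < r) :
    ∑ m ∈ s, (if p m then B else 0) ≤ (2 * r + 1) * B := by
  rw [← Finset.sum_filter, Finset.sum_const, nsmul_eq_mul]
  refine mul_le_mul_of_nonneg_right ?_ hB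
  obtain ⟨h1, h2⟩ := card_int_near a r hr
  refine le_trans ?_ h2
  rw [← Set.ncard_coe_finset]
  refine Nat.cast_le.2 (Set.ncard_le_ncard (fun m hm => ?_) h1)
  rw [Finset.mem_coe, Finset.mem_filter] at hm
  exact hp m hm.2

theorem tent_kernel {H : ℝ} (hH : 1 ≤ H) (c c' b : ℝ) (R : ℤ)
    (hR : ∀ m : ℤ, R < |m| → tent H c m = 0) :
    ‖∑ m ∈ Finset.Icc (-R) R, ((tent H c m * tent H c' m : ℝ) : ℂ) * ee (m * b)‖ ≤ 3 * H ∧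
    ‖∑ m ∈ Finset.Icc (-R) R, ((tent H c m * tent H c' m : ℝ) : ℂ) * ee (m * b)‖ *
      (H * |b - round b|) ^ 2 ≤ 3 * H := by
  classical
  have hH0 : 0 < H := by linarith
  constructor
  · calc _ ≤ ∑ m ∈ Finset.Icc (-R) R, (if |(m : ℝ) - c| < H then (1 : ℝ) else 0) := by
          refine (norm_sum_le _ _).trans (Finset.sum_le_sum fun m _ => ?_)
          rw [norm_mul, norm_ee, mul_one, Complex.norm_real, Real.norm_eq_abs, abs_of_nonneg
            (mul_nonneg (tent_nonneg _ _ _) (tent_nonneg _ _ _))]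
          split_ifs with h
          · exact mul_le_one₀ (tent_le_one hH0 _ _) (tent_nonneg _ _ _) (tent_le_one hH0 _ _)
          · rw [tent_eq_zero hH0 (not_lt.1 h), zero_mul]
      _ ≤ (2 * H + 1) * 1 := sum_ite_near_le _ _ c H 1 hH0.le zero_le_one fun m h => h
      _ ≤ 3 * H := by linarith
  · have h1 := sum_second_diff_kernel (fun m => tent H c m * tent H c' m) R
      (fun m hm => by rw [hR m hm, zero_mul]) b
    set N := ‖∑ m ∈ Finset.Icc (-R) R, ((tent H c m * tent H c' m : ℝ) : ℂ) * ee (m * b)‖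
    set T : Finset ℤ := Finset.Icc (-(R + 1)) (R + 1)
    have hkink : ∀ d, ∑ m ∈ T, (if |(m : ℝ) - d| < 1 ∨ |(m : ℝ) - (d + H)| < 1 ∨
        |(m : ℝ) - (d - H)| < 1 then 2 / H else 0) ≤ 18 / H := by
      intro d
      have h2 : (0 : ℝ) ≤ 2 / H := by positivity
      calc _ ≤ ∑ m ∈ T, ((if |(m : ℝ) - d| < 1 then 2 / H else 0) +
            ((if |(m : ℝ) - (d + H)| < 1 then 2 / H else 0) +
            (if |(m : ℝ) - (d - H)| < 1 then 2 / H else 0))) := by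
            refine Finset.sum_le_sum fun m _ => ?_
            split_ifs <;> first | linarith | tauto
        _ ≤ (2 * 1 + 1) * (2 / H) + ((2 * 1 + 1) * (2 / H) + (2 * 1 + 1) * (2 / H)) := by
            rw [Finset.sum_add_distrib, Finset.sum_add_distrib]
            refine add_le_add ?_ (add_le_add ?_ ?_) <;>
            exact sum_ite_near_le _ _ _ 1 _ zero_le_one h2 fun m h => h
        _ = 18 / H := by ring
    have hpt : ∀ m : ℤ, |tent H c ((m + 1 : ℤ) : ℝ) * tent H c' ((m + 1 : ℤ) : ℝ) -
        2 * (tent H c m * tent H c' m) + tent H c ((m - 1 : ℤ) : ℝ) * tent H c' ((m - 1 : ℤ) : ℝ)| ≤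
        (if |(m : ℝ) - c| < 1 ∨ |(m : ℝ) - (c + H)| < 1 ∨
        |(m : ℝ) - (c - H)| < 1 then 2 / H else 0) + (if |(m : ℝ) - c'| < 1 ∨
        |(m : ℝ) - (c' + H)| < 1 ∨ |(m : ℝ) - (c' - H)| < 1 then 2 / H else 0) +
        (if |(m : ℝ) - c| < H + 1 then 2 / H ^ 2 else 0) := by
      intro m
      push_cast
      have a1 := tent_second_diff hH c m
      have a2 := tent_second_diff hH c' m
      have b1 := tent_sub_le hH0 c (m + 1) m
      have b2 := tent_sub_le hH0 c (m - 1) m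
      have b3 := tent_sub_le hH0 c' (m + 1) m
      have b4 := tent_sub_le hH0 c' (m - 1) m
      rw [show (m : ℝ) + 1 - m = 1 by ring, abs_one] at b1 b3
      rw [show (m : ℝ) - 1 - m = -1 by ring, abs_neg, abs_one] at b2 b4
      have p : |(tent H c (m + 1) - tent H c m) * (tent H c' (m + 1) - tent H c' m) +
          (tent H c (m - 1) - tent H c m) * (tent H c' (m - 1) - tent H c' m)| ≤
          (if |(m : ℝ) - c| < H + 1 then 2 / H ^ 2 else 0) := by
        split_ifs with h
        · refine (abs_add_le _ _).trans ?_
          rw [abs_mul, abs_mul, show 2 / H ^ 2 = 1 / H * (1 / H) + 1 / H * (1 / H) by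
            field_simp; norm_num]
          gcongr
        · push Not at h
          have : ∀ s, |s - (m : ℝ)| ≤ 1 → tent H c s = 0 := fun s hs => by
            refine tent_eq_zero hH0 ?_
            have := abs_sub_abs_le_abs_sub ((m : ℝ) - c) (m - s)
            rw [show (m : ℝ) - c - (m - s) = s - c by ring, abs_sub_comm (m : ℝ) s] at this
            linarith
          rw [this _ (by simp), this m (by simp), this (m - 1) (by simp)]
          simp
      have t0 := tent_nonneg H c m
      have t1 := tent_le_one hH0 c m
      have t0' := tent_nonneg H c' m
      have t1' := tent_le_one hH0 c' m
      set X1 := tent H c (m + 1) - 2 * tent H c m + tent H c (m - 1)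
      set X2 := tent H c' (m + 1) - 2 * tent H c' m + tent H c' (m - 1)
      have q1 : |tent H c' m * X1| ≤ |X1| := by
        rw [abs_mul, abs_of_nonneg t0']; exact mul_le_of_le_one_left (abs_nonneg _) t1'
      have q2 : |tent H c m * X2| ≤ |X2| := by
        rw [abs_mul, abs_of_nonneg t0]; exact mul_le_of_le_one_left (abs_nonneg _) t1
      rw [show tent H c (m + 1) * tent H c' (m + 1) - 2 * (tent H c m * tent H c' m) +
        tent H c (m - 1) * tent H c' (m - 1) = tent H c' m * X1 + tent H c m * X2 +
        ((tent H c (m + 1) - tent H c m) * (tent H c' (m + 1) - tent H c' m) +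
          (tent H c (m - 1) - tent H c m) * (tent H c' (m - 1) - tent H c' m)) by
        simp only [X1, X2]; ring]
      exact (abs_add_three _ _ _).trans (add_le_add (add_le_add (q1.trans a1) (q2.trans a2)) p)
    have h2 : N * (16 * |b - round b| ^ 2) ≤ 46 / H := by
      refine h1.trans ((Finset.sum_le_sum fun m _ => hpt m).trans ?_)
      rw [Finset.sum_add_distrib, Finset.sum_add_distrib]
      have h3 : ∑ m ∈ T, (if |(m : ℝ) - c| < H + 1 then 2 / H ^ 2 else 0) ≤ 10 / H := by
        refine (sum_ite_near_le T _ c (H + 1) (2 / H ^ 2) (by linarith) (by positivity)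
          fun m h => h).trans ?_
        rw [← mul_div_assoc, div_le_div_iff₀ (by positivity) hH0]
        nlinarith
      have := hkink c
      have := hkink c'
      calc _ ≤ 18 / H + 18 / H + 10 / H := by gcongr
        _ = 46 / H := by ring
    have h4 : N * (16 * |b - round b| ^ 2) * H ^ 2 ≤ 46 / H * H ^ 2 := by gcongr
    have h5 : 46 / H * H ^ 2 = 46 * H := by field_simp
    nlinarith

/-- Weyl's inequality for tent weights. -/
theorem exists_expY_tent_le (n : ℕ) (D : ℝ) : ∃ C : ℝ, 1 ≤ C ∧
    ∀ (A : Fin n → Fin n → Fin n → Fin n → ℤ) (H : ℝ) (c : Fin n → ℝ) (R : ℤ), 1 ≤ H →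
    (∀ i, |c i| ≤ D * H) → (D + 1) * H ≤ R → (R : ℝ) ≤ (D + 1) * H + 1 → ∀ (α : ℝ) (x : Fin n → ℤ),
    ‖expY A (fun i m => tent H (c i) m) R α x‖ ^ 2 ≤
      C * H ^ n * latN (matQR A α x) (4 * (D + 2) * H) (1 / H) := by
  obtain ⟨C, hC, h⟩ := exists_sum_prod_kernel_le n
  refine ⟨C * 3 ^ n, ?_, ?_⟩
  · have : (1 : ℝ) ≤ 3 ^ n := one_le_pow₀ (by norm_num)
    nlinarith
  intro A H c R hH hc hR hR' α x
  have hH0 : 0 < H := by linarith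
  have hz : ∀ i, ∀ m : ℤ, R < |m| → tent H (c i) m = 0 := by
    intro i m hm
    refine tent_eq_zero hH0 ?_
    have h1 : (R : ℝ) < |(m : ℝ)| := by exact_mod_cast hm
    have h2 := abs_sub_abs_le_abs_sub (m : ℝ) (c i)
    have := hc i
    linarith
  refine (norm_expY_sq_le A _ R hz α x).trans ?_
  refine (h (matQR A α x) (ibox n (2 * R)) (2 * R) H (3 * H) hH0 (by positivity) ?_
    (fun j s => ‖∑ m ∈ Finset.Icc (-R) R, ((tent H (c j) m * tent H (c j) ((m + s j : ℤ) : ℝ) : ℝ) : ℂ) *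
        ee (m * ∑ k, matQR A α x j k * s k)‖) ?_).trans ?_
  · intro s hs i
    have := mem_ibox.1 hs i
    exact_mod_cast this
  · intro s _ j
    have hs : ∀ m : ℤ, tent H (c j) ((m + s j : ℤ) : ℝ) = tent H (c j - s j) m := by
      intro m; simp only [tent]; push_cast; congr 4; ring
    simp only [hs]
    obtain ⟨h1, h2⟩ := tent_kernel hH (c j) (c j - s j) (∑ k, matQR A α x j k * s k) R (hz j)
    exact ⟨norm_nonneg _, h1, h2⟩
  · rw [mul_pow, ← mul_assoc]
    gcongr
    refine Nat.cast_le.2 (latN_mono _ ?_ le_rfl)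
    linarith

theorem norm_sum_Icc_ee (a b : ℤ) (β : ℝ) :
    ‖∑ m ∈ Finset.Icc a b, ee (m * β)‖ = ‖geoSum (b + 1 - a).toNat β‖ := by
  have : ∑ m ∈ Finset.Icc a b, ee (m * β) = ee (a * β) * geoSum (b + 1 - a).toNat β := by
    rw [geoSum, Finset.mul_sum]
    refine Finset.sum_nbij' (fun m => (m - a).toNat) (fun k => a + k) ?_ ?_ ?_ ?_ ?_
    · intro m hm; rw [Finset.mem_Icc] at hm; rw [Finset.mem_range]; omega
    · intro k hk; rw [Finset.mem_range] at hk; rw [Finset.mem_Icc]; omega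
    · intro m hm; rw [Finset.mem_Icc] at hm; omega
    · intro k hk; simp
    · intro m hm
      rw [Finset.mem_Icc] at hm
      have : (((m - a).toNat : ℤ) : ℝ) = m - a := by
        rw [Int.toNat_of_nonneg (by omega)]; push_cast; ring
      rw [← ee_add, show (((m - a).toNat : ℕ) : ℝ) = m - a by exact_mod_cast this]
      congr 1; ring
  rw [this, norm_mul, norm_ee, one_mul]

/-- The indicator weight of `[-R, R]`. -/
def boxWt (R : ℕ) (m : ℤ) : ℝ := if |m| ≤ R then 1 else 0

theorem boxWt_kernel {R : ℕ} (hR : 1 ≤ R) (h : ℤ) (β : ℝ) :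
    ‖∑ m ∈ Finset.Icc (-(R : ℤ)) R, ((boxWt R m * boxWt R (m + h) : ℝ) : ℂ) * ee (m * β)‖ ≤ 3 * R ∧
    ‖∑ m ∈ Finset.Icc (-(R : ℤ)) R, ((boxWt R m * boxWt R (m + h) : ℝ) : ℂ) * ee (m * β)‖ *
      |β - round β| ≤ 1 / 2 := by
  have h1 : ∑ m ∈ Finset.Icc (-(R : ℤ)) R, ((boxWt R m * boxWt R (m + h) : ℝ) : ℂ) * ee (m * β) =
      ∑ m ∈ Finset.Icc (max (-(R : ℤ)) (-R - h)) (min (R : ℤ) (R - h)), ee (m * β) := by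
    symm
    rw [← Finset.sum_subset (s₁ := Finset.Icc (max (-(R : ℤ)) (-R - h)) (min (R : ℤ) (R - h)))
      (s₂ := Finset.Icc (-(R : ℤ)) R)
      (f := fun m => ((boxWt R m * boxWt R (m + h) : ℝ) : ℂ) * ee (m * β))]
    · refine Finset.sum_congr rfl fun m hm => ?_
      rw [Finset.mem_Icc] at hm
      rw [boxWt, boxWt, if_pos (abs_le.2 (by omega)), if_pos (abs_le.2 (by omega))]
      simp
    · intro m hm; rw [Finset.mem_Icc] at *; omega
    · intro m hm hm'
      rw [Finset.mem_Icc] at *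
      rw [boxWt, boxWt, if_neg (c := |m + h| ≤ R) (fun hc => by rw [abs_le] at hc; omega)]
      simp
  rw [h1, norm_sum_Icc_ee]
  refine ⟨(norm_geoSum_le _ _).trans ?_, norm_geoSum_mul_le _ _⟩
  have : (min (R : ℤ) (R - h) + 1 - max (-(R : ℤ)) (-R - h)).toNat ≤ 3 * R := by omega
  exact_mod_cast this

/-- Weyl's inequality for the indicator of a box, with a logarithmic loss. -/
theorem norm_expY_box_le (A : Fin n → Fin n → Fin n → Fin n → ℤ) (R M : ℕ) (hR : 1 ≤ R) (α : ℝ)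
    (x : Fin n → ℤ)
    (hM : ∀ h ∈ ibox n (2 * (R : ℤ)), ∀ j, R * |∑ k, matQR A α x j k * h k| ≤ M) :
    ‖expY A (fun _ => boxWt R) R α x‖ ^ 2 ≤
      (14 * R * (1 + Real.log (M + 2))) ^ n * latN (matQR A α x) (4 * R) (1 / R) := by
  have hR0 : (0 : ℝ) < R := by exact_mod_cast hR
  refine (norm_expY_sq_le A _ R (fun i m hm => if_neg (by omega)) α x).trans ?_
  refine (sum_prod_cell_le (matQR A α x) (ibox n (2 * (R : ℤ))) (R := 2 * R) hR0 ?_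
    (fun j s => ‖∑ m ∈ Finset.Icc (-(R : ℤ)) R, ((boxWt R m * boxWt R (m + s j) : ℝ) : ℂ) *
        ee (m * ∑ k, matQR A α x j k * s k)‖) (fun r => 7 * R / (1 + |(r : ℝ)|))
        (Finset.Icc (-(M : ℤ) - 1) M) ?_ ?_ ?_ ?_).trans ?_
  · intro s hs i
    have := mem_ibox.1 hs i
    exact_mod_cast this
  · intro s _ j; positivity
  · intro r _; positivity
  · intro s hs j
    set β := ∑ k, matQR A α x j k * s k
    have h1 := hM s hs j
    have h2 : |β - round β| ≤ |β| := by simpa using round_le β 0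
    have h3 : |R * (β - round β)| ≤ M := by
      rw [abs_mul, abs_of_pos hR0]
      exact (mul_le_mul_of_nonneg_left h2 hR0.le).trans h1
    obtain ⟨h4, h5⟩ := abs_le.1 h3
    rw [Finset.mem_Icc]
    constructor
    · rw [Int.le_floor]; push_cast; linarith
    · have : (⌊R * (β - round β)⌋ : ℝ) ≤ M := (Int.floor_le _).trans h5
      exact_mod_cast this
  · intro s hs j
    set β := ∑ k, matQR A α x j k * s k
    obtain ⟨h1, h2⟩ := boxWt_kernel hR (s j) β
    set f := ‖∑ m ∈ Finset.Icc (-(R : ℤ)) R, ((boxWt R m * boxWt R (m + s j) : ℝ) : ℂ) *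
        ee (m * β)‖
    have hf : 0 ≤ f := norm_nonneg _
    set r := ⌊R * (β - round β)⌋ with hr
    have h3 : |(r : ℝ)| ≤ R * |β - round β| + 1 := by
      have := Int.floor_le (R * (β - round β))
      have := Int.lt_floor_add_one (R * (β - round β))
      have h6 : R * |β - round β| = |R * (β - round β)| := by rw [abs_mul, abs_of_pos hR0]
      rw [h6]
      have := abs_sub_abs_le_abs_sub (r : ℝ) (R * (β - round β))
      have h4 : |(r : ℝ) - (R * (β - round β))| ≤ 1 := abs_le.2 ⟨by linarith, by linarith⟩
      linarith
    rw [le_div_iff₀ (by positivity)]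
    have h5 : f * |(r : ℝ)| ≤ f * (R * |β - round β| + 1) := mul_le_mul_of_nonneg_left h3 hf
    have h6 := mul_le_mul_of_nonneg_left h2 hR0.le
    linarith
  · have hsum : ∑ r ∈ Finset.Icc (-(M : ℤ) - 1) M, 7 * R / (1 + |(r : ℝ)|) ≤
        14 * R * (1 + Real.log (M + 2)) := by
      have hh : ∑ k ∈ Finset.range (M + 2), 7 * (R : ℝ) / (1 + k) ≤ 7 * R * (1 + Real.log (M + 2)) := by
        have := harmonic_le_one_add_log (M + 2)
        rw [harmonic] at this
        push_cast at this
        calc _ = 7 * R * ∑ k ∈ Finset.range (M + 2), ((k : ℝ) + 1)⁻¹ := by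
              rw [Finset.mul_sum]
              exact Finset.sum_congr rfl fun k _ => by rw [div_eq_mul_inv, add_comm]
          _ ≤ _ := by gcongr
      have hsub : Finset.Icc (-(M : ℤ) - 1) M ⊆
          (Finset.range (M + 2)).image (fun k : ℕ => (k : ℤ)) ∪
          (Finset.range (M + 2)).image (fun k : ℕ => -(k : ℤ)) := by
        intro r hr
        rw [Finset.mem_Icc] at hr
        simp only [Finset.mem_union, Finset.mem_image, Finset.mem_range]
        rcases le_total 0 r with h | h
        · exact Or.inl ⟨r.toNat, by omega, by omega⟩
        · exact Or.inr ⟨(-r).toNat, by omega, by omega⟩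
      have h0 : ∀ r : ℤ, 0 ≤ 7 * (R : ℝ) / (1 + |(r : ℝ)|) := fun r => by positivity
      calc _ ≤ _ := Finset.sum_le_sum_of_subset_of_nonneg hsub fun r _ _ => h0 r
        _ ≤ ∑ r ∈ (Finset.range (M + 2)).image (fun k : ℕ => (k : ℤ)), 7 * R / (1 + |(r : ℝ)|) +
            ∑ r ∈ (Finset.range (M + 2)).image (fun k : ℕ => -(k : ℤ)), 7 * R / (1 + |(r : ℝ)|) := by
            rw [← Finset.sum_union_inter]
            exact le_add_of_nonneg_right (Finset.sum_nonneg fun r _ => h0 r)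
        _ ≤ ∑ k ∈ Finset.range (M + 2), 7 * (R : ℝ) / (1 + k) +
            ∑ k ∈ Finset.range (M + 2), 7 * (R : ℝ) / (1 + k) := by
            rw [Finset.sum_image (by intro a _ b _ h; simpa using h),
              Finset.sum_image (by intro a _ b _ h; simpa using h)]
            simp
        _ ≤ _ := by linarith
    have : (2 : ℝ) * (2 * R) = 4 * R := by ring
    rw [this]
    gcongr

end

section

/-! ### Smoothness and the dimension of the singular loci -/

variable {n : ℕ}

section Forms
variable {k : Type*} [CommRing k]

/-- The partial derivatives of `F` with respect to `x`. -/
def dX (A : Fin n → Fin n → Fin n → Fin n → ℤ) (x y : Fin n → k) (m : Fin n) : k :=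
  ∑ j, ∑ k', ∑ l, ((A m j k' l + A j m k' l : ℤ) : k) * x j * y k' * y l

/-- The partial derivatives of `F` with respect to `y`. -/
def dY (A : Fin n → Fin n → Fin n → Fin n → ℤ) (x y : Fin n → k) (m : Fin n) : k :=
  ∑ i, ∑ j, ∑ l, ((A i j m l + A i j l m : ℤ) : k) * x i * x j * y l

/-- The trilinear forms obtained by polarising the forms `dY` in the first variable. -/
def triT (A : Fin n → Fin n → Fin n → Fin n → ℤ) (u w h : Fin n → k) (m : Fin n) : k :=
  ∑ i, ∑ j, ∑ l, ((A i j m l + A j i m l + A i j l m + A j i l m : ℤ) : k) * u i * w j * h l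

variable {k' : Type*} [CommRing k'] (g : k →+* k')

theorem map_dX (A : Fin n → Fin n → Fin n → Fin n → ℤ) (x y : Fin n → k) (m : Fin n) :
    g (dX A x y m) = dX A (fun i => g (x i)) (fun i => g (y i)) m := by
  simp only [dX, map_sum, map_mul, map_intCast]

theorem map_dY (A : Fin n → Fin n → Fin n → Fin n → ℤ) (x y : Fin n → k) (m : Fin n) :
    g (dY A x y m) = dY A (fun i => g (x i)) (fun i => g (y i)) m := by
  simp only [dY, map_sum, map_mul, map_intCast]

theorem map_triT (A : Fin n → Fin n → Fin n → Fin n → ℤ) (u w h : Fin n → k) (m : Fin n) :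
    g (triT A u w h m) = triT A (fun i => g (u i)) (fun i => g (w i)) (fun i => g (h i)) m := by
  simp only [triT, map_sum, map_mul, map_intCast]

theorem dX_smul (A : Fin n → Fin n → Fin n → Fin n → ℤ) (a b : k) (x y : Fin n → k) (m : Fin n) :
    dX A (fun i => a * x i) (fun i => b * y i) m = a * b ^ 2 * dX A x y m := by
  simp only [dX, Finset.mul_sum]
  exact Finset.sum_congr rfl fun _ _ => Finset.sum_congr rfl fun _ _ =>
    Finset.sum_congr rfl fun _ _ => by ring

theorem dY_smul (A : Fin n → Fin n → Fin n → Fin n → ℤ) (a b : k) (x y : Fin n → k) (m : Fin n) :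
    dY A (fun i => a * x i) (fun i => b * y i) m = a ^ 2 * b * dY A x y m := by
  simp only [dY, Finset.mul_sum]
  exact Finset.sum_congr rfl fun _ _ => Finset.sum_congr rfl fun _ _ =>
    Finset.sum_congr rfl fun _ _ => by ring

theorem triT_smul (A : Fin n → Fin n → Fin n → Fin n → ℤ) (a b c : k) (u w h : Fin n → k)
    (m : Fin n) : triT A (fun i => a * u i) (fun i => b * w i) (fun i => c * h i) m =
      a * b * c * triT A u w h m := by
  simp only [triT, Finset.mul_sum]
  exact Finset.sum_congr rfl fun _ _ => Finset.sum_congr rfl fun _ _ =>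
    Finset.sum_congr rfl fun _ _ => by ring

theorem triT_self (A : Fin n → Fin n → Fin n → Fin n → ℤ) (x h : Fin n → k) (m : Fin n) :
    triT A x x h m = 2 * dY A x h m := by
  have : ∑ i, ∑ j, ∑ l, ((A j i m l + A j i l m : ℤ) : k) * x i * x j * h l = dY A x h m := by
    rw [Finset.sum_comm]
    exact Finset.sum_congr rfl fun _ _ => Finset.sum_congr rfl fun _ _ =>
      Finset.sum_congr rfl fun _ _ => by ring
  rw [two_mul]
  nth_rewrite 1 [← this]
  simp only [triT, dY, ← Finset.sum_add_distrib]
  exact Finset.sum_congr rfl fun _ _ => Finset.sum_congr rfl fun _ _ =>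
    Finset.sum_congr rfl fun _ _ => by push_cast; ring

end Forms

/-- Membership in a radical transfers from complex points to points in extension fields. -/
theorem eval₂_eq_zero_of_forall {σ k : Type*} [Finite σ] [Field k] (φ : ℂ →+* k)
    (s : Set (MvPolynomial σ ℂ)) (g : MvPolynomial σ ℂ)
    (h : ∀ x : σ → ℂ, (∀ f ∈ s, MvPolynomial.eval x f = 0) → MvPolynomial.eval x g = 0)
    (z : σ → k) (hz : ∀ f ∈ s, MvPolynomial.eval₂ φ z f = 0) : MvPolynomial.eval₂ φ z g = 0 := by
  have h1 : g ∈ MvPolynomial.vanishingIdeal ℂ (MvPolynomial.zeroLocus ℂ (Ideal.span s)) := by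
    rw [MvPolynomial.mem_vanishingIdeal_iff]
    intro x hx
    rw [MvPolynomial.mem_zeroLocus_iff] at hx
    rw [MvPolynomial.aeval_eq_eval]
    exact h x fun f hf => by
      have := hx f (Ideal.subset_span hf); rwa [MvPolynomial.aeval_eq_eval] at this
  rw [MvPolynomial.vanishingIdeal_zeroLocus_eq_radical] at h1
  obtain ⟨m, hm⟩ := h1
  have h2 : Ideal.span s ≤ RingHom.ker (MvPolynomial.eval₂Hom φ z) :=
    Ideal.span_le.2 fun f hf => hz f hf
  have h3 : MvPolynomial.eval₂Hom φ z (g ^ m) = 0 := h2 hm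
  rw [map_pow] at h3
  by_contra hne
  exact pow_ne_zero m hne h3

theorem SmoothBiquad.eq_zero_or {k : Type*} [Field k] (φ : ℂ →+* k)
    {A : Fin n → Fin n → Fin n → Fin n → ℤ} (hA : SmoothBiquad A) (x y : Fin n → k)
    (hx : ∀ m, dX A x y m = 0) (hy : ∀ m, dY A x y m = 0) : x = 0 ∨ y = 0 := by
  by_contra! hne
  obtain ⟨⟨i, hi⟩, ⟨j, hj⟩⟩ := hne.imp Function.ne_iff.1 Function.ne_iff.1
  let ξ : Fin n → MvPolynomial (Fin n ⊕ Fin n) ℂ := fun i => .X (.inl i)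
  let η : Fin n → MvPolynomial (Fin n ⊕ Fin n) ℂ := fun i => .X (.inr i)
  have := eval₂_eq_zero_of_forall φ (Set.range (dX A ξ η) ∪ Set.range (dY A ξ η)) (ξ i * η j)
    (fun z hz => ?_) (Sum.elim x y) ?_
  · rw [MvPolynomial.eval₂_mul] at this
    simp only [ξ, η, MvPolynomial.eval₂_X, Sum.elim_inl, Sum.elim_inr] at this
    exact (mul_ne_zero hi hj) this
  · by_contra hc
    refine hA (fun i => z (.inl i)) (fun i => z (.inr i)) (fun h0 => hc ?_) (fun h0 => hc ?_)
      ⟨fun m => ?_, fun m => ?_⟩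
    · simp [ξ, congrFun h0 i]
    · simp [η, congrFun h0 j]
    · have := hz _ (Or.inl ⟨m, rfl⟩)
      rw [map_dX] at this
      simpa [ξ, η, dX] using this
    · have := hz _ (Or.inr ⟨m, rfl⟩)
      rw [map_dY] at this
      simpa [ξ, η, dY] using this
  · rintro f (⟨m, rfl⟩ | ⟨m, rfl⟩)
    · have := map_dX (MvPolynomial.eval₂Hom φ (Sum.elim x y)) A ξ η m
      simp only [MvPolynomial.coe_eval₂Hom, ξ, η, MvPolynomial.eval₂_X, Sum.elim_inl,
        Sum.elim_inr] at this
      rw [this, hx]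
    · have := map_dY (MvPolynomial.eval₂Hom φ (Sum.elim x y)) A ξ η m
      simp only [MvPolynomial.coe_eval₂Hom, ξ, η, MvPolynomial.eval₂_X, Sum.elim_inl,
        Sum.elim_inr] at this
      rw [this, hy]

section Valuation
variable {K : Type*} [Field K]

theorem isAlgebraic_of_forall_valuationSubring [Algebra ℂ K] (s : Set K) (a : K)
    (h : ∀ V : ValuationSubring K, (∀ c : ℂ, algebraMap ℂ K c ∈ V) → s ⊆ V → a ∈ V) :
    IsAlgebraic (Algebra.adjoin ℂ s) a := by
  have h1 : a ∈ (⨅ V : {V : ValuationSubring K // (Set.range (algebraMap ℂ K) ∪ s) ⊆ V.toSubring},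
      V.1.toSubring) := by
    rw [Subring.mem_iInf]
    rintro ⟨V, hV⟩
    exact h V (fun c => hV (Or.inl ⟨c, rfl⟩)) fun x hx => hV (Or.inr hx)
  rw [iInf_valuationSubring_superset] at h1
  obtain ⟨p, hp, hp0⟩ := (h1 : IsIntegral _ a)
  have hle : Subring.closure (Set.range (algebraMap ℂ K) ∪ s) ≤ (Algebra.adjoin ℂ s).toSubring := by
    rw [Subring.closure_le]
    rintro x (⟨c, rfl⟩ | hx)
    · exact (Algebra.adjoin ℂ s).algebraMap_mem c
    · exact Algebra.subset_adjoin hx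
  refine IsIntegral.isAlgebraic ⟨p.map (Subring.inclusion hle), hp.map _, ?_⟩
  rw [Polynomial.eval₂_map]
  exact hp0

theorem exists_div_mem (V : ValuationSubring K) {ι : Type*} [Finite ι] (z : ι → K) (hz : z ≠ 0) :
    ∃ i, z i ≠ 0 ∧ (∀ j, z j / z i ∈ V) := by
  obtain ⟨j, hj⟩ := Function.ne_iff.1 hz
  have : Nonempty ι := ⟨j⟩
  obtain ⟨i, hi⟩ := Finite.exists_max fun i => V.valuation (z i)
  have h0 : z i ≠ 0 := fun h => by
    have := hi j
    rw [h, map_zero, le_zero_iff, map_eq_zero] at this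
    exact hj this
  refine ⟨i, h0, fun j => ?_⟩
  rw [← V.valuation_le_one_iff, map_div₀]
  exact div_le_one_of_le₀ (hi j) zero_le

theorem residue_div_eq_zero (V : ValuationSubring K) {a b : K} (ha : a ∈ V) (hb : b ∉ V)
    (h : a / b ∈ V) : IsLocalRing.residue V ⟨a / b, h⟩ = 0 := by
  rw [IsLocalRing.residue_eq_zero_iff, IsLocalRing.mem_maximalIdeal, mem_nonunits_iff]
  rintro hu
  have hv : V.valuation (a / b) = 1 := (V.valuation_eq_one_iff ⟨a / b, h⟩).1 hu
  rw [← V.valuation_le_one_iff] at ha hb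
  have hb0 : V.valuation b ≠ 0 := fun h0 => hb (by simp [h0])
  rw [map_div₀, div_eq_one_iff_eq hb0] at hv
  exact hb (hv ▸ ha)

end Valuation

theorem div_mul_div_mul_div_mul_cancel {K : Type*} [Field K] {a b : K} (ha : a ≠ 0) (hb : b ≠ 0)
    (x y z : K) : x / a * (y / b) * (z / b) * (a * b ^ 2) = x * y * z := by
  field_simp

theorem mul_mul_mul_inv_mul_inv {K : Type*} [Field K] {a b : K} (ha : a ≠ 0) (hb : b ≠ 0)
    (x : K) : a * b * x * b⁻¹ * a⁻¹ = x := by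
  field_simp

section Prime
variable {σ : Type} (p : Ideal (MvPolynomial σ ℂ))

/-- The function field of the variety of a prime ideal. -/
abbrev funField : Type := FractionRing (MvPolynomial σ ℂ ⧸ p)

/-- The generic point of the variety of a prime ideal. -/
def genPt (f : MvPolynomial σ ℂ) : funField p :=
  algebraMap (MvPolynomial σ ℂ ⧸ p) (funField p) (Ideal.Quotient.mk p f)

/-- The generic point as a ring homomorphism. -/
def genHom : MvPolynomial σ ℂ →+* funField p :=
  (algebraMap (MvPolynomial σ ℂ ⧸ p) (funField p)).comp (Ideal.Quotient.mk p)

theorem genHom_apply (f : MvPolynomial σ ℂ) : genHom p f = genPt p f := rfl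

variable [p.IsPrime]

theorem genPt_eq_zero {f : MvPolynomial σ ℂ} : genPt p f = 0 ↔ f ∈ p := by
  rw [genPt, FaithfulSMul.algebraMap_eq_zero_iff, Ideal.Quotient.eq_zero_iff_mem]

theorem trdeg_quotient_le (s : Set (funField p))
    (h : ∀ i, IsAlgebraic (Algebra.adjoin ℂ s) (genPt p (.X i))) :
    Algebra.trdeg ℂ (MvPolynomial σ ℂ ⧸ p) ≤ Cardinal.mk s := by
  have halg : Algebra.IsAlgebraic (Algebra.adjoin ℂ s) (funField p) := by
    constructor
    have h1 : ∀ f : MvPolynomial σ ℂ, IsAlgebraic (Algebra.adjoin ℂ s) (genPt p f) := by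
      intro f
      induction f using MvPolynomial.induction_on with
      | C c =>
        have : genPt p (MvPolynomial.C c) = algebraMap (Algebra.adjoin ℂ s) (funField p)
          ⟨algebraMap ℂ _ c, (Algebra.adjoin ℂ s).algebraMap_mem c⟩ := rfl
        rw [this]
        exact isAlgebraic_algebraMap _
      | add f g hf hg =>
        rw [← genHom_apply, map_add]
        exact hf.add hg
      | mul_X f i hf =>
        rw [← genHom_apply, map_mul]
        exact hf.mul (h i)
    intro z
    obtain ⟨a, b, hb, rfl⟩ := IsFractionRing.div_surjective (MvPolynomial σ ℂ ⧸ p) z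
    obtain ⟨f, rfl⟩ := Ideal.Quotient.mk_surjective a
    obtain ⟨g, rfl⟩ := Ideal.Quotient.mk_surjective b
    rw [div_eq_mul_inv]
    exact (h1 f).mul (h1 g).inv
  have : Algebra.trdeg ℂ (MvPolynomial σ ℂ ⧸ p) ≤ Algebra.trdeg ℂ (funField p) :=
    trdeg_le_of_injective (IsScalarTower.toAlgHom ℂ _ (funField p))
      (IsFractionRing.injective _ _)
  exact this.trans (Algebra.IsAlgebraic.trdeg_le_cardinalMk ℂ s)

end Prime

/-- The dimension of the variety of pairs `(x, h)` with `M(x) h = 0`. -/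
theorem SmoothBiquad.trdeg_le {A : Fin n → Fin n → Fin n → Fin n → ℤ} (hA : SmoothBiquad A)
    (p : Ideal (MvPolynomial (Fin n ⊕ Fin n) ℂ)) [p.IsPrime]
    (hp : ∀ m, dY A (fun i => .X (.inl i)) (fun i => .X (.inr i)) m ∈ p) :
    Algebra.trdeg ℂ (MvPolynomial (Fin n ⊕ Fin n) ℂ ⧸ p) ≤ (n + 1 : ℕ) := by
  set K := funField p
  set ξ : Fin n → K := fun i => genPt p (.X (.inl i)) with hξ
  set η : Fin n → K := fun i => genPt p (.X (.inr i)) with hη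
  have hM : ∀ m, dY A ξ η m = 0 := fun m => by
    have := (genPt_eq_zero p).2 (hp m)
    rwa [← genHom_apply, map_dY] at this
  have hr : ∀ g : Fin n → K, Cardinal.mk (Set.range g) ≤ n := fun g => by
    simpa using Cardinal.mk_range_le (f := g)
  have h01 : ∀ s : Set K, (0 : K) ∈ Algebra.adjoin ℂ s := fun s => zero_mem _
  have halg : ∀ (s : Set K) (a : K), a ∈ Algebra.adjoin ℂ s → IsAlgebraic (Algebra.adjoin ℂ s) a :=
    fun s a ha => isAlgebraic_algebraMap (⟨a, ha⟩ : Algebra.adjoin ℂ s)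
  by_cases hξ0 : ξ = 0
  · refine (trdeg_quotient_le p (Set.range η) ?_).trans ((hr η).trans (by exact_mod_cast n.le_succ))
    rintro (i | i)
    · exact halg _ _ (by rw [show genPt p (.X (.inl i)) = 0 from congrFun hξ0 i]; exact h01 _)
    · exact halg _ _ (Algebra.subset_adjoin ⟨i, rfl⟩)
  by_cases hη0 : η = 0
  · refine (trdeg_quotient_le p (Set.range ξ) ?_).trans ((hr ξ).trans (by exact_mod_cast n.le_succ))
    rintro (i | i)
    · exact halg _ _ (Algebra.subset_adjoin ⟨i, rfl⟩)
    · exact halg _ _ (by rw [show genPt p (.X (.inr i)) = 0 from congrFun hη0 i]; exact h01 _)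
  have key : ∀ i j k (V : ValuationSubring K), (∀ c : ℂ, algebraMap ℂ K c ∈ V) →
      Set.range (dX A ξ η) ⊆ V → ξ i * η j * η k ∈ V := by
    intro i j k V hV hf
    obtain ⟨i0, hi0, hi⟩ := exists_div_mem V ξ hξ0
    obtain ⟨j0, hj0, hj⟩ := exists_div_mem V η hη0
    have hb : ξ i0 * η j0 ^ 2 ∈ V := by
      by_contra hb
      let φ : ℂ →+* IsLocalRing.ResidueField V :=
        (IsLocalRing.residue V).comp ((algebraMap ℂ K).codRestrict V.toSubring hV)
      let x : Fin n → V := fun i => ⟨ξ i / ξ i0, hi i⟩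
      let y : Fin n → V := fun i => ⟨η i / η j0, hj i⟩
      have hxc : (fun i => (V.subtype (x i))) = fun i => (ξ i0)⁻¹ * ξ i := by
        funext i; exact (div_eq_inv_mul _ _)
      have hyc : (fun i => (V.subtype (y i))) = fun i => (η j0)⁻¹ * η i := by
        funext i; exact (div_eq_inv_mul _ _)
      have h1 : ∀ m, IsLocalRing.residue V (dX A x y m) = 0 := by
        intro m
        have e1 : ((dX A x y m : V) : K) = dX A ξ η m / (ξ i0 * η j0 ^ 2) := by
          change V.subtype _ = _
          rw [map_dX, hxc, hyc, dX_smul, div_eq_mul_inv, mul_inv, inv_pow, mul_comm]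
        have := residue_div_eq_zero V (hf ⟨m, rfl⟩) hb (e1 ▸ (dX A x y m).2)
        convert this
      have h2 : ∀ m, IsLocalRing.residue V (dY A x y m) = 0 := by
        intro m
        have e1 : dY A x y m = 0 := Subtype.ext (by
          change V.subtype _ = 0
          rw [map_dY, hxc, hyc, dY_smul, hM, mul_zero])
        rw [e1, map_zero]
      rcases hA.eq_zero_or φ (fun i => IsLocalRing.residue V (x i))
        (fun i => IsLocalRing.residue V (y i)) (fun m => by rw [← map_dX, h1])
        (fun m => by rw [← map_dY, h2]) with h | h
      · have h3 := congrFun h i0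
        have : x i0 = 1 := Subtype.ext (div_self hi0)
        simp [this] at h3
      · have h3 := congrFun h j0
        have : y j0 = 1 := Subtype.ext (div_self hj0)
        simp [this] at h3
    have := V.mul_mem _ _ (V.mul_mem _ _ (V.mul_mem _ _ (hi i) (hj j)) (hj k)) hb
    rwa [div_mul_div_mul_div_mul_cancel hi0 hj0] at this
  obtain ⟨j0, hj0⟩ := Function.ne_iff.1 hη0
  obtain ⟨i0, hi0⟩ := Function.ne_iff.1 hξ0
  set s : Set K := insert (η j0) (Set.range (dX A ξ η)) with hs
  have hs' : ∀ i j k, IsAlgebraic (Algebra.adjoin ℂ s) (ξ i * η j * η k) := fun i j k =>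
    isAlgebraic_of_forall_valuationSubring s _ fun V hV hsV =>
      key i j k V hV ((Set.subset_insert _ _).trans hsV)
  have hη1 : IsAlgebraic (Algebra.adjoin ℂ s) (η j0) :=
    halg _ _ (Algebra.subset_adjoin (Set.mem_insert _ _))
  have hξ1 : ∀ i, IsAlgebraic (Algebra.adjoin ℂ s) (ξ i) := fun i => by
    have := ((hs' i j0 j0).mul hη1.inv).mul hη1.inv
    rwa [mul_inv_cancel_right₀ hj0, mul_inv_cancel_right₀ hj0] at this
  have hη2 : ∀ j, IsAlgebraic (Algebra.adjoin ℂ s) (η j) := fun j => by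
    have := ((hs' i0 j0 j).mul hη1.inv).mul (hξ1 i0).inv
    rwa [mul_mul_mul_inv_mul_inv hi0 hj0] at this
  refine (trdeg_quotient_le p s ?_).trans ((Cardinal.mk_insert_le).trans ?_)
  · rintro (i | i)
    · exact hξ1 i
    · exact hη2 i
  · push_cast
    gcongr
    exact hr _

theorem trdeg_add_one_le_of_not_injective {R S : Type} [CommRing R] [IsDomain R] [Algebra ℂ R]
    [CommRing S] [IsDomain S] [Algebra ℂ S] (f : R →ₐ[ℂ] S) (hf : Function.Surjective f)
    {a : R} (ha : a ≠ 0) (hfa : f a = 0) : Algebra.trdeg ℂ S + 1 ≤ Algebra.trdeg ℂ R := by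
  obtain ⟨s, hs⟩ := exists_isTranscendenceBasis ℂ S
  choose g hg using hf
  have hfg : AlgebraicIndependent ℂ (f ∘ fun i : s => g i) := by
    have : (f ∘ fun i : s => g i) = ((↑) : s → S) := by funext i; exact hg _
    rw [this]; exact hs.1
  have hx : AlgebraicIndependent ℂ (fun i : s => g i) := hfg.of_comp f
  have htr : Transcendental (Algebra.adjoin ℂ (Set.range fun i : s => g i)) a := by
    intro halg
    obtain ⟨P, hP0, hP⟩ := halg.exists_nonzero_coeff_and_aeval_eq_zero
      (mem_nonZeroDivisors_of_ne_zero ha)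
    obtain ⟨F, hF⟩ : ∃ F : MvPolynomial s ℂ,
        MvPolynomial.aeval (fun i : s => g i) F = (P.coeff 0 : R) :=
      (Algebra.adjoin_range_eq_range_aeval ℂ (fun i : s => g i)).le (P.coeff 0).2
    have h1 : f (P.coeff 0 : R) = 0 := by
      have h2 : (Polynomial.aeval a) P = (P.coeff 0 : R) + a *
          (Polynomial.aeval a) P.divX := by
        conv_lhs => rw [← Polynomial.divX_mul_X_add P]
        simp only [map_add, map_mul, Polynomial.aeval_X, Polynomial.aeval_C]
        rw [add_comm, mul_comm]; rfl
      rw [hP] at h2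
      have := congrArg f h2
      simpa [hfa] using this.symm
    have h2 : MvPolynomial.aeval (f ∘ fun i : s => g i) F = 0 := by
      rw [← h1, ← hF]
      have : MvPolynomial.aeval (f ∘ fun i : s => g i) =
          f.comp (MvPolynomial.aeval fun i : s => g i) := by ext; simp
      rw [this]; rfl
    rw [hfg.eq_zero_of_aeval_eq_zero F h2, map_zero] at hF
    exact hP0 (Subtype.ext hF.symm)
  have h := ((hx.option_iff_transcendental a).2 htr).cardinalMk_le_trdeg
  rw [Cardinal.mk_option, hs.cardinalMk_eq_trdeg] at h
  exact h

theorem trdeg_quotient_add_one_le {σ : Type} {p q : Ideal (MvPolynomial σ ℂ)} [p.IsPrime]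
    [q.IsPrime] (h : p < q) : Algebra.trdeg ℂ (MvPolynomial σ ℂ ⧸ q) + 1 ≤
      Algebra.trdeg ℂ (MvPolynomial σ ℂ ⧸ p) := by
  obtain ⟨a, haq, hap⟩ := SetLike.exists_of_lt h
  refine trdeg_add_one_le_of_not_injective (Ideal.Quotient.factorₐ ℂ h.le)
    (Ideal.Quotient.factor_surjective h.le) (a := Ideal.Quotient.mk p a)
    (by rwa [Ne, Ideal.Quotient.eq_zero_iff_mem]) ?_
  change Ideal.Quotient.factor h.le (Ideal.Quotient.mk p a) = 0
  rw [Ideal.Quotient.factor_mk]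
  exact Ideal.Quotient.eq_zero_iff_mem.2 haq

/-- The linear form with given coefficients. -/
def linForm {σ : Type} [Fintype σ] (c : σ → ℂ) : MvPolynomial σ ℂ :=
  ∑ i, MvPolynomial.C (c i) * .X i

/-- A linear form outside all minimal primes except those containing all the variables. -/
theorem exists_linForm_notMem {σ : Type} [Fintype σ] (I : Ideal (MvPolynomial σ ℂ)) :
    ∃ c : σ → ℂ, ∀ p ∈ I.minimalPrimes, linForm c ∈ p → ∀ i, (.X i : MvPolynomial σ ℂ) ∈ p := by
  classical
  let Φ : (σ → ℂ) →ₗ[ℂ] MvPolynomial σ ℂ :=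
    ∑ i, (LinearMap.toSpanSingleton ℂ (MvPolynomial σ ℂ) (.X i)).comp (LinearMap.proj i)
  have hΦ : ∀ c, Φ c = linForm c := fun c => by
    simp [Φ, linForm, MvPolynomial.smul_eq_C_mul]
  let W : Ideal (MvPolynomial σ ℂ) → Submodule ℂ (σ → ℂ) := fun p =>
    (p.restrictScalars ℂ).comap Φ
  have hfin := Ideal.finite_minimalPrimes_of_isNoetherianRing _ I
  let s : Set (Ideal (MvPolynomial σ ℂ)) := {p ∈ I.minimalPrimes | ∃ i, (.X i : MvPolynomial σ ℂ) ∉ p}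
  have hs : s.Finite := hfin.subset fun p hp => hp.1
  have h1 : (⋃ V ∈ (hs.image W).toFinset, (V : Set (σ → ℂ))) ≠ Set.univ := by
    apply Subspace.biUnion_ne_univ_of_top_notMem
    simp only [Set.Finite.mem_toFinset, Set.mem_image, not_exists, not_and]
    rintro p ⟨hp, i, hi⟩ htop
    apply hi
    have : Pi.single i 1 ∈ W p := by rw [htop]; trivial
    have h2 : Φ (Pi.single i 1) ∈ p := this
    have h3 : linForm (Pi.single i 1) = (.X i : MvPolynomial σ ℂ) := by
      rw [linForm, Finset.sum_eq_single i]
      · simp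
      · intro j _ hj; simp [Pi.single_eq_of_ne hj]
      · simp
    rwa [hΦ, h3] at h2
  obtain ⟨c, hc⟩ := (Set.ne_univ_iff_exists_notMem _).1 h1
  refine ⟨c, fun p hp hcp i => ?_⟩
  by_contra hi
  apply hc
  simp only [Set.mem_iUnion]
  exact ⟨W p, by simpa using ⟨p, ⟨hp, i, hi⟩, rfl⟩, by
    change Φ c ∈ p
    rwa [hΦ]⟩

theorem trdeg_eq_zero_of_X_mem {σ : Type} (p : Ideal (MvPolynomial σ ℂ)) [p.IsPrime]
    (h : ∀ i, (.X i : MvPolynomial σ ℂ) ∈ p) : Algebra.trdeg ℂ (MvPolynomial σ ℂ ⧸ p) ≤ 0 := by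
  have := trdeg_quotient_le p ∅ fun i => by
    rw [(genPt_eq_zero p).2 (h i)]
    exact isAlgebraic_zero
  simpa using this

theorem exists_linForms {σ : Type} [Fintype σ] (d : ℕ) (I : Ideal (MvPolynomial σ ℂ))
    (hI : ∀ p : Ideal (MvPolynomial σ ℂ), p.IsPrime → I ≤ p →
      Algebra.trdeg ℂ (MvPolynomial σ ℂ ⧸ p) ≤ d) :
    ∃ c : Fin d → σ → ℂ, ∀ p : Ideal (MvPolynomial σ ℂ), p.IsPrime → I ≤ p →
      (∀ k, linForm (c k) ∈ p) → Algebra.trdeg ℂ (MvPolynomial σ ℂ ⧸ p) ≤ 0 := by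
  induction d generalizing I with
  | zero => exact ⟨Fin.elim0, fun p hp hI' _ => by simpa using hI p hp hI'⟩
  | succ d ih =>
    obtain ⟨c₀, hc₀⟩ := exists_linForm_notMem I
    obtain ⟨c, hc⟩ := ih (I ⊔ Ideal.span {linForm c₀}) (by
      intro q hq hIq
      have hc₀q : linForm c₀ ∈ q :=
        hIq (Ideal.mem_sup_right (Ideal.mem_span_singleton_self _))
      obtain ⟨p, hp, hpq⟩ := Ideal.exists_minimalPrimes_le (le_sup_left.trans hIq)
      have hpp : p.IsPrime := hp.1.1
      by_cases hX : ∀ i, (.X i : MvPolynomial σ ℂ) ∈ p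
      · exact (trdeg_eq_zero_of_X_mem q fun i => hpq (hX i)).trans (zero_le)
      · have hlt : p < q := lt_of_le_of_ne hpq fun h => hX (hc₀ p hp (h ▸ hc₀q))
        have := (trdeg_quotient_add_one_le hlt).trans (hI p hpp hp.1.2)
        push_cast at this
        exact (Cardinal.add_one_le_add_one_iff).1 this)
    refine ⟨Fin.cons c₀ c, fun p hp hIp hk => hc p hp (sup_le hIp ?_) fun k => hk k.succ⟩
    rw [Ideal.span_singleton_le_iff_mem]
    exact hk 0

theorem SmoothBiquad.exists_linForms {A : Fin n → Fin n → Fin n → Fin n → ℤ}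
    (hA : SmoothBiquad A) : ∃ c : Fin (n + 1) → Fin n ⊕ Fin n → ℂ, ∀ x y : Fin n → ℂ,
      (∀ m, dY A x y m = 0) → (∀ k, ∑ i, c k i * Sum.elim x y i = 0) → x = 0 ∧ y = 0 := by
  obtain ⟨c, hc⟩ := _root_.exists_linForms (n + 1) (Ideal.span (Set.range fun m =>
    dY A (fun i => (.X (.inl i) : MvPolynomial (Fin n ⊕ Fin n) ℂ)) (fun i => .X (.inr i)) m))
    (fun p hp hIp => hA.trdeg_le p fun m => hIp (Ideal.subset_span ⟨m, rfl⟩))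
  refine ⟨c, fun x y hxy hk => ?_⟩
  by_contra hne
  obtain ⟨i, hi⟩ : ∃ i, Sum.elim x y i ≠ 0 := by
    by_contra! h
    exact hne ⟨funext fun i => h (.inl i), funext fun i => h (.inr i)⟩
  let φ : MvPolynomial (Fin n ⊕ Fin n) ℂ →ₐ[ℂ] Polynomial ℂ :=
    MvPolynomial.aeval fun i => Polynomial.C (Sum.elim x y i) * Polynomial.X
  have hprime : (RingHom.ker φ).IsPrime := RingHom.ker_isPrime _
  have h0 := hc (RingHom.ker φ) hprime (by
    rw [Ideal.span_le]
    rintro _ ⟨m, rfl⟩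
    change φ _ = 0
    have h1 : (φ : _ →+* Polynomial ℂ) (dY A (fun i => (.X (.inl i) : MvPolynomial (Fin n ⊕ Fin n) ℂ))
      (fun i => .X (.inr i)) m) = 0 := by
      rw [map_dY]
      have e1 : (fun i => (φ : _ →+* Polynomial ℂ) (.X (.inl i) : MvPolynomial (Fin n ⊕ Fin n) ℂ)) =
          fun i => Polynomial.X * Polynomial.C (x i) := by
        funext i
        exact (MvPolynomial.aeval_X _ _).trans (mul_comm _ _)
      have e2 : (fun i => (φ : _ →+* Polynomial ℂ) (.X (.inr i) : MvPolynomial (Fin n ⊕ Fin n) ℂ)) =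
          fun i => Polynomial.X * Polynomial.C (y i) := by
        funext i
        exact (MvPolynomial.aeval_X _ _).trans (mul_comm _ _)
      rw [e1, e2, dY_smul, ← map_dY, hxy, map_zero, mul_zero]
    exact h1) (by
    intro k
    change φ (linForm (c k)) = 0
    have : φ (linForm (c k)) = Polynomial.C (∑ i, c k i * Sum.elim x y i) * Polynomial.X := by
      simp only [linForm, map_sum, map_mul, φ, MvPolynomial.aeval_X, Finset.sum_mul, ← mul_assoc]
      simp
    rw [this, hk, map_zero, zero_mul])
  have h1 : Algebra.IsAlgebraic ℂ (MvPolynomial (Fin n ⊕ Fin n) ℂ ⧸ RingHom.ker φ) :=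
    trdeg_eq_zero_iff.1 (le_antisymm h0 (zero_le))
  have h2 := (h1.isAlgebraic (Ideal.Quotient.mk _ (.X i))).algHom (Ideal.kerLiftAlg φ)
  have h3 : Ideal.kerLiftAlg φ (Ideal.Quotient.mk _ (.X i)) =
      Polynomial.C (Sum.elim x y i) * Polynomial.X := by
    rw [Ideal.kerLiftAlg_mk]; simp [φ]
  rw [h3] at h2
  have h4 : IsAlgebraic ℂ (Polynomial.X : Polynomial ℂ) := by
    have := (isAlgebraic_algebraMap (R := ℂ) (A := Polynomial ℂ) (Sum.elim x y i)⁻¹).mul h2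
    have e : algebraMap ℂ (Polynomial ℂ) (Sum.elim x y i)⁻¹ *
        (Polynomial.C (Sum.elim x y i) * Polynomial.X) = Polynomial.X := by
      rw [← mul_assoc, Polynomial.algebraMap_eq, ← map_mul, inv_mul_cancel₀ hi, map_one, one_mul]
    rwa [e] at this
  exact Polynomial.transcendental_X ℂ h4

theorem SmoothBiquad.trdeg_triT_le {A : Fin n → Fin n → Fin n → Fin n → ℤ} (hA : SmoothBiquad A)
    (p : Ideal (MvPolynomial (Fin n ⊕ Fin n ⊕ Fin n) ℂ)) [p.IsPrime]
    (hp : ∀ m, triT A (fun i => .X (.inl i)) (fun i => .X (.inr (.inl i)))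
      (fun i => .X (.inr (.inr i))) m ∈ p) :
    Algebra.trdeg ℂ (MvPolynomial (Fin n ⊕ Fin n ⊕ Fin n) ℂ ⧸ p) ≤ (2 * n + 1 : ℕ) := by
  obtain ⟨c, hc⟩ := hA.exists_linForms
  set K := funField p
  set ν : Fin n ⊕ Fin n ⊕ Fin n → K := fun i => genPt p (.X i) with hν
  set u : Fin n → K := fun i => ν (.inl i)
  set w : Fin n → K := fun i => ν (.inr (.inl i))
  set h : Fin n → K := fun i => ν (.inr (.inr i))
  have hM : ∀ m, triT A u w h m = 0 := fun m => by
    have := (genPt_eq_zero p).2 (hp m)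
    rwa [← genHom_apply, map_triT] at this
  let ℓ : Fin (n + 1) → K := fun k => ∑ i, algebraMap ℂ K (c k i) * Sum.elim u h i
  set s : Set K := Set.range (fun i => u i - w i) ∪ Set.range ℓ with hs
  have halg : ∀ i, IsAlgebraic (Algebra.adjoin ℂ s) (ν i) := by
    intro i
    refine isAlgebraic_of_forall_valuationSubring s _ fun V hV hsV => ?_
    by_contra hi
    have hν0 : ν ≠ 0 := fun h0 => hi (by rw [h0]; exact V.zero_mem)
    obtain ⟨i0, hi0, hdiv⟩ := exists_div_mem V ν hν0
    have hb : ν i0 ∉ V := fun hb => hi (by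
      have := V.mul_mem _ _ (hdiv i) hb
      rwa [div_mul_cancel₀ _ hi0] at this)
    let φ : ℂ →+* IsLocalRing.ResidueField V :=
      (IsLocalRing.residue V).comp ((algebraMap ℂ K).codRestrict V.toSubring hV)
    let z : Fin n ⊕ Fin n ⊕ Fin n → V := fun i => ⟨ν i / ν i0, hdiv i⟩
    have hz : ∀ j, ((z j : V) : K) = (ν i0)⁻¹ * ν j := fun j => div_eq_inv_mul _ _
    let x : Fin n → IsLocalRing.ResidueField V := fun i => IsLocalRing.residue V (z (.inl i))
    let y : Fin n → IsLocalRing.ResidueField V := fun i =>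
      IsLocalRing.residue V (z (.inr (.inr i)))
    have hres : ∀ (a : V) (b : K), b ∈ s → (a : K) = b / ν i0 → IsLocalRing.residue V a = 0 := by
      intro a b hbs hab
      have := residue_div_eq_zero V (hsV hbs) hb (hab ▸ a.2)
      convert this
    have hxw : ∀ i, IsLocalRing.residue V (z (.inr (.inl i))) = x i := by
      intro i
      rw [← sub_eq_zero, ← map_sub, ← neg_eq_zero, ← map_neg]
      refine hres _ (u i - w i) (Or.inl ⟨i, rfl⟩) ?_
      change -(ν (.inr (.inl i)) / ν i0 - ν (.inl i) / ν i0) = _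
      rw [← sub_div, ← neg_div, neg_sub]
    have hℓ : ∀ k, ∑ i, φ (c k i) * Sum.elim x y i = 0 := by
      intro k
      have e : ∑ i, φ (c k i) * Sum.elim x y i = IsLocalRing.residue V
          (∑ i, (algebraMap ℂ K).codRestrict V.toSubring hV (c k i) *
            Sum.elim (fun i => z (.inl i)) (fun i => z (.inr (.inr i))) i) := by
        rw [map_sum]
        refine Finset.sum_congr rfl fun i _ => ?_
        rw [map_mul]
        rcases i with i | i <;> rfl
      rw [e]
      refine hres _ (ℓ k) (Or.inr ⟨k, rfl⟩) ?_
      change V.subtype _ = _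
      simp only [ℓ]
      rw [map_sum, Finset.sum_div]
      refine Finset.sum_congr rfl fun i _ => ?_
      rw [map_mul, mul_div_assoc]
      rcases i with i | i <;> rfl
    have hdY : ∀ m, dY A x y m = 0 := by
      intro m
      have e0 : triT A (fun i => z (.inl i)) (fun i => z (.inr (.inl i)))
          (fun i => z (.inr (.inr i))) m = 0 := Subtype.ext (by
        change V.subtype _ = 0
        rw [map_triT]
        simp only [ValuationSubring.coe_subtype, hz]
        rw [triT_smul, hM, mul_zero])
      have e1 := congrArg (IsLocalRing.residue V) e0
      rw [map_triT, map_zero, funext hxw, triT_self] at e1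
      have : (2 : IsLocalRing.ResidueField V) ≠ 0 := by
        rw [← map_ofNat φ 2]
        exact (map_ne_zero φ).2 two_ne_zero
      exact (mul_eq_zero.1 e1).resolve_left this
    let ξ : Fin n → MvPolynomial (Fin n ⊕ Fin n) ℂ := fun i => .X (.inl i)
    let η : Fin n → MvPolynomial (Fin n ⊕ Fin n) ℂ := fun i => .X (.inr i)
    have key : ∀ j, Sum.elim x y j = 0 := by
      intro j
      have := eval₂_eq_zero_of_forall φ (Set.range (dY A ξ η) ∪ Set.range fun k => linForm (c k))
        (.X j) (by
          intro P hP
          have h1 : ∀ m, dY A (fun i => P (.inl i)) (fun i => P (.inr i)) m = 0 := fun m => by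
            have := hP _ (Or.inl ⟨m, rfl⟩)
            rw [map_dY] at this
            simpa [ξ, η] using this
          have h2 : ∀ k, ∑ i, c k i * Sum.elim (fun i => P (.inl i)) (fun i => P (.inr i)) i = 0 := by
            intro k
            have := hP _ (Or.inr ⟨k, rfl⟩)
            simpa [linForm] using this
          obtain ⟨h3, h4⟩ := hc _ _ h1 h2
          rw [MvPolynomial.eval_X]
          rcases j with j | j
          · exact congrFun h3 j
          · exact congrFun h4 j) (Sum.elim x y) (by
          rintro _ (⟨m, rfl⟩ | ⟨k, rfl⟩)
          · have e := map_dY (MvPolynomial.eval₂Hom φ (Sum.elim x y)) A ξ η m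
            rw [MvPolynomial.coe_eval₂Hom] at e
            rw [e]
            simpa [ξ, η] using hdY m
          · have := hℓ k
            simpa [linForm] using this)
      simpa using this
    have h1 : IsLocalRing.residue V (z i0) = 0 := by
      rcases i0 with i | i | i
      · exact key (.inl i)
      · rw [hxw]; exact key (.inl i)
      · exact key (.inr i)
    have : z i0 = 1 := Subtype.ext (div_self hi0)
    simp [this] at h1
  refine (trdeg_quotient_le p s halg).trans ((Cardinal.mk_union_le _ _).trans ?_)
  have hr : ∀ {m : ℕ} (g : Fin m → K), Cardinal.mk (Set.range g) ≤ m := fun g => by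
    simpa using Cardinal.mk_range_le (f := g)
  refine (add_le_add (hr _) (hr _)).trans ?_
  exact_mod_cast (by omega : n + (n + 1) ≤ 2 * n + 1)

/-- Coordinates on an irreducible affine variety are algebraic over few of them. -/
theorem exists_algebraic_relations {σ : Type} [Fintype σ] {d : ℕ} (p : Ideal (MvPolynomial σ ℂ))
    [p.IsPrime] (hd : Algebra.trdeg ℂ (MvPolynomial σ ℂ ⧸ p) ≤ d) :
    ∃ (τ : Type) (_ : Fintype τ) (ι : τ → σ), Fintype.card τ ≤ d ∧
      ∀ i, ∃ G : Polynomial (MvPolynomial τ ℂ), MvPolynomial.rename ι G.leadingCoeff ∉ p ∧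
        (G.map (MvPolynomial.rename ι : MvPolynomial τ ℂ →ₐ[ℂ] MvPolynomial σ ℂ).toRingHom).eval
          (.X i) ∈ p := by
  let x : σ → MvPolynomial σ ℂ ⧸ p := fun i => Ideal.Quotient.mk p (.X i)
  have hx : Algebra.adjoin ℂ (Set.range x) = ⊤ := by
    rw [Algebra.adjoin_range_eq_range_aeval, ← top_le_iff]
    rintro y -
    obtain ⟨f, rfl⟩ := Ideal.Quotient.mk_surjective y
    refine ⟨f, ?_⟩
    have : MvPolynomial.aeval x = Ideal.Quotient.mkₐ ℂ p := by ext; simp [x]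
    change MvPolynomial.aeval x f = _
    rw [this]; rfl
  have : Algebra.IsAlgebraic (Algebra.adjoin ℂ (Set.range x)) (MvPolynomial σ ℂ ⧸ p) := by
    constructor
    intro a
    exact isAlgebraic_algebraMap (⟨a, hx ▸ Algebra.mem_top⟩ : Algebra.adjoin ℂ (Set.range x))
  obtain ⟨t, ht, hB⟩ := exists_isTranscendenceBasis_subset (R := ℂ) (Set.range x)
  have hfin : Finite t := (Set.finite_range x).subset ht
  choose ι hι using fun b : t => ht b.2
  refine ⟨t, Fintype.ofFinite t, ι, ?_, fun i => ?_⟩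
  · have h1 := hB.cardinalMk_eq_trdeg.trans_le hd
    have := Fintype.ofFinite t
    rw [Cardinal.mk_fintype] at h1
    convert (Nat.cast_le (α := Cardinal)).1 h1
  have halg := hB.isAlgebraic.isAlgebraic (x i)
  obtain ⟨P, hP0, hP⟩ := halg
  let e := hB.1.aevalEquiv
  let G : Polynomial (MvPolynomial t ℂ) := P.map (e.symm : _ →+* MvPolynomial t ℂ)
  have hmk : ∀ f : MvPolynomial t ℂ, Ideal.Quotient.mk p (MvPolynomial.rename ι f) = (e f : _) := by
    intro f
    have : (Ideal.Quotient.mkₐ ℂ p).comp (MvPolynomial.rename ι) =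
        MvPolynomial.aeval ((↑) : t → MvPolynomial σ ℂ ⧸ p) := by
      ext b; simp [← hι, x]
    exact (AlgHom.congr_fun this f).trans (hB.1.algebraMap_aevalEquiv f).symm
  refine ⟨G, ?_, ?_⟩
  · rw [← Ideal.Quotient.eq_zero_iff_mem, hmk]
    have hG : G ≠ 0 := (Polynomial.map_ne_zero_iff e.symm.injective).2 hP0
    intro h0
    have h1 : e G.leadingCoeff = 0 := Subtype.ext h0
    rw [EmbeddingLike.map_eq_zero_iff] at h1
    exact hG (Polynomial.leadingCoeff_eq_zero.1 h1)
  · rw [← Ideal.Quotient.eq_zero_iff_mem, Polynomial.eval_map, Polynomial.hom_eval₂,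
      Polynomial.eval₂_map, ← hP, Polynomial.aeval_def]
    congr 1
    ext1 a
    change Ideal.Quotient.mk p (MvPolynomial.rename ι (e.symm a)) = a
    rw [hmk, AlgEquiv.apply_symm_apply]

/-- Evaluation at an integer point. -/
def evalZ {σ : Type} (z : σ → ℤ) : MvPolynomial σ ℂ →+* ℂ := MvPolynomial.eval fun i => (z i : ℂ)

/-- Integer points of height at most `K` on an affine variety of dimension at most `d`
are at most `O(K ^ d)` in number, provided this holds for the proper subvarieties. -/
theorem exists_card_generic_zeros_le {σ : Type} [Fintype σ] [DecidableEq σ] {τ : Type} [Fintype τ]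
    (ι : τ → σ) {d : ℕ} (hd : Fintype.card τ ≤ d) (G : σ → Polynomial (MvPolynomial τ ℂ)) :
    ∃ C : ℕ, ∀ K : ℕ, 1 ≤ K → ∀ s : Finset (σ → ℤ), (∀ z ∈ s, (∀ i, |z i| ≤ K) ∧ ∀ i,
      evalZ z (MvPolynomial.rename ι (G i).leadingCoeff) ≠ 0 ∧
      evalZ z (((G i).map
        (MvPolynomial.rename ι : MvPolynomial τ ℂ →ₐ[ℂ] MvPolynomial σ ℂ).toRingHom).eval
          (.X i)) = 0) → s.card ≤ C * K ^ d := by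
  classical
  refine ⟨(∏ i, (G i).natDegree) * 3 ^ d, fun K hK s hs => ?_⟩
  let t : Finset (τ → ℤ) := Fintype.piFinset fun _ => Finset.Icc (-(K : ℤ)) K
  have ht : t.card ≤ (3 * K) ^ d := by
    rw [Fintype.card_piFinset]
    simp only [Int.card_Icc, Finset.prod_const, Finset.card_univ]
    refine (Nat.pow_le_pow_left (by omega : _ ≤ 3 * K) _).trans (Nat.pow_le_pow_right (by omega) hd)
  have hst : ∀ z ∈ s, z ∘ ι ∈ t := fun z hz => by
    simp only [t, Fintype.mem_piFinset, Finset.mem_Icc, Function.comp_apply]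
    exact fun b => abs_le.1 ((hs z hz).1 (ι b))
  refine (Finset.card_le_mul_card_image_of_maps_to hst (∏ i, (G i).natDegree) ?_).trans ?_
  · intro b _
    let P : σ → Polynomial ℂ := fun i => (G i).map (evalZ b)
    let r : σ → Finset ℤ := fun i =>
      (P i).roots.toFinset.preimage (Int.cast : ℤ → ℂ) Int.cast_injective.injOn
    have hr : ∀ i, (r i).card ≤ (G i).natDegree := fun i => by
      refine (Finset.card_le_card_of_injOn (t := (P i).roots.toFinset) (Int.cast : ℤ → ℂ)
        (fun a ha => Finset.mem_preimage.1 ha) Int.cast_injective.injOn).trans ?_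
      refine (Multiset.toFinset_card_le _).trans ((Polynomial.card_roots' _).trans ?_)
      exact Polynomial.natDegree_map_le
    refine (Finset.card_le_card (t := Fintype.piFinset r) fun z hz => ?_).trans
      ((Fintype.card_piFinset r).trans_le (Finset.prod_le_prod' fun i _ => hr i))
    rw [Finset.mem_filter] at hz
    obtain ⟨hzs, rfl⟩ := hz
    have hcomp : ∀ f, evalZ z (MvPolynomial.rename ι f) = evalZ (z ∘ ι) f := fun f => by
      simp only [evalZ, MvPolynomial.eval_rename]; rfl
    simp only [Fintype.mem_piFinset]
    intro i
    obtain ⟨h1, h2⟩ := (hs z hzs).2 i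
    rw [hcomp] at h1
    rw [Polynomial.eval_map, Polynomial.hom_eval₂] at h2
    simp only [r, P, Finset.mem_preimage, Multiset.mem_toFinset, Polynomial.mem_roots']
    refine ⟨fun h0 => h1 ?_, ?_⟩
    · have := congrArg (fun Q => Polynomial.coeff Q (G i).natDegree) h0
      simpa using this
    · rw [Polynomial.IsRoot, Polynomial.eval_map, ← h2]
      have e1 : evalZ z (.X i) = (z i : ℂ) := by simp [evalZ]
      rw [e1]
      congr 1
      exact RingHom.ext fun f => (hcomp f).symm
  · rw [mul_assoc, ← mul_pow]
    gcongr

theorem exists_card_zeros_prime_le {σ : Type} [Fintype σ] (d : ℕ)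
    (p : Ideal (MvPolynomial σ ℂ)) (hp : p.IsPrime)
    (hd : Algebra.trdeg ℂ (MvPolynomial σ ℂ ⧸ p) ≤ d) :
    ∃ C : ℕ, ∀ K : ℕ, 1 ≤ K → ∀ s : Finset (σ → ℤ), (∀ z ∈ s, (∀ i, |z i| ≤ K) ∧
      ∀ f ∈ p, evalZ z f = 0) → s.card ≤ C * K ^ d := by
  classical
  induction p using WellFoundedGT.induction with
  | ind p ih =>
  obtain ⟨τ, hτ, ι, hcard, hG⟩ := exists_algebraic_relations p hd
  choose G hG1 hG2 using hG
  obtain ⟨C₀, hC₀⟩ := exists_card_generic_zeros_le ι hcard G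
  let J : σ → Ideal (MvPolynomial σ ℂ) := fun i =>
    p ⊔ Ideal.span {MvPolynomial.rename ι (G i).leadingCoeff}
  have hJ : ∀ i, MvPolynomial.rename ι (G i).leadingCoeff ∈ J i := fun i =>
    Ideal.mem_sup_right (Ideal.mem_span_singleton_self _)
  let I : σ → Finset (Ideal (MvPolynomial σ ℂ)) := fun i =>
    (Ideal.finite_minimalPrimes_of_isNoetherianRing _ (J i)).toFinset
  have hI : ∀ i, ∀ q ∈ I i, q.IsPrime ∧ J i ≤ q := fun i q hq => by
    have : q ∈ (J i).minimalPrimes := by simpa [I] using hq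
    exact this.1
  have hbound : ∀ i, ∀ q : Ideal (MvPolynomial σ ℂ), ∃ C : ℕ, q ∈ I i → ∀ K : ℕ, 1 ≤ K →
      ∀ s : Finset (σ → ℤ), (∀ z ∈ s, (∀ i, |z i| ≤ K) ∧ ∀ f ∈ q, evalZ z f = 0) →
        s.card ≤ C * K ^ d := by
    intro i q
    by_cases hq : q ∈ I i
    · obtain ⟨hqp, hJq⟩ := hI i q hq
      have hlt : p < q := lt_of_le_of_ne (le_sup_left.trans hJq) fun h => hG1 i (h ▸ hJq (hJ i))
      obtain ⟨C, hC⟩ := ih q hlt hqp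
        ((le_self_add.trans (trdeg_quotient_add_one_le hlt)).trans hd)
      exact ⟨C, fun _ => hC⟩
    · exact ⟨0, fun h => absurd h hq⟩
  choose C hC using hbound
  refine ⟨C₀ + ∑ i, ∑ q ∈ I i, C i q, fun K hK s hs => ?_⟩
  let good : Finset (σ → ℤ) := s.filter fun z =>
    ∀ i, evalZ z (MvPolynomial.rename ι (G i).leadingCoeff) ≠ 0
  let bad : (i : σ) → (q : Ideal (MvPolynomial σ ℂ)) → Finset (σ → ℤ) := fun i q =>
    s.filter fun z => ∀ f ∈ q, evalZ z f = 0
  have hsub : s ⊆ good ∪ Finset.univ.biUnion fun i => (I i).biUnion (bad i) := by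
    intro z hz
    rw [Finset.mem_union]
    by_cases hg : ∀ i, evalZ z (MvPolynomial.rename ι (G i).leadingCoeff) ≠ 0
    · exact Or.inl (Finset.mem_filter.2 ⟨hz, hg⟩)
    · right
      push Not at hg
      obtain ⟨i, hi⟩ := hg
      have hprime : (RingHom.ker (evalZ z)).IsPrime := RingHom.ker_isPrime _
      have hle : J i ≤ RingHom.ker (evalZ z) :=
        sup_le (fun f hf => (hs z hz).2 f hf) ((Ideal.span_singleton_le_iff_mem _).2 hi)
      obtain ⟨q, hq, hqz⟩ := Ideal.exists_minimalPrimes_le hle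
      simp only [Finset.mem_biUnion, Finset.mem_univ, true_and]
      exact ⟨i, q, by simpa [I] using hq, Finset.mem_filter.2 ⟨hz, fun f hf => hqz hf⟩⟩
  have h1 : good.card ≤ C₀ * K ^ d := hC₀ K hK good fun z hz => by
    rw [Finset.mem_filter] at hz
    exact ⟨(hs z hz.1).1, fun i => ⟨hz.2 i, (hs z hz.1).2 _ (hG2 i)⟩⟩
  have h2 : ∀ i, ∀ q ∈ I i, (bad i q).card ≤ C i q * K ^ d := fun i q hq =>
    hC i q hq K hK _ fun z hz => by
      rw [Finset.mem_filter] at hz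
      exact ⟨(hs z hz.1).1, hz.2⟩
  calc s.card ≤ _ := Finset.card_le_card hsub
    _ ≤ good.card + ∑ i, ∑ q ∈ I i, (bad i q).card :=
        (Finset.card_union_le _ _).trans (Nat.add_le_add_left (Finset.card_biUnion_le.trans
          (Finset.sum_le_sum fun i _ => Finset.card_biUnion_le)) _)
    _ ≤ C₀ * K ^ d + ∑ i, ∑ q ∈ I i, C i q * K ^ d :=
        Nat.add_le_add h1 (Finset.sum_le_sum fun i _ => Finset.sum_le_sum fun q hq => h2 i q hq)
    _ = _ := by simp only [add_mul, Finset.sum_mul]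

theorem exists_card_zeros_le {σ : Type} [Fintype σ] (d : ℕ) (I : Ideal (MvPolynomial σ ℂ))
    (hI : ∀ p : Ideal (MvPolynomial σ ℂ), p.IsPrime → I ≤ p →
      Algebra.trdeg ℂ (MvPolynomial σ ℂ ⧸ p) ≤ d) :
    ∃ C : ℕ, ∀ K : ℕ, 1 ≤ K → ∀ s : Finset (σ → ℤ), (∀ z ∈ s, (∀ i, |z i| ≤ K) ∧
      ∀ f ∈ I, evalZ z f = 0) → s.card ≤ C * K ^ d := by
  classical
  let P : Finset (Ideal (MvPolynomial σ ℂ)) :=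
    (Ideal.finite_minimalPrimes_of_isNoetherianRing _ I).toFinset
  have hb : ∀ q : Ideal (MvPolynomial σ ℂ), ∃ C : ℕ, q ∈ P → ∀ K : ℕ, 1 ≤ K →
      ∀ s : Finset (σ → ℤ), (∀ z ∈ s, (∀ i, |z i| ≤ K) ∧ ∀ f ∈ q, evalZ z f = 0) →
        s.card ≤ C * K ^ d := by
    intro q
    by_cases hq : q ∈ P
    · have hq' : q ∈ I.minimalPrimes := by simpa [P] using hq
      obtain ⟨C, hC⟩ := exists_card_zeros_prime_le d q hq'.1.1 (hI q hq'.1.1 hq'.1.2)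
      exact ⟨C, fun _ => hC⟩
    · exact ⟨0, fun h => absurd h hq⟩
  choose C hC using hb
  refine ⟨∑ q ∈ P, C q, fun K hK s hs => ?_⟩
  have hsub : s ⊆ P.biUnion fun q => s.filter fun z => ∀ f ∈ q, evalZ z f = 0 := by
    intro z hz
    have hprime : (RingHom.ker (evalZ z)).IsPrime := RingHom.ker_isPrime _
    obtain ⟨q, hq, hqz⟩ := Ideal.exists_minimalPrimes_le
      (show I ≤ RingHom.ker (evalZ z) from fun f hf => (hs z hz).2 f hf)
    rw [Finset.mem_biUnion]
    exact ⟨q, by simpa [P] using hq, Finset.mem_filter.2 ⟨hz, fun f hf => hqz hf⟩⟩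
  rw [Finset.sum_mul]
  refine (Finset.card_le_card hsub).trans (Finset.card_biUnion_le.trans
    (Finset.sum_le_sum fun q hq => hC q hq K hK _ fun z hz => ?_))
  rw [Finset.mem_filter] at hz
  exact ⟨(hs z hz.1).1, hz.2⟩

/-- The form with the roles of `x` and `y` exchanged. -/
def swapA (A : Fin n → Fin n → Fin n → Fin n → ℤ) : Fin n → Fin n → Fin n → Fin n → ℤ :=
  fun i j k l => A k l i j

theorem biForm_swapA (A : Fin n → Fin n → Fin n → Fin n → ℤ) (x y : Fin n → ℤ) :
    biForm (swapA A) x y = biForm A y x := by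
  simp only [biForm, swapA]
  calc _ = ∑ i, ∑ k, ∑ j, ∑ l, A k l i j * x i * x j * y k * y l :=
        Finset.sum_congr rfl fun _ _ => Finset.sum_comm
    _ = ∑ k, ∑ i, ∑ j, ∑ l, A k l i j * x i * x j * y k * y l := Finset.sum_comm
    _ = ∑ k, ∑ l, ∑ i, ∑ j, A k l i j * x i * x j * y k * y l :=
        Finset.sum_congr rfl fun k _ => by
          rw [Finset.sum_comm' (t' := Finset.univ) (s' := fun _ => Finset.univ) (by simp)]
          conv_rhs => rw [Finset.sum_comm]; enter [2, i]; rw [Finset.sum_comm]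
          rw [Finset.sum_comm]
    _ = _ := Finset.sum_congr rfl fun _ _ => Finset.sum_congr rfl fun _ _ =>
        Finset.sum_congr rfl fun _ _ => Finset.sum_congr rfl fun _ _ => by ring

theorem dX_swapA {k : Type*} [CommRing k] (A : Fin n → Fin n → Fin n → Fin n → ℤ) (x y : Fin n → k)
    (m : Fin n) : dX (swapA A) x y m = dY A y x m := by
  simp only [dX, dY, swapA]
  rw [Finset.sum_comm]
  refine Finset.sum_congr rfl fun i _ => ?_
  rw [Finset.sum_comm]
  exact Finset.sum_congr rfl fun _ _ => Finset.sum_congr rfl fun _ _ => by ring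

theorem dY_swapA {k : Type*} [CommRing k] (A : Fin n → Fin n → Fin n → Fin n → ℤ) (x y : Fin n → k)
    (m : Fin n) : dY (swapA A) x y m = dX A y x m := (dX_swapA (swapA A) y x m).symm

theorem SmoothBiquad.swapA {A : Fin n → Fin n → Fin n → Fin n → ℤ} (hA : SmoothBiquad A) :
    SmoothBiquad (swapA A) := fun x y hx hy h =>
  hA y x hy hx ⟨fun m => (dY_swapA A x y m).symm.trans (h.2 m),
    fun m => (dX_swapA A x y m).symm.trans (h.1 m)⟩

theorem SmoothBiquad.exists_card_triT_le {A : Fin n → Fin n → Fin n → Fin n → ℤ}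
    (hA : SmoothBiquad A) : ∃ C : ℕ, ∀ K : ℕ, 1 ≤ K →
      ∀ s : Finset ((Fin n → ℤ) × (Fin n → ℤ) × (Fin n → ℤ)), (∀ z ∈ s, (∀ i, |z.1 i| ≤ K) ∧
        (∀ i, |z.2.1 i| ≤ K) ∧ (∀ i, |z.2.2 i| ≤ K) ∧ ∀ m, triT A z.1 z.2.1 z.2.2 m = 0) →
      s.card ≤ C * K ^ (2 * n + 1) := by
  obtain ⟨C, hC⟩ := exists_card_zeros_le (2 * n + 1) (Ideal.span (Set.range fun m =>
    triT A (fun i => (.X (.inl i) : MvPolynomial (Fin n ⊕ Fin n ⊕ Fin n) ℂ))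
      (fun i => .X (.inr (.inl i))) (fun i => .X (.inr (.inr i))) m))
    (fun p hp hIp => hA.trdeg_triT_le p fun m => hIp (Ideal.subset_span ⟨m, rfl⟩))
  refine ⟨C, fun K hK s hs => ?_⟩
  let f : (Fin n → ℤ) × (Fin n → ℤ) × (Fin n → ℤ) → (Fin n ⊕ Fin n ⊕ Fin n → ℤ) :=
    fun z => Sum.elim z.1 (Sum.elim z.2.1 z.2.2)
  have hf : Function.Injective f := by
    rintro ⟨u, w, h⟩ ⟨u', w', h'⟩ e
    have h1 : u = u' := funext fun i => congrFun e (.inl i)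
    have h3 : w = w' := funext fun i => congrFun e (.inr (.inl i))
    have h4 : h = h' := funext fun i => congrFun e (.inr (.inr i))
    rw [h1, h3, h4]
  classical
  rw [← Finset.card_image_of_injective s hf]
  refine hC K hK _ fun z hz => ?_
  obtain ⟨⟨u, w, h⟩, hzs, rfl⟩ := Finset.mem_image.1 hz
  obtain ⟨h1, h2, h3, h4⟩ := hs _ hzs
  refine ⟨?_, ?_⟩
  · rintro (i | i | i)
    exacts [h1 i, h2 i, h3 i]
  · intro g hg
    have : Ideal.span (Set.range fun m =>
        triT A (fun i => (.X (.inl i) : MvPolynomial (Fin n ⊕ Fin n ⊕ Fin n) ℂ))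
        (fun i => .X (.inr (.inl i))) (fun i => .X (.inr (.inr i))) m) ≤
          RingHom.ker (evalZ (f (u, w, h))) := Ideal.span_le.2 (by
      rintro _ ⟨m, rfl⟩
      change evalZ _ _ = 0
      rw [map_triT]
      have := congrArg (Int.castRingHom ℂ) (h4 m)
      rw [map_triT, map_zero] at this
      simpa [evalZ, f] using this)
    exact this hg

/-- Twice the matrix of `F_x`. -/
def dblMat {k : Type*} [CommRing k] (A : Fin n → Fin n → Fin n → Fin n → ℤ) (x : Fin n → k) :
    Matrix (Fin n) (Fin n) k :=
  Matrix.of fun m l => ∑ i, ∑ j, ((A i j m l + A i j l m : ℤ) : k) * x i * x j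

theorem dblMat_mulVec {k : Type*} [CommRing k] (A : Fin n → Fin n → Fin n → Fin n → ℤ)
    (x y : Fin n → k) (m : Fin n) : (dblMat A x).mulVec y m = dY A x y m := by
  simp only [Matrix.mulVec, dotProduct, dblMat, Matrix.of_apply, dY, Finset.sum_mul]
  rw [Finset.sum_comm]
  exact Finset.sum_congr rfl fun i _ => Finset.sum_comm

/-- Differentiating a kernel vector of `M(x)` along a coordinate. -/
theorem two_mul_dX_eq_zero {k R : Type*} [CommRing k] [CommRing R] [Algebra k R]
    (D : Derivation k R R) (A : Fin n → Fin n → Fin n → Fin n → ℤ) (X y : Fin n → R) (m : Fin n)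
    (hDX : ∀ i, D (X i) = if i = m then 1 else 0) (hY : ∀ m, dY A X y m = 0) :
    2 * dX A X y m = 0 := by
  have h1 : ∑ k, y k * D (dY A X y k) = 0 := Finset.sum_eq_zero fun k _ => by
    rw [hY, map_zero, mul_zero]
  have h2 : ∀ k, D (dY A X y k) =
      (∑ j, ∑ l, ((A m j k l + A m j l k : ℤ) : R) * X j * y l) +
      (∑ j, ∑ l, ((A j m k l + A j m l k : ℤ) : R) * X j * y l) +
      dY A X (fun l => D (y l)) k := by
    intro k
    have e : ∀ i j l, D (((A i j k l + A i j l k : ℤ) : R) * X i * X j * y l) =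
        (if i = m then ((A i j k l + A i j l k : ℤ) : R) * X j * y l else 0) +
        (if j = m then ((A i j k l + A i j l k : ℤ) : R) * X i * y l else 0) +
        ((A i j k l + A i j l k : ℤ) : R) * X i * X j * D (y l) := by
      intro i j l
      simp only [Derivation.leibniz, hDX, Derivation.map_intCast, smul_eq_mul]
      split_ifs <;> ring
    simp only [dY, map_sum, e, Finset.sum_add_distrib]
    congr 2
    · rw [Finset.sum_eq_single m (fun i _ hi => by simp [hi]) (by simp)]
      simp
    · refine Finset.sum_congr rfl fun i _ => ?_
      rw [Finset.sum_eq_single m (fun i _ hi => by simp [hi]) (by simp)]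
      simp
  have h3 : ∑ k, y k * dY A X (fun l => D (y l)) k = ∑ k, D (y k) * dY A X y k := by
    simp only [← dblMat_mulVec, Matrix.mulVec, dotProduct, Finset.mul_sum]
    rw [Finset.sum_comm]
    refine Finset.sum_congr rfl fun k _ => Finset.sum_congr rfl fun l _ => ?_
    have : dblMat A X l k = dblMat A X k l := by simp [dblMat, add_comm]
    rw [this]; ring
  have h5 : ∀ (a : Fin n → Fin n → Fin n → ℤ),
      ∑ k, y k * ∑ j, ∑ l, ((a j k l + a j l k : ℤ) : R) * X j * y l =
        2 * ∑ j, ∑ k, ∑ l, (a j k l : R) * X j * y k * y l := by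
    intro a
    simp only [Finset.mul_sum]
    rw [Finset.sum_comm]
    refine Finset.sum_congr rfl fun j _ => ?_
    have : ∑ k, ∑ l, (a j l k : R) * X j * y k * y l =
        ∑ k, ∑ l, (a j k l : R) * X j * y k * y l := by
      rw [Finset.sum_comm]
      exact Finset.sum_congr rfl fun _ _ => Finset.sum_congr rfl fun _ _ => by ring
    simp only [← Finset.mul_sum]
    rw [two_mul]
    nth_rewrite 2 [← this]
    simp only [← Finset.sum_add_distrib, Finset.mul_sum]
    exact Finset.sum_congr rfl fun _ _ => Finset.sum_congr rfl fun _ _ => by push_cast; ring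
  have h4 : ∑ k, y k * D (dY A X y k) = 2 * dX A X y m := by
    have e : ∀ k, y k * D (dY A X y k) =
        y k * (∑ j, ∑ l, ((A m j k l + A m j l k : ℤ) : R) * X j * y l) +
        y k * (∑ j, ∑ l, ((A j m k l + A j m l k : ℤ) : R) * X j * y l) +
        y k * dY A X (fun l => D (y l)) k := fun k => by rw [h2, mul_add, mul_add]
    have e0 : ∑ k, D (y k) * dY A X y k = 0 := Finset.sum_eq_zero fun k _ => by
      rw [hY, mul_zero]
    rw [Finset.sum_congr rfl fun k _ => e k, Finset.sum_add_distrib, Finset.sum_add_distrib, h3, e0,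
      h5 fun j k l => A m j k l, h5 fun j k l => A j m k l, add_zero, ← mul_add, dX]
    simp only [← Finset.sum_add_distrib]
    congr 1
    exact Finset.sum_congr rfl fun _ _ => Finset.sum_congr rfl fun _ _ =>
      Finset.sum_congr rfl fun _ _ => by push_cast; ring
  rw [← h4, h1]

theorem SmoothBiquad.det_dblMat_ne_zero {A : Fin n → Fin n → Fin n → Fin n → ℤ}
    (hA : SmoothBiquad A) : (dblMat A (.X : Fin n → MvPolynomial (Fin n) ℂ)).det ≠ 0 := by
  intro h0
  obtain ⟨y, hy0, hy⟩ := Matrix.exists_mulVec_eq_zero_iff.2 h0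
  set X : Fin n → MvPolynomial (Fin n) ℂ := .X
  have hY : ∀ m, dY A X y m = 0 := fun m => by rw [← dblMat_mulVec, hy]; rfl
  have hXm : ∀ m, dX A X y m = 0 := by
    intro m
    let D := MvPolynomial.pderiv (R := ℂ) (σ := Fin n) m
    have hDX : ∀ i, D (X i) = if i = m then 1 else 0 := fun i => by
      simp [D, X, MvPolynomial.pderiv_X, Pi.single_apply, eq_comm]
    have h1 := two_mul_dX_eq_zero D A X y m hDX hY
    exact (mul_eq_zero.1 h1).resolve_left two_ne_zero
  let ψ := algebraMap (MvPolynomial (Fin n) ℂ) (FractionRing (MvPolynomial (Fin n) ℂ))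
  have hψ : Function.Injective ψ := IsFractionRing.injective _ _
  obtain ⟨i, hi⟩ := Function.ne_iff.1 hy0
  rcases hA.eq_zero_or (ψ.comp MvPolynomial.C) (fun i => ψ (X i)) (fun i => ψ (y i))
    (fun m => by rw [← map_dX, hXm, map_zero]) (fun m => by rw [← map_dY, hY, map_zero]) with h | h
  · have := congrFun h i
    exact MvPolynomial.X_ne_zero i (hψ (this.trans (map_zero ψ).symm))
  · have := congrFun h i
    exact hi (hψ (this.trans (map_zero ψ).symm))

theorem detFx_eq (A : Fin n → Fin n → Fin n → Fin n → ℤ) (x : Fin n → ℤ) :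
    detFx A x = (dblMat A x).det / 2 ^ n := by
  have : matFx A (fun i => (x i : ℚ)) = (1 / 2 : ℚ) • (dblMat A x).map (Int.castRingHom ℚ) := by
    ext k l
    simp [matFx, dblMat, div_eq_inv_mul]
  rw [detFx, this, Matrix.det_smul, ← RingHom.mapMatrix_apply, ← RingHom.map_det]
  simp [div_eq_inv_mul]

theorem map_det_dblMat {k k' : Type*} [CommRing k] [CommRing k'] (g : k →+* k')
    (A : Fin n → Fin n → Fin n → Fin n → ℤ) (x : Fin n → k) :
    g (dblMat A x).det = (dblMat A fun i => g (x i)).det := by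
  rw [RingHom.map_det]
  congr 1
  ext m l
  simp [dblMat]

theorem SmoothBiquad.exists_card_detFx_eq_zero_le {A : Fin n → Fin n → Fin n → Fin n → ℤ}
    (hA : SmoothBiquad A) (hn : 0 < n) : ∃ C : ℕ, ∀ K : ℕ, 1 ≤ K → ∀ s : Finset (Fin n → ℤ),
      (∀ x ∈ s, (∀ i, |x i| ≤ K) ∧ detFx A x = 0) → s.card ≤ C * K ^ (n - 1) := by
  obtain ⟨C, hC⟩ := exists_card_zeros_le (n - 1)
    (Ideal.span {(dblMat A (.X : Fin n → MvPolynomial (Fin n) ℂ)).det}) (by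
      intro p hp hIp
      have hlt : ⊥ < p := bot_lt_iff_ne_bot.2 fun h => hA.det_dblMat_ne_zero (by
        rw [h] at hIp
        exact hIp (Ideal.mem_span_singleton_self _))
      have hbot : (⊥ : Ideal (MvPolynomial (Fin n) ℂ)).IsPrime := Ideal.isPrime_bot
      have h1 : Algebra.trdeg ℂ (MvPolynomial (Fin n) ℂ ⧸ (⊥ : Ideal (MvPolynomial (Fin n) ℂ))) ≤
          (n - 1 : ℕ) + 1 := by
        refine (trdeg_quotient_le ⊥ (Set.range fun i => genPt ⊥ (.X i)) fun i =>
          isAlgebraic_algebraMap (⟨_, Algebra.subset_adjoin ⟨i, rfl⟩⟩ : Algebra.adjoin ℂ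
            (Set.range fun i => genPt (⊥ : Ideal (MvPolynomial (Fin n) ℂ)) (.X i)))).trans ?_
        refine (Cardinal.mk_range_le).trans ?_
        rw [Cardinal.mk_fin]
        exact_mod_cast (by omega : n ≤ n - 1 + 1)
      exact Cardinal.add_one_le_add_one_iff.1 ((trdeg_quotient_add_one_le hlt).trans h1))
  refine ⟨C, fun K hK s hs => hC K hK s fun x hx => ⟨(hs x hx).1, fun f hf => ?_⟩⟩
  have : Ideal.span {(dblMat A (.X : Fin n → MvPolynomial (Fin n) ℂ)).det} ≤
      RingHom.ker (evalZ x) := (Ideal.span_singleton_le_iff_mem _).2 (by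
    change evalZ x _ = 0
    rw [map_det_dblMat]
    have h0 : (dblMat A x).det = 0 := by
      have := (hs x hx).2
      rw [detFx_eq, div_eq_zero_iff] at this
      exact_mod_cast this.resolve_right (by positivity)
    have := congrArg (Int.castRingHom ℂ) h0
    rw [map_det_dblMat, map_zero] at this
    simpa [evalZ] using this)
  exact this hf

end

section

/-! ### Minor arc estimates -/

variable {n : ℕ} {A : Fin n → Fin n → Fin n → Fin n → ℤ}

open Classical in
/-- The indicator function of vectors all of whose entries are within `e` of an integer. -/
def nearI (e : ℝ) (t : Fin n → ℝ) : ℝ := if ∀ i, |t i - round (t i)| ≤ e then 1 else 0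

theorem nearI_nonneg (e : ℝ) (t : Fin n → ℝ) : 0 ≤ nearI e t := by
  unfold nearI; split_ifs <;> norm_num

theorem nearI_mul_le {e : ℝ} {s t u : Fin n → ℝ} (hu : ∀ i, u i = 2 * s i - 2 * t i) :
    nearI e s * nearI e t ≤ nearI (4 * e) u := by
  unfold nearI
  split_ifs with h1 h2 h3 <;> norm_num
  refine h3 fun i => ?_
  refine (round_le (u i) (2 * round (s i) - 2 * round (t i))).trans ?_
  have h4 := abs_le.1 (h1 i)
  have h5 := abs_le.1 (h2 i)
  rw [hu i, abs_le]
  push_cast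
  constructor <;> linarith

theorem sum_nearI (s : Finset (Fin n → ℤ)) (e : ℝ) (f : (Fin n → ℤ) → Fin n → ℝ) :
    ∑ u ∈ s, nearI e (f u) =
      ((@Finset.filter _ (fun u => ∀ i, |f u i - round (f u i)| ≤ e)
        (fun _ => Classical.propDecidable _) s).card : ℝ) := by
  classical
  simp only [nearI]
  rw [Finset.sum_ite, Finset.sum_const_zero, add_zero, Finset.sum_const, nsmul_eq_mul, mul_one]
  congr!

theorem latN_le_sum_nearI (L : Matrix (Fin n) (Fin n) ℝ) (K : ℕ) {e : ℝ} (he : e ≤ 1) :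
    (latN L K e : ℝ) ≤ 3 ^ n * ∑ u ∈ ibox n K, nearI e (L.mulVec fun j => (u j : ℝ)) := by
  classical
  rw [sum_nearI, latN, Set.ncard_eq_toFinset_card _ (latSet_finite L K e)]
  set t : (Fin n → ℤ) → Fin n → ℝ := fun u => L.mulVec fun j => (u j : ℝ) with ht
  have h1 : (ibox n 1).card = 3 ^ n := by simp [ibox]
  have := Finset.card_le_card_of_injOn (s := (latSet_finite L K e).toFinset)
    (t := ((ibox n K).filter fun u => ∀ i, |t u i - round (t u i)| ≤ e) ×ˢ ibox n 1)
    (fun p => (p.1, fun i => p.2 i + round (t p.1 i))) ?_ ?_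
  · rw [Finset.card_product, h1] at this
    rw [mul_comm]
    refine (Nat.cast_le.2 this).trans (le_of_eq ?_)
    push_cast
    congr!
  · intro p hp
    rw [Set.Finite.coe_toFinset] at hp
    have h2 : ∀ i, |t p.1 i + p.2 i| ≤ e := hp.2
    have h3 : ∀ i, |t p.1 i - round (t p.1 i)| ≤ e := fun i => by
      refine (round_le _ (-p.2 i)).trans ?_
      push_cast
      rw [sub_neg_eq_add]
      exact h2 i
    refine Finset.mem_coe.2 (Finset.mem_product.2 ⟨Finset.mem_filter.2 ⟨mem_ibox.2 fun i => ?_, h3⟩,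
      mem_ibox.2 fun i => ?_⟩)
    · have := hp.1 i
      exact_mod_cast this
    · have a1 := abs_sub_round (t p.1 i)
      have a2 := (h2 i).trans he
      have : |((p.2 i + round (t p.1 i) : ℤ) : ℝ)| < 2 := by
        push_cast
        rw [abs_le] at a1 a2
        rw [abs_lt]
        constructor <;> linarith [a1.1, a1.2, a2.1, a2.2]
      have : |p.2 i + round (t p.1 i)| < 2 := by exact_mod_cast this
      show |p.2 i + round (t p.1 i)| ≤ 1
      omega
  · rintro ⟨u, v⟩ - ⟨u', v'⟩ - h
    simp only [Prod.mk.injEq] at h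
    obtain ⟨rfl, h⟩ := h
    refine Prod.ext rfl (funext fun i => ?_)
    simpa using congrFun h i

theorem sum_nearI_le_latN (L : Matrix (Fin n) (Fin n) ℝ) (K : ℕ) (e : ℝ) :
    ∑ u ∈ ibox n K, nearI e (L.mulVec fun j => (u j : ℝ)) ≤ latN L K e := by
  classical
  rw [sum_nearI, latN, Set.ncard_eq_toFinset_card _ (latSet_finite L K e), Nat.cast_le]
  refine Finset.card_le_card_of_injOn
    (fun u => (u, fun i => -round (L.mulVec (fun j => (u j : ℝ)) i))) ?_ ?_
  · intro u hu
    rw [Set.Finite.coe_toFinset]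
    obtain ⟨h1, h2⟩ := (@Finset.mem_filter _ _ (fun _ => Classical.propDecidable _) _ _).1
      (Finset.mem_coe.1 hu)
    refine ⟨fun i => ?_, fun i => ?_⟩
    · exact_mod_cast mem_ibox.1 h1 i
    · have := h2 i
      push_cast
      rw [← sub_eq_add_neg]
      exact this
  · intro u _ u' _ h
    exact (Prod.ext_iff.1 h).1

theorem exists_sum_nearI_shrink (n : ℕ) : ∃ C : ℝ, 1 ≤ C ∧
    ∀ (L : Matrix (Fin n) (Fin n) ℝ) (K X : ℕ) (e : ℝ), 1 ≤ K → K ≤ X → 0 < e → K * e ≤ 1 →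
    ∑ u ∈ ibox n X, nearI e (L.mulVec fun j => (u j : ℝ)) ≤ C * ((X : ℝ) / K) ^ n *
      (∑ u ∈ ibox n K, nearI (K * e / X) (L.mulVec fun j => (u j : ℝ)) +
        ∑ u ∈ ibox n K, nearI (K * e / X) (L.transpose.mulVec fun j => (u j : ℝ))) := by
  obtain ⟨C, hC, h⟩ := exists_latN_le_shrink n
  refine ⟨C * 3 ^ n, ?_, fun L K X e hK hKX he hKe => ?_⟩
  · have : (1 : ℝ) ≤ 3 ^ n := one_le_pow₀ (by norm_num)
    nlinarith
  have hX : (1 : ℝ) ≤ X := by exact_mod_cast hK.trans hKX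
  have he' : (K : ℝ) * e / X ≤ 1 := by rw [div_le_one (by linarith)]; linarith
  refine (sum_nearI_le_latN L X e).trans ((h L X e K (by exact_mod_cast hK)
    (by exact_mod_cast hKX) he hKe).trans ?_)
  have h1 := latN_le_sum_nearI L K he'
  have h2 := latN_le_sum_nearI L.transpose K he'
  rw [mul_assoc, mul_assoc C, mul_assoc C]
  refine mul_le_mul_of_nonneg_left ?_ (by linarith)
  calc _ ≤ ((X : ℝ) / K) ^ n * (3 ^ n * _ + 3 ^ n * _) :=
        mul_le_mul_of_nonneg_left (add_le_add h1 h2) (by positivity)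
    _ = _ := by ring

theorem scaled_mulVec (M : Matrix (Fin n) (Fin n) ℤ) (α : ℝ) (u : Fin n → ℤ) :
    (Matrix.of fun l k => α * (M l k : ℝ)).mulVec (fun j => (u j : ℝ)) =
      fun m => α * ((M.mulVec u m : ℤ) : ℝ) := by
  ext m
  simp only [Matrix.mulVec, dotProduct, Matrix.of_apply, Int.cast_sum, Int.cast_mul,
    Finset.mul_sum, mul_assoc]

theorem exists_sum_nearI_shrink_int (n : ℕ) : ∃ C : ℝ, 1 ≤ C ∧
    ∀ (M : Matrix (Fin n) (Fin n) ℤ) (α : ℝ) (K X : ℕ) (e : ℝ), 1 ≤ K → K ≤ X → 0 < e →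
    K * e ≤ 1 → ∑ u ∈ ibox n X, nearI e (fun m => α * ((M.mulVec u m : ℤ) : ℝ)) ≤
      C * ((X : ℝ) / K) ^ n *
      (∑ u ∈ ibox n K, nearI (K * e / X) (fun m => α * ((M.mulVec u m : ℤ) : ℝ)) +
        ∑ u ∈ ibox n K, nearI (K * e / X) (fun m => α * ((M.transpose.mulVec u m : ℤ) : ℝ))) := by
  obtain ⟨C, hC, h⟩ := exists_sum_nearI_shrink n
  refine ⟨C, hC, fun M α K X e h1 h2 h3 h4 => ?_⟩
  have h5 : (Matrix.of fun l k => α * (M l k : ℝ)).transpose =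
    Matrix.of fun l k => α * (M.transpose l k : ℝ) := rfl
  have := h (Matrix.of fun l k => α * (M l k : ℝ)) K X e h1 h2 h3 h4
  rw [h5] at this
  simpa only [scaled_mulVec] using this

theorem triT_comm (A : Fin n → Fin n → Fin n → Fin n → ℤ) (u w h : Fin n → ℤ) (m : Fin n) :
    triT A u w h m = triT A w u h m := by
  unfold triT
  rw [Finset.sum_comm]
  refine Finset.sum_congr rfl fun _ _ => Finset.sum_congr rfl fun _ _ =>
    Finset.sum_congr rfl fun _ _ => ?_
  push_cast
  ring

theorem triT_sub_add (A : Fin n → Fin n → Fin n → Fin n → ℤ) (x x' h : Fin n → ℤ) (m : Fin n) :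
    triT A (x - x') (x + x') h m = 2 * dY A x h m - 2 * dY A x' h m := by
  have h1 := triT_comm A x x' h m
  rw [← triT_self, ← triT_self]
  have : triT A (x - x') (x + x') h m =
      triT A x x h m + triT A x x' h m - triT A x' x h m - triT A x' x' h m := by
    simp only [triT, ← Finset.sum_add_distrib, ← Finset.sum_sub_distrib, Pi.sub_apply, Pi.add_apply]
    refine Finset.sum_congr rfl fun _ _ => Finset.sum_congr rfl fun _ _ =>
      Finset.sum_congr rfl fun _ _ => ?_
    ring
  rw [this, h1]
  ring

/-- The matrix of `triT A · w h`. -/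
def matT (A : Fin n → Fin n → Fin n → Fin n → ℤ) (w h : Fin n → ℤ) : Matrix (Fin n) (Fin n) ℤ :=
  Matrix.of fun m i => ∑ j, ∑ l, (A i j m l + A j i m l + A i j l m + A j i l m) * w j * h l

/-- The matrix of `triT A s h ·`. -/
def matS (A : Fin n → Fin n → Fin n → Fin n → ℤ) (s h : Fin n → ℤ) : Matrix (Fin n) (Fin n) ℤ :=
  Matrix.of fun m l => ∑ i, ∑ j, (A i j m l + A j i m l + A i j l m + A j i l m) * s i * h j

theorem matT_mulVec (A : Fin n → Fin n → Fin n → Fin n → ℤ) (u w h : Fin n → ℤ) :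
    (matT A w h).mulVec u = triT A u w h := by
  ext m
  simp only [matT, Matrix.mulVec, dotProduct, Matrix.of_apply, triT, Finset.sum_mul, Int.cast_id]
  refine Finset.sum_congr rfl fun _ _ => Finset.sum_congr rfl fun _ _ =>
    Finset.sum_congr rfl fun _ _ => ?_
  ring

theorem matT_transpose_mulVec (A : Fin n → Fin n → Fin n → Fin n → ℤ) (s w h : Fin n → ℤ) :
    (matT A w h).transpose.mulVec s = triT (swapA A) s h w := by
  ext i
  simp only [matT, Matrix.mulVec, dotProduct, Matrix.of_apply, Matrix.transpose_apply, triT,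
    Finset.sum_mul, Int.cast_id, swapA]
  refine Finset.sum_congr rfl fun _ _ => ?_
  rw [Finset.sum_comm]
  refine Finset.sum_congr rfl fun _ _ => Finset.sum_congr rfl fun _ _ => ?_
  ring

theorem matS_mulVec (A : Fin n → Fin n → Fin n → Fin n → ℤ) (s h w : Fin n → ℤ) :
    (matS A s h).mulVec w = triT A s h w := by
  ext m
  simp only [matS, Matrix.mulVec, dotProduct, Matrix.of_apply, triT, Finset.sum_mul, Int.cast_id]
  rw [Finset.sum_comm]
  refine Finset.sum_congr rfl fun _ _ => ?_
  rw [Finset.sum_comm]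

theorem matS_transpose (A : Fin n → Fin n → Fin n → Fin n → ℤ) (s h : Fin n → ℤ) :
    (matS A s h).transpose = matS A s h := by
  ext m l
  simp only [matS, Matrix.transpose_apply, Matrix.of_apply]
  refine Finset.sum_congr rfl fun _ _ => Finset.sum_congr rfl fun _ _ => ?_
  ring

/-- The number of `u, w, h` of height at most `K` with `α • triT A u w h` within `e` of an integer
vector. -/
def triN (A : Fin n → Fin n → Fin n → Fin n → ℤ) (α : ℝ) (K : ℕ) (e : ℝ) : ℝ :=
  ∑ u ∈ ibox n K, ∑ w ∈ ibox n K, ∑ h ∈ ibox n K,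
    nearI e (fun m => α * ((triT A u w h m : ℤ) : ℝ))

theorem triN_nonneg (A : Fin n → Fin n → Fin n → Fin n → ℤ) (α : ℝ) (K : ℕ) (e : ℝ) :
    0 ≤ triN A α K e :=
  Finset.sum_nonneg fun _ _ => Finset.sum_nonneg fun _ _ => Finset.sum_nonneg fun _ _ =>
    nearI_nonneg _ _

theorem exists_sum_triT_shrink (n : ℕ) : ∃ C : ℝ, 1 ≤ C ∧
    ∀ (A : Fin n → Fin n → Fin n → Fin n → ℤ) (α : ℝ) (K X : ℕ) (e : ℝ), 1 ≤ K → K ≤ X → 0 < e →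
    K * e ≤ 1 → ∑ h ∈ ibox n K, ∑ w ∈ ibox n X, ∑ u ∈ ibox n X,
        nearI e (fun m => α * ((triT A u w h m : ℤ) : ℝ)) ≤ C * ((X : ℝ) / K) ^ (2 * n) *
      (triN A α K (K * (K * e / X) / X) + triN (swapA A) α K (K * (K * e / X) / X)) := by
  obtain ⟨C, hC, hs⟩ := exists_sum_nearI_shrink_int n
  refine ⟨3 * C ^ 2, by nlinarith, fun A α K X e h1 h2 h3 h4 => ?_⟩
  have hK : (1 : ℝ) ≤ K := by exact_mod_cast h1
  have hX : (K : ℝ) ≤ X := by exact_mod_cast h2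
  set e1 := (K : ℝ) * e / X with he1
  have hX0 : (0 : ℝ) < X := by linarith
  have he1' : 0 < e1 := by positivity
  have he1'' : K * e1 ≤ 1 := by
    have : e1 ≤ e := by
      rw [he1, div_le_iff₀ (by linarith)]
      nlinarith
    nlinarith
  set e2 := (K : ℝ) * e1 / X with he2
  set r := C * ((X : ℝ) / K) ^ n with hr
  have hr0 : 0 ≤ r := by positivity
  have s1 : ∀ w h, ∑ u ∈ ibox n X, nearI e (fun m => α * ((triT A u w h m : ℤ) : ℝ)) ≤
      r * (∑ u ∈ ibox n K, nearI e1 (fun m => α * ((triT A u w h m : ℤ) : ℝ)) +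
        ∑ s ∈ ibox n K, nearI e1 (fun m => α * ((triT (swapA A) s h w m : ℤ) : ℝ))) := by
    intro w h
    have := hs (matT A w h) α K X e h1 h2 h3 h4
    simpa only [matT_mulVec, matT_transpose_mulVec] using this
  have s2 : ∀ u h, ∑ w ∈ ibox n X, nearI e1 (fun m => α * ((triT A u w h m : ℤ) : ℝ)) ≤
      r * (∑ w ∈ ibox n K, nearI e2 (fun m => α * ((triT A u w h m : ℤ) : ℝ)) +
        ∑ s ∈ ibox n K, nearI e2 (fun m => α * ((triT (swapA A) s h u m : ℤ) : ℝ))) := by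
    intro u h
    have := hs (matT A u h) α K X e1 h1 h2 he1' he1''
    simp only [matT_mulVec, matT_transpose_mulVec] at this
    simpa only [triT_comm A u] using this
  have s3 : ∀ s h, ∑ w ∈ ibox n X, nearI e1 (fun m => α * ((triT (swapA A) s h w m : ℤ) : ℝ)) ≤
      r * (2 * ∑ w ∈ ibox n K, nearI e2 (fun m => α * ((triT (swapA A) s h w m : ℤ) : ℝ))) := by
    intro s h
    have := hs (matS (swapA A) s h) α K X e1 h1 h2 he1' he1''
    rw [matS_transpose] at this
    simpa only [matS_mulVec, ← two_mul] using this
  have t1 : ∑ h ∈ ibox n K, ∑ w ∈ ibox n X, ∑ u ∈ ibox n K,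
      nearI e1 (fun m => α * ((triT A u w h m : ℤ) : ℝ)) ≤
      r * (triN A α K e2 + triN (swapA A) α K e2) := by
    have a1 : triN A α K e2 = ∑ h ∈ ibox n K, ∑ u ∈ ibox n K, ∑ w ∈ ibox n K,
        nearI e2 (fun m => α * ((triT A u w h m : ℤ) : ℝ)) := by
      rw [Finset.sum_comm]
      exact Finset.sum_congr rfl fun _ _ => Finset.sum_comm
    have a2 : triN (swapA A) α K e2 = ∑ h ∈ ibox n K, ∑ u ∈ ibox n K, ∑ s ∈ ibox n K,
        nearI e2 (fun m => α * ((triT (swapA A) s h u m : ℤ) : ℝ)) := by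
      unfold triN
      rw [Finset.sum_comm]
      exact Finset.sum_congr rfl fun _ _ => Finset.sum_comm
    rw [a1, a2, ← Finset.sum_add_distrib, Finset.mul_sum]
    refine Finset.sum_le_sum fun h _ => ?_
    rw [Finset.sum_comm, ← Finset.sum_add_distrib, Finset.mul_sum]
    exact Finset.sum_le_sum fun u _ => s2 u h
  have t2 : ∑ h ∈ ibox n K, ∑ w ∈ ibox n X, ∑ s ∈ ibox n K,
      nearI e1 (fun m => α * ((triT (swapA A) s h w m : ℤ) : ℝ)) ≤
      r * (2 * triN (swapA A) α K e2) := by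
    unfold triN
    rw [Finset.sum_comm (s := ibox n K) (t := ibox n K), Finset.mul_sum, Finset.mul_sum]
    refine Finset.sum_le_sum fun h _ => ?_
    rw [Finset.sum_comm, Finset.mul_sum, Finset.mul_sum]
    exact Finset.sum_le_sum fun s _ => s3 s h
  have t3 : ∑ h ∈ ibox n K, ∑ w ∈ ibox n X, ∑ u ∈ ibox n X,
      nearI e (fun m => α * ((triT A u w h m : ℤ) : ℝ)) ≤
      r * (r * (triN A α K e2 + triN (swapA A) α K e2) + r * (2 * triN (swapA A) α K e2)) := by
    refine le_trans ?_ (mul_le_mul_of_nonneg_left (add_le_add t1 t2) hr0)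
    rw [← Finset.sum_add_distrib, Finset.mul_sum]
    refine Finset.sum_le_sum fun h _ => ?_
    rw [← Finset.sum_add_distrib, Finset.mul_sum]
    exact Finset.sum_le_sum fun w _ => s1 w h
  have p1 := triN_nonneg A α K e2
  have p2 := triN_nonneg (swapA A) α K e2
  have hr2 : r ^ 2 = C ^ 2 * ((X : ℝ) / K) ^ (2 * n) := by rw [hr, mul_pow, ← pow_mul, mul_comm 2]
  calc _ ≤ _ := t3
    _ = r ^ 2 * (triN A α K e2 + 3 * triN (swapA A) α K e2) := by ring
    _ ≤ r ^ 2 * (3 * (triN A α K e2 + triN (swapA A) α K e2)) :=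
      mul_le_mul_of_nonneg_left (by linarith) (by positivity)
    _ = _ := by rw [hr2]; ring

theorem exists_abs_triT_le (A : Fin n → Fin n → Fin n → Fin n → ℤ) : ∃ C : ℕ, 1 ≤ C ∧
    ∀ (K : ℤ) (u w h : Fin n → ℤ), (∀ i, |u i| ≤ K) → (∀ i, |w i| ≤ K) → (∀ i, |h i| ≤ K) →
    ∀ m, |triT A u w h m| ≤ C * K ^ 3 := by
  set S : ℤ := ∑ m, ∑ i, ∑ j, ∑ l, |A i j m l + A j i m l + A i j l m + A j i l m| with hS
  have hn : ∀ m, 0 ≤ ∑ i, ∑ j, ∑ l, |A i j m l + A j i m l + A i j l m + A j i l m| := fun m =>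
    Finset.sum_nonneg fun _ _ => Finset.sum_nonneg fun _ _ => Finset.sum_nonneg fun _ _ =>
      abs_nonneg _
  have hS0 : 0 ≤ S := Finset.sum_nonneg fun m _ => hn m
  obtain ⟨N, hN⟩ := Int.eq_ofNat_of_zero_le hS0
  refine ⟨N + 1, Nat.le_add_left 1 _, fun K u w h hu hw hh m => ?_⟩
  have hK : 0 ≤ K := (abs_nonneg _).trans (hu m)
  push_cast
  have h1 : |triT A u w h m| ≤
      (∑ i, ∑ j, ∑ l, |A i j m l + A j i m l + A i j l m + A j i l m|) * K ^ 3 := by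
    simp only [triT, Finset.sum_mul]
    refine (Finset.abs_sum_le_sum_abs _ _).trans (Finset.sum_le_sum fun i _ => ?_)
    refine (Finset.abs_sum_le_sum_abs _ _).trans (Finset.sum_le_sum fun j _ => ?_)
    refine (Finset.abs_sum_le_sum_abs _ _).trans (Finset.sum_le_sum fun l _ => ?_)
    rw [abs_mul, abs_mul, abs_mul, mul_assoc, mul_assoc, Int.cast_id]
    refine mul_le_mul_of_nonneg_left ?_ (abs_nonneg _)
    calc |u i| * (|w j| * |h l|) ≤ K * (K * K) := by gcongr <;> simp_all
      _ = K ^ 3 := by ring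
  refine h1.trans (mul_le_mul_of_nonneg_right ?_ (by positivity))
  have : (∑ i, ∑ j, ∑ l, |A i j m l + A j i m l + A i j l m + A j i l m|) ≤ S :=
    Finset.single_le_sum (f := fun m => ∑ i, ∑ j, ∑ l, |A i j m l + A j i m l + A i j l m + A j i l m|)
      (fun m _ => hn m) (Finset.mem_univ m)
  rw [hN] at this
  linarith

theorem natAbs_mul_sub_round_le (t : ℤ) (α : ℝ) :
    |(t.natAbs : ℝ) * α - round ((t.natAbs : ℝ) * α)| ≤ |α * t - round (α * t)| := by
  have h : ((t.natAbs : ℝ)) = |(t : ℝ)| := by rw [← Int.cast_abs, Int.abs_eq_natAbs]; simp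
  rw [h]
  rcases abs_cases (t : ℝ) with ⟨h', -⟩ | ⟨h', -⟩ <;> rw [h']
  · rw [mul_comm]
  · refine (round_le _ (-round (α * t))).trans (le_of_eq ?_)
    rw [← abs_neg]
    congr 1
    push_cast
    ring

/-- If `α` is not close to a rational of small denominator, then `triN` counts only zeros. -/
theorem SmoothBiquad.exists_triN_le (hA : SmoothBiquad A) :
    ∃ C : ℕ, 1 ≤ C ∧ ∀ (α : ℝ) (K : ℕ) (e : ℝ), 1 ≤ K →
    (∀ q : ℕ, 1 ≤ q → q ≤ C * K ^ 3 → e < |q * α - round (q * α)|) →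
    triN A α K e ≤ C * (K : ℝ) ^ (2 * n + 1) := by
  classical
  obtain ⟨C1, hC1, h1⟩ := exists_abs_triT_le A
  obtain ⟨C2, h2⟩ := hA.exists_card_triT_le
  refine ⟨C1 + C2, by omega, fun α K e hK hq => ?_⟩
  set s := (ibox n K ×ˢ ibox n K ×ˢ ibox n K).filter fun z => triT A z.1 z.2.1 z.2.2 = 0 with hs
  have h3 := h2 K hK s ?_
  swap
  · intro z hz
    simp only [hs, Finset.mem_filter, Finset.mem_product, mem_ibox] at hz
    exact ⟨hz.1.1, hz.1.2.1, hz.1.2.2, fun m => congrFun hz.2 m⟩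
  have h4 : triN A α K e ≤ s.card := by
    unfold triN
    rw [hs, Finset.card_filter, Finset.sum_product]
    push_cast
    refine Finset.sum_le_sum fun u hu => ?_
    rw [Finset.sum_product]
    refine Finset.sum_le_sum fun w hw => Finset.sum_le_sum fun h hh => ?_
    unfold nearI
    split_ifs with a1 a2 a2 <;> norm_num
    refine a2 (funext fun m => ?_)
    by_contra h0
    have b1 := h1 K u w h (mem_ibox.1 hu) (mem_ibox.1 hw) (mem_ibox.1 hh) m
    have b2 : (triT A u w h m).natAbs ≤ (C1 + C2) * K ^ 3 := by
      zify
      refine b1.trans ?_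
      have : (0 : ℤ) ≤ C2 * K ^ 3 := by positivity
      linarith
    have b3 := hq _ (Nat.one_le_iff_ne_zero.2 (Int.natAbs_ne_zero.2 h0)) b2
    have b4 := a1 m
    exact absurd b4 (not_le.2 (b3.trans_le (natAbs_mul_sub_round_le _ _)))
  refine h4.trans ?_
  have : (s.card : ℝ) ≤ C2 * (K : ℝ) ^ (2 * n + 1) := by exact_mod_cast h3
  refine this.trans (mul_le_mul_of_nonneg_right ?_ (by positivity))
  push_cast
  linarith [(Nat.cast_nonneg C1 : (0 : ℝ) ≤ C1)]

theorem matQR_mulVec (A : Fin n → Fin n → Fin n → Fin n → ℤ) (α : ℝ) (x h : Fin n → ℤ) :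
    (matQR A α x).mulVec (fun j => (h j : ℝ)) = fun m => α * ((dY A x h m : ℤ) : ℝ) := by
  rw [matQR, scaled_mulVec]
  have : (matQ A x).mulVec h = dY A x h := by
    ext m
    simp only [matQ, Matrix.mulVec, dotProduct, Matrix.of_apply, dY, Finset.sum_mul, Int.cast_id]
    rw [Finset.sum_comm]
    refine Finset.sum_congr rfl fun _ _ => ?_
    rw [Finset.sum_comm]
    refine Finset.sum_congr rfl fun _ _ => Finset.sum_congr rfl fun _ _ => ?_
    ring
  rw [this]

theorem card_ibox_le (n K : ℕ) (hK : 1 ≤ K) : ((ibox n K).card : ℝ) ≤ (3 * K) ^ n := by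
  have h : (ibox n K).card = (2 * K + 1) ^ n := by
    simp only [ibox, Fintype.card_piFinset, Int.card_Icc, Finset.prod_const, Finset.card_univ,
      Fintype.card_fin]
    congr 1
    omega
  have hK' : (1 : ℝ) ≤ K := by exact_mod_cast hK
  rw [h]
  push_cast
  exact pow_le_pow_left₀ (by positivity) (by linarith) _

theorem sq_sum_nearI_le (A : Fin n → Fin n → Fin n → Fin n → ℤ) (α e : ℝ) (X : ℕ)
    (h : Fin n → ℤ) :
    (∑ x ∈ ibox n X, nearI e (fun m => α * ((dY A x h m : ℤ) : ℝ))) ^ 2 ≤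
      ∑ w ∈ ibox n (2 * X : ℕ), ∑ u ∈ ibox n (2 * X : ℕ),
        nearI (4 * e) (fun m => α * ((triT A u w h m : ℤ) : ℝ)) := by
  classical
  set f : (Fin n → ℤ) × (Fin n → ℤ) → ℝ :=
    fun z => nearI (4 * e) (fun m => α * ((triT A z.2 z.1 h m : ℤ) : ℝ)) with hf
  set g : (Fin n → ℤ) × (Fin n → ℤ) → (Fin n → ℤ) × (Fin n → ℤ) := fun p => (p.1 + p.2, p.1 - p.2)
    with hg
  have hinj : Set.InjOn g (ibox n X ×ˢ ibox n X : Finset _) := by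
    rintro ⟨x, x'⟩ - ⟨y, y'⟩ - hxy
    simp only [hg, Prod.mk.injEq] at hxy
    have h1 : ∀ i, x i = y i ∧ x' i = y' i := fun i => by
      have a := congrFun hxy.1 i
      have b := congrFun hxy.2 i
      simp only [Pi.add_apply, Pi.sub_apply] at a b
      omega
    exact Prod.ext (funext fun i => (h1 i).1) (funext fun i => (h1 i).2)
  calc (∑ x ∈ ibox n X, nearI e (fun m => α * ((dY A x h m : ℤ) : ℝ))) ^ 2
      = ∑ p ∈ ibox n X ×ˢ ibox n X, nearI e (fun m => α * ((dY A p.1 h m : ℤ) : ℝ)) *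
          nearI e (fun m => α * ((dY A p.2 h m : ℤ) : ℝ)) := by
        rw [sq, Finset.sum_mul_sum, Finset.sum_product]
    _ ≤ ∑ p ∈ ibox n X ×ˢ ibox n X, f (g p) := by
        refine Finset.sum_le_sum fun p _ => nearI_mul_le fun m => ?_
        simp only [hg, triT_sub_add]
        push_cast
        ring
    _ = ∑ z ∈ (ibox n X ×ˢ ibox n X).image g, f z := (Finset.sum_image hinj).symm
    _ ≤ ∑ z ∈ ibox n (2 * X : ℕ) ×ˢ ibox n (2 * X : ℕ), f z := by
        refine Finset.sum_le_sum_of_subset_of_nonneg ?_ fun _ _ _ => nearI_nonneg _ _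
        intro z hz
        obtain ⟨p, hp, rfl⟩ := Finset.mem_image.1 hz
        obtain ⟨h1, h2⟩ := Finset.mem_product.1 hp
        rw [mem_ibox] at h1 h2
        refine Finset.mem_product.2 ⟨mem_ibox.2 fun i => ?_, mem_ibox.2 fun i => ?_⟩
        · have := abs_add_le (p.1 i) (p.2 i)
          have := h1 i
          have := h2 i
          show |p.1 i + p.2 i| ≤ _
          push_cast
          linarith
        · have := abs_sub (p.1 i) (p.2 i)
          have := h1 i
          have := h2 i
          show |p.1 i - p.2 i| ≤ _
          push_cast
          linarith
    _ = _ := Finset.sum_product _ _ _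

/-- The Weyl bound on average over `x`, for `α` not close to a rational of small denominator. -/
theorem SmoothBiquad.exists_weyl_average
    (hA : SmoothBiquad A) : ∃ C : ℕ, 1 ≤ C ∧ ∀ c : ℝ, 4 ≤ c → ∃ C' : ℝ, 1 ≤ C' ∧
    ∀ (α : ℝ) (K X : ℕ) (Y L : ℝ) (s : (Fin n → ℤ) → ℝ), 1 ≤ K → K ≤ X → K ≤ Y → 0 ≤ L →
    (∀ x ∈ ibox n X, s x ^ 2 ≤ L * Y ^ n * latN (matQR A α x) (c * Y) (1 / Y)) →
    (∀ q : ℕ, 1 ≤ q → q ≤ C * K ^ 3 → K ^ 3 / (c * (X * Y) ^ 2) < |q * α - round (q * α)|) →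
    (∑ x ∈ ibox n X, s x) ^ 4 * (K : ℝ) ^ n ≤ C' * L ^ 2 * (X * Y) ^ (4 * n) * K := by
  obtain ⟨Ca, hCa, ha⟩ := hA.exists_triN_le
  obtain ⟨Cb, hCb, hb⟩ := hA.swapA.exists_triN_le
  obtain ⟨C1, hC1, h1⟩ := exists_latN_le_shrink n
  obtain ⟨C2, hC2, h2⟩ := exists_sum_triT_shrink n
  refine ⟨max Ca Cb, le_max_of_le_left hCa, fun c hc => ?_⟩
  set B1 : ℝ := 3 ^ n * 2 * 3 ^ n * C1 * c ^ n with hB1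
  set B2 : ℝ := 3 ^ n * C2 * 2 ^ (2 * n) * (Ca + Cb) with hB2
  refine ⟨max 1 (B1 ^ 2 * B2), le_max_left _ _, fun α K X Y L s hK hKX hKY hL hs hq => ?_⟩
  have hK' : (1 : ℝ) ≤ K := by exact_mod_cast hK
  have hX' : (K : ℝ) ≤ X := by exact_mod_cast hKX
  have hX0 : (0 : ℝ) < X := by linarith
  have hY0 : (0 : ℝ) < Y := by linarith
  have hc0 : (0 : ℝ) < c := by linarith
  set e : ℝ := K * (1 / Y) / (c * Y) with he
  have he0 : 0 < e := by positivity
  have heK : K * (4 * e) ≤ 1 := by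
    have : K * (4 * e) = 4 * K * K / (c * (Y * Y)) := by rw [he]; field_simp
    rw [this, div_le_one (by positivity)]
    have : (K : ℝ) * K ≤ Y * Y := mul_le_mul hKY hKY (by linarith) hY0.le
    nlinarith
  have he1 : e ≤ 1 := by nlinarith
  set g : (Fin n → ℤ) → ℝ :=
    fun x => ∑ h ∈ ibox n K, nearI e (fun m => α * ((dY A x h m : ℤ) : ℝ)) with hg
  have s1 : ∀ x ∈ ibox n X,
      s x ^ 2 ≤ L * Y ^ n * (C1 * (c * Y / K) ^ n * (2 * (3 ^ n * g x))) := by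
    intro x hx
    have b1 := h1 (matQR A α x) (c * Y) (1 / Y) K hK' (by nlinarith) (by positivity)
      (by rw [mul_one_div, div_le_one hY0]; exact hKY)
    have b2 := latN_le_sum_nearI (matQR A α x) K he1
    rw [matQR_transpose, ← two_mul] at b1
    simp only [matQR_mulVec] at b2
    refine (hs x hx).trans (mul_le_mul_of_nonneg_left (b1.trans ?_) (by positivity))
    exact mul_le_mul_of_nonneg_left (mul_le_mul_of_nonneg_left b2 (by norm_num)) (by positivity)
  set Tg := ∑ x ∈ ibox n X, g x with hTg
  have hTg0 : 0 ≤ Tg := Finset.sum_nonneg fun _ _ => Finset.sum_nonneg fun _ _ => nearI_nonneg _ _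
  have s2 : (∑ x ∈ ibox n X, s x) ^ 2 ≤
      (3 * X) ^ n * (L * Y ^ n * (C1 * (c * Y / K) ^ n * (2 * (3 ^ n * Tg)))) := by
    refine sq_sum_le_card_mul_sum_sq.trans ?_
    refine mul_le_mul (card_ibox_le n X (hK.trans hKX)) ?_
      (Finset.sum_nonneg fun _ _ => sq_nonneg _) (by positivity)
    rw [hTg, Finset.mul_sum, Finset.mul_sum, Finset.mul_sum, Finset.mul_sum]
    exact Finset.sum_le_sum s1
  have s3 : Tg ^ 2 ≤ (3 * K) ^ n * (C2 * (((2 * X : ℕ) : ℝ) / K) ^ (2 * n) *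
      ((Ca + Cb) * (K : ℝ) ^ (2 * n + 1))) := by
    have e2 : K * (K * (4 * e) / ((2 * X : ℕ) : ℝ)) / ((2 * X : ℕ) : ℝ) =
        K ^ 3 / (c * (X * Y) ^ 2) := by
      rw [he]
      push_cast
      field_simp
      norm_num
    have c1 := h2 A α K (2 * X) (4 * e) hK (by omega) (by positivity) heK
    rw [e2] at c1
    have c2 := ha α K (K ^ 3 / (c * (X * Y) ^ 2)) hK fun q h3 h4 =>
      hq q h3 (h4.trans (Nat.mul_le_mul_right _ (le_max_left _ _)))
    have c3 := hb α K (K ^ 3 / (c * (X * Y) ^ 2)) hK fun q h3 h4 =>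
      hq q h3 (h4.trans (Nat.mul_le_mul_right _ (le_max_right _ _)))
    rw [hTg]
    simp only [hg]
    rw [Finset.sum_comm]
    refine sq_sum_le_card_mul_sum_sq.trans ?_
    refine mul_le_mul (card_ibox_le n K hK) ?_
      (Finset.sum_nonneg fun _ _ => sq_nonneg _) (by positivity)
    refine (Finset.sum_le_sum fun h _ => sq_sum_nearI_le A α e X h).trans (c1.trans ?_)
    refine mul_le_mul_of_nonneg_left ?_ (by positivity)
    linarith
  have s4 : (∑ x ∈ ibox n X, s x) ^ 4 ≤
      ((3 * X) ^ n * (L * Y ^ n * (C1 * (c * Y / K) ^ n * (2 * 3 ^ n)))) ^ 2 *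
      ((3 * K) ^ n * (C2 * (((2 * X : ℕ) : ℝ) / K) ^ (2 * n) *
      ((Ca + Cb) * (K : ℝ) ^ (2 * n + 1)))) := by
    calc (∑ x ∈ ibox n X, s x) ^ 4 = ((∑ x ∈ ibox n X, s x) ^ 2) ^ 2 := by ring
      _ ≤ ((3 * X) ^ n * (L * Y ^ n * (C1 * (c * Y / K) ^ n * (2 * (3 ^ n * Tg))))) ^ 2 :=
        pow_le_pow_left₀ (sq_nonneg _) s2 _
      _ = ((3 * X) ^ n * (L * Y ^ n * (C1 * (c * Y / K) ^ n * (2 * 3 ^ n)))) ^ 2 * Tg ^ 2 := by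
        ring
      _ ≤ _ := mul_le_mul_of_nonneg_left s3 (by positivity)
  calc _ ≤ _ := mul_le_mul_of_nonneg_right s4 (by positivity)
    _ = (B1 ^ 2 * B2) * L ^ 2 * (X * Y) ^ (4 * n) * K := by
      rw [hB1, hB2]
      have hk : (K : ℝ) ^ n ≠ 0 := by positivity
      push_cast
      simp only [mul_pow, div_pow, pow_succ _ (2 * n), pow_mul]
      generalize (K : ℝ) ^ n = k at *
      field_simp
      ring
    _ ≤ _ := by
      refine mul_le_mul_of_nonneg_right (mul_le_mul_of_nonneg_right
        (mul_le_mul_of_nonneg_right (le_max_right _ _) (sq_nonneg _)) (by positivity)) (by linarith)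

theorem latN_le_trivial (L : Matrix (Fin n) (Fin n) ℝ) {a e : ℝ} (ha : 1 ≤ a) (he : e ≤ 1) :
    (latN L a e : ℝ) ≤ (18 * a) ^ n := by
  have h1 : (latN L a e : ℝ) ≤ latN L (⌈a⌉₊ : ℕ) e := Nat.cast_le.2 (latN_mono _ (Nat.le_ceil a) le_rfl)
  have hc : 1 ≤ ⌈a⌉₊ := Nat.one_le_iff_ne_zero.2 (by simp; linarith)
  have h2 : (⌈a⌉₊ : ℝ) ≤ 2 * a := by linarith [Nat.ceil_lt_add_one (by linarith : 0 ≤ a)]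
  refine h1.trans ((latN_le_sum_nearI L _ he).trans ?_)
  have h3 : ∑ u ∈ ibox n (⌈a⌉₊ : ℕ), nearI e (L.mulVec fun j => (u j : ℝ)) ≤
      (3 * (⌈a⌉₊ : ℕ)) ^ n := by
    refine le_trans (Finset.sum_le_card_nsmul _ _ 1 fun u _ => ?_) ?_
    · unfold nearI; split_ifs <;> norm_num
    · rw [nsmul_eq_mul, mul_one]
      exact card_ibox_le n _ hc
  calc _ ≤ (3 : ℝ) ^ n * (3 * (⌈a⌉₊ : ℕ)) ^ n := mul_le_mul_of_nonneg_left h3 (by positivity)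
    _ = (9 * (⌈a⌉₊ : ℕ)) ^ n := by rw [← mul_pow]; ring
    _ ≤ _ := pow_le_pow_left₀ (by positivity) (by linarith) _

theorem SmoothBiquad.exists_weyl_average_le
    (hA : SmoothBiquad A) (hn : 35 < n) {c D : ℝ} (hc : 4 ≤ c) (hD : 1 ≤ D) :
    ∃ C : ℝ, 1 ≤ C ∧ ∀ (α : ℝ) (X : ℕ) (Y L k : ℝ) (s : (Fin n → ℤ) → ℝ), 1 ≤ Y → X ≤ D * Y →
    1 ≤ k → k ≤ X → 0 ≤ L →
    (∀ x ∈ ibox n X, s x ^ 2 ≤ L * Y ^ n * latN (matQR A α x) (c * Y) (1 / Y)) →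
    (∀ q : ℕ, 1 ≤ q → q ≤ C * k ^ 3 → C * k ^ 3 / (X * Y) ^ 2 < |q * α - round (q * α)|) →
    (∑ x ∈ ibox n X, s x) ^ 2 ≤ C * L * (X * Y) ^ (2 * n) / k ^ 16 := by
  obtain ⟨C0, hC0, h0⟩ := hA.exists_weyl_average
  obtain ⟨C1, hC1, h1⟩ := h0 c hc
  refine ⟨max C0 (max (3 ^ n * 3 ^ n * (18 * c) ^ n * D ^ 16) (C1 * (2 * D) ^ 16)), ?_,
    fun α X Y L k s hY hXY hk hkX hL hs hq => ?_⟩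
  · exact le_max_of_le_left (by exact_mod_cast hC0)
  set C := max (C0 : ℝ) (max (3 ^ n * 3 ^ n * (18 * c) ^ n * D ^ 16) (C1 * (2 * D) ^ 16)) with hC
  have hX : (1 : ℝ) ≤ X := hk.trans hkX
  have hX1 : 1 ≤ X := by exact_mod_cast hX
  have hC0' : (1 : ℝ) ≤ C0 := by exact_mod_cast hC0
  rw [le_div_iff₀ (by positivity)]
  rcases lt_or_ge k D with hkD | hkD
  · have h2 : (∑ x ∈ ibox n X, s x) ^ 2 ≤
        (3 * X) ^ n * ((3 * X) ^ n * (L * Y ^ n * (18 * (c * Y)) ^ n)) := by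
      refine sq_sum_le_card_mul_sum_sq.trans ?_
      refine mul_le_mul (card_ibox_le n X hX1) ?_
        (Finset.sum_nonneg fun _ _ => sq_nonneg _) (by positivity)
      refine (Finset.sum_le_card_nsmul _ _ (L * Y ^ n * (18 * (c * Y)) ^ n) fun x hx => ?_).trans ?_
      · refine (hs x hx).trans (mul_le_mul_of_nonneg_left ?_ (by positivity))
        exact latN_le_trivial _ (by nlinarith) (by rw [div_le_one] <;> linarith)
      · rw [nsmul_eq_mul]
        exact mul_le_mul_of_nonneg_right (card_ibox_le n X hX1) (by positivity)
    have h3 : k ^ 16 ≤ D ^ 16 := pow_le_pow_left₀ (by linarith) hkD.le _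
    calc _ ≤ _ := mul_le_mul h2 h3 (by positivity) (by positivity)
      _ = (3 ^ n * 3 ^ n * (18 * c) ^ n * D ^ 16) * L * (X * Y) ^ (2 * n) := by
        simp only [mul_pow, pow_mul]; ring
      _ ≤ _ := by
        gcongr
        exact (le_max_left _ _).trans (le_max_right _ _)
  · set K := ⌊k / D⌋₊ with hKdef
    have hkD1 : 1 ≤ k / D := by rw [le_div_iff₀ (by linarith)]; linarith
    have hK1 : 1 ≤ K := Nat.one_le_floor_iff _ |>.2 hkD1
    have hK1' : (1 : ℝ) ≤ K := by exact_mod_cast hK1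
    have hKk : (K : ℝ) ≤ k / D := Nat.floor_le (by linarith)
    have hKk' : k / D ≤ 2 * K := by linarith [Nat.lt_floor_add_one (k / D)]
    have hkk : k / D ≤ k := div_le_self (by linarith) hD
    have hKY : (K : ℝ) ≤ Y := by
      refine hKk.trans ?_
      rw [div_le_iff₀ (by linarith)]
      linarith
    have hK3 : (K : ℝ) ^ 3 ≤ k ^ 3 := pow_le_pow_left₀ (by positivity) (hKk.trans hkk) _
    have h2 := h1 α K X Y L s hK1 (by exact_mod_cast (hKk.trans hkk).trans hkX) hKY hL hs
      fun q hq1 hq2 => ?_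
    · have h3 : (∑ x ∈ ibox n X, s x) ^ 4 * (K : ℝ) ^ 32 ≤ C1 * L ^ 2 * (X * Y) ^ (4 * n) := by
        have e1 : (K : ℝ) ^ 33 ≤ (K : ℝ) ^ n := pow_le_pow_right₀ hK1' (by omega)
        have e2 := (mul_le_mul_of_nonneg_left e1
          (by positivity : 0 ≤ (∑ x ∈ ibox n X, s x) ^ 4)).trans h2
        rw [pow_succ (K : ℝ) 32, ← mul_assoc] at e2
        exact le_of_mul_le_mul_right e2 (by positivity)
      have h4 : k ^ 16 ≤ (2 * D) ^ 16 * K ^ 16 := by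
        rw [← mul_pow]
        refine pow_le_pow_left₀ (by linarith) ?_ _
        rw [div_le_iff₀ (by linarith)] at hKk'
        linarith
      have h5 : (∑ x ∈ ibox n X, s x) ^ 2 * (K : ℝ) ^ 16 ≤ C1 * L * (X * Y) ^ (2 * n) := by
        rw [← pow_le_pow_iff_left₀ (by positivity) (by positivity) two_ne_zero]
        calc _ = (∑ x ∈ ibox n X, s x) ^ 4 * (K : ℝ) ^ 32 := by ring
          _ ≤ _ := h3
          _ ≤ C1 ^ 2 * L ^ 2 * (X * Y) ^ (4 * n) := by gcongr; nlinarith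
          _ = _ := by simp only [mul_pow, ← pow_mul]; ring_nf
      calc _ ≤ (∑ x ∈ ibox n X, s x) ^ 2 * ((2 * D) ^ 16 * K ^ 16) :=
            mul_le_mul_of_nonneg_left h4 (sq_nonneg _)
        _ = (2 * D) ^ 16 * ((∑ x ∈ ibox n X, s x) ^ 2 * K ^ 16) := by ring
        _ ≤ (2 * D) ^ 16 * (C1 * L * (X * Y) ^ (2 * n)) :=
            mul_le_mul_of_nonneg_left h5 (by positivity)
        _ = (C1 * (2 * D) ^ 16) * L * (X * Y) ^ (2 * n) := by ring
        _ ≤ _ := by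
          gcongr
          exact (le_max_right _ _).trans (le_max_right _ _)
    · refine lt_of_le_of_lt ?_ (hq q hq1 ?_)
      · rw [div_le_div_iff₀ (by positivity) (by positivity), mul_comm c, ← mul_assoc]
        have a1 : (K : ℝ) ^ 3 ≤ C * k ^ 3 := by
          refine hK3.trans (le_mul_of_one_le_left (by positivity) ?_)
          exact hC0'.trans (le_max_left _ _)
        calc (K : ℝ) ^ 3 * (X * Y) ^ 2 ≤ C * k ^ 3 * (X * Y) ^ 2 := by gcongr
          _ ≤ C * k ^ 3 * (X * Y) ^ 2 * c :=
            le_mul_of_one_le_right (by positivity) (by linarith)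
      · have : (q : ℝ) ≤ C0 * K ^ 3 := by exact_mod_cast hq2
        refine this.trans (mul_le_mul (le_max_left _ _) hK3 (by positivity) ?_)
        exact (by linarith : (0 : ℝ) ≤ C0).trans (le_max_left _ _)

theorem exists_abs_dY_le (A : Fin n → Fin n → Fin n → Fin n → ℤ) : ∃ C : ℝ, 1 ≤ C ∧
    ∀ (X K : ℝ) (x h : Fin n → ℤ), (∀ i, |(x i : ℝ)| ≤ X) → (∀ i, |(h i : ℝ)| ≤ K) →
    ∀ m, |((dY A x h m : ℤ) : ℝ)| ≤ C * X ^ 2 * K := by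
  have hn : ∀ m, 0 ≤ ∑ i, ∑ j, ∑ l, |((A i j m l + A i j l m : ℤ) : ℝ)| := fun m =>
    Finset.sum_nonneg fun _ _ => Finset.sum_nonneg fun _ _ => Finset.sum_nonneg fun _ _ =>
      abs_nonneg _
  refine ⟨1 + ∑ m, ∑ i, ∑ j, ∑ l, |((A i j m l + A i j l m : ℤ) : ℝ)|,
    le_add_of_nonneg_right (Finset.sum_nonneg fun m _ => hn m), fun X K x h hx hh m => ?_⟩
  have hX : 0 ≤ X := (abs_nonneg _).trans (hx m)
  have hK : 0 ≤ K := (abs_nonneg _).trans (hh m)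
  have h1 : |((dY A x h m : ℤ) : ℝ)| ≤
      (∑ i, ∑ j, ∑ l, |((A i j m l + A i j l m : ℤ) : ℝ)|) * (X ^ 2 * K) := by
    simp only [dY, Finset.sum_mul, Int.cast_id, Int.cast_sum]
    refine (Finset.abs_sum_le_sum_abs _ _).trans (Finset.sum_le_sum fun i _ => ?_)
    refine (Finset.abs_sum_le_sum_abs _ _).trans (Finset.sum_le_sum fun j _ => ?_)
    refine (Finset.abs_sum_le_sum_abs _ _).trans (Finset.sum_le_sum fun l _ => ?_)
    rw [Int.cast_mul, Int.cast_mul, Int.cast_mul, abs_mul, abs_mul, abs_mul, mul_assoc, mul_assoc]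
    refine mul_le_mul_of_nonneg_left ?_ (abs_nonneg _)
    calc |(x i : ℝ)| * (|(x j : ℝ)| * |(h l : ℝ)|) ≤ X * (X * K) := by
          have := hx i; have := hx j; have := hh l
          gcongr
      _ = X ^ 2 * K := by ring
  refine h1.trans ?_
  rw [mul_assoc]
  refine mul_le_mul_of_nonneg_right ?_ (by positivity)
  have := Finset.single_le_sum
    (f := fun m => ∑ i, ∑ j, ∑ l, |((A i j m l + A i j l m : ℤ) : ℝ)|)
    (fun m _ => hn m) (Finset.mem_univ m)
  linarith

/-- The Weyl bound for an individual nonsingular form `F_x`. -/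
theorem exists_weyl_det_le (A : Fin n → Fin n → Fin n → Fin n → ℤ) (hn : 35 < n) {c D : ℝ}
    (hc : 4 ≤ c) (hD : 1 ≤ D) :
    ∃ C : ℝ, 1 ≤ C ∧ ∀ (α X Y L k s : ℝ) (x : Fin n → ℤ), 1 ≤ Y → (∀ i, |(x i : ℝ)| ≤ X) →
    detFx A x ≠ 0 → 1 ≤ k → k ≤ D * Y → 0 ≤ L →
    s ^ 2 ≤ L * Y ^ n * latN (matQR A α x) (c * Y) (1 / Y) →
    (∀ q : ℕ, 1 ≤ q → q ≤ C * X ^ 2 * k → C * k / Y ^ 2 < |q * α - round (q * α)|) →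
    s ^ 2 ≤ C * L * Y ^ (2 * n) / k ^ 32 := by
  obtain ⟨C0, hC0, h0⟩ := exists_abs_dY_le A
  obtain ⟨C1, hC1, h1⟩ := exists_latN_le_shrink n
  refine ⟨max C0 (max ((18 * c) ^ n * D ^ 32) (C1 * c ^ n * 2 * D ^ 32)), le_max_of_le_left hC0,
    fun α X Y L k s x hY hx hdet hk hkY hL hs hq => ?_⟩
  set C := max C0 (max ((18 * c) ^ n * D ^ 32) (C1 * c ^ n * 2 * D ^ 32)) with hC
  have hCC : C0 ≤ C := le_max_left _ _
  rw [le_div_iff₀ (by positivity)]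
  rcases lt_or_ge k D with hkD | hkD
  · have h3 : k ^ 32 ≤ D ^ 32 := pow_le_pow_left₀ (by linarith) hkD.le _
    have h2 : s ^ 2 ≤ L * Y ^ n * (18 * (c * Y)) ^ n :=
      hs.trans (mul_le_mul_of_nonneg_left (latN_le_trivial _ (by nlinarith)
        (by rw [div_le_one] <;> linarith)) (by positivity))
    calc _ ≤ _ := mul_le_mul h2 h3 (by positivity) (by positivity)
      _ = ((18 * c) ^ n * D ^ 32) * L * Y ^ (2 * n) := by simp only [mul_pow, pow_mul]; ring
      _ ≤ _ := by
        gcongr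
        exact (le_max_left _ _).trans (le_max_right _ _)
  · have hkD1 : 1 ≤ k / D := by rw [le_div_iff₀ (by linarith)]; linarith
    have hkk : k / D ≤ k := div_le_self (by linarith) hD
    have hKY : k / D ≤ Y := by rw [div_le_iff₀ (by linarith)]; linarith
    set K := k / D with hK
    have h2 := h1 (matQR A α x) (c * Y) (1 / Y) K hkD1 (by nlinarith) (by positivity)
      (by rw [mul_one_div, div_le_one (by linarith)]; exact hKY)
    rw [matQR_transpose, ← two_mul] at h2
    set e := K * (1 / Y) / (c * Y) with he
    have he' : e = K / Y ^ 2 / c := by rw [he]; field_simp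
    have he1 : e < 1 := by
      rw [he', div_div, div_lt_one (by positivity)]
      nlinarith
    have hek : e ≤ C * k / Y ^ 2 := by
      rw [he']
      refine (div_le_self (by positivity) (by linarith)).trans ?_
      gcongr
      nlinarith
    have h3 : latN (matQR A α x) K e ≤ 1 := by
      refine (Set.ncard_le_ncard (t := {(0, 0)}) ?_).trans (Set.ncard_singleton _).le
      rintro ⟨u, v⟩ ⟨hu, hv⟩
      have huv : ∀ i, |α * ((dY A x u i : ℤ) : ℝ) + v i| ≤ e := fun i => by
        rw [← congrFun (matQR_mulVec A α x u) i]
        exact hv i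
      have hu0 : u = 0 := by
        by_contra hne
        have : dY A x u ≠ 0 := by
          intro h4
          refine hne (Matrix.eq_zero_of_mulVec_eq_zero (M := dblMat A x) (fun h5 => hdet ?_) ?_)
          · rw [detFx_eq, h5]; simp
          · rw [← h4]
            exact funext fun m => dblMat_mulVec A x u m
        obtain ⟨m, hm⟩ := Function.ne_iff.1 this
        have a1 := hq (dY A x u m).natAbs (Nat.one_le_iff_ne_zero.2 (Int.natAbs_ne_zero.2 hm)) ?_
        · refine absurd a1 (not_lt.2 (((natAbs_mul_sub_round_le _ _).trans ?_).trans hek))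
          refine (round_le _ (-v m)).trans ?_
          push_cast
          rw [sub_neg_eq_add]
          exact huv m
        · have e1 : (((dY A x u m).natAbs : ℕ) : ℝ) = |((dY A x u m : ℤ) : ℝ)| := by
            rw [← Int.cast_abs, Int.abs_eq_natAbs]; simp
          rw [e1]
          refine (h0 X K x u hx hu m).trans ?_
          gcongr
      subst hu0
      have hv0 : v = 0 := funext fun i => by
        have a1 := (huv i).trans_lt he1
        have a2 : dY A x (0 : Fin n → ℤ) i = 0 := by simp [dY]
        rw [a2] at a1
        simp only [Int.cast_zero, mul_zero, zero_add] at a1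
        have : |v i| < 1 := by exact_mod_cast a1
        exact Int.abs_lt_one_iff.1 this
      rw [hv0]
      rfl
    have h4 : s ^ 2 ≤ L * Y ^ n * (C1 * (c * Y / K) ^ n * (2 * 1)) := by
      refine hs.trans (mul_le_mul_of_nonneg_left (h2.trans ?_) (by positivity))
      gcongr
      exact_mod_cast h3
    have h5 : s ^ 2 * K ^ 32 ≤ C1 * c ^ n * 2 * L * Y ^ (2 * n) := by
      have e1 : K ^ 32 ≤ K ^ n := pow_le_pow_right₀ hkD1 (by omega)
      calc _ ≤ L * Y ^ n * (C1 * (c * Y / K) ^ n * (2 * 1)) * K ^ n := by gcongr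
        _ = _ := by
          have : K ^ n ≠ 0 := by positivity
          simp only [mul_pow, div_pow, pow_mul]
          field_simp
          ring
    have h6 : k ^ 32 = D ^ 32 * K ^ 32 := by rw [hK, ← mul_pow]; congr 1; field_simp
    calc s ^ 2 * k ^ 32 = D ^ 32 * (s ^ 2 * K ^ 32) := by rw [h6]; ring
      _ ≤ D ^ 32 * (C1 * c ^ n * 2 * L * Y ^ (2 * n)) := mul_le_mul_of_nonneg_left h5 (by positivity)
      _ = (C1 * c ^ n * 2 * D ^ 32) * L * Y ^ (2 * n) := by ring
      _ ≤ _ := by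
        gcongr
        exact (le_max_right _ _).trans (le_max_right _ _)

/-- Real numbers with a good rational approximation of denominator at most `Q`. -/
def arcs (Q δ : ℝ) : Set ℝ := {α | ∃ q : ℕ, 1 ≤ q ∧ (q : ℝ) ≤ Q ∧ |q * α - round (q * α)| ≤ δ}

theorem measurableSet_arcs (Q δ : ℝ) : MeasurableSet (arcs Q δ) := by
  have h : arcs Q δ = ⋃ (q : ℕ) (_ : 1 ≤ q ∧ (q : ℝ) ≤ Q) (a : ℤ), {α : ℝ | |q * α - a| ≤ δ} := by
    ext α
    simp only [arcs, Set.mem_ofPred_eq, Set.mem_iUnion, exists_prop, and_assoc]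
    refine exists_congr fun q => and_congr_right fun _ => and_congr_right fun _ => ?_
    exact ⟨fun h => ⟨_, h⟩, fun ⟨a, ha⟩ => (round_le _ a).trans ha⟩
  rw [h]
  refine MeasurableSet.iUnion fun q => MeasurableSet.iUnion fun _ => MeasurableSet.iUnion fun a => ?_
  exact (isClosed_le (by fun_prop) continuous_const).measurableSet

theorem volume_real_arcs_le {Q δ : ℝ} (hQ : 0 ≤ Q) (hδ : 0 ≤ δ) :
    volume.real (Set.Icc (-1 : ℝ) 1 ∩ arcs Q δ) ≤ 6 * Q * δ := by
  have hsub : Set.Icc (-1 : ℝ) 1 ∩ arcs Q δ ⊆ ⋃ q ∈ Finset.Icc 1 ⌊Q⌋₊,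
      ⋃ a ∈ Finset.Icc (-(q : ℤ)) q, Set.Icc ((a - δ) / q) ((a + δ) / q) := by
    rintro α ⟨⟨h1, h2⟩, q, hq1, hq2, hq3⟩
    have hq0 : (0 : ℝ) < q := by exact_mod_cast hq1
    simp only [Set.mem_iUnion, exists_prop, Finset.mem_Icc]
    refine ⟨q, ⟨hq1, Nat.le_floor hq2⟩, round (q * α), ?_, ?_⟩
    · have h3 := abs_le.1 (abs_sub_round ((q : ℝ) * α))
      constructor
      · have : (-(q : ℤ) : ℝ) - 1 < (round (q * α) : ℝ) := by push_cast; nlinarith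
        have : -(q : ℤ) - 1 < round (q * α) := by exact_mod_cast this
        omega
      · have : (round (q * α) : ℝ) < ((q : ℤ) : ℝ) + 1 := by push_cast; nlinarith
        have : round (q * α) < (q : ℤ) + 1 := by exact_mod_cast this
        omega
    · have h3 := abs_le.1 hq3
      constructor
      · rw [div_le_iff₀ hq0]; linarith
      · rw [le_div_iff₀ hq0]; linarith
  refine (measureReal_mono hsub ?_).trans ?_
  · refine ((measure_biUnion_finset_le _ _).trans_lt ?_).ne
    refine ENNReal.sum_lt_top.2 fun q _ => (measure_biUnion_finset_le _ _).trans_lt ?_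
    exact ENNReal.sum_lt_top.2 fun a _ => measure_Icc_lt_top
  refine (measureReal_biUnion_finset_le _ _).trans ?_
  have h1 : ∀ q ∈ Finset.Icc 1 ⌊Q⌋₊, volume.real (⋃ a ∈ Finset.Icc (-(q : ℤ)) q,
      Set.Icc (((a : ℝ) - δ) / q) ((a + δ) / q)) ≤ 6 * δ := by
    intro q hq
    have hq1 : 1 ≤ q := (Finset.mem_Icc.1 hq).1
    have hq0 : (1 : ℝ) ≤ q := by exact_mod_cast hq1
    refine (measureReal_biUnion_finset_le _ _).trans ?_
    have h2 : ∀ a ∈ Finset.Icc (-(q : ℤ)) q,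
        volume.real (Set.Icc (((a : ℝ) - δ) / q) ((a + δ) / q)) = 2 * δ / q := by
      intro a _
      rw [Real.volume_real_Icc_of_le (by gcongr; linarith)]
      ring
    rw [Finset.sum_congr rfl h2, Finset.sum_const, Int.card_Icc, nsmul_eq_mul]
    have h3 : (((q : ℤ) + 1 - -(q : ℤ)).toNat : ℝ) = 2 * q + 1 := by
      have : ((q : ℤ) + 1 - -(q : ℤ)).toNat = 2 * q + 1 := by omega
      rw [this]; push_cast; ring
    rw [h3, ← mul_div_assoc, div_le_iff₀ (by linarith)]
    nlinarith
  refine (Finset.sum_le_sum h1).trans ?_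
  rw [Finset.sum_const, Nat.card_Icc, nsmul_eq_mul, Nat.add_sub_cancel]
  nlinarith [Nat.floor_le hQ]

theorem setIntegral_diff_le_add {f : ℝ → ℝ} (hf : Continuous f) (hf0 : ∀ α, 0 ≤ f α)
    {E E' : Set ℝ} (hE' : MeasurableSet E') {b v : ℝ} (hb0 : 0 ≤ b)
    (hb : ∀ α, α ∉ E → f α ≤ b) (hv : volume.real (Set.Icc (-1 : ℝ) 1 ∩ E') ≤ v) :
    ∫ α in Set.Icc (-1 : ℝ) 1 \ E, f α ≤ b * v + ∫ α in Set.Icc (-1 : ℝ) 1 \ E', f α := by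
  have hfint : IntegrableOn f (Set.Icc (-1) 1) := hf.integrableOn_Icc
  have hfin : volume (Set.Icc (-1 : ℝ) 1 ∩ E') ≠ ⊤ :=
    ((measure_mono Set.inter_subset_left).trans_lt measure_Icc_lt_top).ne
  rw [← integral_inter_add_sdiff hE' (hfint.mono_set Set.sdiff_subset)]
  refine add_le_add ?_ ?_
  · refine (Real.le_norm_self _).trans ((norm_setIntegral_le_of_norm_le_const (C := b) ?_ ?_).trans ?_)
    · refine (measure_mono ?_).trans_lt hfin.lt_top
      exact Set.inter_subset_inter_left _ Set.sdiff_subset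
    · rintro α ⟨⟨_, h⟩, _⟩
      rw [Real.norm_of_nonneg (hf0 α)]
      exact hb α h
    · refine mul_le_mul_of_nonneg_left ((measureReal_mono ?_ hfin).trans hv) hb0
      exact Set.inter_subset_inter_left _ Set.sdiff_subset
  · refine setIntegral_mono_set (hfint.mono_set Set.sdiff_subset)
      (Eventually.of_forall hf0) (LE.le.eventuallyLE ?_)
    exact Set.sdiff_subset_sdiff_left Set.sdiff_subset

theorem setIntegral_diff_le {f : ℝ → ℝ} (hf0 : ∀ α, 0 ≤ f α)
    {E : Set ℝ} {b : ℝ} (hb0 : 0 ≤ b) (hb : ∀ α, α ∉ E → f α ≤ b) :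
    ∫ α in Set.Icc (-1 : ℝ) 1 \ E, f α ≤ 2 * b := by
  refine (Real.le_norm_self _).trans ((norm_setIntegral_le_of_norm_le_const (C := b) ?_ ?_).trans ?_)
  · exact (measure_mono Set.sdiff_subset).trans_lt measure_Icc_lt_top
  · rintro α ⟨_, h⟩
    rw [Real.norm_of_nonneg (hf0 α)]
    exact hb α h
  · have : volume.real (Set.Icc (-1 : ℝ) 1 \ E) ≤ 2 := by
      refine (measureReal_mono Set.sdiff_subset measure_Icc_lt_top.ne).trans ?_
      rw [Real.volume_real_Icc_of_le (by norm_num)]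
      norm_num
    nlinarith

theorem dyadic_bound {f : ℝ → ℝ} {c T X K : ℝ} (hc : 0 ≤ c) (hK : 0 < K) (hKX : K ≤ X)
    (h1 : ∀ k, K ≤ k → 2 * k ≤ X → f k ≤ c / k ^ 2 + f (2 * k))
    (h2 : ∀ k, K ≤ k → k ≤ X → X < 2 * k → f k ≤ T) : f K ≤ 2 * c / K ^ 2 + T := by
  have key : ∀ N : ℕ, ∀ k, K ≤ k → k ≤ X → X < 2 ^ N * (2 * k) → f k ≤ 2 * c / k ^ 2 + T := by
    intro N
    induction N with
    | zero =>
      intro k hk hkX h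
      have h3 := h2 k hk hkX (by simpa using h)
      have : 0 ≤ 2 * c / k ^ 2 := by positivity
      linarith
    | succ N ih =>
      intro k hk hkX h
      have hk0 : 0 < k := hK.trans_le hk
      have h3 : 0 ≤ c / k ^ 2 := by positivity
      have h3' : 2 * c / k ^ 2 = 2 * (c / k ^ 2) := by ring
      rcases lt_or_ge X (2 * k) with h4 | h4
      · have := h2 k hk hkX h4
        linarith
      · have h5 := ih (2 * k) (by linarith) h4 (by rw [pow_succ] at h; linarith)
        have h6 := h1 k hk h4
        have h7 : 2 * c / (2 * k) ^ 2 = (c / k ^ 2) / 2 := by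
          field_simp
        linarith
  obtain ⟨N, hN⟩ := pow_unbounded_of_one_lt (X / (2 * K)) (one_lt_two (α := ℝ))
  exact key N K le_rfl hKX (by rwa [div_lt_iff₀ (by linarith)] at hN)

/-- Compatibility conditions for a product of tents of width `H`. -/
structure IsTent (D H : ℝ) (c : Fin n → ℝ) (R : ℤ) : Prop where
  one_le : 1 ≤ H
  abs_le : ∀ i, |c i| ≤ D * H
  le_radius : (D + 1) * H ≤ R
  radius_le : (R : ℝ) ≤ (D + 1) * H + 1

/-- The sum of the absolute values of the weighted exponential sums over nondegenerate `x`. -/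
def phiSum (A : Fin n → Fin n → Fin n → Fin n → ℤ) (X : ℕ) (H : ℝ) (c : Fin n → ℝ) (R : ℤ)
    (α : ℝ) : ℝ :=
  ∑ x ∈ ibox n X, if detFx A x ≠ 0 then ‖expY A (fun i m => tent H (c i) m) R α x‖ else 0

theorem continuous_expY (A : Fin n → Fin n → Fin n → Fin n → ℤ) (v : Fin n → ℤ → ℝ) (R : ℤ)
    (x : Fin n → ℤ) : Continuous fun α => expY A v R α x := by
  unfold expY
  exact continuous_finsetSum _ fun y _ =>
    continuous_const.mul (continuous_ee.comp (continuous_id.mul continuous_const))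

theorem continuous_phiSum (A : Fin n → Fin n → Fin n → Fin n → ℤ) (X : ℕ) (H : ℝ)
    (c : Fin n → ℝ) (R : ℤ) : Continuous (phiSum A X H c R) := by
  unfold phiSum
  refine continuous_finsetSum _ fun x _ => ?_
  split_ifs
  · exact (continuous_expY A _ R x).norm
  · exact continuous_const

theorem phiSum_nonneg (A : Fin n → Fin n → Fin n → Fin n → ℤ) (X : ℕ) (H : ℝ)
    (c : Fin n → ℝ) (R : ℤ) (α : ℝ) : 0 ≤ phiSum A X H c R α :=
  Finset.sum_nonneg fun x _ => by split_ifs <;> positivity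

theorem le_of_sq_le_mul_sq {a b P k : ℝ} {m : ℕ} (hb : 1 ≤ b) (hP : 0 ≤ P) (hk : 0 < k)
    (h : a ^ 2 ≤ b * P ^ 2 / k ^ (2 * m)) : a ≤ b * P / k ^ m := by
  refine le_of_sq_le_sq ?_ (by positivity)
  refine h.trans ?_
  rw [div_pow, ← pow_mul, mul_comm m 2, mul_pow]
  gcongr
  nlinarith

theorem not_mem_arcs {Q δ α : ℝ} (h : α ∉ arcs Q δ) (q : ℕ) (h1 : 1 ≤ q) (h2 : (q : ℝ) ≤ Q) :
    δ < |q * α - round (q * α)| := by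
  by_contra h3
  exact h ⟨q, h1, h2, not_lt.1 h3⟩

theorem SmoothBiquad.exists_phiSum_le (hA : SmoothBiquad A) (hn : 35 < n) {D : ℝ} (hD : 1 ≤ D) :
    ∃ C : ℝ, 1 ≤ C ∧ ∀ (X : ℕ) (H : ℝ) (c : Fin n → ℝ) (R : ℤ), IsTent D H c R → X ≤ D * H →
    ∀ α k : ℝ, 1 ≤ k → k ≤ X → α ∉ arcs (C * k ^ 3) (C * k ^ 3 / (X * H) ^ 2) →
    phiSum A X H c R α ≤ C * (X * H) ^ n / k ^ 8 := by
  obtain ⟨L, hL, h0⟩ := exists_expY_tent_le n D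
  obtain ⟨C, hC, h1⟩ := hA.exists_weyl_average_le hn (c := 4 * (D + 2)) (D := D) (by linarith) hD
  have hCL : C ≤ C * L := le_mul_of_one_le_right (by linarith) hL
  refine ⟨C * L, hC.trans hCL, fun X H c R hT hXH α k hk hkX hα => ?_⟩
  have hH := hT.one_le
  have h2 := h1 α X H L k (fun x => if detFx A x ≠ 0 then
    ‖expY A (fun i m => tent H (c i) m) R α x‖ else 0) hH hXH hk hkX (by linarith) ?_ ?_
  · refine le_of_sq_le_mul_sq (m := 8) (hC.trans hCL) (by positivity) (by linarith) ?_
    rw [← pow_mul, mul_comm n 2]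
    exact h2
  · intro x _
    split_ifs
    · exact h0 A H c R hH hT.abs_le hT.le_radius hT.radius_le α x
    · rw [zero_pow two_ne_zero]; positivity
  · intro q hq1 hq2
    have hk3 : 0 ≤ k ^ 3 := by positivity
    refine lt_of_le_of_lt ?_ (not_mem_arcs hα q hq1 (hq2.trans ?_))
    · gcongr
    · gcongr

theorem SmoothBiquad.exists_phiSum_det_le (A : Fin n → Fin n → Fin n → Fin n → ℤ)
    (hn : 35 < n) {D : ℝ} (hD : 1 ≤ D) :
    ∃ C : ℝ, 1 ≤ C ∧ ∀ (X : ℕ) (H : ℝ) (c : Fin n → ℝ) (R : ℤ), IsTent D H c R → 1 ≤ X →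
    ∀ α k : ℝ, 1 ≤ k → k ≤ D * H → α ∉ arcs (C * X ^ 2 * k) (C * k / H ^ 2) →
    phiSum A X H c R α ≤ C * (X * H) ^ n / k ^ 16 := by
  obtain ⟨L, hL, h0⟩ := exists_expY_tent_le n D
  obtain ⟨C, hC, h1⟩ := exists_weyl_det_le A hn (c := 4 * (D + 2)) (D := D) (by linarith) hD
  have hCL : C ≤ C * L := le_mul_of_one_le_right (by linarith) hL
  have h3n : (1 : ℝ) ≤ 3 ^ n := one_le_pow₀ (by norm_num)
  have hCC : C ≤ C * L * 3 ^ n := hCL.trans (le_mul_of_one_le_right (by linarith) h3n)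
  refine ⟨C * L * 3 ^ n, hC.trans hCC, fun X H c R hT hX α k hk hkH hα => ?_⟩
  have hH := hT.one_le
  have h2 : ∀ x ∈ ibox n X, (if detFx A x ≠ 0 then
      ‖expY A (fun i m => tent H (c i) m) R α x‖ else 0) ≤ C * L * H ^ n / k ^ 16 := by
    intro x hx
    split_ifs with hdet
    · refine le_of_sq_le_mul_sq (m := 16) (hC.trans hCL) (by positivity) (by linarith) ?_
      rw [← pow_mul, mul_comm n 2]
      refine h1 α X H L k _ x hH (fun i => ?_) hdet hk hkH (by linarith)
        (h0 A H c R hH hT.abs_le hT.le_radius hT.radius_le α x) fun q hq1 hq2 => ?_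
      · exact_mod_cast mem_ibox.1 hx i
      · refine lt_of_le_of_lt ?_ (not_mem_arcs hα q hq1 (hq2.trans ?_))
        · gcongr
        · gcongr
    · have : 0 < k := by linarith
      positivity
  refine (Finset.sum_le_card_nsmul _ _ _ h2).trans ?_
  rw [nsmul_eq_mul]
  have hk0 : 0 < k := by linarith
  calc _ ≤ (3 * (X : ℝ)) ^ n * (C * L * H ^ n / k ^ 16) :=
        mul_le_mul_of_nonneg_right (card_ibox_le n X hX) (by positivity)
    _ = _ := by rw [mul_pow, mul_pow]; ring

theorem SmoothBiquad.exists_minor_le (hA : SmoothBiquad A) (hn : 35 < n) {D : ℝ} (hD : 1 ≤ D) :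
    ∃ C₁ : ℝ, 1 ≤ C₁ ∧ ∃ C : ℝ, 1 ≤ C ∧ ∀ (X : ℕ) (H : ℝ) (c : Fin n → ℝ) (R : ℤ),
    IsTent D H c R → 1 ≤ X → X ≤ D * H → ∀ K : ℝ, 1 ≤ K → K ≤ X →
    ∫ α in Set.Icc (-1 : ℝ) 1 \ arcs (C₁ * K ^ 3) (C₁ * K ^ 3 / (X * H) ^ 2), phiSum A X H c R α ≤
      C * ((X * H) ^ n / (X * H) ^ 2) / K ^ 2 := by
  obtain ⟨C₁, hC₁, h1⟩ := hA.exists_phiSum_le hn hD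
  obtain ⟨C₂, hC₂, h2⟩ := SmoothBiquad.exists_phiSum_det_le A hn hD
  refine ⟨C₁, hC₁, 768 * C₁ ^ 3 + (1536 * C₁ * C₂ ^ 2 + 48 * C₂ ^ 3 + 8 * C₂), ?_,
    fun X H c R hT hX hXH K hK hKX => ?_⟩
  · have e1 : (1 : ℝ) ≤ C₁ ^ 3 := one_le_pow₀ hC₁
    have e2 : (0 : ℝ) ≤ 1536 * C₁ * C₂ ^ 2 := by positivity
    have e3 : (0 : ℝ) ≤ C₂ ^ 3 := by positivity
    linarith
  have hH := hT.one_le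
  have hX1 : (1 : ℝ) ≤ X := by exact_mod_cast hX
  have hf := continuous_phiSum A X H c R
  have hf0 := phiSum_nonneg A X H c R
  replace h1 := h1 X H c R hT hXH
  replace h2 := h2 X H c R hT hX
  set f := phiSum A X H c R
  have hP : (0 : ℝ) ≤ (X * H) ^ n := by positivity
  generalize ((X : ℝ) * H) ^ n = P at *
  generalize (X : ℝ) = x at *
  set W := P / (x * H) ^ 2 with hW
  have hW0 : 0 ≤ W := by positivity
  have hx0 : 0 < x := by linarith
  have hH0 : 0 < H := by linarith
  have hPW : P = W * (x * H) ^ 2 := by rw [hW]; field_simp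
  have s2 : ∫ α in Set.Icc (-1 : ℝ) 1 \ arcs (C₂ * x ^ 2 * x) (C₂ * x / H ^ 2), f α ≤
      2 * (24 * C₂ ^ 3 * W) / x ^ 2 + 8 * C₂ * W / x ^ 2 := by
    refine dyadic_bound (f := fun k => ∫ α in Set.Icc (-1 : ℝ) 1 \ arcs (C₂ * x ^ 2 * k)
      (C₂ * k / H ^ 2), f α) (X := D * H) (by positivity) hx0 hXH (fun k hk hk2 => ?_)
      (fun k hk hk2 hk3 => ?_)
    · have hk0 : 0 < k := hx0.trans_le hk
      refine (setIntegral_diff_le_add hf hf0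
        (measurableSet_arcs (C₂ * x ^ 2 * (2 * k)) (C₂ * (2 * k) / H ^ 2)) (b := C₂ * P / k ^ 16)
        (by positivity) (fun α hα => h2 α k (by linarith) (by linarith) hα)
        (volume_real_arcs_le (by positivity) (by positivity))).trans ?_
      refine add_le_add ?_ le_rfl
      rw [hPW, le_div_iff₀ (by positivity)]
      have e : C₂ * (W * (x * H) ^ 2) / k ^ 16 *
          (6 * (C₂ * x ^ 2 * (2 * k)) * (C₂ * (2 * k) / H ^ 2)) * k ^ 2 =
          24 * C₂ ^ 3 * W * (x / k) ^ 4 / k ^ 8 := by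
        field_simp
        ring
      rw [e]
      refine (div_le_self (by positivity) (one_le_pow₀ (by linarith))).trans ?_
      refine mul_le_of_le_one_right (by positivity) (pow_le_one₀ (by positivity) ?_)
      rwa [div_le_one hk0]
    · have hk0 : 0 < k := hx0.trans_le hk
      refine (setIntegral_diff_le hf0 (b := C₂ * P / k ^ 16) (by positivity)
        (fun α hα => h2 α k (by linarith) hk2 hα)).trans ?_
      rw [hPW, le_div_iff₀ (by positivity)]
      have e : 2 * (C₂ * (W * (x * H) ^ 2) / k ^ 16) * x ^ 2 =
          2 * C₂ * W * (x / k) ^ 4 * (H / k) ^ 2 / k ^ 10 := by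
        field_simp
      rw [e]
      refine (div_le_self (by positivity) (one_le_pow₀ (by linarith))).trans ?_
      have e1 : (x / k) ^ 4 ≤ 1 := pow_le_one₀ (by positivity) (by rwa [div_le_one hk0])
      have e2 : H / k ≤ 2 := by
        rw [div_le_iff₀ hk0]
        nlinarith
      have e3 : (H / k) ^ 2 ≤ 4 := by
        have : 0 ≤ H / k := by positivity
        nlinarith
      have e4 : 0 ≤ 2 * C₂ * W := by positivity
      calc _ ≤ 2 * C₂ * W * 1 * 4 := by gcongr
        _ = _ := by ring
  have s1 : ∫ α in Set.Icc (-1 : ℝ) 1 \ arcs (C₁ * K ^ 3) (C₁ * K ^ 3 / (x * H) ^ 2), f α ≤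
      2 * (384 * C₁ ^ 3 * W) / K ^ 2 +
        (1536 * C₁ * C₂ ^ 2 + 48 * C₂ ^ 3 + 8 * C₂) * W / x ^ 2 := by
    refine dyadic_bound (f := fun k => ∫ α in Set.Icc (-1 : ℝ) 1 \ arcs (C₁ * k ^ 3)
      (C₁ * k ^ 3 / (x * H) ^ 2), f α) (X := x) (by positivity) (by linarith) hKX
      (fun k hk hk2 => ?_) (fun k hk hk2 hk3 => ?_)
    · have hk0 : 0 < k := by linarith
      refine (setIntegral_diff_le_add hf hf0
        (measurableSet_arcs (C₁ * (2 * k) ^ 3) (C₁ * (2 * k) ^ 3 / (x * H) ^ 2))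
        (b := C₁ * P / k ^ 8) (by positivity) (fun α hα => h1 α k (by linarith) (by linarith) hα)
        (volume_real_arcs_le (by positivity) (by positivity))).trans ?_
      refine add_le_add (le_of_eq ?_) le_rfl
      rw [hPW]
      field_simp
      ring
    · have hk0 : 0 < k := by linarith
      refine (setIntegral_diff_le_add hf hf0 (measurableSet_arcs (C₂ * x ^ 2 * x) (C₂ * x / H ^ 2))
        (b := C₁ * P / k ^ 8) (by positivity) (fun α hα => h1 α k (by linarith) hk2 hα)
        (volume_real_arcs_le (by positivity) (by positivity))).trans ?_
      have e : C₁ * P / k ^ 8 * (6 * (C₂ * x ^ 2 * x) * (C₂ * x / H ^ 2)) =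
          6 * C₁ * C₂ ^ 2 * W * (x / k) ^ 8 / x ^ 2 := by
        rw [hPW]
        field_simp
      have e2 : (x / k) ^ 8 ≤ 2 ^ 8 := by
        refine pow_le_pow_left₀ (by positivity) ?_ _
        rw [div_le_iff₀ hk0]
        exact hk3.le
      have e3 : 6 * C₁ * C₂ ^ 2 * W * (x / k) ^ 8 / x ^ 2 ≤ 6 * C₁ * C₂ ^ 2 * W * 2 ^ 8 / x ^ 2 := by
        have : 0 ≤ 6 * C₁ * C₂ ^ 2 * W := by positivity
        gcongr
      rw [e]
      refine (add_le_add e3 s2).trans (le_of_eq ?_)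
      ring
  refine s1.trans ?_
  have e : (1536 * C₁ * C₂ ^ 2 + 48 * C₂ ^ 3 + 8 * C₂) * W / x ^ 2 ≤
      (1536 * C₁ * C₂ ^ 2 + 48 * C₂ ^ 3 + 8 * C₂) * W / K ^ 2 := by
    have : 0 ≤ 1536 * C₁ * C₂ ^ 2 + 48 * C₂ ^ 3 + 8 * C₂ := by positivity
    gcongr
  refine (add_le_add le_rfl e).trans (le_of_eq ?_)
  ring

end

section

/-! ### Major arcs and the singular series -/

variable {n : ℕ} {A : Fin n → Fin n → Fin n → Fin n → ℤ}

theorem floor_div_eq_iff {δ t : ℝ} (hδ : 0 < δ) (u : ℤ) :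
    ⌊t / δ⌋ = u ↔ t ∈ Set.Ico (δ * u) (δ * (u + 1)) := by
  rw [Int.floor_eq_iff, le_div_iff₀ hδ, div_lt_iff₀ hδ, Set.mem_Ico, mul_comm (u : ℝ),
    mul_comm (u + 1 : ℝ)]

theorem integral_floor_div {ι E : Type*} [Fintype ι] [NormedAddCommGroup E] [NormedSpace ℝ E]
    [CompleteSpace E]
    {δ : ι → ℝ} (hδ : ∀ i, 0 < δ i) (g : (ι → ℤ) → E) (s : Finset (ι → ℤ))
    (hs : ∀ u, g u ≠ 0 → u ∈ s) :
    ∫ t : ι → ℝ, g (fun i => ⌊t i / δ i⌋) = (∏ i, δ i) • ∑ u ∈ s, g u := by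
  classical
  have h1 : ∀ t : ι → ℝ, g (fun i => ⌊t i / δ i⌋) = ∑ u ∈ s,
      (Set.univ.pi fun i => Set.Ico (δ i * u i) (δ i * (u i + 1))).indicator (fun _ => g u) t := by
    intro t
    have h2 : ∀ u ∈ s, (Set.univ.pi fun i => Set.Ico (δ i * u i) (δ i * (u i + 1))).indicator
        (fun _ => g u) t = if (fun i => ⌊t i / δ i⌋) = u then g u else 0 := by
      intro u _
      rw [Set.indicator_apply]
      refine if_congr ?_ rfl rfl
      simp only [Set.mem_univ_pi, funext_iff, floor_div_eq_iff (hδ _)]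
    rw [Finset.sum_congr rfl h2, Finset.sum_ite_eq]
    split_ifs with h3
    · rfl
    · by_contra h4
      exact h3 (hs _ h4)
  have hmeas : ∀ u : ι → ℤ,
      MeasurableSet (Set.univ.pi fun i => Set.Ico (δ i * u i) (δ i * (u i + 1))) :=
    fun u => MeasurableSet.univ_pi fun i => measurableSet_Ico
  have hvol : ∀ u : ι → ℤ, volume (Set.univ.pi fun i => Set.Ico (δ i * u i) (δ i * (u i + 1))) =
      ENNReal.ofReal (∏ i, δ i) := by
    intro u
    rw [Real.volume_pi_Ico, ENNReal.ofReal_prod_of_nonneg fun i _ => (hδ i).le]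
    refine Finset.prod_congr rfl fun i _ => ?_
    congr 1
    ring
  simp_rw [h1]
  rw [integral_finsetSum, Finset.smul_sum]
  · refine Finset.sum_congr rfl fun u _ => ?_
    rw [integral_indicator_const _ (hmeas u), measureReal_def, hvol,
      ENNReal.toReal_ofReal (Finset.prod_nonneg fun i _ => (hδ i).le)]
  · intro u _
    rw [integrable_indicator_iff (hmeas u)]
    exact integrableOn_const (by rw [hvol]; exact ENNReal.ofReal_ne_top)

/-- Convergence of lattice Riemann sums with variable integrands. -/
theorem tendsto_riemann_sum {ι κ E : Type*} [Fintype ι] [NormedAddCommGroup E] [NormedSpace ℝ E]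
    [CompleteSpace E]
    {l : Filter κ} [l.IsCountablyGenerated] {δ : κ → ι → ℝ}
    (hδ : ∀ᶠ k in l, ∀ i, 0 < δ k i ∧ δ k i ≤ 1) (g : κ → (ι → ℤ) → E) (M B : ℝ)
    (hM : ∀ᶠ k in l, ∀ u, ‖g k u‖ ≤ M) (s : κ → Finset (ι → ℤ))
    (hs : ∀ᶠ k in l, ∀ u, g k u ≠ 0 → u ∈ s k ∧ ∀ i, |δ k i * u i| ≤ B) (G : (ι → ℝ) → E)
    (hlim : ∀ᵐ t : ι → ℝ, Tendsto (fun k => g k fun i => ⌊t i / δ k i⌋) l (nhds (G t))) :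
    Tendsto (fun k => (∏ i, δ k i) • ∑ u ∈ s k, g k u) l (nhds (∫ t, G t)) := by
  have h1 : Tendsto (fun k => ∫ t : ι → ℝ, g k (fun i => ⌊t i / δ k i⌋)) l (nhds (∫ t, G t)) := by
    refine tendsto_integral_filter_of_dominated_convergence
      ((Set.univ.pi fun _ : ι => Set.Icc (-(B + 1)) (B + 1)).indicator fun _ => M) ?_ ?_ ?_ hlim
    · refine Eventually.of_forall fun k => ?_
      have h2 : Measurable fun t : ι → ℝ => fun i => ⌊t i / δ k i⌋ :=
        measurable_pi_lambda _ fun i =>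
          Int.measurable_floor.comp ((measurable_pi_apply i).div_const _)
      exact (StronglyMeasurable.of_discrete (f := g k)).comp_measurable h2 |>.aestronglyMeasurable
    · filter_upwards [hδ, hM, hs] with k hk1 hk2 hk3
      refine Eventually.of_forall fun t => ?_
      by_cases h3 : g k (fun i => ⌊t i / δ k i⌋) = 0
      · rw [h3, norm_zero]
        exact Set.indicator_nonneg (fun _ _ => (norm_nonneg _).trans (hk2 0)) _
      · rw [Set.indicator_of_mem]
        · exact hk2 _
        · refine Set.mem_univ_pi.2 fun i => ?_
          have h4 := abs_le.1 ((hk3 _ h3).2 i)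
          have h5 := (floor_div_eq_iff (hk1 i).1 ⌊t i / δ k i⌋ (t := t i)).1 rfl
          have h6 := (hk1 i).2
          constructor
          · linarith [h5.1, h4.1]
          · linarith [h5.2, h4.2]
    · rw [integrable_indicator_iff (MeasurableSet.univ_pi fun i => measurableSet_Icc)]
      exact integrableOn_const (isCompact_univ_pi fun i => isCompact_Icc).measure_lt_top.ne
  refine h1.congr' ?_
  filter_upwards [hδ, hs] with k hk1 hk3
  exact integral_floor_div (fun i => (hk1 i).1) _ _ fun u hu => (hk3 u hu).1

theorem tendsto_mul_floor_div {κ : Type*} {l : Filter κ} {δ : κ → ℝ} (hδ : ∀ᶠ k in l, 0 < δ k)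
    (hδ0 : Tendsto δ l (nhds 0)) (t : ℝ) : Tendsto (fun k => δ k * ⌊t / δ k⌋) l (nhds t) := by
  have h1 : Tendsto (fun k => t - δ k) l (nhds t) := by simpa using hδ0.const_sub t
  refine tendsto_of_tendsto_of_tendsto_of_le_of_le' h1 tendsto_const_nhds ?_ ?_
  · filter_upwards [hδ] with k hk
    have := ((floor_div_eq_iff hk ⌊t / δ k⌋ (t := t)).1 rfl).2
    linarith
  · filter_upwards [hδ] with k hk
    exact ((floor_div_eq_iff hk ⌊t / δ k⌋ (t := t)).1 rfl).1

theorem tendsto_residue_sum {κ E : Type*} [NormedAddCommGroup E] [NormedSpace ℝ E]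
    [CompleteSpace E] {l : Filter κ} [l.IsCountablyGenerated] {T : κ → ℝ} (hT : Tendsto T l atTop)
    {q : ℕ} (hq : 1 ≤ q) (b : Fin n → Fin q) (f : κ → (Fin n → ℝ) → E) (M B : ℝ)
    (hM : ∀ᶠ k in l, ∀ z, ‖f k z‖ ≤ M) (hB : ∀ᶠ k in l, ∀ z, f k z ≠ 0 → ∀ i, |z i| ≤ B)
    (s : κ → Finset (Fin n → ℤ))
    (hs : ∀ᶠ k in l, ∀ u : Fin n → ℤ, f k (fun i => ((b i : ℕ) + q * u i) / T k) ≠ 0 → u ∈ s k)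
    (G : (Fin n → ℝ) → E) (hlim : ∀ᵐ t : Fin n → ℝ, ∀ z : κ → Fin n → ℝ,
      Tendsto z l (nhds t) → Tendsto (fun k => f k (z k)) l (nhds (G t))) :
    Tendsto (fun k => ((q : ℝ) / T k) ^ n • ∑ u ∈ s k, f k fun i => ((b i : ℕ) + q * u i) / T k) l
      (nhds (∫ t, G t)) := by
  have hq0 : (0 : ℝ) < q := by exact_mod_cast hq
  have hδ : ∀ᶠ k in l, 0 < (q : ℝ) / T k ∧ (q : ℝ) / T k ≤ 1 := by
    filter_upwards [hT.eventually_ge_atTop (q : ℝ)] with k hk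
    have : 0 < T k := hq0.trans_le hk
    exact ⟨by positivity, by rwa [div_le_one this]⟩
  have hδ0 : Tendsto (fun k => (q : ℝ) / T k) l (nhds 0) := hT.const_div_atTop _
  have h := tendsto_riemann_sum (ι := Fin n) (δ := fun k _ => (q : ℝ) / T k)
    (hδ.mono fun k hk _ => hk) (fun k u => f k fun i => ((b i : ℕ) + q * u i) / T k) M (B + 1)
    (hM.mono fun k hk u => hk _) s ?_ G ?_
  · simpa only [Finset.prod_const, Finset.card_univ, Fintype.card_fin] using h
  · filter_upwards [hs, hB, hδ, hT.eventually_gt_atTop 0] with k hk1 hk2 hk3 hk4 u hu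
    refine ⟨hk1 u hu, fun i => ?_⟩
    have h1 := hk2 _ hu i
    have h2 : (q : ℝ) / T k * u i = ((b i : ℕ) + q * u i) / T k - (b i : ℕ) / T k := by ring
    have h3 : |((b i : ℕ) : ℝ) / T k| ≤ 1 := by
      rw [abs_of_nonneg (by positivity)]
      refine le_trans ?_ hk3.2
      have : ((b i : ℕ) : ℝ) ≤ q := by exact_mod_cast (b i).2.le
      gcongr
    rw [h2]
    exact (abs_sub _ _).trans (add_le_add h1 h3)
  · filter_upwards [hlim] with t ht
    refine ht _ (tendsto_pi_nhds.2 fun i => ?_)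
    have h1 : Tendsto (fun k => ((b i : ℕ) : ℝ) / T k) l (nhds 0) := hT.const_div_atTop _
    have h2 := h1.add (tendsto_mul_floor_div (hδ.mono fun k hk => hk.1) hδ0 (t i))
    rw [zero_add] at h2
    refine h2.congr fun k => ?_
    ring

/-- Splitting a sum over a box into residue classes. -/
theorem sum_ibox_eq_sum_residue {E : Type*} [AddCommMonoid E] {q : ℕ} (hq : 1 ≤ q) (X : ℤ)
    (h : (Fin n → ℤ) → E) :
    ∑ x ∈ ibox n X, h x = ∑ b : Fin n → Fin q, ∑ u ∈ ibox n X,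
      if (∀ i, |((b i : ℕ) : ℤ) + q * u i| ≤ X) then h fun i => ((b i : ℕ) : ℤ) + q * u i else 0 := by
  have hq0 : (0 : ℤ) < q := by exact_mod_cast hq
  rw [← Finset.sum_product', ← Finset.sum_filter]
  symm
  refine Finset.sum_nbij' (fun p i => ((p.1 i : ℕ) : ℤ) + q * p.2 i)
    (fun x => (fun i => ⟨(x i % q).toNat, by
      have h1 := Int.emod_nonneg (x i) hq0.ne'
      have h2 := Int.emod_lt_of_pos (x i) hq0
      omega⟩, fun i => x i / q)) ?_ ?_ ?_ ?_ ?_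
  · rintro ⟨b, u⟩ hp
    exact mem_ibox.2 (Finset.mem_filter.1 hp).2
  · intro x hx
    have hx' := mem_ibox.1 hx
    have h3 : ∀ i, (((x i % q).toNat : ℕ) : ℤ) + q * (x i / q) = x i := fun i => by
      rw [Int.toNat_of_nonneg (Int.emod_nonneg (x i) hq0.ne'), Int.emod_add_mul_ediv]
    simp only [Finset.mem_filter, Finset.mem_product, Finset.mem_univ, true_and]
    refine ⟨mem_ibox.2 fun i => ?_, fun i => by rw [h3]; exact hx' i⟩
    have h4 := abs_le.1 (hx' i)
    rw [abs_le]
    constructor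
    · rw [Int.le_ediv_iff_mul_le hq0]
      nlinarith
    · exact Int.ediv_le_of_le_mul hq0 (by nlinarith)
  · rintro ⟨b, u⟩ hp
    refine Prod.ext (funext fun i => Fin.ext ?_) (funext fun i => ?_)
    · have h1 : (((b i : ℕ) : ℤ) + q * u i) % q = (b i : ℕ) := by
        rw [Int.add_mul_emod_self_left, Int.emod_eq_of_lt (by positivity)
          (by exact_mod_cast (b i).2)]
      simp [h1]
    · have h1 : (((b i : ℕ) : ℤ) + q * u i) / q = u i := by
        rw [Int.add_mul_ediv_left _ _ hq0.ne', Int.ediv_eq_zero_of_lt (by positivity)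
          (by exact_mod_cast (b i).2), zero_add]
      exact h1
  · intro x hx
    funext i
    dsimp only
    rw [Int.toNat_of_nonneg (Int.emod_nonneg (x i) hq0.ne'), Int.emod_add_mul_ediv]
  · intro p hp
    rfl

theorem measurableSet_box (n : ℕ) (κ : ℝ) : MeasurableSet (box n κ) :=
  MeasurableSet.univ_pi fun _ => measurableSet_Icc

/-- The inner oscillatory integral over the box in `x`. -/
def oscInt (A : Fin n → Fin n → Fin n → Fin n → ℤ) (γ : ℝ) (y : Fin n → ℝ) : ℂ :=
  ∫ x in box n 1, ee (γ * biFormR A x y)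

theorem continuous_biFormR (A : Fin n → Fin n → Fin n → Fin n → ℤ) :
    Continuous fun p : (Fin n → ℝ) × (Fin n → ℝ) => biFormR A p.1 p.2 := by
  unfold biFormR
  fun_prop

theorem ae_abs_ne (c : ℝ) : ∀ᵐ t : Fin n → ℝ, ∀ i, |t i| ≠ c := by
  rw [ae_all_iff]
  intro i
  have h : ∀ r : ℝ, ∀ᵐ t : Fin n → ℝ, t i ≠ r := by
    intro r
    have h1 : volume {t : Fin n → ℝ | t i = r} = 0 := by
      rw [volume_pi]
      exact Measure.pi_hyperplane (fun _ : Fin n => (volume : Measure ℝ)) i r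
    exact compl_mem_ae_iff.2 h1
  filter_upwards [h c, h (-c)] with t h1 h2 h3
  rcases eq_or_eq_neg_of_abs_eq h3 with h4 | h4
  · exact h1 h4
  · exact h2 h4

theorem eventually_box_iff {κ : Type*} {l : Filter κ} {z : κ → Fin n → ℝ} {t : Fin n → ℝ}
    (hz : Tendsto z l (nhds t)) {c : ℝ} (ht : ∀ i, |t i| ≠ c) :
    ∀ᶠ k in l, (∀ i, |z k i| ≤ c) ↔ ∀ i, |t i| ≤ c := by
  have h1 : ∀ i, ∀ᶠ k in l, |z k i| ≤ c ↔ |t i| ≤ c := by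
    intro i
    have h2 := ((tendsto_pi_nhds.1 hz) i).abs
    rcases lt_or_gt_of_ne (ht i) with h3 | h3
    · filter_upwards [h2.eventually_lt_const h3] with k hk
      exact ⟨fun _ => h3.le, fun _ => hk.le⟩
    · filter_upwards [h2.eventually_const_lt h3] with k hk
      exact ⟨fun h => absurd h (not_le.2 hk), fun h => absurd h (not_le.2 h3)⟩
  filter_upwards [eventually_all.2 h1] with k hk
  exact forall_congr' hk

/-- The normalised inner sum over a residue class. -/
def oscSum (A : Fin n → Fin n → Fin n → Fin n → ℤ) (γ : ℝ) (X : ℕ) {q : ℕ} (b : Fin n → Fin q)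
    (z : Fin n → ℝ) : ℂ :=
  ((q : ℝ) / X) ^ n • ∑ u ∈ ibox n X, if (∀ i, |((b i : ℕ) : ℤ) + q * u i| ≤ X) then
    ee (γ * biFormR A (fun i => ((b i : ℕ) + q * u i) / (X : ℝ)) z) else 0

theorem mem_of_abs_residue_le {X : ℤ} {q : ℕ} (b : Fin n → Fin q) {u : Fin n → ℤ}
    (h : ∀ i, |((b i : ℕ) : ℤ) + q * u i| ≤ X) : u ∈ ibox n X := by
  refine mem_ibox.2 fun i => ?_
  have h1 := abs_le.1 (h i)
  have h2 : ((b i : ℕ) : ℤ) < q := by exact_mod_cast (b i).2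
  have h3 : (0 : ℤ) ≤ ((b i : ℕ) : ℤ) := by positivity
  rw [abs_le]
  constructor <;> by_contra h4 <;> push Not at h4 <;> nlinarith

theorem tendsto_oscSum {κ : Type*} {l : Filter κ} [l.IsCountablyGenerated]
    (A : Fin n → Fin n → Fin n → Fin n → ℤ) (γ : ℝ) {X : κ → ℕ} (hX : Tendsto X l atTop)
    {q : ℕ} (hq : 1 ≤ q) (b : Fin n → Fin q) {z : κ → Fin n → ℝ} {y : Fin n → ℝ}
    (hz : Tendsto z l (nhds y)) :
    Tendsto (fun k => oscSum A γ (X k) b (z k)) l (nhds (oscInt A γ y)) := by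
  classical
  have hT : Tendsto (fun k => (X k : ℝ)) l atTop := tendsto_natCast_atTop_atTop.comp hX
  have key : ∀ᶠ k in l, ∀ u : Fin n → ℤ, (∀ i, |(((b i : ℕ) : ℝ) + q * u i) / (X k : ℝ)| ≤ 1) ↔
      ∀ i, |((b i : ℕ) : ℤ) + q * u i| ≤ (X k : ℤ) := by
    filter_upwards [hT.eventually_gt_atTop 0] with k hk u
    refine forall_congr' fun i => ?_
    rw [abs_div, abs_of_pos hk, div_le_one hk]
    exact_mod_cast Iff.rfl
  have h := tendsto_residue_sum hT hq b (fun k w => if (∀ i, |w i| ≤ 1) then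
    ee (γ * biFormR A w (z k)) else 0) 1 1 ?_ ?_ (fun k => ibox n (X k)) ?_
    ((box n 1).indicator fun x => ee (γ * biFormR A x y)) ?_
  · rw [integral_indicator (measurableSet_box n 1)] at h
    refine h.congr' ?_
    filter_upwards [key] with k hk
    rw [oscSum]
    congr 1
    exact Finset.sum_congr rfl fun u _ => if_congr (hk u) rfl rfl
  · refine Eventually.of_forall fun k w => ?_
    split_ifs
    · rw [norm_ee]
    · simp
  · refine Eventually.of_forall fun k w hw => ?_
    by_contra h1
    exact hw (if_neg h1)
  · filter_upwards [key] with k hk u hu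
    by_contra h1
    refine hu (if_neg fun h2 => h1 ?_)
    exact mem_of_abs_residue_le b ((hk u).1 h2)
  · filter_upwards [ae_abs_ne 1] with t ht w hw
    have h1 : (box n 1).indicator (fun x => ee (γ * biFormR A x y)) t =
        if (∀ i, |t i| ≤ 1) then ee (γ * biFormR A t y) else 0 := by
      rw [Set.indicator_apply]
      refine if_congr ?_ rfl rfl
      simp only [box, Set.mem_univ_pi, Set.mem_Icc, abs_le]
    rw [h1]
    have h2 : Tendsto (fun k => if (∀ i, |t i| ≤ 1) then ee (γ * biFormR A (w k) (z k)) else 0) l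
        (nhds (if (∀ i, |t i| ≤ 1) then ee (γ * biFormR A t y) else 0)) := by
      split_ifs
      · exact (continuous_ee.tendsto _).comp (((continuous_biFormR A).tendsto (t, y)).comp
          (hw.prodMk_nhds hz) |>.const_mul γ)
      · exact tendsto_const_nhds
    refine h2.congr' ?_
    filter_upwards [eventually_box_iff hw ht] with k hk
    exact if_congr hk.symm rfl rfl

theorem norm_oscSum_le (A : Fin n → Fin n → Fin n → Fin n → ℤ) (γ : ℝ) {X : ℕ} {q : ℕ}
    (hX : 1 ≤ X) (b : Fin n → Fin q) (z : Fin n → ℝ) :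
    ‖oscSum A γ X b z‖ ≤ (3 * q) ^ n := by
  have hX0 : (0 : ℝ) < X := by exact_mod_cast hX
  rw [oscSum, norm_smul, norm_pow, Real.norm_of_nonneg (by positivity)]
  have h1 : ‖∑ u ∈ ibox n X, (if (∀ i, |((b i : ℕ) : ℤ) + q * u i| ≤ X) then
      ee (γ * biFormR A (fun i => ((b i : ℕ) + q * u i) / (X : ℝ)) z) else 0)‖ ≤
      (3 * (X : ℝ)) ^ n := by
    refine (norm_sum_le _ _).trans ((Finset.sum_le_sum (g := fun _ => (1 : ℝ)) fun u _ => ?_).trans ?_)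
    · split_ifs
      · rw [norm_ee]
      · simp
    · rw [Finset.sum_const, nsmul_one]
      exact card_ibox_le n X hX
  calc _ ≤ ((q : ℝ) / X) ^ n * (3 * (X : ℝ)) ^ n := by gcongr
    _ = _ := by rw [← mul_pow]; congr 1; field_simp

/-- A product of unit tents centred at `p`. -/
def hat (p y : Fin n → ℝ) : ℝ := ∏ i, tent 1 (p i) (y i)

theorem hat_nonneg (p y : Fin n → ℝ) : 0 ≤ hat p y := Finset.prod_nonneg fun _ _ => tent_nonneg _ _ _

theorem hat_le_one (p y : Fin n → ℝ) : hat p y ≤ 1 :=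
  Finset.prod_le_one (fun _ _ => tent_nonneg _ _ _) fun _ _ => tent_le_one one_pos _ _

theorem continuous_hat (p : Fin n → ℝ) : Continuous (hat p) := by
  unfold hat tent
  fun_prop

theorem abs_sub_lt_of_hat_ne_zero {p y : Fin n → ℝ} (h : hat p y ≠ 0) (i : Fin n) :
    |y i - p i| < 1 := by
  by_contra h1
  exact h (Finset.prod_eq_zero (Finset.mem_univ i) (tent_eq_zero one_pos (not_lt.1 h1)))

theorem tent_scale {H : ℝ} (hH : 0 < H) (p t : ℝ) : tent H (p * H) t = tent 1 p (t / H) := by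
  unfold tent
  have h : t / H - p = (t - p * H) / H := by field_simp
  rw [div_one, h, abs_div, abs_of_pos hH]

/-- The radius of a box containing the support of the scaled tents. -/
def tentR (D H : ℝ) : ℤ := ⌈(D + 1) * H⌉

theorem isTent_tentR {D H : ℝ} (hH : 1 ≤ H) {p : Fin n → ℝ} (hp : ∀ i, |p i| ≤ D) :
    IsTent D H (fun i => p i * H) (tentR D H) := by
  refine ⟨hH, fun i => ?_, Int.le_ceil _, (Int.ceil_lt_add_one _).le⟩
  rw [abs_mul, abs_of_pos (by linarith : 0 < H)]
  exact mul_le_mul_of_nonneg_right (hp i) (by linarith)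

theorem biFormR_div (A : Fin n → Fin n → Fin n → Fin n → ℤ) (X H : ℝ) (x y : Fin n → ℤ) :
    biFormR A (fun i => (x i : ℝ) / X) (fun i => (y i : ℝ) / H) =
      (biForm A x y : ℝ) / (X * H) ^ 2 := by
  unfold biFormR biForm
  push_cast
  simp_rw [Finset.sum_div]
  refine Finset.sum_congr rfl fun i _ => Finset.sum_congr rfl fun j _ =>
    Finset.sum_congr rfl fun k _ => Finset.sum_congr rfl fun l _ => ?_
  simp only [div_eq_mul_inv, mul_pow, mul_inv]
  ring

theorem exists_biForm_add_mul (A : Fin n → Fin n → Fin n → Fin n → ℤ) (q : ℕ)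
    (b u d v : Fin n → ℤ) : ∃ t : ℤ,
    biForm A (fun i => b i + q * u i) (fun i => d i + q * v i) = biForm A b d + q * t := by
  have h : (biForm A (fun i => b i + q * u i) (fun i => d i + q * v i) : ZMod q) =
      (biForm A b d : ZMod q) := by
    unfold biForm
    push_cast
    simp
  rw [eq_comm, ZMod.intCast_eq_intCast_iff_dvd_sub] at h
  obtain ⟨t, ht⟩ := h
  exact ⟨t, by linarith⟩

/-- The complete exponential sum for a fixed numerator. -/
def expS (A : Fin n → Fin n → Fin n → Fin n → ℤ) (q : ℕ) (a : ℤ) : ℂ :=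
  ∑ x : Fin n → Fin q, ∑ y : Fin n → Fin q,
    ee (((a * biForm A (fun i => ((x i : ℕ) : ℤ)) (fun i => ((y i : ℕ) : ℤ)) : ℤ) : ℝ) / q)

/-- The local factor at infinity attached to a weight on `y`. -/
def psiInt (A : Fin n → Fin n → Fin n → Fin n → ℤ) (ψ : (Fin n → ℝ) → ℝ) (γ : ℝ) : ℂ :=
  ∫ y, ψ y • oscInt A γ y

/-- The full weighted exponential sum. -/
def arcSum (A : Fin n → Fin n → Fin n → Fin n → ℤ) (D : ℝ) (p : Fin n → ℝ) (X : ℕ) (H α : ℝ) : ℂ :=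
  ∑ x ∈ ibox n X, expY A (fun i m => tent H (p i * H) m) (tentR D H) α x

theorem ee_phase (A : Fin n → Fin n → Fin n → Fin n → ℤ) {q : ℕ} (hq : 1 ≤ q) (a : ℤ)
    (γ X H : ℝ) (b d : Fin n → Fin q) (u v : Fin n → ℤ) :
    ee ((a / q + γ / (X * H) ^ 2) * biForm A (fun i => ((b i : ℕ) : ℤ) + q * u i)
      (fun i => ((d i : ℕ) : ℤ) + q * v i)) =
    ee (((a * biForm A (fun i => ((b i : ℕ) : ℤ)) (fun i => ((d i : ℕ) : ℤ)) : ℤ) : ℝ) / q) *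
      ee (γ * biFormR A (fun i => ((b i : ℕ) + q * u i) / X)
        (fun i => ((d i : ℕ) + q * v i) / H)) := by
  have h1 := biFormR_div A X H (fun i => ((b i : ℕ) : ℤ) + q * u i)
    (fun i => ((d i : ℕ) : ℤ) + q * v i)
  push_cast at h1
  rw [h1, add_mul, ee_add]
  congr 1
  · obtain ⟨t, ht⟩ := exists_biForm_add_mul A q (fun i => ((b i : ℕ) : ℤ)) u
      (fun i => ((d i : ℕ) : ℤ)) v
    rw [ht]
    have hq0 : (q : ℝ) ≠ 0 := by positivity
    have h2 : (a / q : ℝ) * ((biForm A (fun i => ((b i : ℕ) : ℤ)) (fun i => ((d i : ℕ) : ℤ)) +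
        q * t : ℤ) : ℝ) = ((a * biForm A (fun i => ((b i : ℕ) : ℤ))
          (fun i => ((d i : ℕ) : ℤ)) : ℤ) : ℝ) / q + ((a * t : ℤ) : ℝ) := by
      push_cast
      field_simp
    rw [h2, ee_add_int]
  · congr 1
    ring

theorem arcSum_eq (A : Fin n → Fin n → Fin n → Fin n → ℤ) {D : ℝ} {p : Fin n → ℝ}
    (hp : ∀ i, |p i| ≤ D) {X : ℕ} (hX : 1 ≤ X) {H : ℝ} (hH : 0 < H) {q : ℕ} (hq : 1 ≤ q)
    (a : ℤ) (γ : ℝ) :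
    arcSum A D p X H (a / q + γ / (X * H) ^ 2) / (X * H) ^ n =
      ∑ d : Fin n → Fin q, ∑ b : Fin n → Fin q,
        ee (((a * biForm A (fun i => ((b i : ℕ) : ℤ)) (fun i => ((d i : ℕ) : ℤ)) : ℤ) : ℝ) / q) /
          (q : ℂ) ^ (2 * n) * (((q : ℝ) / H) ^ n • ∑ v ∈ ibox n (tentR D H),
            (hat p fun i => ((d i : ℕ) + q * v i) / H) •
              oscSum A γ X b fun i => ((d i : ℕ) + q * v i) / H) := by
  have hX0 : (X : ℂ) ≠ 0 := by
    have : X ≠ 0 := by omega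
    exact_mod_cast this
  have hH0 : (H : ℂ) ≠ 0 := by exact_mod_cast hH.ne'
  have hq0 : (q : ℂ) ≠ 0 := by
    have : q ≠ 0 := by omega
    exact_mod_cast this
  unfold arcSum expY
  rw [Finset.sum_comm, sum_ibox_eq_sum_residue hq, Finset.sum_div]
  refine Finset.sum_congr rfl fun d _ => ?_
  simp_rw [Finset.smul_sum, Finset.mul_sum]
  rw [Finset.sum_comm, Finset.sum_div]
  refine Finset.sum_congr rfl fun v _ => ?_
  have hw : ∏ i, tent H (p i * H) (((d i : ℕ) : ℤ) + q * v i : ℤ) =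
      hat p fun i => ((d i : ℕ) + q * v i) / H := by
    refine Finset.prod_congr rfl fun i _ => ?_
    rw [tent_scale hH]
    push_cast
    rfl
  split_ifs with hif
  · rw [sum_ibox_eq_sum_residue hq, Finset.sum_div]
    refine Finset.sum_congr rfl fun b _ => ?_
    rw [oscSum, Finset.smul_sum, Finset.smul_sum, Finset.smul_sum, Finset.mul_sum, Finset.sum_div]
    refine Finset.sum_congr rfl fun u _ => ?_
    split_ifs with hu
    · rw [ee_phase A hq, hw]
      simp only [Complex.real_smul]
      push_cast
      generalize ee _ = e1
      generalize ee _ = e2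
      rw [two_mul, pow_add, mul_pow, div_pow, div_pow]
      field_simp
    · simp
  · have h0 : (hat p fun i => ((d i : ℕ) + q * v i) / H) = 0 := by
      by_contra h1
      push Not at hif
      obtain ⟨i, hi⟩ := hif
      have h2 := abs_sub_lt_of_hat_ne_zero h1 i
      have h3 : |(((d i : ℕ) + q * v i) / H : ℝ)| ≤ D + 1 := by
        have := abs_sub_abs_le_abs_sub (((d i : ℕ) + q * v i) / H : ℝ) (p i)
        linarith [hp i]
      rw [abs_div, abs_of_pos hH, div_le_iff₀ hH] at h3
      have h4 : (tentR D H : ℝ) < |((d i : ℕ) + q * v i : ℝ)| := by exact_mod_cast hi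
      have h5 : (D + 1) * H ≤ tentR D H := Int.le_ceil _
      linarith
    simp [h0]

theorem tentR_le {D H : ℝ} (hH : 1 ≤ H) : (tentR D H : ℝ) ≤ (D + 2) * H := by
  have := (Int.ceil_lt_add_one ((D + 1) * H)).le
  unfold tentR
  linarith

theorem le_tentR {D H : ℝ} : (D + 1) * H ≤ tentR D H := Int.le_ceil _

theorem one_le_tentR {D H : ℝ} (hD : 0 ≤ D) (hH : 1 ≤ H) : 1 ≤ tentR D H := by
  have h1 : (1 : ℝ) ≤ tentR D H := le_trans (by nlinarith) le_tentR
  exact_mod_cast h1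

theorem card_ibox_tentR_le {D H : ℝ} (hD : 0 ≤ D) (hH : 1 ≤ H) :
    ((ibox n (tentR D H)).card : ℝ) ≤ (3 * ((D + 2) * H)) ^ n := by
  have h1 := one_le_tentR hD hH
  obtain ⟨m, hm⟩ := Int.eq_ofNat_of_zero_le (by omega : 0 ≤ tentR D H)
  have h2 := tentR_le (D := D) hH
  rw [hm] at h1 h2 ⊢
  refine (card_ibox_le n m (by exact_mod_cast h1)).trans ?_
  have h3 : (m : ℝ) ≤ (D + 2) * H := by exact_mod_cast h2
  gcongr

theorem tendsto_arcSum (A : Fin n → Fin n → Fin n → Fin n → ℤ) {D : ℝ} {p : Fin n → ℝ}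
    (hp : ∀ i, |p i| ≤ D) {κ : Type*} {l : Filter κ} [l.IsCountablyGenerated]
    {X : κ → ℕ} (hX : Tendsto X l atTop) {H : κ → ℝ} (hH : Tendsto H l atTop)
    {q : ℕ} (hq : 1 ≤ q) (a : ℤ) (γ : ℝ) :
    Tendsto (fun k => arcSum A D p (X k) (H k) (a / q + γ / (X k * H k) ^ 2) / (X k * H k) ^ n) l
      (nhds (expS A q a / (q : ℂ) ^ (2 * n) * psiInt A (hat p) γ)) := by
  have h1 : expS A q a / (q : ℂ) ^ (2 * n) * psiInt A (hat p) γ =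
      ∑ d : Fin n → Fin q, ∑ b : Fin n → Fin q,
        ee (((a * biForm A (fun i => ((b i : ℕ) : ℤ)) (fun i => ((d i : ℕ) : ℤ)) : ℤ) : ℝ) / q) /
          (q : ℂ) ^ (2 * n) * psiInt A (hat p) γ := by
    rw [expS, Finset.sum_comm, Finset.sum_div, Finset.sum_mul]
    refine Finset.sum_congr rfl fun d _ => ?_
    rw [Finset.sum_div, Finset.sum_mul]
  rw [h1]
  have h2 : Tendsto (fun k => ∑ d : Fin n → Fin q, ∑ b : Fin n → Fin q,
        ee (((a * biForm A (fun i => ((b i : ℕ) : ℤ)) (fun i => ((d i : ℕ) : ℤ)) : ℤ) : ℝ) / q) /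
          (q : ℂ) ^ (2 * n) * (((q : ℝ) / H k) ^ n • ∑ v ∈ ibox n (tentR D (H k)),
            (hat p fun i => ((d i : ℕ) + q * v i) / H k) •
              oscSum A γ (X k) b fun i => ((d i : ℕ) + q * v i) / H k)) l
      (nhds (∑ d : Fin n → Fin q, ∑ b : Fin n → Fin q,
        ee (((a * biForm A (fun i => ((b i : ℕ) : ℤ)) (fun i => ((d i : ℕ) : ℤ)) : ℤ) : ℝ) / q) /
          (q : ℂ) ^ (2 * n) * psiInt A (hat p) γ)) := by
    refine tendsto_finsetSum _ fun d _ => tendsto_finsetSum _ fun b _ => Tendsto.const_mul _ ?_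
    have hle : ∀ z : Fin n → ℝ, hat p z ≠ 0 → ∀ i, |z i| ≤ D + 1 := fun z hz i => by
      have := abs_sub_abs_le_abs_sub (z i) (p i)
      linarith [hp i, abs_sub_lt_of_hat_ne_zero hz i]
    refine tendsto_residue_sum hH hq d (fun k z => hat p z • oscSum A γ (X k) b z)
      ((3 * q) ^ n) (D + 1) ?_ ?_ _ ?_ _ ?_
    · filter_upwards [hX.eventually_ge_atTop 1] with k hk z
      rw [norm_smul, Real.norm_of_nonneg (hat_nonneg _ _)]
      exact (mul_le_of_le_one_left (norm_nonneg _) (hat_le_one _ _)).trans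
        (norm_oscSum_le A γ hk b z)
    · exact Eventually.of_forall fun k z hz => hle z fun h => hz (by rw [h, zero_smul])
    · filter_upwards [hH.eventually_gt_atTop 0] with k hk u hu
      refine mem_of_abs_residue_le d fun i => ?_
      have h3 := hle _ (fun h => hu (by rw [h, zero_smul])) i
      rw [abs_div, abs_of_pos hk, div_le_iff₀ hk] at h3
      have h4 := h3.trans (le_tentR (D := D))
      exact_mod_cast h4
    · refine Eventually.of_forall fun t z hz => ?_
      exact ((continuous_hat p).tendsto t |>.comp hz).smul (tendsto_oscSum A γ hX hq b hz)
  refine h2.congr' ?_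
  filter_upwards [hX.eventually_ge_atTop 1, hH.eventually_gt_atTop 0] with k hk1 hk2
  exact (arcSum_eq A hp hk1 hk2 hq a γ).symm

/-- The weighted exponential sum over nondegenerate `x`. -/
def arcSumDet (A : Fin n → Fin n → Fin n → Fin n → ℤ) (D : ℝ) (p : Fin n → ℝ) (X : ℕ)
    (H α : ℝ) : ℂ :=
  ∑ x ∈ ibox n X, if detFx A x ≠ 0 then
    expY A (fun i m => tent H (p i * H) m) (tentR D H) α x else 0

theorem norm_arcSumDet_le (A : Fin n → Fin n → Fin n → Fin n → ℤ) (D : ℝ) (p : Fin n → ℝ) (X : ℕ)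
    (H α : ℝ) : ‖arcSumDet A D p X H α‖ ≤ phiSum A X H (fun i => p i * H) (tentR D H) α := by
  refine (norm_sum_le _ _).trans (Finset.sum_le_sum fun x _ => ?_)
  split_ifs <;> simp

theorem continuous_arcSumDet (A : Fin n → Fin n → Fin n → Fin n → ℤ) (D : ℝ) (p : Fin n → ℝ)
    (X : ℕ) (H : ℝ) : Continuous (arcSumDet A D p X H) := by
  unfold arcSumDet
  refine continuous_finsetSum _ fun x _ => ?_
  split_ifs
  · exact continuous_expY A _ _ x
  · exact continuous_const

theorem norm_expY_tent_le (A : Fin n → Fin n → Fin n → Fin n → ℤ) {D H : ℝ} (hD : 0 ≤ D)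
    (hH : 1 ≤ H) (p : Fin n → ℝ) (α : ℝ) (x : Fin n → ℤ) :
    ‖expY A (fun i m => tent H (p i * H) m) (tentR D H) α x‖ ≤ (3 * ((D + 2) * H)) ^ n := by
  have hH0 : 0 < H := by linarith
  refine (norm_sum_le _ _).trans
    ((Finset.sum_le_sum (g := fun _ => (1 : ℝ)) fun y _ => ?_).trans ?_)
  · rw [norm_mul, norm_ee, mul_one, Complex.norm_real, Real.norm_of_nonneg
      (Finset.prod_nonneg fun _ _ => tent_nonneg _ _ _)]
    exact Finset.prod_le_one (fun _ _ => tent_nonneg _ _ _) fun _ _ => tent_le_one hH0 _ _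
  · rw [Finset.sum_const, nsmul_one]
    exact card_ibox_tentR_le hD hH

theorem phiSum_trivial_le (A : Fin n → Fin n → Fin n → Fin n → ℤ) {D H : ℝ} (hD : 0 ≤ D)
    (hH : 1 ≤ H) (p : Fin n → ℝ) {X : ℕ} (hX : 1 ≤ X) (α : ℝ) :
    phiSum A X H (fun i => p i * H) (tentR D H) α ≤ (9 * (D + 2)) ^ n * (X * H) ^ n := by
  refine (Finset.sum_le_card_nsmul _ _ ((3 * ((D + 2) * H)) ^ n) fun x _ => ?_).trans ?_
  · split_ifs
    · exact norm_expY_tent_le A hD hH p α x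
    · positivity
  · rw [nsmul_eq_mul]
    calc _ ≤ (3 * (X : ℝ)) ^ n * (3 * ((D + 2) * H)) ^ n := by
          gcongr
          exact card_ibox_le n X hX
      _ = _ := by rw [← mul_pow, ← mul_pow]; ring

theorem SmoothBiquad.exists_norm_arcSum_sub_le
    (hA : SmoothBiquad A) (hn : 0 < n) {D : ℝ} (hD : 0 ≤ D) : ∃ C : ℝ, ∀ (p : Fin n → ℝ) (X : ℕ)
    (H α : ℝ), 1 ≤ X → 1 ≤ H →
    ‖arcSum A D p X H α - arcSumDet A D p X H α‖ / (X * H) ^ n ≤ C / X := by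
  classical
  obtain ⟨C, hC⟩ := hA.exists_card_detFx_eq_zero_le hn
  refine ⟨C * (3 * (D + 2)) ^ n, fun p X H α hX hH => ?_⟩
  have hX0 : (0 : ℝ) < X := by exact_mod_cast hX
  have hH0 : 0 < H := by linarith
  rw [arcSum, arcSumDet, ← Finset.sum_sub_distrib]
  have h1 : ‖∑ x ∈ ibox n X, (expY A (fun i m => tent H (p i * H) m) (tentR D H) α x -
      if detFx A x ≠ 0 then expY A (fun i m => tent H (p i * H) m) (tentR D H) α x else 0)‖ ≤
      C * (X : ℝ) ^ (n - 1) * (3 * ((D + 2) * H)) ^ n := by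
    have h2 : ∀ x ∈ ibox n X, (expY A (fun i m => tent H (p i * H) m) (tentR D H) α x -
        if detFx A x ≠ 0 then expY A (fun i m => tent H (p i * H) m) (tentR D H) α x else 0) =
        if detFx A x = 0 then expY A (fun i m => tent H (p i * H) m) (tentR D H) α x else 0 := by
      intro x _
      by_cases h : detFx A x = 0 <;> simp [h]
    rw [Finset.sum_congr rfl h2, ← Finset.sum_filter]
    refine (norm_sum_le _ _).trans ((Finset.sum_le_card_nsmul _ _ _ fun x _ =>
      norm_expY_tent_le A hD hH p α x).trans ?_)
    rw [nsmul_eq_mul]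
    refine mul_le_mul_of_nonneg_right ?_ (by positivity)
    have h3 := hC X hX (ibox n X |>.filter fun x => detFx A x = 0) fun x hx => by
      rw [Finset.mem_filter] at hx
      exact ⟨mem_ibox.1 hx.1, hx.2⟩
    exact_mod_cast h3
  rw [div_le_div_iff₀ (by positivity) hX0]
  calc _ ≤ C * (X : ℝ) ^ (n - 1) * (3 * ((D + 2) * H)) ^ n * X := by gcongr
    _ = C * (3 * (D + 2)) ^ n * ((X : ℝ) ^ (n - 1) * X) * H ^ n := by simp only [mul_pow]; ring
    _ = _ := by rw [pow_sub_one_mul hn.ne', mul_pow (X : ℝ) H]; ring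

theorem SmoothBiquad.tendsto_arcSumDet (hA : SmoothBiquad A) (hn : 0 < n) {D : ℝ} {p : Fin n → ℝ}
    (hD : 0 ≤ D) (hp : ∀ i, |p i| ≤ D) {κ : Type*} {l : Filter κ} [l.IsCountablyGenerated]
    {X : κ → ℕ} (hX : Tendsto X l atTop) {H : κ → ℝ} (hH : Tendsto H l atTop)
    {q : ℕ} (hq : 1 ≤ q) (a : ℤ) (γ : ℝ) :
    Tendsto (fun k => arcSumDet A D p (X k) (H k) (a / q + γ / (X k * H k) ^ 2) /
      (X k * H k) ^ n) l (nhds (expS A q a / (q : ℂ) ^ (2 * n) * psiInt A (hat p) γ)) := by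
  obtain ⟨C, hC⟩ := hA.exists_norm_arcSum_sub_le hn hD
  have h1 : Tendsto (fun k => (arcSum A D p (X k) (H k) (a / q + γ / (X k * H k) ^ 2) -
      arcSumDet A D p (X k) (H k) (a / q + γ / (X k * H k) ^ 2)) / ((X k * H k : ℝ) : ℂ) ^ n) l
      (nhds 0) := by
    refine squeeze_zero_norm' ?_ ((tendsto_natCast_atTop_atTop.comp hX).const_div_atTop C)
    filter_upwards [hX.eventually_ge_atTop 1, hH.eventually_ge_atTop 1] with k hk1 hk2
    rw [norm_div, norm_pow, Complex.norm_real, Real.norm_of_nonneg (by positivity)]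
    exact hC p _ _ _ hk1 hk2
  have h2 := (tendsto_arcSum A hp hX hH hq a γ).sub h1
  rw [sub_zero] at h2
  refine h2.congr fun k => ?_
  push_cast
  ring

theorem volume_box_lt_top (κ : ℝ) : volume (box n κ) < ⊤ := by
  have : IsCompact (box n κ) := isCompact_univ_pi fun _ => isCompact_Icc
  exact this.measure_lt_top

theorem mem_box_iff {κ : ℝ} {y : Fin n → ℝ} : y ∈ box n κ ↔ ∀ i, |y i| ≤ κ := by
  simp only [box, Set.mem_pi, Set.mem_univ, forall_const, Set.mem_Icc, abs_le]

theorem volume_real_box {κ : ℝ} (hκ : 0 ≤ κ) : volume.real (box n κ) = (2 * κ) ^ n := by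
  rw [box, measureReal_def, volume_pi_pi]
  simp [Real.volume_Icc, ENNReal.toReal_ofReal (by linarith : 0 ≤ κ + κ), two_mul]

theorem oscInt_zero (A : Fin n → Fin n → Fin n → Fin n → ℤ) (y : Fin n → ℝ) :
    oscInt A 0 y = (2 : ℂ) ^ n := by
  simp only [oscInt, zero_mul, ee_zero]
  rw [setIntegral_const, volume_real_box zero_le_one]
  simp

theorem hasCompactSupport_hat (p : Fin n → ℝ) : HasCompactSupport (hat p) := by
  refine HasCompactSupport.of_support_subset_isCompact (K := Set.univ.pi fun i =>
    Set.Icc (p i - 1) (p i + 1)) (isCompact_univ_pi fun _ => isCompact_Icc) fun y hy => ?_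
  have := abs_sub_lt_of_hat_ne_zero (Function.mem_support.1 hy)
  simp only [Set.mem_pi, Set.mem_univ, forall_const, Set.mem_Icc]
  intro i
  have := abs_lt.1 (this i)
  constructor <;> linarith

theorem psiInt_hat_zero_ne_zero (A : Fin n → Fin n → Fin n → Fin n → ℤ) :
    psiInt A (hat 0) 0 ≠ 0 := by
  have h1 : 0 < ∫ y, hat (0 : Fin n → ℝ) y := by
    refine Continuous.integral_pos_of_hasCompactSupport_nonneg_nonzero (x := 0) (continuous_hat _)
      (hasCompactSupport_hat _) (fun y => hat_nonneg _ _) ?_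
    simp [hat, tent]
  simp only [psiInt, oscInt_zero]
  rw [integral_smul_const]
  simp [h1.ne']

theorem not_mem_arcs_div {q : ℕ} (hq : 1 ≤ q) {a : ℤ} (h : IsCoprime a q) {Q δ : ℝ} (hQ : Q < q)
    (hδ : δ < 1 / q) : (a / q : ℝ) ∉ arcs Q δ := by
  rintro ⟨r, hr1, hrQ, hr⟩
  have hq0 : (0 : ℝ) < q := by exact_mod_cast hq
  set m := round ((r : ℝ) * (a / q)) with hm
  have h1 : (r : ℤ) * a - q * m = 0 := by
    by_contra h2
    have h3 : (1 : ℝ) ≤ |((r * a - q * m : ℤ) : ℝ)| := by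
      rw [← Int.cast_abs]
      exact_mod_cast Int.one_le_abs h2
    have h4 : (r : ℝ) * (a / q) - m = ((r * a - q * m : ℤ) : ℝ) / q := by
      push_cast
      field_simp
    rw [h4, abs_div, abs_of_pos hq0, div_le_iff₀ hq0] at hr
    rw [lt_div_iff₀ hq0] at hδ
    linarith
  have h2 : (q : ℤ) ∣ r * a := ⟨m, by linarith⟩
  have h3 := h.symm.dvd_of_dvd_mul_right h2
  have h4 := Int.le_of_dvd (by exact_mod_cast hr1) h3
  have : (q : ℝ) ≤ r := by exact_mod_cast h4
  linarith

theorem norm_expS_le (A : Fin n → Fin n → Fin n → Fin n → ℤ) (q : ℕ) (a : ℤ) :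
    ‖expS A q a‖ ≤ (q : ℝ) ^ (2 * n) := by
  unfold expS
  refine (norm_sum_le _ _).trans ((Finset.sum_le_sum (g := fun _ => (q : ℝ) ^ n) fun x _ =>
    (norm_sum_le _ _).trans ?_).trans ?_)
  · simp [norm_ee]
  · simp [two_mul, pow_add]

theorem SmoothBiquad.exists_norm_expS_le_of_lt
    (hA : SmoothBiquad A) (hn : 35 < n) : ∃ C : ℝ, 1 ≤ C ∧ ∀ (q : ℕ) (a : ℤ) (k : ℝ), 1 ≤ q →
    IsCoprime a (q : ℤ) → 1 ≤ k → C * k ^ 3 < q →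
    ‖expS A q a‖ / (q : ℝ) ^ (2 * n) ≤ C / k ^ 8 := by
  obtain ⟨C, hC, h⟩ := hA.exists_phiSum_le hn le_rfl
  set c := ‖psiInt A (hat (0 : Fin n → ℝ)) 0‖ with hc
  have hc0 : 0 < c := norm_pos_iff.2 (psiInt_hat_zero_ne_zero A)
  refine ⟨max C (C / c), hC.trans (le_max_left _ _), fun q a k hq ha hk hkq => ?_⟩
  have hq0 : (0 : ℝ) < q := by exact_mod_cast hq
  have hkq' : C * k ^ 3 < q := lt_of_le_of_lt (by gcongr; exact le_max_left _ _) hkq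
  have h1 := hA.tendsto_arcSumDet (by omega) (p := 0) zero_le_one (by simp) (tendsto_id (α := ℕ))
    tendsto_natCast_atTop_atTop hq a 0
  have h2 := h1.norm
  have h3 : ‖expS A q a / (q : ℂ) ^ (2 * n) * psiInt A (hat 0) 0‖ ≤ C / k ^ 8 := by
    refine le_of_tendsto h2 ?_
    have h4 : Tendsto (fun P : ℕ => C * k ^ 3 / ((P : ℝ) * P) ^ 2) atTop (nhds 0) := by
      have h5 : Tendsto (fun P : ℕ => (P : ℝ)) atTop atTop := tendsto_natCast_atTop_atTop
      exact ((tendsto_pow_atTop two_ne_zero).comp (h5.atTop_mul_atTop₀ h5)).const_div_atTop _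
    filter_upwards [h4.eventually_lt_const (by positivity : (0 : ℝ) < 1 / q),
      tendsto_natCast_atTop_atTop.eventually_ge_atTop k, eventually_ge_atTop 1] with P hP1 hP2 hP3
    have hP4 : (1 : ℝ) ≤ P := by exact_mod_cast hP3
    have h6 := h P P (fun i => (0 : Fin n → ℝ) i * P) (tentR 1 P) (isTent_tentR hP4 (by simp))
      (by linarith) (a / q) k hk hP2 (not_mem_arcs_div hq ha hkq' hP1)
    have h7 := (norm_arcSumDet_le A 1 0 P P (a / q)).trans h6
    simp only [zero_div, add_zero, norm_div, norm_pow, norm_mul, id, RCLike.norm_natCast]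
    rw [Complex.norm_real, Real.norm_of_nonneg (by positivity), div_le_iff₀ (by positivity)]
    refine h7.trans (le_of_eq ?_)
    ring
  rw [norm_mul, norm_div, norm_pow, ← hc, RCLike.norm_natCast, ← le_div_iff₀ hc0] at h3
  refine h3.trans (le_trans (le_of_eq ?_) (div_le_div_of_nonneg_right (le_max_right C (C / c))
    (by positivity)))
  ring

theorem SmoothBiquad.exists_norm_expS_le
    (hA : SmoothBiquad A) (hn : 35 < n) : ∃ C : ℝ, 0 ≤ C ∧ ∀ (q : ℕ) (a : ℤ), 1 ≤ q →
    IsCoprime a (q : ℤ) → ‖expS A q a‖ / (q : ℝ) ^ (2 * n) ≤ C * (q : ℝ) ^ (-(8 / 3) : ℝ) := by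
  obtain ⟨C, hC, h⟩ := hA.exists_norm_expS_le_of_lt hn
  refine ⟨C * (2 * C) ^ (8 / 3 : ℝ), by positivity, fun q a hq ha => ?_⟩
  have hq0 : (0 : ℝ) < q := by exact_mod_cast hq
  have e1 : C * (2 * C) ^ (8 / 3 : ℝ) * (q : ℝ) ^ (-(8 / 3) : ℝ) =
      C / (q / (2 * C)) ^ (8 / 3 : ℝ) := by
    rw [Real.div_rpow (by positivity) (by positivity), Real.rpow_neg (by positivity)]
    field_simp
  rw [e1]
  rcases le_or_gt ((q : ℝ)) (2 * C) with hqC | hqC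
  · have h1 : ‖expS A q a‖ / (q : ℝ) ^ (2 * n) ≤ 1 :=
      div_le_one_of_le₀ (norm_expS_le A q a) (by positivity)
    refine h1.trans ?_
    rw [one_le_div (by positivity)]
    refine le_trans (Real.rpow_le_one (by positivity) ?_ (by norm_num)) hC
    rw [div_le_one (by positivity)]
    exact hqC
  · set k := (q / (2 * C) : ℝ) ^ (1 / 3 : ℝ) with hk
    have hqC1 : 1 ≤ q / (2 * C) := by
      rw [one_le_div (by positivity)]
      exact hqC.le
    have hk3 : k ^ 3 = q / (2 * C) := by
      rw [hk, ← Real.rpow_natCast, ← Real.rpow_mul (by positivity)]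
      norm_num
    have hk8 : k ^ 8 = (q / (2 * C)) ^ (8 / 3 : ℝ) := by
      rw [hk, ← Real.rpow_natCast, ← Real.rpow_mul (by positivity)]
      norm_num
    rw [← hk8]
    refine h q a k hq ha (Real.one_le_rpow hqC1 (by norm_num)) ?_
    rw [hk3]
    field_simp
    linarith

/-- The `q`-th term of the singular series. -/
def serTerm (A : Fin n → Fin n → Fin n → Fin n → ℤ) (q : ℕ) : ℂ :=
  ∑ a ∈ (Finset.range q).filter fun a => Nat.Coprime a q, expS A q a / (q : ℂ) ^ (2 * n)

theorem biSingSeries_eq (A : Fin n → Fin n → Fin n → Fin n → ℤ) :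
    biSingSeries A = ∑' q : ℕ+, serTerm A q := by
  unfold biSingSeries serTerm biExpSum
  refine tsum_congr fun q => ?_
  rw [Finset.mul_sum]
  refine Finset.sum_congr rfl fun a _ => ?_
  rw [zpow_neg, mul_comm, div_eq_mul_inv]
  rfl

theorem SmoothBiquad.summable_serTerm
    (hA : SmoothBiquad A) (hn : 35 < n) : Summable (serTerm A) := by
  obtain ⟨C, hC, h⟩ := hA.exists_norm_expS_le hn
  have h1 : Summable fun q : ℕ => C * (q : ℝ) ^ (-(5 / 3) : ℝ) :=
    (Real.summable_nat_rpow.2 (by norm_num)).mul_left C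
  refine Summable.of_norm_bounded h1 fun q => ?_
  rcases Nat.eq_zero_or_pos q with rfl | hq
  · simp only [serTerm, Finset.range_zero, Finset.filter_empty, Finset.sum_empty, norm_zero]
    positivity
  have hq0 : (0 : ℝ) < q := by exact_mod_cast hq
  refine (norm_sum_le _ _).trans ((Finset.sum_le_card_nsmul _ _ (C * (q : ℝ) ^ (-(8 / 3) : ℝ))
    fun a ha => ?_).trans ?_)
  · rw [norm_div, norm_pow, RCLike.norm_natCast]
    exact h q a hq (Nat.isCoprime_iff_coprime.2 (Finset.mem_filter.1 ha).2)
  · rw [nsmul_eq_mul]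
    have h2 : (((Finset.range q).filter fun a => Nat.Coprime a q).card : ℝ) ≤ q := by
      exact_mod_cast (Finset.card_filter_le _ _).trans (Finset.card_range q).le
    calc _ ≤ q * (C * (q : ℝ) ^ (-(8 / 3) : ℝ)) := by gcongr
      _ = C * ((q : ℝ) ^ (1 : ℝ) * (q : ℝ) ^ (-(8 / 3) : ℝ)) := by rw [Real.rpow_one]; ring
      _ = _ := by rw [← Real.rpow_add hq0]; norm_num

theorem SmoothBiquad.tendsto_sum_serTerm (hA : SmoothBiquad A) (hn : 35 < n) :
    Tendsto (fun Q : ℕ => ∑ q ∈ Finset.Icc 1 Q, serTerm A q) atTop (nhds (biSingSeries A)) := by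
  have h0 : serTerm A 0 = 0 := by simp [serTerm]
  have h1 := ((hA.summable_serTerm hn).hasSum.tendsto_sum_nat).comp (tendsto_add_atTop_nat 1)
  have h2 : biSingSeries A = ∑' q, serTerm A q := by
    rw [biSingSeries_eq, (hA.summable_serTerm hn).tsum_eq_zero_add, h0, zero_add]
    exact tsum_pnat_eq_tsum_succ (f := serTerm A)
  rw [h2]
  refine h1.congr fun Q => ?_
  rw [Function.comp, Finset.sum_range_succ', h0, add_zero, Finset.range_eq_Ico,
    Finset.sum_Ico_add' (serTerm A) 0 Q 1]
  rfl

/-- A majorant for the local factors at infinity. -/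
def oscMaj (A : Fin n → Fin n → Fin n → Fin n → ℤ) (γ : ℝ) : ℝ := ∫ y in box n 2, ‖oscInt A γ y‖

theorem continuous_oscInt (A : Fin n → Fin n → Fin n → Fin n → ℤ) :
    Continuous fun p : ℝ × (Fin n → ℝ) => oscInt A p.1 p.2 := by
  have h1 : Continuous fun p : (ℝ × (Fin n → ℝ)) × (Fin n → ℝ) => biFormR A p.2 p.1.2 := by
    unfold biFormR
    fun_prop
  have h2 : Continuous (Function.uncurry fun (p : ℝ × (Fin n → ℝ)) (x : Fin n → ℝ) =>
      ee (p.1 * biFormR A x p.2)) :=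
    continuous_ee.comp ((by fun_prop : Continuous
      fun p : (ℝ × (Fin n → ℝ)) × (Fin n → ℝ) => p.1.1).mul h1)
  have h3 : IsCompact (box n 1) := isCompact_univ_pi fun _ => isCompact_Icc
  exact continuous_parametric_integral_of_continuous h2 h3

theorem norm_oscInt_le (A : Fin n → Fin n → Fin n → Fin n → ℤ) (γ : ℝ) (y : Fin n → ℝ) :
    ‖oscInt A γ y‖ ≤ 2 ^ n := by
  refine (norm_setIntegral_le_of_norm_le_const (C := 1) (volume_box_lt_top 1)
    fun x _ => (norm_ee _).le).trans ?_
  rw [volume_real_box zero_le_one]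
  simp

theorem oscMaj_nonneg (A : Fin n → Fin n → Fin n → Fin n → ℤ) (γ : ℝ) : 0 ≤ oscMaj A γ :=
  integral_nonneg fun _ => norm_nonneg _

theorem oscMaj_le_const (A : Fin n → Fin n → Fin n → Fin n → ℤ) (γ : ℝ) :
    oscMaj A γ ≤ 8 ^ n := by
  refine (Real.le_norm_self _).trans ((norm_setIntegral_le_of_norm_le_const (C := 2 ^ n)
    (volume_box_lt_top 2) fun x _ => ?_).trans ?_)
  · rw [norm_norm]
    exact norm_oscInt_le A γ x
  · rw [volume_real_box zero_le_two, ← mul_pow]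
    norm_num

theorem tendsto_oscMaj (A : Fin n → Fin n → Fin n → Fin n → ℤ) (γ : ℝ) :
    Tendsto (fun P : ℕ => (∑ v ∈ ibox n (2 * P : ℕ),
      ‖expY (swapA A) (fun _ => boxWt P) P (γ / (P : ℝ) ^ 4) v‖) / (P : ℝ) ^ (2 * n)) atTop
      (nhds (oscMaj A γ)) := by
  classical
  have hT : Tendsto (fun P : ℕ => (P : ℝ)) atTop atTop := tendsto_natCast_atTop_atTop
  set b : Fin n → Fin 1 := fun _ => 0
  have h := tendsto_residue_sum hT le_rfl b (fun P w => if (∀ i, |w i| ≤ 2) then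
    ‖oscSum A γ P b w‖ else 0) ((3 * (1 : ℕ)) ^ n) 2 ?_ ?_ (fun P => ibox n (2 * P : ℕ)) ?_
    ((box n 2).indicator fun y => ‖oscInt A γ y‖) ?_
  · rw [integral_indicator (measurableSet_box n 2)] at h
    refine h.congr' ?_
    filter_upwards [eventually_ge_atTop 1] with P hP
    have hP0 : (0 : ℝ) < P := by exact_mod_cast hP
    rw [smul_eq_mul, Finset.mul_sum, Finset.sum_div]
    refine Finset.sum_congr rfl fun v hv => ?_
    have h1 : ∀ i, |(((b i : ℕ) : ℝ) + ((1 : ℕ) : ℝ) * v i) / (P : ℝ)| ≤ 2 := fun i => by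
      have h2 : (|v i| : ℤ) ≤ (2 * P : ℕ) := mem_ibox.1 hv i
      have h3 : |(v i : ℝ)| ≤ 2 * P := by exact_mod_cast h2
      rw [abs_div, abs_of_pos hP0, div_le_iff₀ hP0]
      simpa [b] using h3
    have h4 : oscSum A γ P b (fun i => (((b i : ℕ) : ℝ) + ((1 : ℕ) : ℝ) * v i) / (P : ℝ)) =
        (1 / (P : ℝ)) ^ n • expY (swapA A) (fun _ => boxWt P) P (γ / (P : ℝ) ^ 4) v := by
      rw [oscSum, expY, Nat.cast_one]
      congr 1
      refine Finset.sum_congr rfl fun u hu => ?_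
      have h5 : ∀ i, |((b i : ℕ) : ℤ) + ((1 : ℕ) : ℤ) * u i| ≤ (P : ℤ) := fun i => by
        simpa [b] using mem_ibox.1 hu i
      have h6 : ∏ i, boxWt P (u i) = 1 :=
        Finset.prod_eq_one fun i _ => if_pos (mem_ibox.1 hu i)
      have h7 := biFormR_div A P P u v
      rw [if_pos h5, h6, biForm_swapA]
      have h8 : (fun i => (((b i : ℕ) : ℝ) + 1 * u i) / (P : ℝ)) = fun i => (u i : ℝ) / P := by
        simp [b]
      have h9 : (fun i => (((b i : ℕ) : ℝ) + 1 * v i) / (P : ℝ)) = fun i => (v i : ℝ) / P := by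
        simp [b]
      rw [h8, h9, h7]
      simp only [Complex.ofReal_one, one_mul]
      congr 1
      field_simp
    rw [if_pos h1, h4, norm_smul, norm_pow, Real.norm_of_nonneg (by positivity), Nat.cast_one]
    rw [two_mul, pow_add]
    simp only [one_div, inv_pow]
    field_simp
  · filter_upwards [eventually_ge_atTop 1] with P hP w
    split_ifs
    · rw [norm_norm]
      exact norm_oscSum_le A γ hP b w
    · simp
  · refine Eventually.of_forall fun k w hw => ?_
    by_contra h1
    exact hw (if_neg h1)
  · filter_upwards [eventually_ge_atTop 1] with P hP u hu
    have hP0 : (0 : ℝ) < P := by exact_mod_cast hP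
    have h1 : ∀ i, |(((b i : ℕ) : ℝ) + ((1 : ℕ) : ℝ) * u i) / (P : ℝ)| ≤ 2 := by
      by_contra h2
      exact hu (if_neg h2)
    refine mem_ibox.2 fun i => ?_
    have h3 := h1 i
    rw [abs_div, abs_of_pos hP0, div_le_iff₀ hP0] at h3
    have h4 : |(u i : ℝ)| ≤ 2 * P := by simpa [b] using h3
    exact_mod_cast h4
  · filter_upwards [ae_abs_ne 2] with t ht w hw
    have h1 : (box n 2).indicator (fun y => ‖oscInt A γ y‖) t =
        if (∀ i, |t i| ≤ 2) then ‖oscInt A γ t‖ else 0 := by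
      rw [Set.indicator_apply]
      exact if_congr mem_box_iff rfl rfl
    rw [h1]
    have h2 : Tendsto (fun k => if (∀ i, |t i| ≤ 2) then ‖oscSum A γ k b (w k)‖ else 0) atTop
        (nhds (if (∀ i, |t i| ≤ 2) then ‖oscInt A γ t‖ else 0)) := by
      split_ifs
      · exact (tendsto_oscSum A γ tendsto_id le_rfl b hw).norm
      · exact tendsto_const_nhds
    refine h2.congr' ?_
    filter_upwards [eventually_box_iff hw ht] with k hk
    exact if_congr hk.symm rfl rfl

theorem exists_matQR_le (A : Fin n → Fin n → Fin n → Fin n → ℤ) : ∃ C : ℝ, 0 ≤ C ∧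
    ∀ (α T : ℝ) (x h : Fin n → ℤ) (j : Fin n), (∀ i, |(x i : ℝ)| ≤ T) → (∀ i, |(h i : ℝ)| ≤ T) →
    |∑ k, matQR A α x j k * h k| ≤ C * |α| * T ^ 3 := by
  refine ⟨∑ j, ∑ k, ∑ i, ∑ i', |((A i i' k j + A i i' j k : ℤ) : ℝ)|,
    by positivity, fun α T x h j hx hh => ?_⟩
  have hT : 0 ≤ T := (abs_nonneg _).trans (hx j)
  have h1 : |∑ k, matQR A α x j k * h k| ≤
      (∑ k, ∑ i, ∑ i', |((A i i' k j + A i i' j k : ℤ) : ℝ)|) * |α| * T ^ 3 := by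
    rw [Finset.sum_mul, Finset.sum_mul]
    refine (Finset.abs_sum_le_sum_abs _ _).trans (Finset.sum_le_sum fun k _ => ?_)
    rw [matQR, Matrix.of_apply, matQ, Matrix.of_apply, abs_mul, abs_mul]
    have h2 : |((∑ i, ∑ i', (A i i' k j + A i i' j k) * x i * x i' : ℤ) : ℝ)| ≤
        (∑ i, ∑ i', |((A i i' k j + A i i' j k : ℤ) : ℝ)|) * T ^ 2 := by
      push_cast
      rw [Finset.sum_mul]
      refine (Finset.abs_sum_le_sum_abs _ _).trans (Finset.sum_le_sum fun i _ => ?_)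
      rw [Finset.sum_mul]
      refine (Finset.abs_sum_le_sum_abs _ _).trans (Finset.sum_le_sum fun i' _ => ?_)
      rw [abs_mul, abs_mul, mul_assoc, sq]
      exact mul_le_mul_of_nonneg_left (mul_le_mul (hx _) (hx _) (abs_nonneg _) hT) (abs_nonneg _)
    have h3 : (0 : ℝ) ≤ ∑ i, ∑ i', |((A i i' k j + A i i' j k : ℤ) : ℝ)| :=
      Finset.sum_nonneg fun _ _ => Finset.sum_nonneg fun _ _ => abs_nonneg _
    calc _ ≤ |α| * ((∑ i, ∑ i', |((A i i' k j + A i i' j k : ℤ) : ℝ)|) * T ^ 2) * T :=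
          mul_le_mul (mul_le_mul_of_nonneg_left h2 (abs_nonneg _)) (hh k) (abs_nonneg _)
            (mul_nonneg (abs_nonneg _) (mul_nonneg h3 (sq_nonneg _)))
      _ = _ := by ring
  refine h1.trans (mul_le_mul_of_nonneg_right (mul_le_mul_of_nonneg_right ?_ (abs_nonneg _))
    (pow_nonneg hT _))
  exact Finset.single_le_sum (f := fun j => ∑ k, ∑ i, ∑ i', |((A i i' k j + A i i' j k : ℤ) : ℝ)|)
    (fun _ _ => Finset.sum_nonneg fun _ _ => Finset.sum_nonneg fun _ _ =>
      Finset.sum_nonneg fun _ _ => abs_nonneg _) (Finset.mem_univ j)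

theorem SmoothBiquad.exists_oscMaj_sq_le
    (hA : SmoothBiquad A) (hn : 35 < n) : ∃ C : ℝ, 1 ≤ C ∧ ∀ γ k : ℝ, 1 ≤ k → C * k ^ 3 < |γ| →
    oscMaj A γ ^ 2 ≤ C * (1 + Real.log (C * |γ| + 3)) ^ n / k ^ 16 := by
  obtain ⟨S, hS, h0⟩ := exists_matQR_le (_root_.swapA A)
  have hA' : SmoothBiquad (_root_.swapA A) := hA.swapA
  obtain ⟨C, hC, h1⟩ := hA'.exists_weyl_average_le hn (c := 4) (D := 2) le_rfl (by norm_num)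
  have hC4 : C ≤ C * 4 ^ n * 14 ^ n := by
    rw [mul_assoc, ← mul_pow]
    exact le_mul_of_one_le_right (by linarith) (one_le_pow₀ (by norm_num))
  refine ⟨max (C * 4 ^ n * 14 ^ n) (8 * S), hC.trans (hC4.trans (le_max_left _ _)),
    fun γ k hk hkγ => ?_⟩
  replace hkγ : C * k ^ 3 < |γ| :=
    lt_of_le_of_lt (by gcongr; exact hC4.trans (le_max_left _ _)) hkγ
  set M := ⌈8 * S * |γ|⌉₊ with hM
  set L := (14 * (1 + Real.log (M + 2))) ^ n with hL
  have hlog : 0 ≤ Real.log (M + 2) := Real.log_nonneg (by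
    have : (0 : ℝ) ≤ M := by positivity
    linarith)
  have hL0 : 0 ≤ L := by positivity
  have h2 : oscMaj A γ ^ 2 ≤ C * L * 4 ^ n / k ^ 16 := by
    refine le_of_tendsto ((tendsto_oscMaj A γ).pow 2) ?_
    have h4 : Tendsto (fun P : ℕ => C * k ^ 3 * |γ| / (P : ℝ) ^ 4) atTop (nhds 0) := by
      have h5 : Tendsto (fun P : ℕ => (P : ℝ)) atTop atTop := tendsto_natCast_atTop_atTop
      exact ((tendsto_pow_atTop (by norm_num)).comp h5).const_div_atTop _
    filter_upwards [h4.eventually_lt_const (by norm_num : (0 : ℝ) < 1 / 2),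
      tendsto_natCast_atTop_atTop.eventually_ge_atTop k, eventually_ge_atTop 1] with P hP1 hP2 hP3
    have hP4 : (1 : ℝ) ≤ P := by exact_mod_cast hP3
    have hP0 : (0 : ℝ) < P := by linarith
    have hγ : |γ / (P : ℝ) ^ 4| = |γ| / (P : ℝ) ^ 4 := by
      rw [abs_div, abs_of_pos (by positivity : (0 : ℝ) < (P : ℝ) ^ 4)]
    have h6 := h1 (γ / (P : ℝ) ^ 4) (2 * P) P L k
      (fun v => ‖expY (_root_.swapA A) (fun _ => boxWt P) P (γ / (P : ℝ) ^ 4) v‖) hP4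
      (by push_cast; linarith) hk (by push_cast; linarith) hL0 ?_ ?_
    · rw [div_pow, div_le_iff₀ (by positivity)]
      refine h6.trans (le_of_eq ?_)
      push_cast
      have e1 : (4 : ℝ) ^ n = 2 ^ (2 * n) := by rw [pow_mul]; norm_num
      rw [e1]
      have e2 : (2 * (P : ℝ) * P) ^ (2 * n) = 2 ^ (2 * n) * ((P : ℝ) ^ (2 * n)) ^ 2 := by
        rw [mul_assoc, mul_pow, mul_pow]; ring
      rw [e2]
      ring
    · intro v hv
      refine (norm_expY_box_le (_root_.swapA A) P M hP3 _ v ?_).trans (le_of_eq ?_)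
      · intro h hh j
        have h7 := h0 (γ / (P : ℝ) ^ 4) (2 * P) v h j
          (fun i => by have := mem_ibox.1 hv i; exact_mod_cast this)
          (fun i => by have := mem_ibox.1 hh i; exact_mod_cast this)
        rw [hγ] at h7
        refine (mul_le_mul_of_nonneg_left h7 hP0.le).trans (le_trans (le_of_eq ?_) (Nat.le_ceil _))
        field_simp
        ring
      · rw [hL, ← mul_pow]
        congr 2
        ring
    · intro q hq hqC
      have hq0 : (1 : ℝ) ≤ q := by exact_mod_cast hq
      have h8 : |q * (γ / (P : ℝ) ^ 4)| = q * (|γ| / (P : ℝ) ^ 4) := by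
        rw [abs_mul, hγ, abs_of_pos (by linarith)]
      have h9 : |q * (γ / (P : ℝ) ^ 4)| < 1 / 2 := by
        rw [h8]
        refine lt_of_le_of_lt ?_ hP1
        rw [mul_div_assoc]
        gcongr
      have h10 : round (q * (γ / (P : ℝ) ^ 4)) = 0 := by
        rw [round_eq_zero_iff]
        have := abs_lt.1 h9
        constructor <;> linarith
      rw [h10, Int.cast_zero, sub_zero, h8]
      have h11 : |γ| / (P : ℝ) ^ 4 ≤ q * (|γ| / (P : ℝ) ^ 4) :=
        le_mul_of_one_le_left (by positivity) hq0
      refine lt_of_lt_of_le ?_ h11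
      push_cast
      rw [div_lt_div_iff₀ (by positivity) (by positivity)]
      have h12 : (0 : ℝ) < (P : ℝ) ^ 4 := by positivity
      nlinarith [abs_nonneg γ]
  refine h2.trans ?_
  have h3 : (M : ℝ) + 2 ≤ max (C * 4 ^ n * 14 ^ n) (8 * S) * |γ| + 3 := by
    have := (Nat.ceil_lt_add_one (by positivity : 0 ≤ 8 * S * |γ|)).le
    have h4 := mul_le_mul_of_nonneg_right (le_max_right (C * 4 ^ n * 14 ^ n) (8 * S))
      (abs_nonneg γ)
    linarith
  have h5 := Real.log_le_log (by positivity) h3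
  calc _ = C * 4 ^ n * 14 ^ n * (1 + Real.log (M + 2)) ^ n / k ^ 16 := by
        rw [hL, mul_pow]; ring
    _ ≤ _ := by
        gcongr
        exact le_max_left _ _

theorem SmoothBiquad.exists_oscMaj_le
    (hA : SmoothBiquad A) (hn : 35 < n) : ∃ C : ℝ, ∀ γ : ℝ, oscMaj A γ ≤ C * (1 + γ ^ 2)⁻¹ := by
  obtain ⟨C, hC, h⟩ := hA.exists_oscMaj_sq_le hn
  have hC0 : 0 < C := by linarith
  set C₂ := C * (1 + n : ℝ) ^ n * (4 * C) * (2 * C) ^ 5 with hC₂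
  have h2 : ∀ γ : ℝ, 2 * C ≤ |γ| → oscMaj A γ ≤ Real.sqrt C₂ / γ ^ 2 := by
    intro γ hγ
    have hγ1 : 1 ≤ |γ| := by linarith
    have hγ0 : 0 < |γ| := by linarith
    set k := (|γ| / (2 * C)) ^ (1 / 3 : ℝ) with hk
    have hk3 : k ^ 3 = |γ| / (2 * C) := by
      rw [hk, ← Real.rpow_natCast, ← Real.rpow_mul (by positivity)]
      norm_num
    have hk1 : 1 ≤ k := Real.one_le_rpow (by rwa [one_le_div (by positivity)]) (by norm_num)
    have h3 := h γ k hk1 (by rw [hk3]; field_simp; linarith)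
    have h4 : (1 + Real.log (C * |γ| + 3)) ^ n ≤ (1 + n : ℝ) ^ n * (4 * C * |γ|) := by
      set u := C * |γ| + 3 with hu
      have hu1 : 1 ≤ u := by rw [hu]; nlinarith
      have hn0 : (0 : ℝ) < n := by exact_mod_cast (by omega : 0 < n)
      have e1 := Real.log_le_rpow_div (by linarith : 0 ≤ u) (by positivity : (0 : ℝ) < 1 / n)
      have e2 : 1 ≤ u ^ (1 / n : ℝ) := Real.one_le_rpow hu1 (by positivity)
      have e3 : 1 + Real.log u ≤ (1 + n) * u ^ (1 / n : ℝ) := by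
        rw [div_div_eq_mul_div, div_one] at e1
        linarith
      have e4 := Real.log_nonneg hu1
      calc (1 + Real.log u) ^ n ≤ ((1 + n) * u ^ (1 / n : ℝ)) ^ n := by gcongr
        _ = (1 + n : ℝ) ^ n * u := by
            rw [mul_pow, ← Real.rpow_natCast (u ^ (1 / n : ℝ)), ← Real.rpow_mul (by linarith),
              one_div, inv_mul_cancel₀ hn0.ne', Real.rpow_one]
        _ ≤ _ := by
            gcongr
            rw [hu]
            nlinarith
    have h5 : oscMaj A γ ^ 2 ≤ C₂ / (γ ^ 2) ^ 2 := by
      refine h3.trans ?_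
      have e1 : (|γ| / (2 * C)) ^ 5 ≤ k ^ 16 := by
        rw [← hk3, ← pow_mul]
        exact pow_le_pow_right₀ hk1 (by norm_num)
      calc _ ≤ C * ((1 + n : ℝ) ^ n * (4 * C * |γ|)) / (|γ| / (2 * C)) ^ 5 := by gcongr
        _ = C₂ / (|γ| ^ 2) ^ 2 := by rw [hC₂]; field_simp
        _ = _ := by rw [sq_abs]
    have h6 := Real.le_sqrt_of_sq_le h5
    rwa [Real.sqrt_div (by positivity), Real.sqrt_sq (by positivity)] at h6
  refine ⟨max (2 * Real.sqrt C₂) (8 ^ n * (1 + (2 * C) ^ 2)), fun γ => ?_⟩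
  have hγ2 : 0 < 1 + γ ^ 2 := by positivity
  rw [← div_eq_mul_inv, le_div_iff₀ hγ2]
  rcases le_or_gt (2 * C) |γ| with hγ | hγ
  · refine le_trans ?_ (le_max_left _ _)
    have h3 := h2 γ hγ
    have h4 : 1 ≤ γ ^ 2 := by
      rw [← sq_abs]
      exact one_le_pow₀ (by linarith)
    rw [le_div_iff₀ (by linarith)] at h3
    nlinarith [oscMaj_nonneg A γ]
  · refine le_trans ?_ (le_max_right _ _)
    have h4 : γ ^ 2 ≤ (2 * C) ^ 2 := by
      rw [← sq_abs]
      exact pow_le_pow_left₀ (abs_nonneg _) hγ.le 2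
    exact mul_le_mul (oscMaj_le_const A γ) (by linarith) hγ2.le (by positivity)

theorem integral_ee_int (a : ℝ) (m : ℤ) :
    ∫ α in a..a + 1, ee (α * m) = if m = 0 then 1 else 0 := by
  split_ifs with h
  · simp [h, ee_zero]
  · have h1 : (2 * Real.pi * Complex.I * m : ℂ) ≠ 0 := by
      have : (m : ℂ) ≠ 0 := by exact_mod_cast h
      simp [this, Real.pi_ne_zero]
    have h2 : ∀ α : ℝ, ee (α * m) = Complex.exp (2 * Real.pi * Complex.I * m * α) := fun α => by
      unfold ee
      congr 1
      push_cast
      ring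
    have h3 : ee ((a + 1) * m) = ee (a * m) := by
      rw [add_mul, one_mul, ee_add_int]
    rw [intervalIntegral.integral_congr fun α _ => h2 α, integral_exp_mul_complex h1, ← h2, ← h2,
      h3, sub_self, zero_div]

/-- The number of zeros with `det F_x ≠ 0` weighted by a product of tents in `y`. -/
def nTent (A : Fin n → Fin n → Fin n → Fin n → ℤ) (D : ℝ) (p : Fin n → ℝ) (X : ℕ) (H : ℝ) : ℝ :=
  ∑ x ∈ ibox n X, if detFx A x ≠ 0 then
    ∑ y ∈ ibox n (tentR D H), if biForm A x y = 0 then ∏ i, tent H (p i * H) (y i) else 0 else 0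

theorem integral_arcSumDet (A : Fin n → Fin n → Fin n → Fin n → ℤ) (D : ℝ) (p : Fin n → ℝ)
    (X : ℕ) (H a : ℝ) : ∫ α in a..a + 1, arcSumDet A D p X H α = nTent A D p X H := by
  unfold arcSumDet nTent
  rw [intervalIntegral.integral_finsetSum]
  · rw [Complex.ofReal_sum]
    refine Finset.sum_congr rfl fun x _ => ?_
    split_ifs
    · unfold expY
      rw [intervalIntegral.integral_finsetSum, Complex.ofReal_sum]
      · refine Finset.sum_congr rfl fun y _ => ?_
        rw [intervalIntegral.integral_const_mul, integral_ee_int]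
        split_ifs <;> simp
      · intro y _
        refine Continuous.intervalIntegrable ?_ _ _
        exact continuous_const.mul (continuous_ee.comp (continuous_id.mul continuous_const))
    · simp
  · intro x _
    refine Continuous.intervalIntegrable ?_ _ _
    split_ifs
    · exact continuous_expY A _ _ x
    · exact continuous_const

theorem SmoothBiquad.exists_nTent_le
    (hA : SmoothBiquad A) (hn : 35 < n) {D : ℝ} (hD : 1 ≤ D) : ∃ C : ℝ, 0 ≤ C ∧
    ∀ (p : Fin n → ℝ) (X : ℕ) (H : ℝ), (∀ i, |p i| ≤ D) → 1 ≤ X → 1 ≤ H → X ≤ D * H →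
    nTent A D p X H ≤ C * (X * H) ^ (n - 2) := by
  obtain ⟨C₁, hC₁, C, hC, h⟩ := hA.exists_minor_le hn hD
  refine ⟨(9 * (D + 2)) ^ n * (6 * C₁ * C₁) + C, by positivity, fun p X H hp hX hH hXH => ?_⟩
  have hX0 : (1 : ℝ) ≤ X := by exact_mod_cast hX
  have hT0 : (0 : ℝ) < X * H := by positivity
  have hn2 : ((X : ℝ) * H) ^ n = (X * H) ^ (n - 2) * (X * H) ^ 2 := by
    rw [← pow_add]; congr 1; omega
  have h1 := h X H (fun i => p i * H) (tentR D H) (isTent_tentR hH hp) hX hXH 1 le_rfl hX0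
  set f := phiSum A X H (fun i => p i * H) (tentR D H) with hf
  have hfc : Continuous f := continuous_phiSum _ _ _ _ _
  have hf0 : ∀ α, 0 ≤ f α := phiSum_nonneg _ _ _ _ _
  have h2 := setIntegral_diff_le_add hfc hf0 (E := ∅) (measurableSet_arcs (C₁ * 1 ^ 3)
    (C₁ * 1 ^ 3 / (X * H) ^ 2)) (by positivity : 0 ≤ (9 * (D + 2)) ^ n * (X * H) ^ n)
    (fun α _ => phiSum_trivial_le A (by linarith) hH p hX α)
    (volume_real_arcs_le (Q := C₁ * 1 ^ 3) (by positivity) (by positivity))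
  rw [Set.sdiff_empty] at h2
  have h3 : nTent A D p X H ≤ ∫ α in Set.Icc (-1 : ℝ) 1, f α := by
    have e1 := integral_arcSumDet A D p X H 0
    have e2 : nTent A D p X H ≤ ‖(nTent A D p X H : ℂ)‖ := by
      rw [Complex.norm_real]
      exact Real.le_norm_self _
    refine e2.trans ?_
    rw [← e1, zero_add]
    refine (intervalIntegral.norm_integral_le_integral_norm zero_le_one).trans ?_
    rw [intervalIntegral.integral_of_le zero_le_one]
    refine (setIntegral_mono_on (g := f) ?_ ?_ measurableSet_Ioc fun α _ =>
      norm_arcSumDet_le A D p X H α).trans ?_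
    · exact ((continuous_arcSumDet A D p X H).norm.integrableOn_Icc (a := 0) (b := 1)).mono_set
        Set.Ioc_subset_Icc_self
    · exact (hfc.integrableOn_Icc (a := 0) (b := 1)).mono_set Set.Ioc_subset_Icc_self
    · refine setIntegral_mono_set hfc.integrableOn_Icc (Eventually.of_forall hf0)
        (LE.le.eventuallyLE fun α hα => ?_)
      exact ⟨by linarith [hα.1], hα.2⟩
  refine h3.trans (h2.trans ?_)
  refine (add_le_add le_rfl h1).trans (le_of_eq ?_)
  rw [hn2]
  field_simp

open Classical in
/-- The number of zeros in a box with both determinants nonzero. -/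
def nBox (A : Fin n → Fin n → Fin n → Fin n → ℤ) (X Y : ℕ) : ℕ :=
  ((ibox n X ×ˢ ibox n Y).filter fun z =>
    detFx A z.1 ≠ 0 ∧ detFy A z.2 ≠ 0 ∧ biForm A z.1 z.2 = 0).card

theorem nBox_swapA (A : Fin n → Fin n → Fin n → Fin n → ℤ) (X Y : ℕ) :
    nBox (swapA A) Y X = nBox A X Y := by
  unfold nBox
  refine Finset.card_bij (fun z _ => (z.2, z.1)) ?_ ?_ ?_
  · intro z hz
    rw [Finset.mem_filter, Finset.mem_product] at hz ⊢
    rw [biForm_swapA] at hz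
    exact ⟨⟨hz.1.2, hz.1.1⟩, hz.2.2.1, hz.2.1, hz.2.2.2⟩
  · rintro ⟨_, _⟩ _ ⟨_, _⟩ _ h
    simp only [Prod.mk.injEq] at h ⊢
    exact ⟨h.2, h.1⟩
  · rintro z hz
    rw [Finset.mem_filter, Finset.mem_product] at hz
    refine ⟨(z.2, z.1), ?_, rfl⟩
    rw [Finset.mem_filter, Finset.mem_product, biForm_swapA]
    exact ⟨⟨hz.1.2, hz.1.1⟩, hz.2.2.1, hz.2.1, hz.2.2.2⟩

theorem SmoothBiquad.exists_nBox_le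
    (hA : SmoothBiquad A) (hn : 35 < n) : ∃ C : ℝ, 0 ≤ C ∧ ∀ X Y : ℕ, 1 ≤ X → X ≤ Y →
    (nBox A X Y : ℝ) ≤ C * ((X : ℝ) * Y) ^ (n - 2) := by
  classical
  obtain ⟨C, hC, h⟩ := hA.exists_nTent_le hn le_rfl
  refine ⟨2 ^ n * C * 2 ^ (n - 2), by positivity, fun X Y hX hXY => ?_⟩
  have hY0 : (1 : ℝ) ≤ Y := by exact_mod_cast hX.trans hXY
  have hXY' : (X : ℝ) ≤ Y := by exact_mod_cast hXY
  have h1 := h 0 X (2 * Y) (by simp) hX (by linarith) (by linarith)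
  have h2 : (nBox A X Y : ℝ) ≤ 2 ^ n * nTent A 1 0 X (2 * Y) := by
    rw [nBox, Finset.card_filter, Finset.sum_product, nTent, Finset.mul_sum, Nat.cast_sum]
    refine Finset.sum_le_sum fun x _ => ?_
    by_cases hx : detFx A x = 0
    · simp [hx]
    · rw [if_pos hx, Finset.mul_sum, Nat.cast_sum]
      refine le_trans (Finset.sum_le_sum (g := fun y => 2 ^ n * if biForm A x y = 0 then
        ∏ i, tent (2 * Y) ((0 : Fin n → ℝ) i * (2 * Y)) (y i) else 0) fun y hy => ?_)
        (Finset.sum_le_sum_of_subset_of_nonneg ?_ fun y _ _ => ?_)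
      · by_cases hxy : biForm A x y = 0
        · rw [if_pos hxy]
          have h3 : ∀ i, (1 / 2 : ℝ) ≤ tent (2 * Y) ((0 : Fin n → ℝ) i * (2 * Y)) (y i) := fun i => by
            refine le_trans ?_ (le_max_right _ _)
            have h4 : |(y i : ℝ)| ≤ Y := by exact_mod_cast mem_ibox.1 hy i
            simp only [Pi.zero_apply, zero_mul, sub_zero]
            have h5 : |(y i : ℝ)| / (2 * Y) ≤ 1 / 2 := by
              rw [div_le_iff₀ (by positivity)]
              linarith
            linarith
          have h6 : (1 / 2 : ℝ) ^ n ≤ ∏ i, tent (2 * Y) ((0 : Fin n → ℝ) i * (2 * Y)) (y i) := by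
            refine le_trans (le_of_eq ?_) (Finset.prod_le_prod (f := fun _ : Fin n => (1 / 2 : ℝ))
              (fun _ _ => by norm_num) fun i _ => h3 i)
            simp
          have h7 : (2 : ℝ) ^ n * (1 / 2) ^ n = 1 := by rw [← mul_pow]; norm_num
          refine le_trans ?_ (h7.symm.le.trans (mul_le_mul_of_nonneg_left h6 (by positivity)))
          split_ifs <;> simp
        · simp [hxy]
      · intro y hy
        refine mem_ibox.2 fun i => (mem_ibox.1 hy i).trans ?_
        have h8 := le_tentR (D := 1) (H := 2 * Y)
        have : ((Y : ℤ) : ℝ) ≤ tentR 1 (2 * Y) := by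
          push_cast
          linarith
        exact_mod_cast this
      · refine mul_nonneg (by positivity) ?_
        split_ifs
        · exact Finset.prod_nonneg fun _ _ => tent_nonneg _ _ _
        · exact le_rfl
  refine h2.trans ((mul_le_mul_of_nonneg_left h1 (by positivity)).trans (le_of_eq ?_))
  rw [show (X : ℝ) * (2 * Y) = 2 * (X * Y) by ring, mul_pow]
  ring

/-- The reduced fractions `a / q` in `[0, 1)` with `q ≤ Q`, as pairs `⟨q, a⟩`. -/
def fracs (Q : ℕ) : Finset (Σ _ : ℕ, ℕ) :=
  (Finset.Icc 1 Q).sigma fun q => (Finset.range q).filter fun a => Nat.Coprime a q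

theorem mem_fracs {Q : ℕ} {r : Σ _ : ℕ, ℕ} :
    r ∈ fracs Q ↔ 1 ≤ r.1 ∧ r.1 ≤ Q ∧ r.2 < r.1 ∧ Nat.Coprime r.2 r.1 := by
  simp [fracs, and_assoc]

/-- The interval of radius `δ` about `a / q`. -/
def wideArc (δ : ℝ) (r : Σ _ : ℕ, ℕ) : Set ℝ :=
  Set.Icc ((r.2 : ℝ) / r.1 - δ) ((r.2 : ℝ) / r.1 + δ)

theorem wideArc_disjoint {Q : ℕ} {δ : ℝ} (hδ : δ < 1 / (2 * (Q : ℝ) ^ 2)) :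
    ((fracs Q : Finset _) : Set (Σ _ : ℕ, ℕ)).Pairwise (Function.onFun Disjoint (wideArc δ)) := by
  rintro ⟨q, a⟩ h ⟨q', a'⟩ h' hne
  rw [Finset.mem_coe, mem_fracs] at h h'
  obtain ⟨h1, h2, h3, h4⟩ := h
  obtain ⟨h1', h2', h3', h4'⟩ := h'
  simp only at h1 h2 h3 h4 h1' h2' h3' h4'
  rw [Function.onFun, Set.disjoint_left]
  rintro α ⟨hα1, hα2⟩ ⟨hα1', hα2'⟩
  simp only at hα1 hα2 hα1' hα2'
  have hq : (0 : ℝ) < q := by exact_mod_cast h1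
  have hq' : (0 : ℝ) < q' := by exact_mod_cast h1'
  have hqQ : (q : ℝ) ≤ Q := by exact_mod_cast h2
  have hqQ' : (q' : ℝ) ≤ Q := by exact_mod_cast h2'
  have hQ : (0 : ℝ) < Q := by linarith
  have h5 : |(a : ℝ) / q - a' / q'| ≤ 2 * δ := by
    rw [abs_le]; constructor <;> linarith
  have h6 : |((a * q' - a' * q : ℤ) : ℝ)| < 1 := by
    have e1 : ((a * q' - a' * q : ℤ) : ℝ) = ((a : ℝ) / q - a' / q') * (q * q') := by
      push_cast
      field_simp
    rw [e1, abs_mul, abs_of_pos (by positivity : (0 : ℝ) < q * q')]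
    calc _ ≤ 2 * δ * (q * q') := by gcongr
      _ < 2 * (1 / (2 * (Q : ℝ) ^ 2)) * (q * q') := by gcongr
      _ ≤ 2 * (1 / (2 * (Q : ℝ) ^ 2)) * (Q * Q) := by gcongr
      _ = 1 := by field_simp
  rw [← Int.cast_abs] at h6
  have h7 : (a : ℤ) * q' - a' * q = 0 := Int.abs_lt_one_iff.1 (by exact_mod_cast h6)
  have h8 : a * q' = a' * q := by
    zify
    linarith
  have h9 : q ∣ q' := h4.symm.dvd_of_dvd_mul_left ⟨a', by rw [h8]; ring⟩
  have h10 : q' ∣ q := h4'.symm.dvd_of_dvd_mul_left ⟨a, by rw [← h8]; ring⟩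
  obtain rfl := Nat.dvd_antisymm h9 h10
  obtain rfl := Nat.eq_of_mul_eq_mul_right h1 h8
  exact hne rfl

theorem wideArc_subset {Q : ℕ} {δ : ℝ} (hδ : δ < 1 / (2 * (Q : ℝ) ^ 2)) {r : Σ _ : ℕ, ℕ}
    (hr : r ∈ fracs Q) : wideArc δ r ⊆ Set.Ioc (-(1 / (2 * (Q : ℝ)))) (-(1 / (2 * (Q : ℝ))) + 1) := by
  obtain ⟨q, a⟩ := r
  rw [mem_fracs] at hr
  obtain ⟨h1, h2, h3, h4⟩ := hr
  simp only at h1 h2 h3 h4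
  rintro α ⟨hα1, hα2⟩
  simp only at hα1 hα2
  have hq : (0 : ℝ) < q := by exact_mod_cast h1
  have hqQ : (q : ℝ) ≤ Q := by exact_mod_cast h2
  have hQ1 : (1 : ℝ) ≤ Q := by exact_mod_cast h1.trans h2
  have hQ : 1 / (2 * (Q : ℝ) ^ 2) ≤ 1 / (2 * (Q : ℝ)) := by
    refine one_div_le_one_div_of_le (by positivity) ?_
    nlinarith
  have h5 : (0 : ℝ) ≤ a / q := by positivity
  have h6 : (a : ℝ) / q ≤ 1 - 1 / Q := by
    have e1 : (a : ℝ) + 1 ≤ q := by exact_mod_cast h3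
    have e2 : (a : ℝ) / q ≤ 1 - 1 / q := by
      rw [div_le_iff₀ hq, sub_mul, one_div_mul_cancel hq.ne']
      linarith
    have e3 := one_div_le_one_div_of_le hq hqQ
    linarith
  have h7 : 1 / (2 * (Q : ℝ)) * 2 = 1 / Q := by field_simp
  constructor <;> linarith

theorem not_mem_arcs_of_not_mem_wideArc {Q : ℕ} {δ : ℝ} (hδ : δ < 1 / (2 * (Q : ℝ) ^ 2)) {α : ℝ}
    (hα : α ∈ Set.Ioc (-(1 / (2 * (Q : ℝ)))) (-(1 / (2 * (Q : ℝ))) + 1))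
    (h : ∀ r ∈ fracs Q, α ∉ wideArc δ r) {Q' δ' : ℝ} (hQ : Q' ≤ Q) (hδ' : δ' ≤ δ) :
    α ∉ arcs Q' δ' := by
  rintro ⟨q, hq1, hq2, hq3⟩
  have hq0 : (0 : ℝ) < q := by exact_mod_cast hq1
  have hqQ : q ≤ Q := by exact_mod_cast hq2.trans hQ
  have hQ1 : (1 : ℝ) ≤ Q := by exact_mod_cast hq1.trans hqQ
  have hQ2 : 1 / (2 * (Q : ℝ) ^ 2) ≤ 1 / (2 * (Q : ℝ)) := by
    refine one_div_le_one_div_of_le (by positivity) ?_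
    nlinarith
  have hQ3 : 1 / (2 * (Q : ℝ)) * 2 = 1 / Q := by field_simp
  set ρ : ℚ := (round ((q : ℝ) * α) : ℤ) / (q : ℤ) with hρ
  have hden : ρ.den ≤ q := by
    have h1 := Rat.den_dvd (round ((q : ℝ) * α)) (q : ℤ)
    rw [Rat.divInt_eq_div, ← hρ] at h1
    exact Nat.le_of_dvd hq1 (by exact_mod_cast h1)
  have hd0 : (0 : ℝ) < ρ.den := by exact_mod_cast ρ.pos
  have hdQ : (ρ.den : ℝ) ≤ Q := by exact_mod_cast hden.trans hqQ
  have hρR : (ρ.num : ℝ) / ρ.den = round ((q : ℝ) * α) / q := by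
    have h1 : ((ρ : ℚ) : ℝ) = (ρ.num : ℝ) / ρ.den := Rat.cast_def ρ
    rw [← h1, hρ]
    push_cast
    rfl
  have h2 : |α - (ρ.num : ℝ) / ρ.den| ≤ δ := by
    have e1 : α - (ρ.num : ℝ) / ρ.den = (q * α - round ((q : ℝ) * α)) / q := by
      rw [hρR]
      field_simp
    have e2 : 0 ≤ δ := (abs_nonneg _).trans (hq3.trans hδ')
    rw [e1, abs_div, abs_of_pos hq0, div_le_iff₀ hq0]
    have e3 : (1 : ℝ) ≤ q := by exact_mod_cast hq1
    nlinarith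
  obtain ⟨h3, h4⟩ := abs_le.1 h2
  have h5 : 0 ≤ ρ.num := by
    have e1 : -(1 / (Q : ℝ)) < (ρ.num : ℝ) / ρ.den := by linarith [hα.1]
    have e2 := one_div_le_one_div_of_le hd0 hdQ
    have e3 : -(1 / (ρ.den : ℝ)) < (ρ.num : ℝ) / ρ.den := by linarith
    rw [← neg_div, div_lt_div_iff_of_pos_right hd0] at e3
    have e4 : -1 < ρ.num := by exact_mod_cast e3
    omega
  obtain ⟨a, ha⟩ := Int.eq_ofNat_of_zero_le h5
  rw [ha] at h2 h3 h4
  refine h ⟨ρ.den, a⟩ (mem_fracs.2 ⟨ρ.pos, hden.trans hqQ, ?_, ?_⟩) ⟨?_, ?_⟩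
  · have e1 : (a : ℝ) / ρ.den < 1 := by
      have := hα.2
      push_cast at h3
      linarith
    rw [div_lt_one hd0] at e1
    exact_mod_cast e1
  · have := ρ.reduced
    rwa [ha] at this
  · push_cast at h3 h4
    simp only
    linarith
  · push_cast at h3 h4
    simp only
    linarith

theorem setIntegral_wideArc {f : ℝ → ℂ} {R T : ℝ} (hR : 0 ≤ R) (hT : 0 < T) (r : Σ _ : ℕ, ℕ) :
    ∫ α in wideArc (R / T) r, f α =
      T⁻¹ • ∫ γ in -R..R, f ((r.2 : ℝ) / r.1 + γ / T) := by
  rw [intervalIntegral.integral_comp_add_div f hT.ne', smul_smul, inv_mul_cancel₀ hT.ne', one_smul,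
    wideArc, integral_Icc_eq_integral_Ioc, intervalIntegral.integral_of_le]
  · rw [neg_div, sub_eq_add_neg]
  · have := div_nonneg hR hT.le
    rw [neg_div]
    linarith

theorem SmoothBiquad.tendsto_integral_arcSumDet
    (hA : SmoothBiquad A) (hn : 0 < n) {D : ℝ} {p : Fin n → ℝ}
    (hD : 0 ≤ D) (hp : ∀ i, |p i| ≤ D) {κ : Type*} {l : Filter κ} [l.IsCountablyGenerated]
    {X : κ → ℕ} (hX : Tendsto X l atTop) {H : κ → ℝ} (hH : Tendsto H l atTop)
    {q : ℕ} (hq : 1 ≤ q) (a : ℕ) (R : ℝ) :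
    Tendsto (fun k => (∫ γ in -R..R, arcSumDet A D p (X k) (H k) ((a : ℝ) / q + γ / (X k * H k) ^ 2)) /
      (X k * H k) ^ n) l
      (nhds (expS A q a / (q : ℂ) ^ (2 * n) * ∫ γ in -R..R, psiInt A (hat p) γ)) := by
  rw [← intervalIntegral.integral_const_mul]
  have h := intervalIntegral.tendsto_integral_filter_of_dominated_convergence (μ := volume)
    (a := -R) (b := R) (l := l)
    (F := fun k γ => arcSumDet A D p (X k) (H k) ((a : ℝ) / q + γ / (X k * H k) ^ 2) /
      (X k * H k) ^ n) (f := fun γ => expS A q a / (q : ℂ) ^ (2 * n) * psiInt A (hat p) γ)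
    (fun _ => (9 * (D + 2)) ^ n) ?_ ?_ ?_ ?_
  · refine h.congr fun k => ?_
    rw [← intervalIntegral.integral_div]
  · refine Eventually.of_forall fun k => ?_
    refine Continuous.aestronglyMeasurable ?_
    exact ((continuous_arcSumDet A D p (X k) (H k)).comp (by fun_prop)).div_const _
  · filter_upwards [hX.eventually_ge_atTop 1, hH.eventually_ge_atTop 1] with k hk1 hk2
    refine Eventually.of_forall fun γ _ => ?_
    have hk3 : (0 : ℝ) < X k := by exact_mod_cast hk1
    have hk4 : 0 < H k := by linarith
    have h1 : ((X k : ℂ) * H k) ^ n = (((X k * H k) ^ n : ℝ) : ℂ) := by push_cast; rfl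
    rw [norm_div, h1, Complex.norm_real, Real.norm_of_nonneg (by positivity),
      div_le_iff₀ (by positivity)]
    exact (norm_arcSumDet_le A D p _ _ _).trans (phiSum_trivial_le A hD hk2 p hk1 _)
  · exact intervalIntegrable_const
  · refine Eventually.of_forall fun γ _ => ?_
    exact hA.tendsto_arcSumDet hn hD hp hX hH hq a γ

/-- The counting function is the major arc contribution up to a small error. -/
theorem SmoothBiquad.exists_norm_nTent_sub_le
    (hA : SmoothBiquad A) (hn : 35 < n) {D : ℝ} (hD : 1 ≤ D) : ∃ C₁ C : ℝ, 1 ≤ C₁ ∧ 0 ≤ C ∧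
    ∀ (p : Fin n → ℝ) (X : ℕ) (H K : ℝ) (Q : ℕ), (∀ i, |p i| ≤ D) → 1 ≤ H → X ≤ D * H →
    1 ≤ K → K ≤ X → C₁ * K ^ 3 ≤ Q → Q / (X * H) ^ 2 < 1 / (2 * (Q : ℝ) ^ 2) →
    ‖(nTent A D p X H : ℂ) / (X * H) ^ (n - 2) - ∑ r ∈ fracs Q,
      (∫ γ in -(Q : ℝ)..Q, arcSumDet A D p X H ((r.2 : ℝ) / r.1 + γ / (X * H) ^ 2)) / (X * H) ^ n‖ ≤
      C / K ^ 2 := by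
  obtain ⟨C₁, hC₁, C, hC, h⟩ := hA.exists_minor_le hn hD
  refine ⟨C₁, C, hC₁, by linarith, fun p X H K Q hp hH hXH hK hKX hQ hδ => ?_⟩
  have hX0 : (1 : ℝ) ≤ X := hK.trans hKX
  have hX1 : 1 ≤ X := by exact_mod_cast hX0
  have hT0 : (0 : ℝ) < X * H := by positivity
  have hQ1 : (1 : ℝ) ≤ Q := by
    refine le_trans ?_ hQ
    nlinarith [one_le_pow₀ hK (n := 3)]
  have h1 := h X H (fun i => p i * H) (tentR D H) (isTent_tentR hH hp) hX1 hXH K hK hKX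
  set T : ℝ := (X * H) ^ 2 with hT
  have hTpos : 0 < T := by positivity
  set f := arcSumDet A D p X H with hf
  have hfc : Continuous f := continuous_arcSumDet A D p X H
  set s : ℝ := -(1 / (2 * (Q : ℝ))) with hs
  set I := Set.Ioc s (s + 1) with hI
  set W := ⋃ r ∈ fracs Q, wideArc (Q / T) r with hW
  have hWI : W ⊆ I := Set.iUnion₂_subset fun r hr => wideArc_subset hδ hr
  have hWm : MeasurableSet W := Finset.measurableSet_biUnion _ fun r _ => measurableSet_Icc
  have hfint : IntegrableOn f I := (hfc.integrableOn_Icc).mono_set Set.Ioc_subset_Icc_self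
  have hIsub : I ⊆ Set.Icc (-1) 1 := by
    intro α hα
    have e1 : 0 < 1 / (2 * (Q : ℝ)) := by positivity
    have e2 : 1 / (2 * (Q : ℝ)) ≤ 1 := by
      rw [div_le_one (by positivity)]
      linarith
    exact ⟨by linarith [hα.1], by linarith [hα.2]⟩
  have h2 : (nTent A D p X H : ℂ) = ∫ α in I, f α := by
    rw [← integral_arcSumDet A D p X H s, intervalIntegral.integral_of_le (by linarith)]
  have h3 : ∫ α in I, f α = (∫ α in W, f α) + ∫ α in I \ W, f α := by
    rw [← integral_inter_add_sdiff hWm hfint, Set.inter_eq_self_of_subset_right hWI]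
  have h4 : ∫ α in W, f α = ∑ r ∈ fracs Q,
      T⁻¹ • ∫ γ in -(Q : ℝ)..Q, f ((r.2 : ℝ) / r.1 + γ / T) := by
    rw [hW, integral_biUnion_finset (s := wideArc (Q / T)) _ (fun r _ => measurableSet_Icc)
      (wideArc_disjoint hδ) fun r _ => hfc.integrableOn_Icc]
    exact Finset.sum_congr rfl fun r _ => setIntegral_wideArc (by linarith) hTpos r
  have h5 : ‖∫ α in I \ W, f α‖ ≤ C * ((X * H) ^ n / T) / K ^ 2 := by
    refine (norm_integral_le_integral_norm _).trans (le_trans ?_ h1)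
    have hpc := continuous_phiSum A X H (fun i => p i * H) (tentR D H)
    refine (setIntegral_mono_on (g := phiSum A X H (fun i => p i * H) (tentR D H)) ?_ ?_
      (measurableSet_Ioc.diff hWm) fun α _ => norm_arcSumDet_le A D p X H α).trans ?_
    · exact (hfint.mono_set Set.sdiff_subset).norm
    · exact (hpc.integrableOn_Icc.mono_set hIsub).mono_set Set.sdiff_subset
    · refine setIntegral_mono_set (hpc.integrableOn_Icc.mono_set Set.sdiff_subset)
        (Eventually.of_forall (phiSum_nonneg _ _ _ _ _)) (LE.le.eventuallyLE fun α hα => ?_)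
      refine ⟨hIsub hα.1, not_mem_arcs_of_not_mem_wideArc hδ hα.1 (fun r hr hr' => hα.2 ?_) hQ ?_⟩
      · exact Set.mem_biUnion hr hr'
      · gcongr
  have hn2 : ((X : ℝ) * H) ^ n = (X * H) ^ (n - 2) * T := by
    rw [hT, ← pow_add]; congr 1; omega
  have hTC : ((T : ℝ) : ℂ) ≠ 0 := by exact_mod_cast hTpos.ne'
  have hn2C : ((X : ℂ) * H) ^ n = (X * H) ^ (n - 2) * (T : ℂ) := by exact_mod_cast hn2
  have hmC : ((X : ℂ) * H) ^ (n - 2) ≠ 0 := by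
    refine pow_ne_zero _ ?_
    exact_mod_cast hT0.ne'
  have h6 : (nTent A D p X H : ℂ) / (X * H) ^ (n - 2) - ∑ r ∈ fracs Q,
      (∫ γ in -(Q : ℝ)..Q, f ((r.2 : ℝ) / r.1 + γ / T)) / (X * H) ^ n =
      (∫ α in I \ W, f α) / (X * H) ^ (n - 2) := by
    rw [h2, h3, h4, hn2C, ← Finset.sum_div, ← Finset.smul_sum, Complex.real_smul,
      Complex.ofReal_inv]
    generalize (∑ r ∈ fracs Q, ∫ γ in -(Q : ℝ)..Q, f ((r.2 : ℝ) / r.1 + γ / T)) = Z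
    field_simp
    ring
  have h7 : ‖((X : ℂ) * H) ^ (n - 2)‖ = (X * H : ℝ) ^ (n - 2) := by
    rw [norm_pow, ← Complex.ofReal_natCast, ← Complex.ofReal_mul, Complex.norm_real,
      Real.norm_of_nonneg hT0.le]
  have h8 := h6.symm ▸ norm_div (∫ α in I \ W, f α) (((X : ℂ) * H) ^ (n - 2))
  push_cast [hT] at h8 ⊢
  rw [h8, h7, div_le_iff₀ (by positivity)]
  refine h5.trans (le_of_eq ?_)
  rw [hn2]
  field_simp

theorem isCompact_box (n : ℕ) (κ : ℝ) : IsCompact (box n κ) :=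
  isCompact_univ_pi fun _ => isCompact_Icc

theorem oscInt_smul (A : Fin n → Fin n → Fin n → Fin n → ℤ) (γ N : ℝ) (y : Fin n → ℝ) :
    oscInt A γ (N • y) = oscInt A (N ^ 2 * γ) y := by
  have h : ∀ x, biFormR A x (N • y) = N ^ 2 * biFormR A x y := fun x => by
    simp only [biFormR, Finset.mul_sum, Pi.smul_apply, smul_eq_mul]
    refine Finset.sum_congr rfl fun i _ => Finset.sum_congr rfl fun j _ =>
      Finset.sum_congr rfl fun k _ => Finset.sum_congr rfl fun l _ => ?_
    ring
  simp only [oscInt, h]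
  exact integral_congr_ae (Eventually.of_forall fun x => by ring_nf)

open scoped Pointwise in
theorem smul_box {D : ℝ} (hD : 0 < D) (κ : ℝ) : D • box n κ = box n (D * κ) := by
  ext y
  rw [Set.mem_smul_set_iff_inv_smul_mem₀ hD.ne', mem_box_iff, mem_box_iff]
  refine forall_congr' fun i => ?_
  rw [Pi.smul_apply, smul_eq_mul, abs_mul, abs_inv, abs_of_pos hD, inv_mul_le_iff₀ hD]

theorem continuous_oscInt_right (A : Fin n → Fin n → Fin n → Fin n → ℤ) (γ : ℝ) :
    Continuous (oscInt A γ) :=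
  (continuous_oscInt A).comp (Continuous.prodMk_right γ)

theorem norm_psiInt_le (A : Fin n → Fin n → Fin n → Fin n → ℤ) {D : ℝ} (hD : 0 < D)
    {ψ : (Fin n → ℝ) → ℝ} (hψ : ∀ y, |ψ y| ≤ 1) (hψ' : ∀ y, y ∉ box n (D * 2) → ψ y = 0) (γ : ℝ) :
    ‖psiInt A ψ γ‖ ≤ D ^ n * oscMaj A (D ^ 2 * γ) := by
  have h1 : D ^ n * oscMaj A (D ^ 2 * γ) = ∫ y in box n (D * 2), ‖oscInt A γ y‖ := by
    have h2 := Measure.setIntegral_comp_smul_of_pos (volume : Measure (Fin n → ℝ))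
      (fun y => ‖oscInt A γ y‖) (box n 2) hD
    simp only [oscInt_smul, smul_box hD, Module.finrank_fin_fun, smul_eq_mul] at h2
    rw [oscMaj, h2]
    field_simp
  rw [h1, ← integral_indicator (measurableSet_box n _)]
  refine (norm_integral_le_integral_norm _).trans (integral_mono_of_nonneg
    (Eventually.of_forall fun _ => norm_nonneg _) ?_ (Eventually.of_forall fun y => ?_))
  · rw [integrable_indicator_iff (measurableSet_box n _)]
    exact (continuous_oscInt_right A γ).norm.continuousOn.integrableOn_compact (isCompact_box n _)
  · by_cases hy : y ∈ box n (D * 2)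
    · simp only [norm_smul, Set.indicator_of_mem hy]
      exact mul_le_of_le_one_left (norm_nonneg _) (hψ y)
    · simp [hψ' y hy, Set.indicator_of_notMem hy]

theorem stronglyMeasurable_psiInt (A : Fin n → Fin n → Fin n → Fin n → ℤ)
    {ψ : (Fin n → ℝ) → ℝ} (hψ : Measurable ψ) : StronglyMeasurable (psiInt A ψ) := by
  refine StronglyMeasurable.integral_prod_right (f := fun γ y => ψ y • oscInt A γ y) ?_
  exact (hψ.comp measurable_snd).stronglyMeasurable.smul (continuous_oscInt A).stronglyMeasurable

theorem SmoothBiquad.integrable_psiInt (hA : SmoothBiquad A) (hn : 35 < n) {D : ℝ} (hD : 0 < D)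
    {ψ : (Fin n → ℝ) → ℝ} (hm : Measurable ψ) (hψ : ∀ y, |ψ y| ≤ 1)
    (hψ' : ∀ y, y ∉ box n (D * 2) → ψ y = 0) : Integrable (psiInt A ψ) := by
  obtain ⟨C, hC⟩ := hA.exists_oscMaj_le hn
  have h1 := ((integrable_inv_one_add_sq.comp_mul_left' (R := D ^ 2) (by positivity)).const_mul
    C).const_mul (D ^ n)
  refine h1.mono' (stronglyMeasurable_psiInt A hm).aestronglyMeasurable
    (Eventually.of_forall fun γ => ?_)
  refine (norm_psiInt_le A hD hψ hψ' γ).trans ?_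
  gcongr
  exact hC _

theorem hat_eq_zero_of_notMem_box {D : ℝ} (hD : 1 ≤ D) {p : Fin n → ℝ} (hp : ∀ i, |p i| ≤ D)
    {y : Fin n → ℝ} (hy : y ∉ box n (D * 2)) : hat p y = 0 := by
  by_contra h
  refine hy (mem_box_iff.2 fun i => ?_)
  have h1 := abs_sub_lt_of_hat_ne_zero h i
  have h2 := abs_sub_abs_le_abs_sub (y i) (p i)
  linarith [hp i]

theorem abs_hat_le_one (p y : Fin n → ℝ) : |hat p y| ≤ 1 := by
  rw [abs_of_nonneg (hat_nonneg p y)]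
  exact hat_le_one p y

/-- Asymptotic formula for the number of zeros with a smooth weight on `y`. -/
theorem SmoothBiquad.tendsto_nTent (hA : SmoothBiquad A) (hn : 35 < n) {D : ℝ} {p : Fin n → ℝ}
    (hD : 1 ≤ D) (hp : ∀ i, |p i| ≤ D) {κ : Type*} {l : Filter κ} [l.IsCountablyGenerated]
    {X : κ → ℕ} (hX : Tendsto X l atTop) {H : κ → ℝ} (hH : Tendsto H l atTop)
    (hXH : ∀ᶠ k in l, (X k : ℝ) ≤ D * H k) :
    Tendsto (fun k => (nTent A D p (X k) (H k) : ℂ) / (X k * H k) ^ (n - 2)) l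
      (nhds (biSingSeries A * ∫ γ, psiInt A (hat p) γ)) := by
  have hfint := hA.integrable_psiInt hn (by linarith) (continuous_hat p).measurable
    (abs_hat_le_one p) (fun y => hat_eq_zero_of_notMem_box hD hp)
  have h1 : Tendsto (fun Q : ℕ => (∑ q ∈ Finset.Icc 1 Q, serTerm A q) *
      ∫ γ in -(Q : ℝ)..Q, psiInt A (hat p) γ) atTop
      (nhds (biSingSeries A * ∫ γ, psiInt A (hat p) γ)) :=
    (hA.tendsto_sum_serTerm hn).mul (intervalIntegral_tendsto_integral hfint
      (tendsto_neg_atTop_atBot.comp tendsto_natCast_atTop_atTop) tendsto_natCast_atTop_atTop)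
  obtain ⟨C₁, C, hC₁, hC, h2⟩ := hA.exists_norm_nTent_sub_le hn hD
  rw [Metric.tendsto_nhds]
  intro ε hε
  have h3 : Tendsto (fun K : ℕ => C / (K : ℝ) ^ 2) atTop (nhds 0) :=
    tendsto_const_nhds.div_atTop ((tendsto_pow_atTop two_ne_zero).comp tendsto_natCast_atTop_atTop)
  obtain ⟨K, hK, hK1⟩ := ((h3.eventually_lt_const (show 0 < ε / 3 by positivity)).and
    (eventually_ge_atTop 1)).exists
  obtain ⟨Q, hQ, hQ1⟩ := (((Metric.tendsto_nhds.1 h1) (ε / 3) (by positivity)).and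
    (tendsto_natCast_atTop_atTop.eventually_ge_atTop (C₁ * (K : ℝ) ^ 3))).exists
  have hXR : Tendsto (fun k => (X k : ℝ)) l atTop := tendsto_natCast_atTop_atTop.comp hX
  have h4 : Tendsto (fun k => ∑ r ∈ fracs Q, (∫ γ in -(Q : ℝ)..Q,
      arcSumDet A D p (X k) (H k) ((r.2 : ℝ) / r.1 + γ / (X k * H k) ^ 2)) / (X k * H k) ^ n) l
      (nhds ((∑ q ∈ Finset.Icc 1 Q, serTerm A q) * ∫ γ in -(Q : ℝ)..Q, psiInt A (hat p) γ)) := by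
    have h5 : (∑ q ∈ Finset.Icc 1 Q, serTerm A q) * ∫ γ in -(Q : ℝ)..Q, psiInt A (hat p) γ =
        ∑ r ∈ fracs Q, expS A r.1 r.2 / (r.1 : ℂ) ^ (2 * n) *
          ∫ γ in -(Q : ℝ)..Q, psiInt A (hat p) γ := by
      rw [← Finset.sum_mul, fracs, Finset.sum_sigma]
      rfl
    rw [h5]
    exact tendsto_finsetSum _ fun r hr => hA.tendsto_integral_arcSumDet (by omega) (by linarith)
      hp hX hH (mem_fracs.1 hr).1 r.2 Q
  have h6 : Tendsto (fun k => (Q : ℝ) / (X k * H k) ^ 2) l (nhds 0) :=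
    tendsto_const_nhds.div_atTop ((tendsto_pow_atTop two_ne_zero).comp (hXR.atTop_mul_atTop₀ hH))
  have hK' : (1 : ℝ) ≤ K := by exact_mod_cast hK1
  have hQ0 : (1 : ℝ) ≤ Q := by
    refine le_trans ?_ hQ1
    nlinarith [one_le_pow₀ hK' (n := 3)]
  filter_upwards [(Metric.tendsto_nhds.1 h4) (ε / 3) (by positivity), hXH,
    h6.eventually_lt_const (show (0 : ℝ) < 1 / (2 * (Q : ℝ) ^ 2) by positivity),
    hH.eventually_ge_atTop 1, hXR.eventually_ge_atTop K] with k e1 e2 e3 e4 e5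
  have e6 := h2 p (X k) (H k) K Q hp e4 e2 hK' e5 hQ1 e3
  rw [← dist_eq_norm] at e6
  have e7 := (dist_triangle _ _ _).trans (add_le_add e6 e1.le)
  refine (dist_triangle _ _ _).trans_lt ((add_lt_add_of_le_of_lt e7 hQ).trans_le ?_)
  linarith

end

section

/-! ### Asymptotic formula for boxes -/

variable {n : ℕ} {A : Fin n → Fin n → Fin n → Fin n → ℤ}

theorem SmoothBiquad.exists_det_dblMat_ne_zero
    (hA : SmoothBiquad A) : ∃ y : Fin n → ℝ, (dblMat A y).det ≠ 0 := by
  by_contra! h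
  have h1 : (dblMat A (.X : Fin n → MvPolynomial (Fin n) ℝ)).det = 0 := by
    refine MvPolynomial.funext fun y => ?_
    rw [map_det_dblMat, map_zero]
    simpa using h y
  refine hA.det_dblMat_ne_zero ?_
  have h2 := congrArg (MvPolynomial.map Complex.ofRealHom) h1
  rw [map_det_dblMat, map_zero] at h2
  simpa using h2

theorem continuous_det_dblMat (A : Fin n → Fin n → Fin n → Fin n → ℤ) :
    Continuous fun y : Fin n → ℝ => (dblMat A y).det := by
  refine Continuous.matrix_det ?_
  refine continuous_matrix fun i j => ?_
  simp only [dblMat, Matrix.of_apply]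
  fun_prop

/-- The determinant vanishes only on a null set. -/
theorem SmoothBiquad.ae_det_dblMat_ne_zero
    (hA : SmoothBiquad A) : ∀ᵐ y : Fin n → ℝ, (dblMat A y).det ≠ 0 := by
  obtain ⟨y₀, hy₀⟩ := hA.exists_det_dblMat_ne_zero
  have hc : Continuous fun z : ℝ × (Fin n → ℝ) => (dblMat A (z.1 • z.2 + y₀)).det :=
    (continuous_det_dblMat A).comp (by fun_prop)
  have h1 : ∀ᵐ y : Fin n → ℝ, ∀ᵐ s : ℝ, (dblMat A (s • y + y₀)).det ≠ 0 := by
    refine Eventually.of_forall fun y => ?_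
    set q : Polynomial ℝ :=
      (dblMat A fun i => Polynomial.X * Polynomial.C (y i) + Polynomial.C (y₀ i)).det with hq
    have hev : ∀ s, q.eval s = (dblMat A (s • y + y₀)).det := fun s => by
      rw [hq, ← Polynomial.coe_evalRingHom, map_det_dblMat]
      simp only [Polynomial.coe_evalRingHom, Polynomial.eval_add, Polynomial.eval_mul,
        Polynomial.eval_X, Polynomial.eval_C]
      rfl
    have hq0 : q ≠ 0 := by
      intro h
      have := hev 0
      rw [h, Polynomial.eval_zero, zero_smul, zero_add] at this
      exact hy₀ this.symm
    rw [ae_iff]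
    refine ((Polynomial.finite_setOfPred_isRoot hq0).subset fun s hs => ?_).measure_zero _
    simp only [not_not] at hs
    exact (hev s).trans hs
  have h2 := (Measure.ae_ae_comm (μ := (volume : Measure ℝ)) (ν := (volume : Measure (Fin n → ℝ)))
    (p := fun s y => (dblMat A (s • y + y₀)).det ≠ 0)
    (hc.measurable (measurableSet_singleton 0).compl)).2 h1
  obtain ⟨s, hs, hs0⟩ := (h2.and (Measure.ae_ne volume 0)).exists
  rw [ae_iff] at hs ⊢
  have h3 : {y : Fin n → ℝ | ¬(dblMat A (s • y + y₀)).det ≠ 0} =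
      (fun y => s • y) ⁻¹' ((fun y => y + y₀) ⁻¹' {y | ¬(dblMat A y).det ≠ 0}) := rfl
  rw [h3, Measure.addHaar_preimage_smul _ hs0, measure_preimage_add_right, mul_eq_zero] at hs
  refine hs.resolve_left ?_
  rw [ENNReal.ofReal_eq_zero, not_le]
  positivity

theorem det_dblMat_smul {k : Type*} [CommRing k] (A : Fin n → Fin n → Fin n → Fin n → ℤ)
    (c : k) (y : Fin n → k) : (dblMat A (c • y)).det = (c ^ 2) ^ n * (dblMat A y).det := by
  have h : dblMat A (c • y) = c ^ 2 • dblMat A y := by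
    ext i j
    simp only [dblMat, Matrix.of_apply, Matrix.smul_apply, Finset.mul_sum, Pi.smul_apply,
      smul_eq_mul]
    exact Finset.sum_congr rfl fun _ _ => Finset.sum_congr rfl fun _ _ => by ring
  rw [h, Matrix.det_smul, Fintype.card_fin]

theorem detFx_ne_zero_iff (A : Fin n → Fin n → Fin n → Fin n → ℤ) (x : Fin n → ℤ) :
    detFx A x ≠ 0 ↔ (dblMat A fun i => (x i : ℝ)).det ≠ 0 := by
  have h := map_det_dblMat (Int.castRingHom ℝ) A x
  simp only [eq_intCast] at h
  rw [detFx_eq, ← h]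
  simp

theorem sum_tent_floor (t : ℝ) : tent 1 (⌊t⌋ : ℤ) t + tent 1 ((⌊t⌋ + 1 : ℤ) : ℝ) t = 1 := by
  have h1 := Int.floor_le t
  have h2 := Int.lt_floor_add_one t
  unfold tent
  push_cast
  rw [abs_of_nonneg (by linarith), abs_of_neg (by linarith), max_eq_right (by linarith),
    max_eq_right (by linarith)]
  ring

theorem tent_eq_zero_of_floor {t : ℝ} {j : ℤ} (h : j ≠ ⌊t⌋) (h' : j ≠ ⌊t⌋ + 1) :
    tent 1 (j : ℝ) t = 0 := by
  refine tent_eq_zero one_pos (not_lt.1 fun h1 => ?_)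
  rw [abs_lt] at h1
  have h2 := Int.floor_le t
  have h3 := Int.lt_floor_add_one t
  have h4 : (j : ℝ) < ⌊t⌋ + 2 := by linarith
  have h5 : (⌊t⌋ : ℝ) < j + 1 := by linarith
  have h6 : j < ⌊t⌋ + 2 := by exact_mod_cast h4
  have h7 : ⌊t⌋ < j + 1 := by exact_mod_cast h5
  omega

theorem sum_tent_union (S : Finset ℤ) (t : ℝ) :
    ∑ j ∈ S ∪ {⌊t⌋, ⌊t⌋ + 1}, tent 1 (j : ℝ) t = 1 := by
  rw [← Finset.sum_subset (Finset.subset_union_right (s₁ := S)), Finset.sum_pair (by omega), sum_tent_floor]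
  intro j _ hj
  simp only [Finset.mem_insert, Finset.mem_singleton, not_or] at hj
  exact tent_eq_zero_of_floor hj.1 hj.2

theorem sum_tent_le_one (S : Finset ℤ) (t : ℝ) : ∑ j ∈ S, tent 1 (j : ℝ) t ≤ 1 := by
  refine le_of_le_of_eq ?_ (sum_tent_union S t)
  exact Finset.sum_le_sum_of_subset_of_nonneg (Finset.subset_union_left (s₁ := S))
    fun _ _ _ => tent_nonneg _ _ _

theorem sum_tent_eq_one {N : ℕ} {t : ℝ} (ht : |t| ≤ N) :
    ∑ j ∈ Finset.Icc (-(N : ℤ)) N, tent 1 (j : ℝ) t = 1 := by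
  refine Eq.trans ?_ (sum_tent_union (Finset.Icc (-(N : ℤ)) N) t)
  refine Finset.sum_subset Finset.subset_union_left fun j _ hj => ?_
  refine tent_eq_zero one_pos (not_lt.1 fun h1 => hj ?_)
  have h2 := abs_sub_abs_le_abs_sub (j : ℝ) t
  rw [abs_sub_comm] at h2
  have h3 : (|j| : ℤ) < (N : ℤ) + 1 := by
    have : |(j : ℝ)| < N + 1 := by linarith
    exact_mod_cast this
  rw [Finset.mem_Icc]
  exact abs_le.1 (by omega)

/-- A sum of hat functions on the lattice of mesh `1 / N`. -/
def hatSum (P : Finset (Fin n → ℤ)) (N : ℕ) (y : Fin n → ℝ) : ℝ :=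
  ∑ p ∈ P, hat (fun i => (p i : ℝ)) ((N : ℝ) • y)

theorem hatSum_nonneg (P : Finset (Fin n → ℤ)) (N : ℕ) (y : Fin n → ℝ) : 0 ≤ hatSum P N y :=
  Finset.sum_nonneg fun _ _ => hat_nonneg _ _

theorem hatSum_ibox (N : ℕ) (y : Fin n → ℝ) : hatSum (ibox n N) N y =
    ∏ i, ∑ j ∈ Finset.Icc (-(N : ℤ)) N, tent 1 (j : ℝ) (N * y i) := by
  rw [Finset.prod_univ_sum]
  rfl

theorem hatSum_le_one {P : Finset (Fin n → ℤ)} {N : ℕ} (hP : P ⊆ ibox n N) (y : Fin n → ℝ) :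
    hatSum P N y ≤ 1 := by
  refine (Finset.sum_le_sum_of_subset_of_nonneg hP fun _ _ _ => hat_nonneg _ _).trans ?_
  refine (hatSum_ibox N y).trans_le (Finset.prod_le_one (fun i _ => ?_) fun i _ => ?_)
  · exact Finset.sum_nonneg fun _ _ => tent_nonneg _ _ _
  · exact sum_tent_le_one _ _

theorem abs_hatSum_le_one {P : Finset (Fin n → ℤ)} {N : ℕ} (hP : P ⊆ ibox n N) (y : Fin n → ℝ) :
    |hatSum P N y| ≤ 1 := by
  rw [abs_of_nonneg (hatSum_nonneg _ _ _)]
  exact hatSum_le_one hP y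

theorem hatSum_ibox_eq_one {N : ℕ} {y : Fin n → ℝ} (hy : y ∈ box n 1) :
    hatSum (ibox n N) N y = 1 := by
  rw [hatSum_ibox]
  refine Finset.prod_eq_one fun i _ => sum_tent_eq_one ?_
  rw [abs_mul, Nat.abs_cast]
  exact mul_le_of_le_one_right (Nat.cast_nonneg _) (mem_box_iff.1 hy i)

theorem measurable_hatSum (P : Finset (Fin n → ℤ)) (N : ℕ) : Measurable (hatSum P N) :=
  Finset.measurable_fun_sum _ fun _ _ => ((continuous_hat _).comp (continuous_const_smul _)).measurable

theorem hat_smul_eq_zero {N : ℕ} (hN : 1 ≤ N) {p : Fin n → ℤ} (hp : p ∈ ibox n N) {y : Fin n → ℝ}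
    (hy : y ∉ box n (1 * 2)) : hat (fun i => (p i : ℝ)) ((N : ℝ) • y) = 0 := by
  have hN0 : (0 : ℝ) < N := by exact_mod_cast hN
  refine hat_eq_zero_of_notMem_box (D := N) (by exact_mod_cast hN)
    (fun i => by exact_mod_cast mem_ibox.1 hp i) fun h => hy ?_
  rw [mem_box_iff] at h ⊢
  intro i
  have := h i
  rw [Pi.smul_apply, smul_eq_mul, abs_mul, Nat.abs_cast] at this
  rw [one_mul]
  exact le_of_mul_le_mul_left this hN0

theorem hatSum_eq_zero {P : Finset (Fin n → ℤ)} {N : ℕ} (hN : 1 ≤ N) (hP : P ⊆ ibox n N)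
    {y : Fin n → ℝ} (hy : y ∉ box n (1 * 2)) : hatSum P N y = 0 :=
  Finset.sum_eq_zero fun _ hp => hat_smul_eq_zero hN (hP hp) hy

theorem integral_psiInt_comp_smul (A : Fin n → Fin n → Fin n → Fin n → ℤ) (hn : 2 ≤ n)
    (ψ : (Fin n → ℝ) → ℝ) {N : ℝ} (hN : 0 < N) :
    ∫ γ, psiInt A (fun y => ψ (N • y)) γ = ((N : ℂ) ^ (n - 2))⁻¹ * ∫ γ, psiInt A ψ γ := by
  have h : ∀ γ, psiInt A (fun y => ψ (N • y)) γ = (N ^ n)⁻¹ • psiInt A ψ (γ / N ^ 2) := fun γ => by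
    have h1 := Measure.integral_comp_smul (volume : Measure (Fin n → ℝ))
      (fun y => ψ y • oscInt A (γ / N ^ 2) y) N
    simp only [oscInt_smul, mul_div_cancel₀ γ (pow_ne_zero 2 hN.ne'), Module.finrank_fin_fun] at h1
    rw [abs_of_pos (by positivity)] at h1
    exact h1
  simp only [h]
  rw [integral_smul, Measure.integral_comp_div, smul_smul, Complex.real_smul]
  congr 1
  rw [abs_of_pos (by positivity), show n = (n - 2) + 2 by omega, pow_add, Nat.add_sub_cancel]
  push_cast
  have : (N : ℂ) ≠ 0 := by exact_mod_cast hN.ne'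
  field_simp

theorem SmoothBiquad.integral_psiInt_hatSum
    (hA : SmoothBiquad A) (hn : 35 < n) {P : Finset (Fin n → ℤ)} {N : ℕ} (hN : 1 ≤ N)
    (hP : P ⊆ ibox n N) : ∫ γ, psiInt A (hatSum P N) γ =
      ∑ p ∈ P, ((N : ℂ) ^ (n - 2))⁻¹ * ∫ γ, psiInt A (hat fun i => (p i : ℝ)) γ := by
  have hN0 : (0 : ℝ) < N := by exact_mod_cast hN
  have hc : ∀ p : Fin n → ℤ, Continuous fun y => hat (fun i => (p i : ℝ)) ((N : ℝ) • y) :=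
    fun p => (continuous_hat _).comp (continuous_const_smul _)
  have h1 : ∀ γ, psiInt A (hatSum P N) γ =
      ∑ p ∈ P, psiInt A (fun y => hat (fun i => (p i : ℝ)) ((N : ℝ) • y)) γ := fun γ => by
    simp only [psiInt, hatSum, Finset.sum_smul]
    refine integral_finsetSum _ fun p _ => ?_
    refine ((hc p).smul (continuous_oscInt_right A γ)).integrable_of_hasCompactSupport ?_
    exact ((hasCompactSupport_hat _).comp_smul hN0.ne').smul_right
  simp only [h1]
  rw [integral_finsetSum]
  · refine Finset.sum_congr rfl fun p _ => ?_
    rw [integral_psiInt_comp_smul A (by omega) _ hN0]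
    simp
  · intro p hp
    exact hA.integrable_psiInt hn one_pos (hc p).measurable (fun _ => abs_hat_le_one _ _)
      fun y hy => hat_smul_eq_zero hN (hP hp) hy

theorem biSingInt_eq (A : Fin n → Fin n → Fin n → Fin n → ℤ) :
    biSingInt A = ∫ γ, psiInt A ((box n 1).indicator 1) γ := by
  have h1 : ∀ γ, psiInt A ((box n 1).indicator 1) γ =
      ∫ p in box n 1 ×ˢ box n 1, ee (γ * biFormR A p.1 p.2) := fun γ => by
    have h2 : psiInt A ((box n 1).indicator 1) γ = ∫ y in box n 1, oscInt A γ y := by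
      rw [← integral_indicator (measurableSet_box n 1)]
      refine integral_congr_ae (Eventually.of_forall fun y => ?_)
      by_cases hy : y ∈ box n 1 <;> simp [hy]
    have hc : Continuous fun p : (Fin n → ℝ) × (Fin n → ℝ) => ee (γ * biFormR A p.1 p.2) := by
      refine continuous_ee.comp (continuous_const.mul ?_)
      unfold biFormR
      fun_prop
    rw [h2]
    have hi := hc.continuousOn.integrableOn_compact (μ := volume)
      ((isCompact_box n 1).prod (isCompact_box n 1))
    rw [Measure.volume_eq_prod, IntegrableOn, ← Measure.prod_restrict] at hi
    rw [Measure.volume_eq_prod, ← Measure.prod_restrict, integral_prod_symm _ hi]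
    rfl
  simp only [h1]
  rw [biSingInt, ← integral_neg_eq_self]
  simp only [neg_mul, neg_neg]

/-- Dominated convergence for the local factor at infinity. -/
theorem SmoothBiquad.tendsto_integral_psiInt
    (hA : SmoothBiquad A) (hn : 35 < n) {ψ : ℕ → (Fin n → ℝ) → ℝ} {φ : (Fin n → ℝ) → ℝ}
    (hm : ∀ N, Measurable (ψ N))
    (h1 : ∀ N y, |ψ N y| ≤ 1) (h2 : ∀ N y, y ∉ box n (1 * 2) → ψ N y = 0)
    (h : ∀ᵐ y, Tendsto (fun N => ψ N y) atTop (nhds (φ y))) :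
    Tendsto (fun N => ∫ γ, psiInt A (ψ N) γ) atTop (nhds (∫ γ, psiInt A φ γ)) := by
  obtain ⟨C, hC⟩ := hA.exists_oscMaj_le hn
  refine tendsto_integral_of_dominated_convergence (fun γ => C * (1 + γ ^ 2)⁻¹)
    (fun N => (stronglyMeasurable_psiInt A (hm N)).aestronglyMeasurable)
    (integrable_inv_one_add_sq.const_mul C)
    (fun N => Eventually.of_forall fun γ => ?_) (Eventually.of_forall fun γ => ?_)
  · refine (norm_psiInt_le A one_pos (h1 N) (h2 N) γ).trans ?_
    simpa using hC γ
  · refine tendsto_integral_of_dominated_convergence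
      ((box n (1 * 2)).indicator fun _ => (2 : ℝ) ^ n) (fun N => ?_) ?_
      (fun N => Eventually.of_forall fun y => ?_) ?_
    · exact ((hm N).stronglyMeasurable.smul
        (continuous_oscInt_right A γ).stronglyMeasurable).aestronglyMeasurable
    · rw [integrable_indicator_iff (measurableSet_box n _)]
      exact integrableOn_const (volume_box_lt_top _).ne
    · by_cases hy : y ∈ box n (1 * 2)
      · rw [Set.indicator_of_mem hy, norm_smul]
        exact (mul_le_of_le_one_left (norm_nonneg _) (h1 N y)).trans (norm_oscInt_le A γ y)
      · rw [h2 N y hy, Set.indicator_of_notMem hy, zero_smul, norm_zero]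
    · filter_upwards [h] with y hy using hy.smul_const _

/-- The number of zeros in a box, smoothed by a sum of hat functions. -/
def nHat (A : Fin n → Fin n → Fin n → Fin n → ℤ) (P : Finset (Fin n → ℤ)) (N X Y : ℕ) : ℝ :=
  ∑ p ∈ P, nTent A N (fun i => (p i : ℝ)) X ((Y : ℝ) / N)

theorem SmoothBiquad.tendsto_nHat
    (hA : SmoothBiquad A) (hn : 35 < n) {P : Finset (Fin n → ℤ)} {N : ℕ} (hN : 1 ≤ N)
    (hP : P ⊆ ibox n N) {κ : Type*} {l : Filter κ} [l.IsCountablyGenerated]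
    {X Y : κ → ℕ} (hX : Tendsto X l atTop) (hXY : ∀ᶠ k in l, X k ≤ Y k) :
    Tendsto (fun k => (nHat A P N (X k) (Y k) : ℂ) / (X k * Y k : ℂ) ^ (n - 2)) l
      (nhds (biSingSeries A * ∫ γ, psiInt A (hatSum P N) γ)) := by
  have hN0 : (0 : ℝ) < N := by exact_mod_cast hN
  have hNC : (N : ℂ) ≠ 0 := by exact_mod_cast hN0.ne'
  have hY : Tendsto Y l atTop := tendsto_atTop_mono' l hXY hX
  have hH : Tendsto (fun k => (Y k : ℝ) / N) l atTop :=
    (tendsto_natCast_atTop_atTop.comp hY).atTop_div_const hN0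
  rw [hA.integral_psiInt_hatSum hn hN hP, Finset.mul_sum]
  simp only [nHat, Complex.ofReal_sum, Finset.sum_div]
  refine tendsto_finsetSum _ fun p hp => ?_
  have h1 := hA.tendsto_nTent hn (D := N) (p := fun i => (p i : ℝ)) (by exact_mod_cast hN)
    (fun i => by exact_mod_cast mem_ibox.1 (hP hp) i) hX hH (by
      filter_upwards [hXY] with k hk
      rw [mul_div_cancel₀ _ hN0.ne']
      exact_mod_cast hk)
  have h2 := h1.const_mul ((N : ℂ) ^ (n - 2))⁻¹
  rw [mul_left_comm] at h2
  refine h2.congr fun k => ?_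
  push_cast
  rw [← mul_div_assoc (X k : ℂ), div_pow]
  field_simp

theorem nHat_eq (A : Fin n → Fin n → Fin n → Fin n → ℤ) (P : Finset (Fin n → ℤ)) {N X Y : ℕ}
    (hN : 1 ≤ N) (hY : 1 ≤ Y) : nHat A P N X Y = ∑ x ∈ ibox n X, if detFx A x ≠ 0 then
      ∑ y ∈ ibox n (tentR N ((Y : ℝ) / N)), if biForm A x y = 0 then
        hatSum P N (fun i => (y i : ℝ) / Y) else 0 else 0 := by
  have hN0 : (0 : ℝ) < N := by exact_mod_cast hN
  have hY0 : (0 : ℝ) < Y := by exact_mod_cast hY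
  have h : ∀ (p y : Fin n → ℤ), ∏ i, tent ((Y : ℝ) / N) (p i * ((Y : ℝ) / N)) (y i) =
      hat (fun i => (p i : ℝ)) ((N : ℝ) • fun i => (y i : ℝ) / Y) := fun p y => by
    refine Finset.prod_congr rfl fun i _ => ?_
    rw [tent_scale (div_pos hY0 hN0)]
    congr 1
    rw [Pi.smul_apply, smul_eq_mul]
    field_simp
  unfold nHat nTent
  simp only [h]
  rw [Finset.sum_comm]
  refine Finset.sum_congr rfl fun x _ => ?_
  split_ifs
  · rw [Finset.sum_comm]
    refine Finset.sum_congr rfl fun y _ => ?_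
    split_ifs
    · rfl
    · exact Finset.sum_const_zero
  · exact Finset.sum_const_zero

open Classical in
theorem nBox_eq_sum (A : Fin n → Fin n → Fin n → Fin n → ℤ) (X Y : ℕ) : (nBox A X Y : ℝ) =
    ∑ x ∈ ibox n X, if detFx A x ≠ 0 then ∑ y ∈ ibox n Y,
      if biForm A x y = 0 then if detFy A y ≠ 0 then (1 : ℝ) else 0 else 0 else 0 := by
  rw [nBox, Finset.card_filter, Finset.sum_product]
  push_cast
  refine Finset.sum_congr rfl fun x _ => ?_
  by_cases hx : detFx A x ≠ 0
  · rw [if_pos hx]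
    refine Finset.sum_congr rfl fun y _ => ?_
    by_cases h1 : biForm A x y = 0 <;> by_cases h2 : detFy A y ≠ 0 <;> simp [hx, h1, h2]
  · rw [if_neg hx]
    exact Finset.sum_eq_zero fun y _ => if_neg fun h => hx h.1

theorem ibox_subset_tentR {N Y : ℕ} (hN : 1 ≤ N) : ibox n Y ⊆ ibox n (tentR N ((Y : ℝ) / N)) := by
  intro y hy
  have hN0 : (0 : ℝ) < N := by exact_mod_cast hN
  rw [mem_ibox] at hy ⊢
  refine fun i => (hy i).trans ?_
  have h1 : ((Y : ℤ) : ℝ) ≤ (tentR N ((Y : ℝ) / N) : ℤ) := by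
    refine le_trans ?_ (Int.le_ceil _)
    push_cast
    rw [add_mul, mul_div_cancel₀ _ hN0.ne']
    have : 0 ≤ (Y : ℝ) / N := by positivity
    linarith
  exact_mod_cast h1

theorem div_mem_box_iff {Y : ℕ} (hY : 1 ≤ Y) (y : Fin n → ℤ) :
    (fun i => (y i : ℝ) / Y) ∈ box n 1 ↔ y ∈ ibox n Y := by
  have hY0 : (0 : ℝ) < Y := by exact_mod_cast hY
  rw [mem_box_iff, mem_ibox]
  refine forall_congr' fun i => ?_
  rw [abs_div, Nat.abs_cast, div_le_one hY0]
  norm_cast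

theorem nBox_le_nHat (A : Fin n → Fin n → Fin n → Fin n → ℤ) {N X Y : ℕ} (hN : 1 ≤ N)
    (hY : 1 ≤ Y) : (nBox A X Y : ℝ) ≤ nHat A (ibox n N) N X Y := by
  rw [nHat_eq A _ hN hY, nBox_eq_sum]
  refine Finset.sum_le_sum fun x _ => ?_
  split_ifs
  · refine (Finset.sum_le_sum fun y hy => ?_).trans (Finset.sum_le_sum_of_subset_of_nonneg
      (ibox_subset_tentR hN) fun y _ _ => ?_)
    · rw [hatSum_ibox_eq_one ((div_mem_box_iff hY y).2 hy)]
      split_ifs <;> norm_num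
    · split_ifs
      exacts [hatSum_nonneg _ _ _, le_rfl]
  · exact le_rfl

theorem nHat_le_nBox (A : Fin n → Fin n → Fin n → Fin n → ℤ) {P : Finset (Fin n → ℤ)} {N X Y : ℕ}
    (hN : 1 ≤ N) (hY : 1 ≤ Y) (hP : P ⊆ ibox n N)
    (h : ∀ p ∈ P, ∀ y, hat (fun i => (p i : ℝ)) ((N : ℝ) • y) ≠ 0 →
      y ∈ box n 1 ∧ (dblMat (swapA A) y).det ≠ 0) :
    nHat A P N X Y ≤ nBox A X Y := by
  have hY0 : (0 : ℝ) < Y := by exact_mod_cast hY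
  have h' : ∀ y, hatSum P N y ≠ 0 → y ∈ box n 1 ∧ (dblMat (swapA A) y).det ≠ 0 := fun y hy => by
    obtain ⟨p, hp, hp'⟩ := Finset.exists_ne_zero_of_sum_ne_zero hy
    exact h p hp y hp'
  rw [nHat_eq A _ hN hY, nBox_eq_sum]
  refine Finset.sum_le_sum fun x _ => ?_
  split_ifs
  · refine le_of_eq_of_le (Finset.sum_subset (ibox_subset_tentR hN) fun y _ hy => ?_).symm
      (Finset.sum_le_sum fun y hy => ?_)
    · split_ifs
      · by_contra h1
        exact hy ((div_mem_box_iff hY y).1 (h' _ h1).1)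
      · rfl
    · split_ifs with h1 h2
      · exact hatSum_le_one hP _
      · by_contra! h3
        have h4 := (h' _ h3.ne').2
        have h5 : (fun i => (y i : ℝ) / Y) = (Y : ℝ)⁻¹ • fun i => (y i : ℝ) := by
          ext i
          simp [div_eq_inv_mul]
        rw [h5, det_dblMat_smul] at h4
        exact h2 ((detFx_ne_zero_iff (swapA A) y).2 (right_ne_zero_of_mul h4))
      · exact le_rfl
  · exact le_rfl

/-- The lattice points whose hat function is supported in the box, away from the zeros of the
determinant. -/
def innerPts (A : Fin n → Fin n → Fin n → Fin n → ℤ) (N : ℕ) : Finset (Fin n → ℤ) :=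
  @Finset.filter _ (fun p : Fin n → ℤ =>
    ∀ y : Fin n → ℝ, hat (fun i => (p i : ℝ)) ((N : ℝ) • y) ≠ 0 →
      y ∈ box n 1 ∧ (dblMat (swapA A) y).det ≠ 0) (fun _ => Classical.propDecidable _) (ibox n N)

theorem innerPts_subset (A : Fin n → Fin n → Fin n → Fin n → ℤ) (N : ℕ) :
    innerPts A N ⊆ ibox n N :=
  @Finset.filter_subset _ _ (fun _ => Classical.propDecidable _) _

theorem eventually_hatSum_ibox_eq_zero {y : Fin n → ℝ} (hy : y ∉ box n 1) :
    ∀ᶠ N : ℕ in atTop, hatSum (ibox n N) N y = 0 := by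
  rw [mem_box_iff] at hy
  push Not at hy
  obtain ⟨i, hi⟩ := hy
  filter_upwards [tendsto_natCast_atTop_atTop.eventually_ge_atTop (1 / (|y i| - 1))] with N hN
  refine Finset.sum_eq_zero fun p hp => ?_
  by_contra h
  have h1 := abs_sub_lt_of_hat_ne_zero h i
  have h2 : |(p i : ℝ)| ≤ N := by exact_mod_cast mem_ibox.1 hp i
  have h3 := abs_sub_abs_le_abs_sub (((N : ℝ) • y) i) (p i)
  rw [Pi.smul_apply, smul_eq_mul] at h1 h3
  rw [abs_mul, Nat.abs_cast] at h3
  rw [div_le_iff₀ (by linarith)] at hN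
  nlinarith

theorem eventually_hatSum_innerPts_eq_one {y : Fin n → ℝ}
    (hy : ∀ i, |y i| < 1) (hd : (dblMat (swapA A) y).det ≠ 0) :
    ∀ᶠ N : ℕ in atTop, hatSum (innerPts A N) N y = 1 := by
  have hU : ∀ᶠ z in nhds y, (∀ i, |z i| < 1) ∧ (dblMat (swapA A) z).det ≠ 0 := by
    refine (eventually_all.2 fun i => ?_).and
      ((continuous_det_dblMat (swapA A)).continuousAt.eventually_ne hd)
    exact (continuous_apply i).abs.continuousAt.eventually_lt continuousAt_const (hy i)
  obtain ⟨δ, hδ, hball⟩ := Metric.eventually_nhds_iff.1 hU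
  filter_upwards [tendsto_natCast_atTop_atTop.eventually_gt_atTop (2 / δ), eventually_ge_atTop 1]
    with N hN hN1
  have hN0 : (0 : ℝ) < N := by exact_mod_cast hN1
  rw [← hatSum_ibox_eq_one (N := N) (mem_box_iff.2 fun i => (hy i).le)]
  refine Finset.sum_subset (innerPts_subset A N) fun p hp hp' => ?_
  by_contra h
  refine hp' ((@Finset.mem_filter _ _ (fun _ => Classical.propDecidable _) _ _).2 ⟨hp, ?_⟩)
  intro z hz
  have h1 : dist z y < δ := by
    refine (dist_pi_lt_iff hδ).2 fun i => ?_
    have e1 := abs_sub_lt_of_hat_ne_zero h i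
    have e2 := abs_sub_lt_of_hat_ne_zero hz i
    rw [Pi.smul_apply, smul_eq_mul, abs_lt] at e1 e2
    rw [div_lt_iff₀ hδ] at hN
    rw [Real.dist_eq, abs_lt]
    constructor <;> nlinarith
  have h2 := hball h1
  exact ⟨mem_box_iff.2 fun i => (h2.1 i).le, h2.2⟩

theorem dist_ofReal_lt_of_sandwich {u v w ε : ℝ} {a b c z : ℂ} (h1 : v ≤ w) (h2 : w ≤ u)
    (e1 : dist (u : ℂ) a < ε / 6) (e1' : dist a c < ε / 6) (e2 : dist (v : ℂ) b < ε / 6)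
    (e2' : dist b c < ε / 6) (hz : z = w) : dist z c < ε := by
  have g1 := (dist_triangle _ _ _).trans_lt (add_lt_add e1 e1')
  have g2 := (dist_triangle _ _ _).trans_lt (add_lt_add e2 e2')
  have g3 := (dist_triangle_right _ _ _).trans_lt (add_lt_add g1 g2)
  have g4 : dist (w : ℂ) u ≤ dist (u : ℂ) v := by
    simp only [Complex.dist_eq, ← Complex.ofReal_sub, Complex.norm_real, Real.norm_eq_abs]
    rw [abs_of_nonpos (by linarith), abs_of_nonneg (by linarith)]
    linarith
  have g5 := dist_triangle (w : ℂ) u c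
  rw [hz]
  linarith

/-- Asymptotic formula for the number of zeros in a box. -/
theorem SmoothBiquad.tendsto_nBox
    (hA : SmoothBiquad A) (hn : 35 < n) {κ : Type*} {l : Filter κ} [l.IsCountablyGenerated]
    {X Y : κ → ℕ} (hX : Tendsto X l atTop) (hXY : ∀ᶠ k in l, X k ≤ Y k) :
    Tendsto (fun k => (nBox A (X k) (Y k) : ℂ) / (X k * Y k : ℂ) ^ (n - 2)) l
      (nhds (biSingSeries A * biSingInt A)) := by
  have hY : Tendsto Y l atTop := tendsto_atTop_mono' l hXY hX
  have hlim : ∀ P : ℕ → Finset (Fin n → ℤ), (∀ N, P N ⊆ ibox n N) →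
      (∀ᵐ y, Tendsto (fun N => hatSum (P N) N y) atTop (nhds ((box n 1).indicator 1 y))) →
      Tendsto (fun N => biSingSeries A * ∫ γ, psiInt A (hatSum (P (N + 1)) (N + 1)) γ) atTop
        (nhds (biSingSeries A * biSingInt A)) := fun P hP h => by
    rw [biSingInt_eq]
    refine (hA.tendsto_integral_psiInt hn (fun N => measurable_hatSum _ _)
      (fun N => abs_hatSum_le_one (hP _)) (fun N y => hatSum_eq_zero (by omega) (hP _)) ?_).const_mul _
    filter_upwards [h] with y hy using hy.comp (tendsto_add_atTop_nat 1)
  have hae : ∀ᵐ y : Fin n → ℝ, (∀ i, |y i| ≠ 1) ∧ (dblMat (_root_.swapA A) y).det ≠ 0 :=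
    (ae_abs_ne 1).and hA.swapA.ae_det_dblMat_ne_zero
  have hU := hlim (fun N => ibox n N) (fun N => subset_rfl) (by
    refine Eventually.of_forall fun y => tendsto_nhds_of_eventually_eq ?_
    by_cases hy : y ∈ box n 1
    · exact Eventually.of_forall fun N => by simp [hatSum_ibox_eq_one hy, hy]
    · simpa [hy] using eventually_hatSum_ibox_eq_zero hy)
  have hL := hlim (innerPts A) (innerPts_subset A) (by
    filter_upwards [hae] with y hy
    refine tendsto_nhds_of_eventually_eq ?_
    by_cases hy1 : y ∈ box n 1
    · simpa [hy1] using eventually_hatSum_innerPts_eq_one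
        (fun i => lt_of_le_of_ne (mem_box_iff.1 hy1 i) (hy.1 i)) hy.2
    · filter_upwards [eventually_hatSum_ibox_eq_zero hy1] with N hN
      rw [Set.indicator_of_notMem hy1]
      refine le_antisymm ?_ (hatSum_nonneg _ _ _)
      rw [← hN]
      exact Finset.sum_le_sum_of_subset_of_nonneg (innerPts_subset A N) fun _ _ _ => hat_nonneg _ _)
  rw [Metric.tendsto_nhds]
  intro ε hε
  have hε6 : 0 < ε / 6 := by positivity
  obtain ⟨N, hN1, hN2⟩ :=
    ((Metric.tendsto_nhds.1 hU _ hε6).and (Metric.tendsto_nhds.1 hL _ hε6)).exists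
  have h1 := hA.tendsto_nHat hn (N := N + 1) (by omega) (subset_refl (ibox n ((N + 1 : ℕ) : ℤ))) hX hXY
  have h2 := hA.tendsto_nHat hn (N := N + 1) (by omega) (innerPts_subset A (N + 1)) hX hXY
  filter_upwards [Metric.tendsto_nhds.1 h1 _ hε6, Metric.tendsto_nhds.1 h2 _ hε6,
    hX.eventually_ge_atTop 1, hY.eventually_ge_atTop 1] with k e1 e2 e3 e4
  have hT : (0 : ℝ) < ((X k : ℝ) * Y k) ^ (n - 2) := by positivity
  have f1 := div_le_div_of_nonneg_right (nBox_le_nHat A (N := N + 1) (X := X k) (by omega) e4) hT.le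
  have f2 := div_le_div_of_nonneg_right (nHat_le_nBox A (N := N + 1) (X := X k) (by omega) e4
    (innerPts_subset A (N + 1)) fun p hp =>
      ((@Finset.mem_filter _ _ (fun _ => Classical.propDecidable _) _ _).1 hp).2) hT.le
  refine dist_ofReal_lt_of_sandwich (u := nHat A (ibox n ((N + 1 : ℕ) : ℤ)) (N + 1) (X k) (Y k) /
    ((X k : ℝ) * Y k) ^ (n - 2)) f2 f1 ?_ hN1 ?_ hN2 ?_
  · push_cast at e1 ⊢
    exact e1
  · push_cast at e2 ⊢
    exact e2
  · push_cast
    rfl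

end

section

/-! ### Summation over the hyperbola and Möbius inversion -/

variable {n : ℕ} {A : Fin n → Fin n → Fin n → Fin n → ℤ}

/-- The part of `S` on which the two sizes `u`, `v` are at most `a`, `b`. -/
def sizeBox {α : Type*} (S : Set α) (u v : α → ℝ) (a b : ℝ) : Set α :=
  {z | z ∈ S ∧ u z ≤ a ∧ v z ≤ b}

/-- The part of `S` on which the product of the sizes is at most `Z`. -/
def sizeHyp {α : Type*} (S : Set α) (u v : α → ℝ) (Z : ℝ) : Set α :=
  {z | z ∈ S ∧ u z * v z ≤ Z}

section Hyperbola

variable {α : Type*} {S : Set α} {u v : α → ℝ} {c C : ℝ} {m : ℕ}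

theorem sizeBox_mono {a b a' b' : ℝ} (ha : a ≤ a') (hb : b ≤ b') :
    sizeBox S u v a b ⊆ sizeBox S u v a' b' :=
  fun _ hz => ⟨hz.1, hz.2.1.trans ha, hz.2.2.trans hb⟩

theorem sizeHyp_subset_sizeBox (hu : ∀ z ∈ S, 1 ≤ u z) (hv : ∀ z ∈ S, 1 ≤ v z) (Z : ℝ) :
    sizeHyp S u v Z ⊆ sizeBox S u v Z Z := by
  rintro z ⟨hz, h⟩
  have h1 := hu z hz
  have h2 := hv z hz
  exact ⟨hz, by nlinarith, by nlinarith⟩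

theorem ncard_sizeHyp_le (hu : ∀ z ∈ S, 1 ≤ u z) (hv : ∀ z ∈ S, 1 ≤ v z)
    (hfin : ∀ a b, (sizeBox S u v a b).Finite)
    (hC : ∀ a b, 1 ≤ a → 1 ≤ b → ((sizeBox S u v a b).ncard : ℝ) ≤ C * (a * b) ^ m)
    (hlim : ∀ ε > 0, ∃ R : ℝ, ∀ a b, R ≤ a → R ≤ b →
      |((sizeBox S u v a b).ncard : ℝ) - c * (a * b) ^ m| ≤ ε * (a * b) ^ m)
    {t ε : ℝ} (ht : 0 < t) (hε : 0 < ε) (hc : 0 ≤ c) :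
    ∃ K : ℝ, ∀ Z : ℝ, 1 ≤ Z → ((sizeHyp S u v Z).ncard : ℝ) ≤
      Z ^ m * (K + Real.log Z / t * (c * (Real.exp (m * t) - 1) + ε * (Real.exp (m * t) + 1))) := by
  obtain ⟨R, hR⟩ := hlim ε hε
  obtain ⟨K0, hK0⟩ := exists_nat_ge (R / t)
  have hRρ : R ≤ Real.exp (K0 * t) := by
    have := Real.add_one_le_exp (K0 * t : ℝ)
    rw [div_le_iff₀ ht] at hK0
    linarith
  have hρ1 : 1 ≤ Real.exp (K0 * t) := Real.one_le_exp (by positivity)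
  generalize hρ : Real.exp (K0 * t) = ρ at hRρ hρ1
  set D := c * (Real.exp (m * t) - 1) + ε * (Real.exp (m * t) + 1) with hD
  have hD0 : 0 ≤ D := by
    have : 1 ≤ Real.exp (m * t) := Real.one_le_exp (by positivity)
    have h2 : 0 ≤ Real.exp (m * t) - 1 := by linarith
    positivity
  refine ⟨2 * (C * ρ ^ m) + D, fun Z hZ => ?_⟩
  have hZ0 : 0 < Z := by linarith
  have hlog := Real.log_nonneg hZ
  let shell : ℕ → Set α := fun k =>
    sizeBox S u v (Real.exp ((k + 1 : ℕ) * t)) (Z / Real.exp (k * t)) \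
      sizeBox S u v (Real.exp (k * t)) (Z / Real.exp (k * t))
  let I : Finset ℕ := (Finset.range (⌊Real.log Z / t⌋₊ + 1)).filter
    fun k => K0 ≤ k ∧ ρ ≤ Z / Real.exp (k * t)
  have hcover : sizeHyp S u v Z ⊆
      (sizeBox S u v ρ Z ∪ sizeBox S u v Z ρ) ∪ ⋃ k ∈ I, shell k := by
    intro z hz
    obtain ⟨hzS, huv⟩ := hz
    have hbox := sizeHyp_subset_sizeBox hu hv Z ⟨hzS, huv⟩
    have h1 := hu z hzS
    have h2 := hv z hzS
    by_cases h3 : u z ≤ ρ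
    · exact Or.inl (Or.inl ⟨hzS, h3, hbox.2.2⟩)
    by_cases h4 : v z ≤ ρ
    · exact Or.inl (Or.inr ⟨hzS, hbox.2.1, h4⟩)
    push Not at h3 h4
    right
    have hu0 : 0 < u z := by linarith
    have hlogu : (K0 : ℝ) * t < Real.log (u z) := by
      rw [Real.lt_log_iff_exp_lt hu0, hρ]; exact h3
    obtain ⟨k, hk1, hk2⟩ : ∃ k : ℕ, (k : ℝ) * t < Real.log (u z) ∧
        Real.log (u z) ≤ (k + 1 : ℕ) * t := by
      have hpos : 0 < ⌈Real.log (u z) / t⌉₊ := Nat.ceil_pos.2 (by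
        have : 0 ≤ (K0 : ℝ) * t := by positivity
        exact div_pos (by linarith) ht)
      refine ⟨⌈Real.log (u z) / t⌉₊ - 1, ?_, ?_⟩
      · rw [← lt_div_iff₀ ht]
        exact Nat.lt_ceil.1 (by omega)
      · rw [← div_le_iff₀ ht, Nat.sub_add_cancel hpos]
        exact Nat.le_ceil _
    have hk3 : Real.exp (k * t) < u z := (Real.lt_log_iff_exp_lt hu0).1 hk1
    have hKk : K0 ≤ k := by
      have : (K0 : ℝ) * t < (k + 1 : ℕ) * t := hlogu.trans_le hk2
      have := lt_of_mul_lt_mul_right this ht.le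
      have := Nat.cast_lt.1 this
      omega
    have hexp := Real.exp_pos (k * t)
    have hvk : v z ≤ Z / Real.exp (k * t) := by
      rw [le_div_iff₀ hexp]; nlinarith
    refine Set.mem_biUnion (x := k) ?_ ⟨⟨hzS, (Real.log_le_iff_le_exp hu0).1 hk2, hvk⟩,
      fun h => absurd h.2.1 (not_le.2 hk3)⟩
    refine Finset.mem_coe.2 (Finset.mem_filter.2 ⟨Finset.mem_range.2 (Nat.lt_succ_of_le ?_), hKk,
      h4.le.trans hvk⟩)
    refine Nat.le_floor ?_
    rw [le_div_iff₀ ht]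
    exact hk1.le.trans (Real.log_le_log hu0 hbox.2.1)
  have hshell : ∀ k ∈ I, ((shell k).ncard : ℝ) ≤ Z ^ m * D := by
    intro k hk
    obtain ⟨-, hk1, hk2⟩ := Finset.mem_filter.1 hk
    have hak : ρ ≤ Real.exp (k * t) := by
      rw [← hρ]; exact Real.exp_le_exp.2 (by gcongr)
    have hak' : Real.exp (k * t) ≤ Real.exp ((k + 1 : ℕ) * t) :=
      Real.exp_le_exp.2 (by gcongr; omega)
    have hsub := sizeBox_mono (S := S) (u := u) (v := v) hak' (le_refl (Z / Real.exp (k * t)))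
    have hsum := Set.ncard_sdiff_add_ncard_of_subset hsub (hfin _ _)
    have hsum' : ((shell k).ncard : ℝ) = (sizeBox S u v (Real.exp ((k + 1 : ℕ) * t))
        (Z / Real.exp (k * t))).ncard - (sizeBox S u v (Real.exp (k * t))
        (Z / Real.exp (k * t))).ncard := by
      rw [eq_sub_iff_add_eq]; exact_mod_cast hsum
    have e1 := (abs_le.1 (hR _ _ (hRρ.trans (hak.trans hak')) (hRρ.trans hk2))).2
    have e2 := (abs_le.1 (hR _ _ (hRρ.trans hak) (hRρ.trans hk2))).1
    have hp1 : Real.exp ((k + 1 : ℕ) * t) * (Z / Real.exp (k * t)) = Real.exp t * Z := by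
      rw [Nat.cast_add, Nat.cast_one, add_mul, one_mul, Real.exp_add]
      field_simp
    have hp2 : Real.exp (k * t) * (Z / Real.exp (k * t)) = Z := by field_simp
    have hp3 : Real.exp t ^ m = Real.exp (m * t) := (Real.exp_nat_mul t m).symm
    rw [hp1, mul_pow, hp3] at e1
    rw [hp2] at e2
    rw [hsum', hD]
    linarith
  have hfinU : ((sizeBox S u v ρ Z ∪ sizeBox S u v Z ρ) ∪ ⋃ k ∈ I, shell k).Finite :=
    ((hfin _ _).union (hfin _ _)).union
      (I.finite_toSet.biUnion fun k _ => (hfin _ _).subset Set.sdiff_subset)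
  have hcard : ((sizeHyp S u v Z).ncard : ℝ) ≤ ((sizeBox S u v ρ Z).ncard +
      (sizeBox S u v Z ρ).ncard) + ∑ k ∈ I, ((shell k).ncard : ℝ) := by
    exact_mod_cast (Set.ncard_le_ncard hcover hfinU).trans ((Set.ncard_union_le _ _).trans
      (add_le_add (Set.ncard_union_le _ _) (Finset.set_ncard_biUnion_le _ _)))
  have hI : (I.card : ℝ) ≤ Real.log Z / t + 1 := by
    have h1 : I.card ≤ ⌊Real.log Z / t⌋₊ + 1 := by
      simpa using Finset.card_filter_le (Finset.range (⌊Real.log Z / t⌋₊ + 1))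
        fun k => K0 ≤ k ∧ ρ ≤ Z / Real.exp (k * t)
    have h2 : (I.card : ℝ) ≤ (⌊Real.log Z / t⌋₊ : ℝ) + 1 := by exact_mod_cast h1
    have := Nat.floor_le (div_nonneg hlog ht.le)
    linarith
  have hsumI : ∑ k ∈ I, ((shell k).ncard : ℝ) ≤ (Real.log Z / t + 1) * (Z ^ m * D) := by
    refine (Finset.sum_le_card_nsmul I _ _ hshell).trans ?_
    rw [nsmul_eq_mul]
    exact mul_le_mul_of_nonneg_right hI (by positivity)
  have b1 := hC ρ Z hρ1 hZ
  have b2 := hC Z ρ hZ hρ1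
  rw [mul_pow] at b1 b2
  linarith

theorem le_ncard_sizeHyp (hu : ∀ z ∈ S, 1 ≤ u z) (hv : ∀ z ∈ S, 1 ≤ v z)
    (hfin : ∀ a b, (sizeBox S u v a b).Finite)
    (hlim : ∀ ε > 0, ∃ R : ℝ, ∀ a b, R ≤ a → R ≤ b →
      |((sizeBox S u v a b).ncard : ℝ) - c * (a * b) ^ m| ≤ ε * (a * b) ^ m)
    {t ε : ℝ} (ht : 0 < t) (hε : 0 < ε) :
    ∃ K : ℝ, ∀ᶠ Z : ℝ in atTop,
      Z ^ m * (Real.log Z / t * (c * (1 - Real.exp (-(m * t))) - 2 * ε) - K) ≤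
        (sizeHyp S u v Z).ncard := by
  obtain ⟨R, hR⟩ := hlim ε hε
  obtain ⟨K0, hK0⟩ := exists_nat_ge (R / t)
  have hRρ : R ≤ Real.exp (K0 * t) := by
    have := Real.add_one_le_exp (K0 * t : ℝ)
    rw [div_le_iff₀ ht] at hK0
    linarith
  set D := c * (1 - Real.exp (-(m * t))) - 2 * ε with hD
  refine ⟨(2 * K0 + 2) * |D|, ?_⟩
  filter_upwards [Real.tendsto_log_atTop.eventually_ge_atTop (t * (2 * K0 + 2)),
    eventually_ge_atTop 1] with Z hlogZ hZ
  have hZ0 : 0 < Z := by linarith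
  have hlog := Real.log_nonneg hZ
  let shell : ℕ → Set α := fun k =>
    sizeBox S u v (Real.exp ((k + 1 : ℕ) * t)) (Z / Real.exp ((k + 1 : ℕ) * t)) \
      sizeBox S u v (Real.exp (k * t)) (Z / Real.exp ((k + 1 : ℕ) * t))
  have hmonoE : ∀ {k l : ℕ}, k ≤ l → Real.exp (k * t) ≤ Real.exp (l * t) := fun h =>
    Real.exp_le_exp.2 (by gcongr)
  let I : Finset ℕ := Finset.Ico K0 (⌊Real.log Z / t⌋₊ - K0)
  have hdisj : (I : Set ℕ).PairwiseDisjoint shell := by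
    have key : ∀ k l : ℕ, k < l → Disjoint (shell k) (shell l) := by
      intro k l hkl
      refine Set.disjoint_left.2 fun z hz hz' => hz'.2 ⟨hz.1.1, ?_, hz'.1.2.2⟩
      exact hz.1.2.1.trans (hmonoE hkl)
    intro k _ l _ hkl
    rcases lt_or_gt_of_ne hkl with h | h
    · exact key k l h
    · exact (key l k h).symm
  have hsub : ⋃ k ∈ I, shell k ⊆ sizeHyp S u v Z := by
    refine Set.iUnion₂_subset fun k _ z hz => ⟨hz.1.1, ?_⟩
    have := hu z hz.1.1
    have h2 := hv z hz.1.1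
    have hexp := Real.exp_pos ((k + 1 : ℕ) * t)
    have h3 := (le_div_iff₀ hexp).1 hz.1.2.2
    nlinarith [hz.1.2.1]
  have hfinH : (sizeHyp S u v Z).Finite := (hfin _ _).subset (sizeHyp_subset_sizeBox hu hv Z)
  have hshell : ∀ k ∈ I, Z ^ m * D ≤ ((shell k).ncard : ℝ) := by
    intro k hk
    obtain ⟨hk1, hk2⟩ := Finset.mem_Ico.1 hk
    have hbig : Real.exp (K0 * t) ≤ Z / Real.exp ((k + 1 : ℕ) * t) := by
      rw [le_div_iff₀ (Real.exp_pos _), ← Real.exp_add, ← Real.le_log_iff_exp_le hZ0, ← add_mul,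
        ← le_div_iff₀ ht]
      refine le_trans ?_ (Nat.floor_le (div_nonneg hlog ht.le))
      exact_mod_cast (by omega : K0 + (k + 1) ≤ ⌊Real.log Z / t⌋₊)
    have hsub := sizeBox_mono (S := S) (u := u) (v := v) (hmonoE (Nat.le_succ k))
      (le_refl (Z / Real.exp ((k + 1 : ℕ) * t)))
    have hsum := Set.ncard_sdiff_add_ncard_of_subset hsub (hfin _ _)
    have hsum' : ((shell k).ncard : ℝ) = (sizeBox S u v (Real.exp ((k + 1 : ℕ) * t))
        (Z / Real.exp ((k + 1 : ℕ) * t))).ncard - (sizeBox S u v (Real.exp (k * t))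
        (Z / Real.exp ((k + 1 : ℕ) * t))).ncard := by
      rw [eq_sub_iff_add_eq]; exact_mod_cast hsum
    have e1 := (abs_le.1 (hR _ _ (hRρ.trans ((hmonoE hk1).trans (hmonoE (Nat.le_succ k))))
      (hRρ.trans hbig))).1
    have e2 := (abs_le.1 (hR _ _ (hRρ.trans (hmonoE hk1)) (hRρ.trans hbig))).2
    have hp1 : Real.exp (k.succ * t) * (Z / Real.exp ((k + 1 : ℕ) * t)) = Z := by
      rw [Nat.succ_eq_add_one]; field_simp
    have hp2 : Real.exp (k * t) * (Z / Real.exp ((k + 1 : ℕ) * t)) = Real.exp (-t) * Z := by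
      rw [Nat.cast_add, Nat.cast_one, add_mul, one_mul, Real.exp_add, Real.exp_neg]
      field_simp
    have hp3 : Real.exp (-t) ^ m = Real.exp (-(m * t)) := by
      rw [← Real.exp_nat_mul, mul_neg]
    rw [hp1] at e1
    rw [hp2, mul_pow, hp3] at e2
    have hle1 : Real.exp (-(m * t)) ≤ 1 := Real.exp_le_one_iff.2 (by
      have : 0 ≤ (m : ℝ) * t := by positivity
      linarith)
    have hεZ : ε * (Real.exp (-(m * t)) * Z ^ m) ≤ ε * Z ^ m := by
      have : Real.exp (-(m * t)) * Z ^ m ≤ 1 * Z ^ m := by gcongr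
      nlinarith
    rw [hsum', hD]
    simp only [Nat.succ_eq_add_one] at e1
    linarith
  have hcard : ∑ k ∈ I, ((shell k).ncard : ℝ) ≤ (sizeHyp S u v Z).ncard := by
    have h1 := Set.Finite.ncard_biUnion I.finite_toSet
      (fun k _ => (hfin _ _).subset Set.sdiff_subset : ∀ k ∈ (I : Set ℕ), (shell k).Finite) hdisj
    have h2 : (⋃ k ∈ (I : Set ℕ), shell k).ncard ≤ _ := Set.ncard_le_ncard hsub hfinH
    rw [h1, finsum_mem_coe_finset] at h2
    exact_mod_cast h2
  have hfloor : 2 * K0 + 2 ≤ ⌊Real.log Z / t⌋₊ := Nat.le_floor (by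
    rw [le_div_iff₀ ht]; push_cast; linarith)
  have hI : |(I.card : ℝ) - Real.log Z / t| ≤ 2 * K0 + 2 := by
    have h1 : I.card + 2 * K0 = ⌊Real.log Z / t⌋₊ := by
      rw [Nat.card_Ico]; omega
    have h2 : (I.card : ℝ) + 2 * K0 = ⌊Real.log Z / t⌋₊ := by exact_mod_cast h1
    have h3 := Nat.floor_le (div_nonneg hlog ht.le)
    have h4 := Nat.lt_floor_add_one (Real.log Z / t)
    rw [abs_le]
    constructor <;> linarith
  have hsumI : (I.card : ℝ) * (Z ^ m * D) ≤ ∑ k ∈ I, ((shell k).ncard : ℝ) := by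
    rw [← nsmul_eq_mul]
    exact Finset.card_nsmul_le_sum I _ _ hshell
  have hdiff : (Real.log Z / t - I.card) * D ≤ (2 * K0 + 2) * |D| := by
    refine (le_abs_self _).trans ?_
    rw [abs_mul, abs_sub_comm]
    gcongr
  have := mul_le_mul_of_nonneg_left hdiff (by positivity : 0 ≤ Z ^ m)
  linarith

end Hyperbola

section Hyperbola

variable {α : Type*} {S : Set α} {u v : α → ℝ} {c C : ℝ} {m : ℕ}

theorem tendsto_exp_sub_one_div (s : ℝ) :
    Tendsto (fun t : ℝ => (Real.exp (s * t) - 1) / t) (nhdsWithin 0 (Set.Ioi 0)) (nhds s) := by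
  have h : HasDerivAt (fun t : ℝ => Real.exp (s * t)) s 0 := by
    simpa using ((hasDerivAt_id (0 : ℝ)).const_mul s).exp
  refine h.tendsto_slope_zero_right.congr fun t => ?_
  simp [div_eq_inv_mul]

theorem tendsto_ncard_sizeHyp (hu : ∀ z ∈ S, 1 ≤ u z) (hv : ∀ z ∈ S, 1 ≤ v z)
    (hfin : ∀ a b, (sizeBox S u v a b).Finite)
    (hC : ∀ a b, 1 ≤ a → 1 ≤ b → ((sizeBox S u v a b).ncard : ℝ) ≤ C * (a * b) ^ m)
    (hlim : ∀ ε > 0, ∃ R : ℝ, ∀ a b, R ≤ a → R ≤ b →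
      |((sizeBox S u v a b).ncard : ℝ) - c * (a * b) ^ m| ≤ ε * (a * b) ^ m)
    (hc : 0 ≤ c) :
    Tendsto (fun Z : ℝ => ((sizeHyp S u v Z).ncard : ℝ) / (Z ^ m * Real.log Z)) atTop
      (nhds (c * m)) := by
  have hinv : ∀ K : ℝ, Tendsto (fun Z : ℝ => K / Real.log Z) atTop (nhds 0) := fun K =>
    tendsto_const_nhds.div_atTop Real.tendsto_log_atTop
  refine tendsto_order.2 ⟨fun a ha => ?_, fun a ha => ?_⟩
  · have h1 : Tendsto (fun t : ℝ => c * -((Real.exp (-m * t) - 1) / t))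
        (nhdsWithin 0 (Set.Ioi 0)) (nhds (c * m)) := by
      simpa using (tendsto_exp_sub_one_div (-m)).neg.const_mul c
    obtain ⟨t, hat, ht⟩ := ((h1.eventually_const_lt ha).and self_mem_nhdsWithin).exists
    have ht : 0 < t := ht
    have hε : 0 < (c * -((Real.exp (-m * t) - 1) / t) - a) * t / 4 := by
      have : 0 < c * -((Real.exp (-m * t) - 1) / t) - a := by linarith
      positivity
    obtain ⟨K, hK⟩ := le_ncard_sizeHyp hu hv hfin hlim ht hε
    have h2 : a < (c * (1 - Real.exp (-(m * t))) -
        2 * ((c * -((Real.exp (-m * t) - 1) / t) - a) * t / 4)) / t := by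
      rw [neg_mul] at hat ⊢
      rw [lt_div_iff₀ ht]
      have h3 : c * -((Real.exp (-(m * t)) - 1) / t) * t = c * (1 - Real.exp (-(m * t))) := by
        field_simp; ring
      have := mul_lt_mul_of_pos_right hat ht
      linarith
    have h4 := tendsto_const_nhds (x := (c * (1 - Real.exp (-(m * t))) -
        2 * ((c * -((Real.exp (-m * t) - 1) / t) - a) * t / 4)) / t).sub (hinv K)
    rw [sub_zero] at h4
    filter_upwards [hK, h4.eventually_const_lt h2, eventually_gt_atTop 1] with Z hZ hZ2 hZ1
    have hlog := Real.log_pos hZ1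
    have hZ0 : 0 < Z := by linarith
    refine hZ2.trans_le ?_
    rw [le_div_iff₀ (by positivity)]
    refine le_of_eq_of_le ?_ hZ
    field_simp
  · have h1 : Tendsto (fun t : ℝ => c * ((Real.exp (m * t) - 1) / t))
        (nhdsWithin 0 (Set.Ioi 0)) (nhds (c * m)) := (tendsto_exp_sub_one_div m).const_mul c
    obtain ⟨t, hat, ht⟩ := ((h1.eventually_lt_const ha).and self_mem_nhdsWithin).exists
    have ht : 0 < t := ht
    have hε : 0 < (a - c * ((Real.exp (m * t) - 1) / t)) * t / (2 * (Real.exp (m * t) + 1)) := by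
      have : 0 < a - c * ((Real.exp (m * t) - 1) / t) := by linarith
      positivity
    obtain ⟨K, hK⟩ := ncard_sizeHyp_le hu hv hfin hC hlim ht hε hc
    have h2 : (c * (Real.exp (m * t) - 1) + (a - c * ((Real.exp (m * t) - 1) / t)) * t /
        (2 * (Real.exp (m * t) + 1)) * (Real.exp (m * t) + 1)) / t < a := by
      have hpos : 0 < Real.exp (m * t) := Real.exp_pos _
      generalize Real.exp (m * t) = E at hat hpos
      rw [div_lt_iff₀ ht]
      have h3 : c * ((E - 1) / t) * t = c * (E - 1) := by field_simp
      have h4 : (a - c * ((E - 1) / t)) * t / (2 * (E + 1)) * (E + 1) =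
        (a * t - c * ((E - 1) / t) * t) / 2 := by field_simp
      have := mul_lt_mul_of_pos_right hat ht
      linarith
    have h4 := (hinv K).add_const ((c * (Real.exp (m * t) - 1) +
      (a - c * ((Real.exp (m * t) - 1) / t)) * t /
        (2 * (Real.exp (m * t) + 1)) * (Real.exp (m * t) + 1)) / t)
    rw [zero_add] at h4
    filter_upwards [h4.eventually_lt_const h2, eventually_gt_atTop 1] with Z hZ2 hZ1
    have hlog := Real.log_pos hZ1
    have hZ0 : 0 < Z := by linarith
    refine lt_of_le_of_lt ?_ hZ2
    rw [div_le_iff₀ (by positivity)]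
    refine (hK Z hZ1.le).trans_eq ?_
    generalize c * (Real.exp (m * t) - 1) + (a - c * ((Real.exp (m * t) - 1) / t)) * t /
        (2 * (Real.exp (m * t) + 1)) * (Real.exp (m * t) + 1) = E
    field_simp

theorem exists_ncard_sizeHyp_le (hu : ∀ z ∈ S, 1 ≤ u z) (hv : ∀ z ∈ S, 1 ≤ v z)
    (hfin : ∀ a b, (sizeBox S u v a b).Finite)
    (hC : ∀ a b, 1 ≤ a → 1 ≤ b → ((sizeBox S u v a b).ncard : ℝ) ≤ C * (a * b) ^ m)
    (hlim : ∀ ε > 0, ∃ R : ℝ, ∀ a b, R ≤ a → R ≤ b →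
      |((sizeBox S u v a b).ncard : ℝ) - c * (a * b) ^ m| ≤ ε * (a * b) ^ m)
    (hc : 0 ≤ c) :
    ∃ C', 0 ≤ C' ∧ ∀ Z : ℝ, 1 ≤ Z →
      ((sizeHyp S u v Z).ncard : ℝ) ≤ C' * Z ^ m * (1 + Real.log Z) := by
  obtain ⟨K, hK⟩ := ncard_sizeHyp_le hu hv hfin hC hlim one_pos one_pos hc
  generalize c * (Real.exp (m * 1) - 1) + 1 * (Real.exp (m * 1) + 1) = D at hK
  refine ⟨|K| + |D|, by positivity, fun Z hZ => (hK Z hZ).trans ?_⟩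
  have hlog := Real.log_nonneg hZ
  have h1 : K + Real.log Z / 1 * D ≤ (|K| + |D|) * (1 + Real.log Z) := by
    rw [div_one]
    nlinarith [le_abs_self K, mul_le_mul_of_nonneg_left (le_abs_self D) hlog, abs_nonneg D,
      mul_nonneg hlog (abs_nonneg K)]
  have := mul_le_mul_of_nonneg_left h1 (by positivity : 0 ≤ Z ^ m)
  linarith

end Hyperbola

/-- The integral zeros of the form at which neither determinant vanishes. -/
def zeroSet (A : Fin n → Fin n → Fin n → Fin n → ℤ) : Set ((Fin n → ℤ) × (Fin n → ℤ)) :=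
  {z | detFx A z.1 ≠ 0 ∧ detFy A z.2 ≠ 0 ∧ biForm A z.1 z.2 = 0}

/-- The sup-norm of the first component. -/
def fstNorm (z : (Fin n → ℤ) × (Fin n → ℤ)) : ℝ := supNorm z.1

/-- The sup-norm of the second component. -/
def sndNorm (z : (Fin n → ℤ) × (Fin n → ℤ)) : ℝ := supNorm z.2

theorem supNorm_le_iff {x : Fin n → ℤ} {N : ℕ} : supNorm x ≤ N ↔ x ∈ ibox n N := by
  rw [mem_ibox, supNorm, Finset.sup_le_iff]
  refine ⟨fun h i => ?_, fun h i _ => ?_⟩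
  · rw [Int.abs_eq_natAbs]; exact_mod_cast h i (Finset.mem_univ i)
  · have := h i
    rw [Int.abs_eq_natAbs] at this
    exact_mod_cast this

theorem supNorm_smul (d : ℕ) (x : Fin n → ℤ) : supNorm ((d : ℤ) • x) = d * supNorm x := by
  refine ((Finset.apply_sup_eq_sup_comp_of_linearOrder (fun k : ℕ => d * k)
    (fun _ _ h => Nat.mul_le_mul_left d h) (Nat.mul_zero d)).trans ?_).symm
  unfold supNorm
  congr 1
  ext i
  simp [Int.natAbs_mul]

theorem detFx_smul_ne_zero_iff (A : Fin n → Fin n → Fin n → Fin n → ℤ) {d : ℤ} (hd : d ≠ 0)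
    (x : Fin n → ℤ) : detFx A (d • x) ≠ 0 ↔ detFx A x ≠ 0 := by
  have hd' : (d : ℝ) ≠ 0 := Int.cast_ne_zero.2 hd
  have h : (fun i => ((d • x) i : ℝ)) = (d : ℝ) • fun i => (x i : ℝ) := by
    ext i; simp
  rw [detFx_ne_zero_iff, detFx_ne_zero_iff, h, det_dblMat_smul]
  simp [hd']

theorem one_le_supNorm (A : Fin n → Fin n → Fin n → Fin n → ℤ) (hn : 0 < n) {x : Fin n → ℤ}
    (hx : detFx A x ≠ 0) : 1 ≤ supNorm x := by
  by_contra h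
  have h0 : supNorm x ≤ 0 := by omega
  rw [supNorm_le_iff, mem_ibox] at h0
  have hx0 : (fun i => (x i : ℝ)) = (0 : ℝ) • fun i => (x i : ℝ) := by
    ext i
    have := abs_nonpos_iff.1 (h0 i)
    simp [this]
  rw [detFx_ne_zero_iff, hx0, det_dblMat_smul] at hx
  simp [hn.ne'] at hx

theorem one_le_fstNorm (hn : 0 < n) :
    ∀ z ∈ zeroSet A, 1 ≤ fstNorm z :=
  fun _ hz => Nat.one_le_cast.2 (one_le_supNorm A hn hz.1)

theorem one_le_sndNorm (hn : 0 < n) :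
    ∀ z ∈ zeroSet A, 1 ≤ sndNorm z :=
  fun _ hz => Nat.one_le_cast.2 (one_le_supNorm (swapA A) hn hz.2.1)

theorem finite_sizeBox (A : Fin n → Fin n → Fin n → Fin n → ℤ) (a b : ℝ) :
    (sizeBox (zeroSet A) fstNorm sndNorm a b).Finite := by
  refine (ibox n ⌊a⌋₊ ×ˢ ibox n ⌊b⌋₊).finite_toSet.subset fun z hz => ?_
  rw [Finset.mem_coe, Finset.mem_product, ← supNorm_le_iff, ← supNorm_le_iff]
  exact ⟨Nat.le_floor hz.2.1, Nat.le_floor hz.2.2⟩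

theorem ncard_sizeBox (A : Fin n → Fin n → Fin n → Fin n → ℤ) {a b : ℝ} (ha : 0 ≤ a)
    (hb : 0 ≤ b) :
    (sizeBox (zeroSet A) fstNorm sndNorm a b).ncard = nBox A ⌊a⌋₊ ⌊b⌋₊ := by
  unfold nBox
  rw [← Set.ncard_coe_finset]
  congr 1
  ext z
  rw [Finset.mem_coe, Finset.mem_filter, Finset.mem_product, ← supNorm_le_iff, ← supNorm_le_iff,
    Nat.le_floor_iff ha, Nat.le_floor_iff hb]
  exact and_comm

/-- The real constant in the asymptotic formula for boxes. -/
def boxConst (A : Fin n → Fin n → Fin n → Fin n → ℤ) : ℝ := (biSingSeries A * biSingInt A).re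

theorem SmoothBiquad.tendsto_nBox_real
    (hA : SmoothBiquad A) (hn : 35 < n) {κ : Type*} {l : Filter κ} [l.IsCountablyGenerated]
    {X Y : κ → ℕ} (hX : Tendsto X l atTop) (hXY : ∀ᶠ k in l, X k ≤ Y k) :
    Tendsto (fun k => (nBox A (X k) (Y k) : ℝ) / (X k * Y k : ℝ) ^ (n - 2)) l
      (nhds (boxConst A)) := by
  refine ((Complex.continuous_re.tendsto _).comp (hA.tendsto_nBox hn hX hXY)).congr fun k => ?_
  have h : (nBox A (X k) (Y k) : ℂ) / (X k * Y k : ℂ) ^ (n - 2) =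
      ((nBox A (X k) (Y k) / (X k * Y k : ℝ) ^ (n - 2) : ℝ) : ℂ) := by push_cast; rfl
  rw [Function.comp_apply, h, Complex.ofReal_re]

theorem SmoothBiquad.ofReal_boxConst
    (hA : SmoothBiquad A) (hn : 35 < n) : (boxConst A : ℂ) = biSingSeries A * biSingInt A := by
  have h1 := hA.tendsto_nBox hn (X := id) (Y := id) tendsto_id (Eventually.of_forall fun _ => le_rfl)
  have h2 := (Complex.continuous_ofReal.tendsto _).comp
    (hA.tendsto_nBox_real hn (X := id) (Y := id) tendsto_id (Eventually.of_forall fun _ => le_rfl))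
  refine tendsto_nhds_unique (h2.congr fun k => ?_) h1
  simp

theorem SmoothBiquad.boxConst_swapA
    (hA : SmoothBiquad A) (hn : 35 < n) : boxConst (_root_.swapA A) = boxConst A := by
  have h1 := hA.tendsto_nBox_real hn (X := id) (Y := id) tendsto_id
    (Eventually.of_forall fun _ => le_rfl)
  have h2 := hA.swapA.tendsto_nBox_real hn (X := id) (Y := id) tendsto_id
    (Eventually.of_forall fun _ => le_rfl)
  simp only [nBox_swapA] at h2
  exact tendsto_nhds_unique h2 h1

theorem SmoothBiquad.boxConst_nonneg (hA : SmoothBiquad A) (hn : 35 < n) : 0 ≤ boxConst A :=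
  ge_of_tendsto' (hA.tendsto_nBox_real hn (X := id) (Y := id) tendsto_id
    (Eventually.of_forall fun _ => le_rfl)) fun _ => by positivity

theorem SmoothBiquad.exists_ncard_sizeBox_le
    (hA : SmoothBiquad A) (hn : 35 < n) : ∃ C : ℝ, ∀ a b : ℝ, 1 ≤ a → 1 ≤ b →
    ((sizeBox (zeroSet A) fstNorm sndNorm a b).ncard : ℝ) ≤ C * (a * b) ^ (n - 2) := by
  obtain ⟨C, hC, h⟩ := hA.exists_nBox_le hn
  obtain ⟨C', hC', h'⟩ := hA.swapA.exists_nBox_le hn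
  refine ⟨max C C', fun a b ha hb => ?_⟩
  have ha1 := (Nat.one_le_floor_iff a).2 ha
  have hb1 := (Nat.one_le_floor_iff b).2 hb
  have hle : ((⌊a⌋₊ : ℝ) * ⌊b⌋₊) ^ (n - 2) ≤ (a * b) ^ (n - 2) := by
    gcongr <;> exact Nat.floor_le (by linarith)
  have hC0 : 0 ≤ max C C' := hC.trans (le_max_left _ _)
  rw [ncard_sizeBox A (by linarith) (by linarith)]
  refine le_trans ?_ (mul_le_mul_of_nonneg_left hle hC0)
  rcases le_total ⌊a⌋₊ ⌊b⌋₊ with hab | hab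
  · exact (h _ _ ha1 hab).trans (mul_le_mul_of_nonneg_right (le_max_left _ _) (by positivity))
  · have := h' _ _ hb1 hab
    rw [nBox_swapA, mul_comm (⌊b⌋₊ : ℝ)] at this
    exact this.trans (mul_le_mul_of_nonneg_right (le_max_right _ _) (by positivity))

theorem SmoothBiquad.eventually_abs_nBox_sub_le
    (hA : SmoothBiquad A) (hn : 35 < n) {ε : ℝ} (hε : 0 < ε) :
    ∀ᶠ p : ℝ × ℝ in atTop, p.1 ≤ p.2 →
      |(nBox A ⌊p.1⌋₊ ⌊p.2⌋₊ : ℝ) - boxConst A * (p.1 * p.2) ^ (n - 2)| ≤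
        ε * (p.1 * p.2) ^ (n - 2) := by
  have hfst : Tendsto (Prod.fst : ℝ × ℝ → ℝ) atTop atTop := by
    rw [← prod_atTop_atTop_eq]; exact tendsto_fst
  have hsnd : Tendsto (Prod.snd : ℝ × ℝ → ℝ) atTop atTop := by
    rw [← prod_atTop_atTop_eq]; exact tendsto_snd
  have hcg : (atTop : Filter (ℝ × ℝ)).IsCountablyGenerated := by
    rw [← prod_atTop_atTop_eq]; infer_instance
  refine eventually_inf_principal (s := {p : ℝ × ℝ | p.1 ≤ p.2}).1 ?_
  have hcg' : (atTop ⊓ 𝓟 {p : ℝ × ℝ | p.1 ≤ p.2}).IsCountablyGenerated := inferInstance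
  have h1 := hA.tendsto_nBox_real hn (l := atTop ⊓ 𝓟 {p : ℝ × ℝ | p.1 ≤ p.2})
    (X := fun p => ⌊p.1⌋₊) (Y := fun p => ⌊p.2⌋₊)
    ((tendsto_nat_floor_atTop.comp hfst).mono_left inf_le_left)
    (eventually_inf_principal.2 (Eventually.of_forall fun p hp => Nat.floor_le_floor hp))
  have h2 := (((tendsto_nat_floor_div_atTop (R := ℝ)).comp hfst).mul
    ((tendsto_nat_floor_div_atTop (R := ℝ)).comp hsnd)).pow (n - 2)
  have h3 := h1.mul (h2.mono_left inf_le_left)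
  rw [one_mul, one_pow, mul_one] at h3
  have hge := (hfst.eventually_ge_atTop 1).and (hsnd.eventually_ge_atTop 1)
  filter_upwards [h3 (Metric.closedBall_mem_nhds _ hε), hge.filter_mono inf_le_left] with p hp hp1
  obtain ⟨ha, hb⟩ := hp1
  have hfa : (⌊p.1⌋₊ : ℝ) ≠ 0 := by
    have := (Nat.one_le_floor_iff p.1).2 ha
    exact_mod_cast (by omega : ⌊p.1⌋₊ ≠ 0)
  have hfb : (⌊p.2⌋₊ : ℝ) ≠ 0 := by
    have := (Nat.one_le_floor_iff p.2).2 hb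
    exact_mod_cast (by omega : ⌊p.2⌋₊ ≠ 0)
  have hp0 : 0 < p.1 * p.2 := by positivity
  have hpa : p.1 ≠ 0 := by linarith
  have hpb : p.2 ≠ 0 := by linarith
  rw [Set.mem_preimage, Metric.mem_closedBall, Real.dist_eq] at hp
  simp only [Function.comp_apply] at hp
  have e : (nBox A ⌊p.1⌋₊ ⌊p.2⌋₊ : ℝ) / ((⌊p.1⌋₊ : ℝ) * ⌊p.2⌋₊) ^ (n - 2) *
      ((⌊p.1⌋₊ : ℝ) / p.1 * (⌊p.2⌋₊ / p.2)) ^ (n - 2) =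
      nBox A ⌊p.1⌋₊ ⌊p.2⌋₊ / (p.1 * p.2) ^ (n - 2) := by
    rw [div_mul_div_comm, div_pow]
    field_simp
  rw [e] at hp
  have hpp : 0 < (p.1 * p.2) ^ (n - 2) := by positivity
  generalize (p.1 * p.2) ^ (n - 2) = w at hp hpp
  have e2 : (nBox A ⌊p.1⌋₊ ⌊p.2⌋₊ : ℝ) - boxConst A * w =
      (nBox A ⌊p.1⌋₊ ⌊p.2⌋₊ / w - boxConst A) * w := by field_simp
  rw [e2, abs_mul, abs_of_pos hpp]
  exact mul_le_mul_of_nonneg_right hp hpp.le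

theorem SmoothBiquad.exists_abs_ncard_sizeBox_sub_le
    (hA : SmoothBiquad A) (hn : 35 < n) : ∀ ε > 0, ∃ R : ℝ, ∀ a b, R ≤ a → R ≤ b →
      |((sizeBox (zeroSet A) fstNorm sndNorm a b).ncard : ℝ) - boxConst A * (a * b) ^ (n - 2)| ≤
        ε * (a * b) ^ (n - 2) := by
  intro ε hε
  obtain ⟨r, hr⟩ := eventually_atTop.1 (hA.eventually_abs_nBox_sub_le hn hε)
  obtain ⟨r', hr'⟩ := eventually_atTop.1 (hA.swapA.eventually_abs_nBox_sub_le hn hε)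
  refine ⟨max (max (max r.1 r.2) (max r'.1 r'.2)) 0, fun a b ha hb => ?_⟩
  simp only [max_le_iff] at ha hb
  rw [ncard_sizeBox A ha.2 hb.2]
  rcases le_total a b with hab | hab
  · exact hr (a, b) ⟨ha.1.1.1, hb.1.1.2⟩ hab
  · have := hr' (b, a) ⟨hb.1.2.1, ha.1.2.2⟩ hab
    rw [nBox_swapA, hA.boxConst_swapA hn, mul_comm b a] at this
    exact this

/-- The number of zeros with product of norms at most `Z`. -/
def hypCount (A : Fin n → Fin n → Fin n → Fin n → ℤ) (Z : ℝ) : ℝ :=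
  (sizeHyp (zeroSet A) fstNorm sndNorm Z).ncard

/-- The primitive zeros with product of norms at most `Z`. -/
def primHyp (A : Fin n → Fin n → Fin n → Fin n → ℤ) (Z : ℝ) :
    Set ((Fin n → ℤ) × (Fin n → ℤ)) :=
  {z ∈ sizeHyp (zeroSet A) fstNorm sndNorm Z |
    Finset.univ.gcd z.1 = 1 ∧ Finset.univ.gcd z.2 = 1}

theorem finite_sizeHyp (A : Fin n → Fin n → Fin n → Fin n → ℤ) (hn : 0 < n) (Z : ℝ) :
    (sizeHyp (zeroSet A) fstNorm sndNorm Z).Finite :=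
  (finite_sizeBox A Z Z).subset
    (sizeHyp_subset_sizeBox (one_le_fstNorm hn) (one_le_sndNorm hn) Z)

theorem hypCount_eq_zero (A : Fin n → Fin n → Fin n → Fin n → ℤ) (hn : 0 < n) {Z : ℝ}
    (hZ : Z < 1) : hypCount A Z = 0 := by
  have : sizeHyp (zeroSet A) fstNorm sndNorm Z = ∅ := by
    refine Set.eq_empty_of_forall_notMem fun z hz => ?_
    have h1 := one_le_fstNorm hn z hz.1
    have h2 := one_le_sndNorm hn z hz.1
    have := hz.2
    nlinarith
  rw [hypCount, this, Set.ncard_empty, Nat.cast_zero]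

theorem biForm_smul_smul (A : Fin n → Fin n → Fin n → Fin n → ℤ) (d e : ℤ) (x y : Fin n → ℤ) :
    biForm A (d • x) (e • y) = d ^ 2 * e ^ 2 * biForm A x y := by
  simp only [biForm, Pi.smul_apply, smul_eq_mul, Finset.mul_sum]
  refine Finset.sum_congr rfl fun i _ => Finset.sum_congr rfl fun j _ =>
    Finset.sum_congr rfl fun k _ => Finset.sum_congr rfl fun l _ => ?_
  ring

theorem smul_mem_zeroSet_iff (A : Fin n → Fin n → Fin n → Fin n → ℤ) {d e : ℤ} (hd : d ≠ 0)
    (he : e ≠ 0) (x y : Fin n → ℤ) : (d • x, e • y) ∈ zeroSet A ↔ (x, y) ∈ zeroSet A := by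
  refine and_congr (detFx_smul_ne_zero_iff A hd x)
    (and_congr (detFx_smul_ne_zero_iff (swapA A) he y) ?_)
  rw [biForm_smul_smul, mul_eq_zero, or_iff_right (by positivity)]

theorem ncard_dvd_sizeHyp (A : Fin n → Fin n → Fin n → Fin n → ℤ) {d e : ℕ} (hd : 1 ≤ d)
    (he : 1 ≤ e) (Z : ℝ) :
    ({z ∈ sizeHyp (zeroSet A) fstNorm sndNorm Z |
      (d : ℤ) ∣ Finset.univ.gcd z.1 ∧ (e : ℤ) ∣ Finset.univ.gcd z.2}.ncard : ℝ) =
      hypCount A (Z / (d * e)) := by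
  have hd0 : (d : ℤ) ≠ 0 := by positivity
  have he0 : (e : ℤ) ≠ 0 := by positivity
  have hde : (0 : ℝ) < d * e := by positivity
  let f : (Fin n → ℤ) × (Fin n → ℤ) → (Fin n → ℤ) × (Fin n → ℤ) :=
    fun w => ((d : ℤ) • w.1, (e : ℤ) • w.2)
  have hf : Function.Injective f := by
    rintro ⟨x, y⟩ ⟨x', y'⟩ h
    obtain ⟨h1, h2⟩ := Prod.mk.inj h
    exact Prod.ext (smul_right_injective _ hd0 h1) (smul_right_injective _ he0 h2)
  have hmem : ∀ w, f w ∈ sizeHyp (zeroSet A) fstNorm sndNorm Z ↔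
      w ∈ sizeHyp (zeroSet A) fstNorm sndNorm (Z / (d * e)) := by
    rintro ⟨x, y⟩
    refine and_congr (smul_mem_zeroSet_iff A hd0 he0 x y) ?_
    rw [le_div_iff₀ hde]
    simp only [f, fstNorm, sndNorm, supNorm_smul]
    push_cast
    rw [mul_mul_mul_comm, mul_comm ((d : ℝ) * e)]
  rw [hypCount, ← Set.ncard_image_of_injective (sizeHyp _ _ _ (Z / (d * e))) hf]
  congr 2
  ext z
  constructor
  · rintro ⟨hz, h1, h2⟩
    rw [Finset.dvd_gcd_iff] at h1 h2
    choose x hx using fun i => h1 i (Finset.mem_univ i)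
    choose y hy using fun i => h2 i (Finset.mem_univ i)
    have hzf : f (x, y) = z := Prod.ext (funext fun i => (hx i).symm) (funext fun i => (hy i).symm)
    exact ⟨(x, y), (hmem _).1 (hzf ▸ hz), hzf⟩
  · rintro ⟨w, hw, rfl⟩
    exact ⟨(hmem w).2 hw, Finset.dvd_gcd fun i _ => ⟨w.1 i, rfl⟩,
      Finset.dvd_gcd fun i _ => ⟨w.2 i, rfl⟩⟩

theorem sum_moebius_dvd_gcd {x : Fin n → ℤ} {N : ℕ} (h1 : 1 ≤ supNorm x) (hN : supNorm x ≤ N) :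
    ∑ d ∈ Finset.Icc 1 N, (if (d : ℤ) ∣ Finset.univ.gcd x then
      (ArithmeticFunction.moebius d : ℝ) else 0) =
      if Finset.univ.gcd x = 1 then 1 else 0 := by
  obtain ⟨i, hi⟩ : ∃ i, x i ≠ 0 := by
    by_contra h
    push Not at h
    have : supNorm x ≤ 0 := supNorm_le_iff.2 (mem_ibox.2 fun i => by simp [h i])
    omega
  generalize hg : Finset.univ.gcd x = g
  have hgi : g ∣ x i := hg ▸ Finset.gcd_dvd (Finset.mem_univ i)
  have hg0 : 0 ≤ g := by
    rw [← hg]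
    exact Int.nonneg_of_normalize_eq_self Finset.normalize_gcd
  lift g to ℕ using hg0
  have hgne : g ≠ 0 := by
    rintro rfl
    exact hi (zero_dvd_iff.1 (by simpa using hgi))
  have hgN : g ≤ N := by
    have h2 := Nat.le_of_dvd (Int.natAbs_pos.2 hi) (Int.natCast_dvd.1 hgi)
    exact h2.trans ((Finset.le_sup (f := fun i => (x i).natAbs) (Finset.mem_univ i)).trans hN)
  have hdiv : (Finset.Icc 1 N).filter (fun d : ℕ => (d : ℤ) ∣ (g : ℤ)) = g.divisors := by
    ext d
    rw [Finset.mem_filter, Finset.mem_Icc, Nat.mem_divisors, Int.natCast_dvd_natCast]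
    refine ⟨fun h => ⟨h.2, hgne⟩, fun h => ⟨⟨Nat.pos_of_dvd_of_pos h.1 (by omega), ?_⟩, h.1⟩⟩
    exact (Nat.le_of_dvd (by omega) h.1).trans hgN
  rw [← Finset.sum_filter, hdiv]
  have h := congrArg (fun f => f g) ArithmeticFunction.moebius_mul_coe_zeta
  simp only [ArithmeticFunction.coe_mul_zeta_apply,
    ArithmeticFunction.one_apply] at h
  have h' := congrArg (Int.cast : ℤ → ℝ) h
  push_cast at h'
  rw [h']
  norm_cast

theorem ncard_primHyp (A : Fin n → Fin n → Fin n → Fin n → ℤ) (hn : 0 < n) (Z : ℝ) :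
    ((primHyp A Z).ncard : ℝ) = ∑' p : ℕ × ℕ, (ArithmeticFunction.moebius p.1 : ℝ) *
      ArithmeticFunction.moebius p.2 * hypCount A (Z / (p.1 * p.2)) := by
  classical
  let N := ⌊Z⌋₊
  let I := Finset.Icc 1 N
  let H := (finite_sizeHyp A hn Z).toFinset
  have hI : ∀ p : ℕ × ℕ, p ∉ I ×ˢ I → (ArithmeticFunction.moebius p.1 : ℝ) *
      ArithmeticFunction.moebius p.2 * hypCount A (Z / (p.1 * p.2)) = 0 := by
    rintro ⟨d, e⟩ hp
    rcases Nat.eq_zero_or_pos d with rfl | hd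
    · simp
    rcases Nat.eq_zero_or_pos e with rfl | he
    · simp
    refine mul_eq_zero_of_right _ (hypCount_eq_zero A hn ?_)
    have hd1 : (1 : ℝ) ≤ d := by exact_mod_cast hd
    have he1 : (1 : ℝ) ≤ e := by exact_mod_cast he
    rw [div_lt_one (by positivity)]
    by_contra! h
    refine hp (Finset.mem_product.2 ⟨Finset.mem_Icc.2 ⟨hd, Nat.le_floor ?_⟩,
      Finset.mem_Icc.2 ⟨he, Nat.le_floor ?_⟩⟩) <;> simp only at h ⊢ <;> nlinarith
  rw [tsum_eq_sum fun p hp => hI p hp]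
  have h1 : ((primHyp A Z).ncard : ℝ) = ∑ z ∈ H,
      (if Finset.univ.gcd z.1 = 1 then (1 : ℝ) else 0) *
        (if Finset.univ.gcd z.2 = 1 then 1 else 0) := by
    have : primHyp A Z = ↑(H.filter fun z => Finset.univ.gcd z.1 = 1 ∧ Finset.univ.gcd z.2 = 1) := by
      ext z
      rw [Finset.mem_coe, Finset.mem_filter, Set.Finite.mem_toFinset]
      rfl
    rw [this, Set.ncard_coe_finset, Finset.card_filter]
    push_cast
    refine Finset.sum_congr rfl fun z _ => ?_
    rw [ite_and, ite_mul, one_mul, zero_mul]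
  have h2 : ∀ p ∈ I ×ˢ I, hypCount A (Z / (p.1 * p.2)) = ∑ z ∈ H,
      if (p.1 : ℤ) ∣ Finset.univ.gcd z.1 ∧ (p.2 : ℤ) ∣ Finset.univ.gcd z.2 then (1 : ℝ) else 0 := by
    intro p hp
    obtain ⟨hp1, hp2⟩ := Finset.mem_product.1 hp
    rw [← ncard_dvd_sizeHyp A (Finset.mem_Icc.1 hp1).1 (Finset.mem_Icc.1 hp2).1]
    have : {z ∈ sizeHyp (zeroSet A) fstNorm sndNorm Z |
        (p.1 : ℤ) ∣ Finset.univ.gcd z.1 ∧ (p.2 : ℤ) ∣ Finset.univ.gcd z.2} =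
        ↑(H.filter fun z => (p.1 : ℤ) ∣ Finset.univ.gcd z.1 ∧ (p.2 : ℤ) ∣ Finset.univ.gcd z.2) := by
      ext z
      rw [Finset.mem_coe, Finset.mem_filter, Set.Finite.mem_toFinset]
      rfl
    rw [this, Set.ncard_coe_finset, Finset.card_filter]
    push_cast
    rfl
  rw [h1, Finset.sum_congr rfl fun p hp => congrArg _ (h2 p hp)]
  simp only [Finset.mul_sum]
  rw [Finset.sum_comm]
  refine Finset.sum_congr rfl fun z hz => ?_
  have hzH := (finite_sizeHyp A hn Z).mem_toFinset.1 hz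
  have hbox := sizeHyp_subset_sizeBox (one_le_fstNorm hn) (one_le_sndNorm hn) Z hzH
  rw [← sum_moebius_dvd_gcd (one_le_supNorm A hn hzH.1.1) (Nat.le_floor hbox.2.1),
    ← sum_moebius_dvd_gcd (one_le_supNorm (swapA A) hn hzH.1.2.1) (Nat.le_floor hbox.2.2),
    Finset.sum_mul_sum, ← Finset.sum_product']
  refine Finset.sum_congr rfl fun p _ => ?_
  rw [ite_and]
  split_ifs <;> simp

/-- The sum of `μ(d) d^{-m}`. -/
def moebiusSum (m : ℕ) : ℝ := ∑' d : ℕ, (ArithmeticFunction.moebius d : ℝ) / (d : ℝ) ^ m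

theorem moebiusSum_mul_riemannZeta {m : ℕ} (hm : 1 < m) :
    (moebiusSum m : ℂ) * riemannZeta m = 1 := by
  have hre : 1 < (m : ℂ).re := by rw [Complex.natCast_re]; exact_mod_cast hm
  rw [← ArithmeticFunction.LSeries_zeta_eq_riemannZeta hre, mul_comm,
    ← ArithmeticFunction.LSeries_zeta_mul_Lseries_moebius hre]
  congr 1
  rw [moebiusSum, Complex.ofReal_tsum, LSeries]
  refine tsum_congr fun d => ?_
  rw [LSeries.term_def]
  split_ifs with hd
  · simp [hd]
  · push_cast
    rw [Complex.cpow_natCast]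

theorem abs_moebius_cast_le (d : ℕ) : |(ArithmeticFunction.moebius d : ℝ)| ≤ 1 := by
  exact_mod_cast ArithmeticFunction.abs_moebius_le_one (n := d)

theorem tsum_moebius_mul_moebius {m : ℕ} (hm : 1 < m) (b : ℝ) :
    ∑' p : ℕ × ℕ, (ArithmeticFunction.moebius p.1 : ℝ) * ArithmeticFunction.moebius p.2 *
      (b / ((p.1 : ℝ) * p.2) ^ m) = b * moebiusSum m ^ 2 := by
  have hs : Summable fun d : ℕ => ‖(ArithmeticFunction.moebius d : ℝ) / (d : ℝ) ^ m‖ := by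
    refine (Real.summable_one_div_nat_pow.2 hm).of_nonneg_of_le (fun _ => norm_nonneg _)
      fun d => ?_
    rw [norm_div, norm_pow, Real.norm_natCast]
    exact div_le_div_of_nonneg_right (abs_moebius_cast_le d) (by positivity)
  rw [sq, moebiusSum, tsum_mul_tsum_of_summable_norm hs hs, ← tsum_mul_left]
  refine tsum_congr fun p => ?_
  rw [mul_pow]
  ring

theorem SmoothBiquad.tendsto_hypCount (hA : SmoothBiquad A) (hn : 35 < n) :
    Tendsto (fun Z : ℝ => hypCount A Z / (Z ^ (n - 2) * Real.log Z)) atTop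
      (nhds (boxConst A * (n - 2 : ℕ))) := by
  obtain ⟨C, hC⟩ := hA.exists_ncard_sizeBox_le hn
  exact tendsto_ncard_sizeHyp (one_le_fstNorm (by omega)) (one_le_sndNorm (by omega))
    (finite_sizeBox A) hC (hA.exists_abs_ncard_sizeBox_sub_le hn) (hA.boxConst_nonneg hn)

theorem SmoothBiquad.exists_hypCount_le
    (hA : SmoothBiquad A) (hn : 35 < n) : ∃ C, 0 ≤ C ∧ ∀ Z : ℝ, 1 ≤ Z →
      hypCount A Z ≤ C * Z ^ (n - 2) * (1 + Real.log Z) := by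
  obtain ⟨C, hC⟩ := hA.exists_ncard_sizeBox_le hn
  exact exists_ncard_sizeHyp_le (one_le_fstNorm (by omega)) (one_le_sndNorm (by omega))
    (finite_sizeBox A) hC (hA.exists_abs_ncard_sizeBox_sub_le hn) (hA.boxConst_nonneg hn)

theorem tendsto_comp_div_div {M : ℝ → ℝ} {b : ℝ} {m : ℕ}
    (h : Tendsto (fun Z : ℝ => M Z / (Z ^ m * Real.log Z)) atTop (nhds b)) {q : ℝ} (hq : 0 < q) :
    Tendsto (fun Z : ℝ => M (Z / q) / (Z ^ m * Real.log Z)) atTop (nhds (b / q ^ m)) := by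
  have h1 := h.comp (tendsto_id.atTop_div_const hq)
  have h2 : Tendsto (fun Z : ℝ => 1 - Real.log q / Real.log Z) atTop (nhds 1) := by
    simpa using (tendsto_const_nhds (x := Real.log q)).div_atTop Real.tendsto_log_atTop
      |>.const_sub 1
  have h3 := (h1.mul h2).div_const (q ^ m)
  rw [mul_one] at h3
  refine h3.congr' ?_
  filter_upwards [eventually_gt_atTop 1, eventually_gt_atTop q] with Z hZ hZq
  have hZ0 : 0 < Z := by linarith
  have hlog := Real.log_pos hZ
  have hlog' : 0 < Real.log (Z / q) := Real.log_pos ((one_lt_div hq).2 hZq)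
  have e : 1 - Real.log q / Real.log Z = Real.log (Z / q) / Real.log Z := by
    rw [Real.log_div hZ0.ne' hq.ne']
    field_simp
  simp only [Function.comp_apply, id]
  rw [e, div_pow]
  generalize Real.log (Z / q) = l at hlog'
  generalize M (Z / q) = x
  field_simp

theorem SmoothBiquad.tendsto_ncard_primHyp (hA : SmoothBiquad A) (hn : 35 < n) :
    Tendsto (fun Z : ℝ => ((primHyp A Z).ncard : ℝ) / (Z ^ (n - 2) * Real.log Z)) atTop
      (nhds (boxConst A * (n - 2 : ℕ) * moebiusSum (n - 2) ^ 2)) := by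
  have hm : 1 < n - 2 := by omega
  obtain ⟨C, hC, hbd⟩ := hA.exists_hypCount_le hn
  have hlim := hA.tendsto_hypCount hn
  have hn0 : 0 < n := by omega
  generalize n - 2 = m at *
  rw [← tsum_moebius_mul_moebius hm]
  simp_rw [ncard_primHyp A hn0, ← tsum_div_const]
  have hsum : Summable fun p : ℕ × ℕ => 2 * C * (1 / (p.1 : ℝ) ^ m * (1 / (p.2 : ℝ) ^ m)) :=
    (Summable.mul_of_nonneg (Real.summable_one_div_nat_pow.2 hm)
      (Real.summable_one_div_nat_pow.2 hm) (fun _ => by positivity)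
      (fun _ => by positivity)).mul_left _
  refine tendsto_tsum_of_dominated_convergence hsum (fun p => ?_) ?_
  · rcases Nat.eq_zero_or_pos p.1 with h1 | h1
    · simp [h1]
    rcases Nat.eq_zero_or_pos p.2 with h2 | h2
    · simp [h2]
    have hq : (0 : ℝ) < p.1 * p.2 := by positivity
    refine ((tendsto_comp_div_div hlim hq).const_mul _).congr fun Z => ?_
    rw [mul_div_assoc]
  · filter_upwards [Real.tendsto_log_atTop.eventually_ge_atTop 1, eventually_gt_atTop 0]
      with Z hlogZ hZ p
    rcases Nat.eq_zero_or_pos p.1 with h1 | h1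
    · simp only [h1, ArithmeticFunction.map_zero, Int.cast_zero, zero_mul, zero_div, norm_zero]
      positivity
    rcases Nat.eq_zero_or_pos p.2 with h2 | h2
    · simp only [h2, ArithmeticFunction.map_zero, Int.cast_zero, zero_mul, mul_zero, zero_div,
        norm_zero]
      positivity
    have hq : (1 : ℝ) ≤ p.1 * p.2 := by exact_mod_cast Nat.mul_pos h1 h2
    have hM0 : 0 ≤ hypCount A (Z / (p.1 * p.2)) := Nat.cast_nonneg _
    have hM : hypCount A (Z / (p.1 * p.2)) ≤
        2 * C * (1 / (p.1 : ℝ) ^ m * (1 / (p.2 : ℝ) ^ m)) * (Z ^ m * Real.log Z) := by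
      rcases lt_or_ge (Z / (p.1 * p.2 : ℝ)) 1 with hW | hW
      · rw [hypCount_eq_zero A hn0 hW]
        positivity
      · have hl : Real.log (Z / (p.1 * p.2)) ≤ Real.log Z :=
          Real.log_le_log (by positivity) (div_le_self hZ.le hq)
        calc hypCount A (Z / (p.1 * p.2)) ≤ _ := hbd _ hW
          _ ≤ C * (Z / (p.1 * p.2)) ^ m * (2 * Real.log Z) := by gcongr; linarith
          _ = _ := by rw [div_pow, mul_pow]; field_simp
    rw [norm_div, Real.norm_eq_abs, Real.norm_eq_abs, abs_mul, abs_mul, abs_of_nonneg hM0,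
      abs_of_pos (by positivity : 0 < Z ^ m * Real.log Z), div_le_iff₀ (by positivity)]
    refine le_trans ?_ hM
    have := mul_le_mul (abs_moebius_cast_le p.1) (abs_moebius_cast_le p.2) (abs_nonneg _) zero_le_one
    nlinarith

theorem NU_eq_ncard_primHyp (A : Fin n → Fin n → Fin n → Fin n → ℤ) (hn : 2 < n) {B : ℝ}
    (hB : 0 ≤ B) : NU A B = (primHyp A (B ^ (((n - 2 : ℕ) : ℝ)⁻¹))).ncard / 4 := by
  have hm : n - 2 ≠ 0 := by omega
  rw [NU, ← Nat.card_coe_set_eq]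
  congr 2
  refine Nat.card_congr (Equiv.subtypeEquivRight fun z => ?_)
  have h : (supNorm z.1 : ℝ) ^ (n - 2) * (supNorm z.2 : ℝ) ^ (n - 2) ≤ B ↔
      fstNorm z * sndNorm z ≤ B ^ (((n - 2 : ℕ) : ℝ)⁻¹) := by
    rw [← mul_pow, fstNorm, sndNorm, Real.le_rpow_inv_iff_of_pos (by positivity) hB (by positivity),
      Real.rpow_natCast]
  rw [h]
  exact ⟨fun ⟨h1, h2, h3, h4, h5, h6⟩ => ⟨⟨⟨h3, h4, h5⟩, h6⟩, h1, h2⟩,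
    fun ⟨⟨⟨h3, h4, h5⟩, h6⟩, h1, h2⟩ => ⟨h1, h2, h3, h4, h5, h6⟩⟩

theorem SmoothBiquad.tendsto_NU_div (hA : SmoothBiquad A) (hn : 35 < n) :
    Tendsto (fun B : ℝ => (NU A B : ℂ) / (B * Real.log B)) atTop
      (nhds (biSingSeries A * biSingInt A / (4 * riemannZeta ((n : ℂ) - 2) ^ 2))) := by
  have hm : 0 < n - 2 := by omega
  have hm' : (0 : ℝ) < (n - 2 : ℕ) := by exact_mod_cast hm
  have h1 := ((hA.tendsto_ncard_primHyp hn).comp (tendsto_rpow_atTop (inv_pos.2 hm'))).div_const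
    (4 * (n - 2 : ℕ))
  have h2 := (Complex.continuous_ofReal.tendsto _).comp h1
  have hz := moebiusSum_mul_riemannZeta (by omega : 1 < n - 2)
  have hcast : ((n - 2 : ℕ) : ℂ) = (n : ℂ) - 2 := by
    rw [Nat.cast_sub (by omega)]; norm_num
  have hlim : ((boxConst A * (n - 2 : ℕ) * moebiusSum (n - 2) ^ 2 / (4 * (n - 2 : ℕ)) : ℝ) : ℂ) =
      biSingSeries A * biSingInt A / (4 * riemannZeta ((n : ℂ) - 2) ^ 2) := by
    rw [← hcast, ← hA.ofReal_boxConst hn]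
    have hz0 : riemannZeta (n - 2 : ℕ) ≠ 0 := right_ne_zero_of_mul (hz.trans_ne one_ne_zero)
    have hs := eq_div_of_mul_eq hz0 hz
    have hmC : ((n - 2 : ℕ) : ℂ) ≠ 0 := by exact_mod_cast hm.ne'
    push_cast
    rw [hs]
    generalize riemannZeta (n - 2 : ℕ) = ζ at hz0
    field_simp
  rw [hlim] at h2
  refine h2.congr' ?_
  filter_upwards [eventually_gt_atTop 1] with B hB
  have hB0 : 0 < B := by linarith
  have hpow : (B ^ (((n - 2 : ℕ) : ℝ)⁻¹)) ^ (n - 2) = B := Real.rpow_inv_natCast_pow hB0.le hm.ne'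
  have hlog := Real.log_pos hB
  have e : ((primHyp A (B ^ (((n - 2 : ℕ) : ℝ)⁻¹))).ncard : ℝ) /
      ((B ^ (((n - 2 : ℕ) : ℝ)⁻¹)) ^ (n - 2) * Real.log (B ^ (((n - 2 : ℕ) : ℝ)⁻¹))) /
        (4 * (n - 2 : ℕ)) = NU A B / (B * Real.log B) := by
    rw [hpow, Real.log_rpow hB0, NU_eq_ncard_primHyp A (by omega) hB0.le]
    field_simp
  simp only [Function.comp_apply]
  rw [e]
  push_cast
  rfl

end

/-- Theorem 1.1: the Manin–Peyre asymptotic for smooth biquadratic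
hypersurfaces in `ℙ^{n-1} × ℙ^{n-1}` with `n > 35`. -/
theorem manin_biquadratic (n : ℕ) (hn : 35 < n) (A : Fin n → Fin n → Fin n → Fin n → ℤ)
    (hA : SmoothBiquad A) :
    Tendsto (fun B : ℝ => (NU A B : ℂ) / (B * Real.log B)) atTop
      (nhds (biSingSeries A * biSingInt A / (4 * riemannZeta ((n : ℂ) - 2) ^ 2))) :=
  hA.tendsto_NU_div hn

end
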